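/- Let M > 0 be fixed. Then for all x ≥ 2 and all Q with x(log x)^{-M} ≤ Q ≤ x, one has ∑_{q ≤ Q} ∑_{a ∈ G_q} (ψ_K(x;q,a) − x/φ_K(q))² ≪ x·Q·log x, where the implied constant depends only on K and M. -/

import Mathlib

/-!
Setting: `K` is a number field, Galois over `ℚ`, with ring of integers `𝓞 K`.
We formalize the objects from Smith, "A generalization of the
Barban-Davenport-Halberstam Theorem to number fields".
-/

open NumberField Ideal
open scoped Classical BigOperators

noncomputable section

/-- `𝔞` is a (positive) power of a nonzero prime ideal of `𝓞 K`. -/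
def IsPrimeIdealPower {K : Type*} [Field K] [NumberField K] (𝔞 : Ideal (𝓞 K)) : Prop :=
  ∃ (𝔭 : Ideal (𝓞 K)) (m : ℕ), 𝔭.IsPrime ∧ 𝔭 ≠ ⊥ ∧ 1 ≤ m ∧ 𝔞 = 𝔭 ^ m

/-- The von Mangoldt function on ideals of `𝓞 K`: `Λ_K(𝔭^m) = log N𝔭`, and `0` otherwise.
(For `𝔞 = 𝔭^m` with `𝔭` prime, the radical of `𝔞` is `𝔭`.) -/
def LambdaK (K : Type*) [Field K] [NumberField K] (𝔞 : Ideal (𝓞 K)) : ℝ :=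
  if IsPrimeIdealPower 𝔞 then Real.log (absNorm 𝔞.radical) else 0

/-- `ψ_K(x; q, a) = ∑_{N𝔭^m ≤ x, N𝔭^m ≡ a (mod q)} log N𝔭`. -/
def psiK (K : Type*) [Field K] [NumberField K] (x : ℝ) (q : ℕ) (a : ZMod q) : ℝ :=
  ∑' 𝔞 : Ideal (𝓞 K),
    if (absNorm 𝔞 : ℝ) ≤ x ∧ ((absNorm 𝔞 : ZMod q) = a) then LambdaK K 𝔞 else 0

/-- `G_q`: the image of `Gal(K(ζ_q)/K)` in `(ℤ/qℤ)ˣ` under restriction to `ℚ(ζ_q)` followed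
by the canonical isomorphism `Gal(ℚ(ζ_q)/ℚ) ≅ (ℤ/qℤ)ˣ`; concretely, the range of the map
sending `σ ∈ Gal(K(ζ_q)/K)` to the exponent `a ∈ (ℤ/qℤ)ˣ` with `σ(ζ_q) = ζ_q^a`. -/
def Gq (K : Type*) [Field K] [NumberField K] (q : ℕ) : Subgroup (ZMod q)ˣ :=
  if h : 0 < q then
    haveI : NeZero q := ⟨h.ne'⟩
    haveI : NeZero (((⟨q, h⟩ : ℕ+) : ℕ) : K) := ⟨Nat.cast_ne_zero.mpr h.ne'⟩
    ((IsCyclotomicExtension.zeta_spec q K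
        (CyclotomicField q K)).autToPow K).range
  else ⊥

/-- `φ_K(q) = |G_q|`. -/
def phiK (K : Type*) [Field K] [NumberField K] (q : ℕ) : ℕ :=
  Nat.card (Gq K q)

/-- `ψ_K(x, χ∘N) = ∑_{N𝔞 ≤ x} χ(N𝔞) Λ_K(𝔞)`. -/
def psiKChi (K : Type*) [Field K] [NumberField K] (x : ℝ) {q : ℕ}
    (χ : DirichletCharacter ℂ q) : ℂ :=
  ∑' 𝔞 : Ideal (𝓞 K),
    if (absNorm 𝔞 : ℝ) ≤ x then χ (absNorm 𝔞 : ZMod q) * (LambdaK K 𝔞 : ℂ) else 0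

/-- `ψ'_K(x, χ∘N)`: equals `ψ_K(x, χ∘N) − x` when `χ` is trivial on `G_q`,
and `ψ_K(x, χ∘N)` otherwise. -/
def psiKChi' (K : Type*) [Field K] [NumberField K] (x : ℝ) {q : ℕ}
    (χ : DirichletCharacter ℂ q) : ℂ :=
  if ∀ a ∈ Gq K q, χ (a : ZMod q) = 1 then psiKChi K x χ - x else psiKChi K x χ

/-- The common residue degree `f(K/ℚ; p)` of the primes of `K` above `p`
(well-defined when `K/ℚ` is Galois): any prime `𝔭` above `p` has `N𝔭 = p^f`. -/
def resDeg (K : Type*) [Field K] [NumberField K] (p : ℕ) : ℕ :=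
  if h : ∃ 𝔭 : Ideal (𝓞 K), 𝔭.IsPrime ∧ 𝔭 ≠ ⊥ ∧ (p : 𝓞 K) ∈ 𝔭 then
    (absNorm h.choose).factorization p
  else 0

/-- `D_K(n)`: the number of prime ideal powers `𝔭^m` of `𝓞 K` with `N𝔭^m = n`. -/
def DK (K : Type*) [Field K] [NumberField K] (n : ℕ) : ℕ :=
  Nat.card {𝔞 : Ideal (𝓞 K) // IsPrimeIdealPower 𝔞 ∧ absNorm 𝔞 = n}

/-- `Λ_K^*(n) = f(K/ℚ; p) · log p` if `n = p^k` is a prime power, and `0` otherwise. -/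
def LambdaStarK (K : Type*) [Field K] [NumberField K] (n : ℕ) : ℝ :=
  if IsPrimePow n then (resDeg K n.minFac : ℝ) * Real.log n.minFac else 0

end

section LatticeCount
open MeasureTheory Module
open scoped Pointwise

variable {E ι : Type*} [NormedAddCommGroup E] [NormedSpace ℝ E] [FiniteDimensional ℝ E]
  [MeasurableSpace E] [BorelSpace E] [Fintype ι]

/-- The number of points of a translated lattice in a set `D` differs from the expected value
by at most the measure of a set containing a boundary layer of `D`. -/
theorem abs_card_lattice_mul_sub_measure_le (μ : Measure E) [μ.IsAddHaarMeasure]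
    (b : Basis ι ℝ E) {D B : Set E} (hD : Bornology.IsBounded D) (hDm : MeasurableSet D)
    (hBf : μ B ≠ ⊤) {ρ : ℝ} (hρ : ∑ i, ‖b i‖ ≤ ρ) (v : E)
    (h : ∀ x y, ‖x - y‖ ≤ ρ → (x ∈ D ↔ y ∈ D) ∨ y ∈ B) :
    |(Nat.card {l : Submodule.span ℤ (Set.range b) // (l : E) + v ∈ D} : ℝ) *
        μ.real (ZSpan.fundamentalDomain b) - μ.real D| ≤ μ.real B := by
  set F := ZSpan.fundamentalDomain b with hF
  have hFm : MeasurableSet F := ZSpan.fundamentalDomain_measurableSet b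
  set S := {l : Submodule.span ℤ (Set.range b) // (l : E) + v ∈ D} with hS
  have hfin : Finite S := by
    have h1 : ((fun x : E => x + v) ⁻¹' D ∩ (Submodule.span ℤ (Set.range b) : Set E)).Finite := by
      apply ZSpan.setFinite_inter b
      obtain ⟨R, hR⟩ := hD.exists_norm_le
      refine isBounded_iff_forall_norm_le.2 ⟨R + ‖v‖, fun x hx => ?_⟩
      have := hR _ hx
      have h2 : ‖x‖ ≤ ‖x + v‖ + ‖v‖ := by simpa using norm_sub_le (x + v) v
      linarith
    refine Set.Finite.to_subtype (s := {l : Submodule.span ℤ (Set.range b) | (l : E) + v ∈ D})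
      (Set.Finite.of_finite_image (f := Subtype.val) (h1.subset ?_)
        Subtype.val_injective.injOn)
    rintro _ ⟨l, hl, rfl⟩
    exact ⟨hl, l.2⟩
  have := Fintype.ofFinite S
  set D' : Set E := ⋃ l : S, (fun z => z - (l.1.1 + v)) ⁻¹' F with hD'
  have hD'm : MeasurableSet D' :=
    MeasurableSet.iUnion fun l => (measurable_id.sub_const _) hFm
  have hmem : ∀ z, z ∈ D' ↔ ((ZSpan.floor b (z - v) : E) + v) ∈ D := by
    intro z
    simp only [hD', Set.mem_iUnion, Set.mem_preimage]
    constructor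
    · rintro ⟨l, hl⟩
      have h3 : (ZSpan.floor b (z - v)) = l.1 := by
        have h4 := (ZSpan.exist_unique_vadd_mem_fundamentalDomain b (z - v)).unique
          (y₁ := -l.1) (y₂ := -(ZSpan.floor b (z - v))) (by
            simp only [Submodule.vadd_def, vadd_eq_add, NegMemClass.coe_neg]
            convert hl using 1; abel) (by
            simp only [Submodule.vadd_def, vadd_eq_add, NegMemClass.coe_neg]
            have := ZSpan.fract_mem_fundamentalDomain b (z - v)
            rw [ZSpan.fract_apply] at this
            convert this using 1; abel)
        exact (neg_injective h4).symm
      rw [h3]; exact l.2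
    · intro hz
      refine ⟨⟨_, hz⟩, ?_⟩
      have := ZSpan.fract_mem_fundamentalDomain b (z - v)
      rw [ZSpan.fract_apply] at this
      convert this using 1
      abel
  have hdisj : Pairwise (Function.onFun Disjoint
      fun l : S => (fun z => z - (l.1.1 + v)) ⁻¹' F) := by
    intro l₁ l₂ hne
    refine Set.disjoint_left.2 fun z hz₁ hz₂ => hne ?_
    simp only [Set.mem_preimage] at hz₁ hz₂
    have h4 := (ZSpan.exist_unique_vadd_mem_fundamentalDomain b (z - v)).unique
          (y₁ := -l₁.1) (y₂ := -l₂.1) (by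
            simp only [Submodule.vadd_def, vadd_eq_add, NegMemClass.coe_neg]
            convert hz₁ using 1; abel) (by
            simp only [Submodule.vadd_def, vadd_eq_add, NegMemClass.coe_neg]
            convert hz₂ using 1; abel)
    exact Subtype.ext (neg_injective h4)
  have hFfin : μ F ≠ ⊤ := (ZSpan.fundamentalDomain_isBounded b).measure_lt_top.ne
  have hμD' : μ.real D' = (Nat.card S : ℝ) * μ.real F := by
    rw [measureReal_def, hD', measure_iUnion hdisj
      (fun l => (measurable_id.sub_const _) hFm)]
    simp only [sub_eq_add_neg, measure_preimage_add_right]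
    rw [tsum_fintype, Finset.sum_const, Finset.card_univ, nsmul_eq_mul, ENNReal.toReal_mul,
      measureReal_def, Nat.card_eq_fintype_card]
    simp
  have hDf : μ D ≠ ⊤ := hD.measure_lt_top.ne
  have hD'f : μ D' ≠ ⊤ := by
    rw [hD', measure_iUnion hdisj (fun l => (measurable_id.sub_const _) hFm)]
    simp only [sub_eq_add_neg, measure_preimage_add_right]
    rw [tsum_fintype]
    exact ENNReal.sum_ne_top.2 fun _ _ => hFfin
  rw [← hμD']
  refine (abs_measureReal_sub_le_measureReal_symmDiff' hD'm.nullMeasurableSet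
    hDm.nullMeasurableSet hD'f hDf).trans (measureReal_mono ?_ hBf)
  intro z hz
  have hn : ‖(ZSpan.floor b (z - v) : E) + v - z‖ ≤ ρ := by
    have h5 := (ZSpan.norm_fract_le b (z - v)).trans hρ
    rw [ZSpan.fract_apply, ← norm_neg] at h5
    have h6 : (ZSpan.floor b (z - v) : E) + v - z = -(z - v - ZSpan.floor b (z - v)) := by abel
    rwa [h6]
  rcases h _ z hn with h6 | h6
  · rw [← hmem] at h6
    rcases hz with hz | hz
    · exact absurd (h6.1 hz.1) hz.2
    · exact absurd (h6.2 hz.1) hz.2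
  · exact h6

/-- Scaled version of `abs_card_lattice_mul_sub_measure_le`. -/
theorem abs_card_lattice_smul_mul_sub_measure_le (μ : Measure E) [μ.IsAddHaarMeasure]
    (b : Basis ι ℝ E) {D B : Set E} (hD : Bornology.IsBounded D) (hDm : MeasurableSet D)
    (hBf : μ B ≠ ⊤) {ρ t : ℝ} (ht : 0 < t) (hρ : ∑ i, ‖b i‖ ≤ ρ) (v : E)
    (h : ∀ x y, ‖x - y‖ ≤ ρ / t → (x ∈ D ↔ y ∈ D) ∨ y ∈ B) :
    |(Nat.card {l : Submodule.span ℤ (Set.range b) // t⁻¹ • ((l : E) + v) ∈ D} : ℝ) *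
        μ.real (ZSpan.fundamentalDomain b) - t ^ finrank ℝ E * μ.real D| ≤
      t ^ finrank ℝ E * μ.real B := by
  have hs : ∀ A : Set E, μ.real (t • A) = t ^ finrank ℝ E * μ.real A := by
    intro A
    rw [measureReal_def, Measure.addHaar_smul, ENNReal.toReal_mul, measureReal_def,
      ENNReal.toReal_ofReal (abs_nonneg _), abs_of_pos (by positivity)]
  have hB' : μ (t • B) ≠ ⊤ := by
    rw [Measure.addHaar_smul]; exact ENNReal.mul_ne_top ENNReal.ofReal_ne_top hBf
  have key := abs_card_lattice_mul_sub_measure_le μ b (D := t • D) (B := t • B) (hD.smul₀ t)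
    (hDm.const_smul₀ t) hB' hρ v (by
      intro x y hxy
      simp only [Set.mem_smul_set_iff_inv_smul_mem₀ ht.ne']
      apply h
      rw [← smul_sub, norm_smul, norm_inv, Real.norm_of_nonneg ht.le, div_eq_inv_mul]
      gcongr)
  rw [hs, hs] at key
  simpa only [Set.mem_smul_set_iff_inv_smul_mem₀ ht.ne'] using key
end LatticeCount

section ConeBoundary
open MeasureTheory Module NumberField.InfinitePlace NumberField.mixedEmbedding Finset Set
  NumberField.mixedEmbedding.fundamentalCone NumberField.Units NumberField.Units.dirichletUnitTheorem
open ENNReal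

variable (K : Type*) [Field K] [NumberField K]

/-- The volume of the set of points having one small coordinate. -/
theorem volume_normAtPlace_lt_le {R : ℝ} (hR : 0 ≤ R) {s : ℝ} (hs : 0 ≤ s) (w : InfinitePlace K) :
    volume {y : mixedSpace K | ‖y‖ ≤ R ∧ normAtPlace w y < s} ≤
      ENNReal.ofReal (2 ^ nrRealPlaces K * (2 * Real.pi) ^ nrComplexPlaces K *
        R ^ nrComplexPlaces K * (s * R ^ (Fintype.card (InfinitePlace K) - 1))) := by
  set S : Set (realSpace K) := Set.univ.pi
    fun w' => if w' = w then Set.Ico 0 s ∩ Set.Icc 0 R else Set.Icc 0 R with hS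
  have hSm : MeasurableSet S := by
    refine MeasurableSet.univ_pi fun w' => ?_
    split_ifs
    · exact measurableSet_Ico.inter measurableSet_Icc
    · exact measurableSet_Icc
  have hSb : ∀ x ∈ S, ∀ w', x w' ∈ Set.Icc 0 R := by
    intro x hx w'
    have := hx w' (Set.mem_univ _)
    simp only at this
    split_ifs at this with h
    · exact this.2
    · exact this
  have hsub : {y : mixedSpace K | ‖y‖ ≤ R ∧ normAtPlace w y < s} ⊆ normAtAllPlaces ⁻¹' S := by
    rintro y ⟨hy1, hy2⟩ w' -
    have h1 : normAtAllPlaces y w' ∈ Set.Icc 0 R := by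
      refine ⟨normAtPlace_nonneg _ _, le_trans ?_ hy1⟩
      rw [norm_eq_sup'_normAtPlace]
      exact le_sup' (fun w => normAtPlace w y) (Finset.mem_univ w')
    simp only
    split_ifs with h
    · subst h; exact ⟨⟨normAtPlace_nonneg _ _, hy2⟩, h1⟩
    · exact h1
  refine (measure_mono hsub).trans ?_
  have hm : MeasurableSet (normAtAllPlaces ⁻¹' S : Set (mixedSpace K)) :=
    hSm.preimage (continuous_normAtAllPlaces K).measurable
  rw [volume_eq_two_pow_mul_two_pi_pow_mul_integral preimage_image_preimage hm,
    normAtAllPlaces_image_preimage_of_nonneg (fun x hx w => (hSb x hx w).1)]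
  have hvol : volume S ≤ ENNReal.ofReal (s * R ^ (Fintype.card (InfinitePlace K) - 1)) := by
    rw [hS, volume_pi_pi, ← mul_prod_erase _ _ (Finset.mem_univ w),
      ofReal_mul hs, ofReal_pow hR]
    gcongr
    · simp only [if_true]
      refine (measure_mono Set.inter_subset_left).trans ?_
      simp
    · rw [← card_univ, ← card_erase_of_mem (Finset.mem_univ w)]
      refine prod_le_pow_card _ _ _ fun w' hw' => ?_
      simp [ne_of_mem_erase hw']
  have hInt : ∫⁻ x in S, ∏ w : {w : InfinitePlace K // IsComplex w}, ENNReal.ofReal (x w.1) ≤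
      ENNReal.ofReal (R ^ nrComplexPlaces K) * volume S := by
    rw [← setLIntegral_const]
    refine setLIntegral_mono measurable_const fun x hx => ?_
    rw [ofReal_pow hR]
    refine prod_le_pow_card _ _ _ fun w' _ => ?_
    exact ofReal_le_ofReal (hSb x hx _).2
  have e1 : (2 : ℝ≥0∞) ^ nrRealPlaces K = ENNReal.ofReal (2 ^ nrRealPlaces K) := by
    rw [ofReal_pow (by norm_num), ofReal_ofNat]
  rw [mul_assoc (2 ^ nrRealPlaces K * (2 * Real.pi) ^ nrComplexPlaces K) (R ^ _) _, e1,
    ← ofReal_pow (by positivity), ← ofReal_mul (by positivity),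
    ofReal_mul (by positivity : 0 ≤ 2 ^ nrRealPlaces K * (2 * Real.pi) ^ nrComplexPlaces K),
    ofReal_mul (by positivity : 0 ≤ R ^ nrComplexPlaces K)]
  gcongr
  exact hInt.trans (by gcongr)

/-- The box of coordinates used to approximate `paramSet`. -/
noncomputable def paramBox (η : ℝ) : Set (realSpace K) :=
  Set.univ.pi fun w => if w = w₀ then Set.Iic η else Set.Ico (-η) (1 + η)

theorem measurableSet_paramBox (η : ℝ) : MeasurableSet (paramBox K η) := by
  refine MeasurableSet.univ_pi fun _ => ?_
  split_ifs
  · exact measurableSet_Iic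
  · exact measurableSet_Ico

theorem paramBox_mono {η η' : ℝ} (h : η ≤ η') : paramBox K η ⊆ paramBox K η' := by
  intro x hx w _
  have := hx w (Set.mem_univ _)
  simp only at this ⊢
  split_ifs at this ⊢
  · exact le_trans this h
  · exact ⟨by linarith [this.1], by linarith [this.2]⟩

theorem setLIntegral_paramBox_exp {n : ℕ} (hn : 0 < n) {η : ℝ} (hη : -(1 / 2) ≤ η) :
    ∫⁻ x in paramBox K η, ENNReal.ofReal (Real.exp (x w₀ * n)) =
      ENNReal.ofReal (Real.exp (n * η) / n * (1 + 2 * η) ^ rank K) := by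
  have hn : 0 < (n : ℝ) := Nat.cast_pos.mpr hn
  rw [volume_pi, paramBox, Measure.restrict_pi_pi, lintegral_eq_lmarginal_univ 0,
    lmarginal_erase' _ (by fun_prop) (Finset.mem_univ w₀), if_pos rfl]
  simp_rw [Function.update_self, lmarginal, lintegral_const, Measure.pi_univ, if_neg
    (ne_of_mem_erase (Subtype.prop _)), Measure.restrict_apply_univ, Real.volume_Ico]
  simp_rw [mul_comm _ (n : ℝ)]
  rw [← ofReal_integral_eq_lintegral_ofReal (integrableOn_exp_mul_Iic hn _), integral_exp_mul_Iic
    hn, ofReal_mul (by positivity), prod_const, ← ofReal_pow (by linarith)]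
  · congr 3
    · ring
    · simp [rank]
  filter_upwards with _ using Real.exp_nonneg _

/-- The region of the mixed space corresponding to `paramBox`. -/
noncomputable def coneBox (η : ℝ) : Set (mixedSpace K) :=
  normAtAllPlaces ⁻¹' (expMapBasis '' paramBox K η)

theorem measurableSet_coneBox (η : ℝ) : MeasurableSet (coneBox K η) := by
  refine MeasurableSet.preimage ?_ (continuous_normAtAllPlaces K).measurable
  exact (measurableSet_paramBox K η).image_of_continuousOn_injOn
    (continuous_expMapBasis K).continuousOn (injective_expMapBasis K).injOn

theorem coneBox_mono {η η' : ℝ} (h : η ≤ η') : coneBox K η ⊆ coneBox K η' :=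
  preimage_mono (Set.image_mono (paramBox_mono K h))

theorem exists_volume_coneBox : ∃ c : ℝ, 0 ≤ c ∧ ∀ η : ℝ, -(1 / 2) ≤ η →
    volume (coneBox K η) =
      ENNReal.ofReal (c * (Real.exp (finrank ℚ K * η) * (1 + 2 * η) ^ rank K)) := by
  refine ⟨(2 ^ nrRealPlaces K * (2 * Real.pi) ^ nrComplexPlaces K) * ((2⁻¹) ^ nrComplexPlaces K *
    regulator K), by have := (regulator_pos K).le; positivity, fun η hη => ?_⟩
  have hm := measurableSet_coneBox K η
  unfold coneBox at hm ⊢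
  rw [volume_eq_two_pow_mul_two_pi_pow_mul_integral preimage_image_preimage hm,
    normAtAllPlaces_image_preimage_expMapBasis,
    setLIntegral_expMapBasis_image (measurableSet_paramBox K η) (by fun_prop)]
  simp_rw [ENNReal.inv_mul_cancel_right
    (prod_ne_zero_iff.mpr fun _ _ ↦ ofReal_ne_zero_iff.mpr (expMapBasis_pos _ _))
    (prod_ne_top fun _ _ ↦ ofReal_ne_top)]
  have hR := (regulator_pos K).le
  have hn : (0 : ℝ) < finrank ℚ K := Nat.cast_pos.mpr finrank_pos
  rw [setLIntegral_paramBox_exp K finrank_pos hη]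
  have e1 : (2 : ℝ≥0∞) ^ nrRealPlaces K = ENNReal.ofReal (2 ^ nrRealPlaces K) := by
    rw [ofReal_pow (by norm_num), ofReal_ofNat]
  have e2 : (2 : ℝ≥0∞)⁻¹ ^ nrComplexPlaces K = ENNReal.ofReal (2⁻¹ ^ nrComplexPlaces K) := by
    rw [ofReal_pow (by norm_num), ofReal_inv_of_pos (by norm_num),
      ofReal_ofNat]
  rw [e1, e2, ← ofReal_pow (by positivity), ← ofReal_natCast,
    ← ofReal_mul (by positivity), ← ofReal_mul (by positivity),
    ← ofReal_mul (by positivity), ← ofReal_mul (by positivity),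
    ← ofReal_mul (by positivity)]
  congr 1
  field_simp

/-- The volume of the boundary layer is linear in its width. -/
theorem exists_volume_coneBox_diff_le : ∃ c : ℝ, 0 ≤ c ∧ ∀ η : ℝ, 0 ≤ η → η ≤ 1 / 2 →
    volume (coneBox K η \ coneBox K (-η)) ≤ ENNReal.ofReal (c * η) := by
  obtain ⟨c, hc, hvol⟩ := exists_volume_coneBox K
  set g : ℝ → ℝ := fun η => Real.exp (finrank ℚ K * η) * (1 + 2 * η) ^ rank K with hg
  have hgd : ContDiff ℝ 1 g := by fun_prop
  obtain ⟨M, hM⟩ := (isCompact_Icc (a := (-(1 / 2) : ℝ)) (b := 1 / 2)).exists_bound_of_continuousOn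
    (hgd.continuous_deriv le_rfl).continuousOn
  have hM0 : 0 ≤ M := (norm_nonneg _).trans (hM 0 (by norm_num))
  refine ⟨c * (M * 2), by positivity, fun η h0 h1 => ?_⟩
  rw [measure_sdiff (coneBox_mono K (by linarith)) (measurableSet_coneBox K _).nullMeasurableSet
    (by rw [hvol _ (by linarith)]; exact ofReal_ne_top), hvol _ (by linarith),
    hvol _ (by linarith), ← ofReal_sub _ (by
      have : 0 ≤ 1 + 2 * -η := by linarith
      positivity)]
  refine ofReal_le_ofReal ?_
  have key := (convex_Icc (-(1 / 2) : ℝ) (1 / 2)).norm_image_sub_le_of_norm_deriv_le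
    (f := g) (C := M) (fun x _ => (hgd.differentiable (by norm_num)) x) (fun x hx => hM x hx)
    (x := -η) (y := η) ⟨by linarith, by linarith⟩ ⟨by linarith, by linarith⟩
  rw [Real.norm_eq_abs, Real.norm_eq_abs] at key
  have k2 := (le_abs_self _).trans key
  rw [abs_of_nonneg (by linarith)] at k2
  have : c * (g η - g (-η)) ≤ c * (M * (η - -η)) := by gcongr
  simp only [hg] at this
  linarith

variable {K} in
theorem abs_normAtPlace_sub_le (w : InfinitePlace K) (x y : mixedSpace K) :
    |normAtPlace w x - normAtPlace w y| ≤ ‖x - y‖ := by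
  have key : ∀ x y : mixedSpace K, normAtPlace w x - normAtPlace w y ≤ ‖x - y‖ := by
    intro x y
    have h1 := normAtPlace_add_le w (x - y) y
    rw [sub_add_cancel] at h1
    have h2 : normAtPlace w (x - y) ≤ ‖x - y‖ := by
      rw [norm_eq_sup'_normAtPlace]
      exact le_sup' (fun w => normAtPlace w (x - y)) (Finset.mem_univ w)
    linarith
  refine abs_sub_le_iff.2 ⟨key x y, ?_⟩
  rw [norm_sub_rev]
  exact key y x

variable {K} in
/-- Coordinates of a point of the mixed space with nonzero norms at all places. -/
noncomputable def coneCoord (y : mixedSpace K) : realSpace K :=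
  (completeBasis K).equivFunL (expMap.symm (normAtAllPlaces y))

variable {K} in
theorem expMapBasis_coneCoord {y : mixedSpace K} (hy : ∀ w, 0 < normAtPlace w y) :
    expMapBasis (coneCoord y) = normAtAllPlaces y := by
  have : expMapBasis (coneCoord y) = expMap ((completeBasis K).equivFunL.symm (coneCoord y)) := rfl
  rw [this, coneCoord, ContinuousLinearEquiv.symm_apply_apply]
  apply expMap.right_inv
  rw [expMap_target]
  exact fun w _ => hy w

variable {K} in
theorem mem_preimage_image_expMapBasis_iff {y : mixedSpace K} (hy : ∀ w, 0 < normAtPlace w y)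
    (S : Set (realSpace K)) :
    y ∈ normAtAllPlaces ⁻¹' (expMapBasis '' S) ↔ coneCoord y ∈ S := by
  rw [Set.mem_preimage, ← expMapBasis_coneCoord hy, (injective_expMapBasis K).mem_set_image]

theorem paramSet_eq_paramBox : paramSet K = paramBox K 0 := by
  unfold paramBox
  simp only [neg_zero, add_zero]

variable {K} in
theorem mem_normLeOne_iff_coneCoord {y : mixedSpace K} (hy : ∀ w, 0 < normAtPlace w y) :
    y ∈ normLeOne K ↔ coneCoord y ∈ paramBox K 0 := by
  rw [normLeOne_eq_preimage, mem_preimage_image_expMapBasis_iff hy, paramSet_eq_paramBox]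

variable {K} in
theorem mem_paramBox_of_norm_sub_le {η η' : ℝ} {a b : realSpace K} (ha : a ∈ paramBox K η)
    (hab : ‖a - b‖ ≤ η') : b ∈ paramBox K (η + η') := by
  intro w _
  have h1 : |a w - b w| ≤ η' := (norm_le_pi_norm (a - b) w).trans hab
  have h2 := ha w (Set.mem_univ _)
  rw [abs_le] at h1
  simp only at h2 ⊢
  split_ifs at h2 ⊢
  · have := Set.mem_Iic.1 h2
    exact Set.mem_Iic.2 (by linarith)
  · exact ⟨by linarith [h2.1], by linarith [h2.2]⟩

theorem exists_norm_coneCoord_sub_le : ∃ M : ℝ, 0 < M ∧ ∀ s : ℝ, 0 < s → s ≤ 1 →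
    ∀ x y : mixedSpace K, ‖x - y‖ ≤ s ^ 2 → (∀ w, 2 * s ≤ normAtPlace w y) →
      (∀ w, 0 < normAtPlace w x) ∧ ‖coneCoord x - coneCoord y‖ ≤ M * s := by
  set T : realSpace K →L[ℝ] realSpace K := ((completeBasis K).equivFunL : realSpace K →L[ℝ] realSpace K)
  refine ⟨(‖T‖ + 1) * 2, by positivity, fun s hs hs1 x y hxy hy => ?_⟩
  have hsq : s ^ 2 ≤ s := by nlinarith
  have hx : ∀ w, s ≤ normAtPlace w x := by
    intro w
    have := (abs_le.1 ((abs_normAtPlace_sub_le w x y).trans hxy)).1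
    linarith [hy w]
  refine ⟨fun w => hs.trans_le (hx w), ?_⟩
  have h1 : ‖expMap.symm (normAtAllPlaces x) - expMap.symm (normAtAllPlaces y)‖ ≤ 2 * s := by
    refine (pi_norm_le_iff_of_nonneg (by positivity)).2 fun w => ?_
    rw [Pi.sub_apply, expMap_symm_apply, expMap_symm_apply, ← mul_sub, norm_mul]
    have hm : ‖(w.mult : ℝ)‖ ≤ 2 := by
      rw [Real.norm_natCast]
      rcases w.isReal_or_isComplex with h | h
      · rw [mult_isReal ⟨w, h⟩]; norm_num
      · rw [mult_isComplex ⟨w, h⟩]; norm_num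
    have hpx : 0 < normAtPlace w x := hs.trans_le (hx w)
    have hpy : 0 < normAtPlace w y := by linarith [hy w]
    have hlog : ∀ a b : ℝ, s ≤ a → s ≤ b → |a - b| ≤ s ^ 2 → Real.log a - Real.log b ≤ s := by
      intro a b ha hb hab
      have ha0 : 0 < a := by linarith
      have hb0 : 0 < b := by linarith
      rw [← Real.log_div ha0.ne' hb0.ne']
      refine (Real.log_le_sub_one_of_pos (by positivity)).trans ?_
      rw [div_sub_one hb0.ne', div_le_iff₀ hb0]
      have := (abs_le.1 hab).2
      nlinarith
    have h3 := (abs_normAtPlace_sub_le w x y).trans hxy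
    have h4 : ‖Real.log (normAtAllPlaces x w) - Real.log (normAtAllPlaces y w)‖ ≤ s := by
      rw [Real.norm_eq_abs]
      refine abs_sub_le_iff.2 ⟨hlog _ _ (hx w) (by linarith [hy w]) h3,
        hlog _ _ (by linarith [hy w]) (hx w) ?_⟩
      rw [abs_sub_comm]; exact h3
    gcongr
  have h2 : coneCoord x - coneCoord y =
      T (expMap.symm (normAtAllPlaces x) - expMap.symm (normAtAllPlaces y)) := by
    rw [map_sub]; rfl
  rw [h2]
  refine (T.le_opNorm _).trans ?_
  have := norm_nonneg T
  calc ‖T‖ * _ ≤ (‖T‖ + 1) * (2 * s) := by gcongr; linarith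
    _ = _ := by ring

/-- Boundary layers of the fundamental cone truncated at norm `1` have small volume. -/
theorem exists_boundary_layer_normLeOne : ∃ C : ℝ, 0 < C ∧ ∀ ε : ℝ, 0 < ε →
    ∃ B : Set (mixedSpace K), volume B ≠ ⊤ ∧
      volume.real B ≤ C * (ε ^ (1 / 2 : ℝ) + ε ^ finrank ℚ K) ∧
      ∀ x y : mixedSpace K, ‖x - y‖ ≤ ε → (x ∉ normLeOne K ∧ y ∉ normLeOne K) ∨
        (x ∈ normLeOne K ∧ y ∈ normLeOne K ∧ ∀ w, 0 < x.1 w * y.1 w) ∨ y ∈ B := by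
  obtain ⟨R₀, hR₀⟩ := (isBounded_normLeOne K).exists_norm_le
  set R := max R₀ 0
  have hR : ∀ y ∈ normLeOne K, ‖y‖ ≤ R := fun y hy => (hR₀ y hy).trans (le_max_left _ _)
  have hR0 : 0 ≤ R := le_max_right _ _
  obtain ⟨M, hM, hcoord⟩ := exists_norm_coneCoord_sub_le K
  obtain ⟨c, hc, hdiff⟩ := exists_volume_coneBox_diff_le K
  set s₀ : ℝ := min 1 (1 / (2 * M)) with hs₀
  have hs₀p : 0 < s₀ := by positivity
  set V : ℝ := 2 ^ nrRealPlaces K * (2 * Real.pi) ^ nrComplexPlaces K *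
        (R + 1) ^ nrComplexPlaces K * (R + 1) ^ (Fintype.card (InfinitePlace K) - 1) with hV
  have hV0 : 0 ≤ V := by positivity
  set U : ℝ := volume.real (Metric.closedBall (0 : mixedSpace K) 1) with hU
  have hU0 : 0 ≤ U := measureReal_nonneg
  set C₁ : ℝ := Fintype.card (InfinitePlace K) * (V * 2) + c * M with hC₁
  set C₂ : ℝ := (R / s₀ ^ 2 + 1) ^ finrank ℚ K * U with hC₂
  have hC₁0 : 0 ≤ C₁ := by positivity
  have hC₂0 : 0 ≤ C₂ := by positivity
  refine ⟨C₁ + C₂ + 1, by positivity, fun ε hε => ?_⟩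
  rw [← Real.sqrt_eq_rpow]
  set s := Real.sqrt ε with hsdef
  have hs : 0 < s := Real.sqrt_pos.2 hε
  have hsε : s ^ 2 = ε := Real.sq_sqrt hε.le
  by_cases hss : s ≤ s₀
  · have hs1 : s ≤ 1 := hss.trans (min_le_left _ _)
    have hMs : M * s ≤ 1 / 2 := by
      have : s ≤ 1 / (2 * M) := hss.trans (min_le_right _ _)
      rw [le_div_iff₀ (by positivity)] at this
      linarith
    have hε1 : ε ≤ 1 := by rw [← hsε]; nlinarith
    set B₁ : Set (mixedSpace K) :=
      ⋃ w : InfinitePlace K, {y : mixedSpace K | ‖y‖ ≤ R + 1 ∧ normAtPlace w y < 2 * s} with hB₁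
    set B₂ : Set (mixedSpace K) := coneBox K (M * s) \ coneBox K (-(M * s)) with hB₂
    have hvol : volume (B₁ ∪ B₂) ≤ ENNReal.ofReal (C₁ * s) := by
      have h1 : volume B₁ ≤ ENNReal.ofReal (Fintype.card (InfinitePlace K) * (V * 2 * s)) := by
        refine (measure_iUnion_le _).trans ?_
        rw [tsum_fintype]
        refine (sum_le_sum fun w _ => volume_normAtPlace_lt_le K (by positivity)
          (by positivity) w).trans ?_
        rw [sum_const, card_univ, nsmul_eq_mul,
          ofReal_mul (Nat.cast_nonneg _), ofReal_natCast]
        refine mul_le_mul' le_rfl (ofReal_le_ofReal (le_of_eq ?_))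
        rw [hV]; ring
      refine (measure_union_le _ _).trans ((add_le_add h1 (hdiff _ (by positivity) hMs)).trans ?_)
      rw [← ofReal_add (by positivity) (by positivity)]
      refine ofReal_le_ofReal (le_of_eq ?_)
      rw [hC₁]; ring
    refine ⟨B₁ ∪ B₂, ne_top_of_le_ne_top ofReal_ne_top hvol, ?_, fun x y hxy => ?_⟩
    · rw [measureReal_def]
      refine (toReal_mono ofReal_ne_top hvol).trans ?_
      rw [toReal_ofReal (by positivity)]
      have : 0 ≤ ε ^ finrank ℚ K := by positivity
      nlinarith [mul_nonneg hC₂0 hs.le, mul_nonneg hC₂0 this, mul_nonneg hC₁0 this]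
    by_cases hN : x ∉ normLeOne K ∧ y ∉ normLeOne K
    · exact Or.inl hN
    right
    by_cases hyB : y ∈ B₁ ∪ B₂
    · exact Or.inr hyB
    left
    have hynorm : ‖y‖ ≤ R + 1 := by
      by_cases hy : y ∈ normLeOne K
      · linarith [hR y hy]
      · have hx : x ∈ normLeOne K := by by_contra h; exact hN ⟨h, hy⟩
        have h2 : ‖y‖ ≤ ‖x‖ + ‖x - y‖ :=
          norm_le_norm_add_norm_sub x y
        linarith [hR x hx]
    have hy2 : ∀ w, 2 * s ≤ normAtPlace w y := by
      intro w
      by_contra h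
      exact hyB (Or.inl (mem_iUnion.2 ⟨w, hynorm, not_le.1 h⟩))
    have hyp : ∀ w, 0 < normAtPlace w y := fun w => by linarith [hy2 w]
    obtain ⟨hxp, hcc⟩ := hcoord s hs hs1 x y (by rwa [hsε]) hy2
    have hboth : x ∈ normLeOne K ∧ y ∈ normLeOne K := by
      rw [mem_normLeOne_iff_coneCoord hxp, mem_normLeOne_iff_coneCoord hyp] at hN ⊢
      have hy3 : coneCoord y ∈ paramBox K (M * s) := by
        by_contra h
        refine hN ⟨fun h' => h ?_, fun h' => h (paramBox_mono K (by positivity) h')⟩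
        simpa using mem_paramBox_of_norm_sub_le h' hcc
      have hy4 : coneCoord y ∈ paramBox K (-(M * s)) := by
        by_contra h
        refine hyB (Or.inr ⟨?_, ?_⟩)
        · exact (mem_preimage_image_expMapBasis_iff hyp _).2 hy3
        · exact fun h' => h ((mem_preimage_image_expMapBasis_iff hyp _).1 h')
      refine ⟨?_, paramBox_mono K (by linarith [mul_pos hM hs]) hy4⟩
      rw [norm_sub_rev] at hcc
      simpa using mem_paramBox_of_norm_sub_le hy4 hcc
    refine ⟨hboth.1, hboth.2, fun w => ?_⟩
    have h5 : |x.1 w - y.1 w| ≤ ε := by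
      refine le_trans ?_ hxy
      have := (norm_le_pi_norm (x - y).1 w).trans (norm_fst_le (x - y))
      simpa using this
    have h6 : 2 * s ≤ |y.1 w| := by
      have := hy2 w.1
      rwa [normAtPlace_apply_of_isReal w.2] at this
    have h7 : ε < 2 * s := by rw [← hsε]; nlinarith
    rw [abs_le] at h5
    rcases le_or_gt 0 (y.1 w) with h | h
    · rw [abs_of_nonneg h] at h6
      exact mul_pos (by linarith) (by linarith)
    · rw [abs_of_neg h] at h6
      exact mul_pos_of_neg_of_neg (by linarith) (by linarith)
  · rw [not_le] at hss
    have hfr : finrank ℝ (mixedSpace K) = finrank ℚ K := mixedEmbedding.finrank K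
    refine ⟨Metric.closedBall 0 (R + ε), measure_closedBall_lt_top.ne, ?_, fun x y hxy => ?_⟩
    · have hb : volume.real (Metric.closedBall (0 : mixedSpace K) (R + ε)) =
          (R + ε) ^ finrank ℚ K * U := by
        rw [measureReal_def, Measure.addHaar_closedBall' _ _ (by positivity), toReal_mul,
          toReal_ofReal (by positivity), hfr, hU, measureReal_def]
      have h1 : R + ε ≤ (R / s₀ ^ 2 + 1) * ε := by
        have h2 : s₀ ^ 2 ≤ ε := by rw [← hsε]; gcongr
        have h3 : R ≤ R / s₀ ^ 2 * ε := by
          rw [div_mul_eq_mul_div, le_div_iff₀ (by positivity)]; gcongr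
        linarith
      have h4 : (R + ε) ^ finrank ℚ K * U ≤ C₂ * ε ^ finrank ℚ K := by
        calc (R + ε) ^ finrank ℚ K * U ≤ ((R / s₀ ^ 2 + 1) * ε) ^ finrank ℚ K * U := by gcongr
          _ = _ := by rw [hC₂, mul_pow]; ring
      have : 0 ≤ ε ^ finrank ℚ K := by positivity
      rw [hb]
      nlinarith [mul_nonneg hC₂0 hs.le, mul_nonneg hC₁0 this, mul_nonneg hC₁0 hs.le]
    by_cases hN : x ∉ normLeOne K ∧ y ∉ normLeOne K
    · exact Or.inl hN
    right; right
    rw [mem_closedBall_zero_iff]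
    by_cases hy : y ∈ normLeOne K
    · linarith [hR y hy]
    · have hx : x ∈ normLeOne K := by by_contra h; exact hN ⟨h, hy⟩
      have h2 : ‖y‖ ≤ ‖x‖ + ‖x - y‖ :=
          norm_le_norm_add_norm_sub x y
      linarith [hR x hx]

end ConeBoundary

section LatticePeriodic
open MeasureTheory Module Finset

variable {E ι : Type*} [NormedAddCommGroup E] [NormedSpace ℝ E] [Fintype ι]

/-- Coordinates on the lattice spanned by a basis. -/
noncomputable def latticeCoord (b : Basis ι ℝ E) :
    (ι → ℤ) ≃ Submodule.span ℤ (Set.range b) :=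
  (b.restrictScalars ℤ).equivFun.symm.toEquiv

theorem coe_latticeCoord (b : Basis ι ℝ E) (c : ι → ℤ) :
    (latticeCoord b c : E) = ∑ i, c i • b i := by
  simp [latticeCoord, Basis.equivFun_symm_apply]

/-- Points of a lattice satisfying a condition that is periodic modulo `m`, counted in a
dilated region. -/
theorem exists_abs_card_lattice_periodic_sub_le [FiniteDimensional ℝ E]
    [MeasurableSpace E] [BorelSpace E] (μ : Measure E) [μ.IsAddHaarMeasure]
    (b : Basis ι ℝ E) {D : Set E} (hD : Bornology.IsBounded D) (hDm : MeasurableSet D)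
    {m : ℕ} (hm : 0 < m) (P : (ι → ℤ) → Prop)
    (hP : ∀ c d : ι → ℤ, P (c + (m : ℤ) • d) ↔ P c) :
    ∃ κ : ℝ, ∀ (B : Set E) (t : ℝ), μ B ≠ ⊤ → 0 < t →
      (∀ x y, ‖x - y‖ ≤ m * (∑ i, ‖b i‖) / t → (x ∈ D ↔ y ∈ D) ∨ y ∈ B) →
      Finite {c : ι → ℤ // t⁻¹ • (∑ i, c i • b i) ∈ D ∧ P c} ∧
      |(Nat.card {c : ι → ℤ // t⁻¹ • (∑ i, c i • b i) ∈ D ∧ P c} : ℝ) -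
        κ * t ^ finrank ℝ E| ≤ t ^ finrank ℝ E * μ.real B / μ.real (ZSpan.fundamentalDomain b) := by
  have : NeZero m := ⟨hm.ne'⟩
  have hm' : (0 : ℝ) < m := by exact_mod_cast hm
  set n := finrank ℝ E with hn
  set F := ZSpan.fundamentalDomain b
  have hF : 0 < μ.real F := by
    refine ENNReal.toReal_pos (ZSpan.measure_fundamentalDomain_ne_zero b) ?_
    exact (ZSpan.fundamentalDomain_isBounded b).measure_lt_top.ne
  let R := {r : ι → Fin m // P (fun i => ((r i : ℕ) : ℤ))}
  refine ⟨Fintype.card R * μ.real D / (m ^ n * μ.real F), fun B t hB ht h => ?_⟩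
  let v : (ι → Fin m) → E := fun r => ∑ i, ((r i : ℕ) : ℤ) • b i
  let S : (ι → Fin m) → Type _ := fun r => {l : Submodule.span ℤ (Set.range b) //
    (t / m)⁻¹ • ((l : E) + (m : ℝ)⁻¹ • v r) ∈ D}
  have hcount : ∀ r, |(Nat.card (S r) : ℝ) * μ.real F - (t / m) ^ n * μ.real D| ≤
      (t / m) ^ n * μ.real B := by
    intro r
    refine abs_card_lattice_smul_mul_sub_measure_le μ b hD hDm hB (div_pos ht hm') le_rfl _ ?_
    intro x y hxy
    apply h x y
    rwa [div_div_eq_mul_div, mul_comm] at hxy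
  have hfin : ∀ r, Finite (S r) := by
    intro r
    obtain ⟨ρ, hρ⟩ := hD.exists_norm_le
    have h1 : ((fun x : E => (t / m)⁻¹ • (x + (m : ℝ)⁻¹ • v r)) ⁻¹' D ∩
        (Submodule.span ℤ (Set.range b) : Set E)).Finite := by
      apply ZSpan.setFinite_inter b
      refine isBounded_iff_forall_norm_le.2 ⟨(t / m) * ρ + ‖(m : ℝ)⁻¹ • v r‖, fun x hx => ?_⟩
      have h2 := hρ _ hx
      rw [norm_smul, norm_inv, Real.norm_of_nonneg (by positivity), inv_mul_le_iff₀ (by positivity)]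
        at h2
      have h3 : ‖x‖ ≤ ‖x + (m : ℝ)⁻¹ • v r‖ + ‖(m : ℝ)⁻¹ • v r‖ := by
        simpa using norm_sub_le (x + (m : ℝ)⁻¹ • v r) ((m : ℝ)⁻¹ • v r)
      linarith
    refine Set.Finite.to_subtype (s := {l : Submodule.span ℤ (Set.range b) | _}) ?_
    refine Set.Finite.of_finite_image (f := Subtype.val) (h1.subset ?_) Subtype.val_injective.injOn
    rintro _ ⟨l, hl, rfl⟩
    exact ⟨hl, l.2⟩
  let e0 : (ι → ℤ) ≃ (ι → ℤ) × (ι → Fin m) :=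
    (Equiv.arrowCongr (Equiv.refl ι) (Int.divModEquiv m)).trans (Equiv.arrowProdEquivProdArrow _ _ _)
  have he0 : ∀ d r, e0.symm (d, r) = (fun i => ((r i : ℕ) : ℤ)) + (m : ℤ) • d := by
    intro d r
    ext i
    simp [e0, Int.divModEquiv, Equiv.arrowProdEquivProdArrow, mul_comm, add_comm]
  have key : ∀ d r, (t⁻¹ • (∑ i, (e0.symm (d, r)) i • b i) ∈ D ∧ P (e0.symm (d, r))) ↔
      P (fun i => ((r i : ℕ) : ℤ)) ∧
        (t / m)⁻¹ • ((latticeCoord b d : E) + (m : ℝ)⁻¹ • v r) ∈ D := by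
    intro d r
    rw [he0, hP, and_comm, coe_latticeCoord]
    have : t⁻¹ • (∑ i, ((fun i => ((r i : ℕ) : ℤ)) + (m : ℤ) • d) i • b i) =
        (t / m)⁻¹ • ((∑ i, d i • b i) + (m : ℝ)⁻¹ • v r) := by
      have h1 : (∑ i, ((fun i => ((r i : ℕ) : ℤ)) + (m : ℤ) • d) i • b i) =
          (m : ℝ) • ((∑ i, d i • b i) + (m : ℝ)⁻¹ • v r) := by
        rw [smul_add, smul_smul, mul_inv_cancel₀ hm'.ne', one_smul, smul_sum,
          ← sum_add_distrib]
        refine sum_congr rfl fun i _ => ?_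
        simp only [Pi.add_apply, Pi.smul_apply, add_smul, smul_eq_mul, mul_smul]
        rw [add_comm]
        congr 1
        simp [← Int.cast_smul_eq_zsmul ℝ]
      rw [h1, smul_smul]
      congr 1
      field_simp
    rw [this]
  let e1 : {c : ι → ℤ // t⁻¹ • (∑ i, c i • b i) ∈ D ∧ P c} ≃
      {p : (ι → ℤ) × (ι → Fin m) // P (fun i => ((p.2 i : ℕ) : ℤ)) ∧
        (t / m)⁻¹ • ((latticeCoord b p.1 : E) + (m : ℝ)⁻¹ • v p.2) ∈ D} :=
    e0.subtypeEquiv fun c => by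
      have := key (e0 c).1 (e0 c).2
      simpa only [Prod.mk.eta, Equiv.symm_apply_apply] using this
  let e2 : {p : (ι → ℤ) × (ι → Fin m) // P (fun i => ((p.2 i : ℕ) : ℤ)) ∧
        (t / m)⁻¹ • ((latticeCoord b p.1 : E) + (m : ℝ)⁻¹ • v p.2) ∈ D} ≃ Σ r : R, S r.1 :=
    { toFun := fun p => ⟨⟨p.1.2, p.2.1⟩, ⟨latticeCoord b p.1.1, p.2.2⟩⟩
      invFun := fun p => ⟨((latticeCoord b).symm p.2.1, p.1.1), p.1.2, by simpa using p.2.2⟩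
      left_inv := fun c => by simp
      right_inv := fun p => by simp; rfl }
  let e := e1.trans e2
  constructor
  · exact Finite.of_equiv _ e.symm
  rw [Nat.card_congr e, Nat.card_sigma]
  push_cast
  rw [le_div_iff₀ hF, ← abs_of_pos hF, ← abs_mul, abs_of_pos hF]
  have hcard : (Fintype.card R : ℝ) ≤ m ^ n := by
    have h1 : Fintype.card R ≤ Fintype.card (ι → Fin m) := Fintype.card_subtype_le _
    rw [Fintype.card_fun, Fintype.card_fin, ← finrank_eq_card_basis b] at h1
    exact_mod_cast h1
  calc |(∑ r : R, (Nat.card (S r.1) : ℝ) -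
        Fintype.card R * μ.real D / (m ^ n * μ.real F) * t ^ n) * μ.real F|
      = |∑ r : R, ((Nat.card (S r.1) : ℝ) * μ.real F - (t / m) ^ n * μ.real D)| := by
        congr 1
        rw [sum_sub_distrib, ← sum_mul, sum_const, card_univ,
          nsmul_eq_mul, sub_mul]
        congr 1
        rw [div_pow]
        field_simp
    _ ≤ ∑ r : R, (t / m) ^ n * μ.real B :=
        (abs_sum_le_sum_abs _ _).trans (sum_le_sum fun r _ => hcount r.1)
    _ ≤ t ^ n * μ.real B := by
        rw [sum_const, card_univ, nsmul_eq_mul, div_pow, ← mul_assoc]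
        refine mul_le_mul_of_nonneg_right ?_ measureReal_nonneg
        rw [mul_div_assoc', div_le_iff₀ (by positivity), mul_comm]
        exact mul_le_mul_of_nonneg_left hcard (by positivity)

end LatticePeriodic

section NormSign
open NumberField.InfinitePlace NumberField.mixedEmbedding Module Finset

variable {K : Type*} [Field K] [NumberField K]

/-- The norm of an algebraic integer modulo `m` depends only on the integer modulo `m`. -/
theorem norm_add_nsmul_modEq (m : ℕ) (α γ : 𝓞 K) :
    ((Algebra.norm ℤ (α + m • γ) : ℤ) : ZMod m) = ((Algebra.norm ℤ α : ℤ) : ZMod m) := by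
  let b := RingOfIntegers.basis K
  rw [Algebra.norm_eq_matrix_det b, Algebra.norm_eq_matrix_det b, map_add, map_nsmul]
  have h : ∀ M : Matrix (Free.ChooseBasisIndex ℤ (𝓞 K)) (Free.ChooseBasisIndex ℤ (𝓞 K)) ℤ,
      ((M.det : ℤ) : ZMod m) = (M.map (Int.castRingHom (ZMod m))).det :=
    fun M => RingHom.map_det (Int.castRingHom (ZMod m)) M
  rw [h, h]
  congr 1
  ext i j
  simp [-nsmul_eq_mul, Matrix.map_apply, Matrix.add_apply, Matrix.smul_apply]

/-- The norm of a number is the product of its real conjugates times a positive number. -/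
theorem exists_norm_eq_prod_real_mul (x : K) (hx : x ≠ 0) :
    ∃ c : ℝ, 0 < c ∧ ((Algebra.norm ℚ x : ℚ) : ℝ) = c * ∏ w, (mixedEmbedding K x).1 w := by
  have h1 : (algebraMap ℚ ℂ) (Algebra.norm ℚ x) = ∏ φ : K →+* ℂ, φ x := by
    rw [Algebra.norm_eq_prod_embeddings ℚ ℂ x]
    exact (Fintype.prod_equiv (RingHom.equivRatAlgHom K ℂ) (fun f : K →+* ℂ => f x) _ fun _ => rfl).symm
  rw [← univ.prod_fiberwise InfinitePlace.mk] at h1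
  have h2 : ∀ w : InfinitePlace K, ∃ c : ℝ, 0 < c ∧
      ∏ φ ∈ univ.filter (fun φ : K →+* ℂ => InfinitePlace.mk φ = w), φ x =
        ((c * (if h : w.IsReal then (mixedEmbedding K x).1 ⟨w, h⟩ else 1) : ℝ) : ℂ) := by
    intro w
    by_cases hw : w.IsReal
    · refine ⟨1, one_pos, ?_⟩
      have h3 : univ.filter (fun φ : K →+* ℂ => InfinitePlace.mk φ = w) = {w.embedding} := by
        ext φ
        simp only [mem_filter, mem_univ, true_and, mem_singleton]
        have hw' : ComplexEmbedding.conjugate w.embedding = w.embedding := isReal_iff.1 hw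
        conv_lhs => rw [← mk_embedding w, mk_eq_iff]
        constructor
        · rintro (h | h)
          · exact h
          · rw [← hw', ← h]; exact (star_star φ).symm
        · intro h; exact Or.inl h
      rw [h3, prod_singleton, dif_pos hw, one_mul]
      simp [mixedEmbedding_apply_isReal]
    · refine ⟨w x ^ 2, by have := (InfinitePlace.pos_iff (w := w)).2 hx; positivity, ?_⟩
      rw [dif_neg hw, mul_one]
      have h3 : univ.filter (fun φ : K →+* ℂ => InfinitePlace.mk φ = w) =
          {w.embedding, ComplexEmbedding.conjugate w.embedding} := by
        ext φ
        simp only [mem_filter, mem_univ, true_and, mem_singleton, mem_insert]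
        conv_lhs => rw [← mk_embedding w, mk_eq_iff]
        refine or_congr Iff.rfl ⟨fun h => ?_, fun h => ?_⟩
        · rw [← h]; exact (star_star φ).symm
        · rw [h]; exact star_star _
      rw [h3, prod_pair]
      · rw [ComplexEmbedding.conjugate_coe_eq, Complex.mul_conj, Complex.normSq_eq_norm_sq, norm_embedding_eq]
      · intro h
        exact hw (isReal_iff.2 h.symm)
  choose c hc hc' using h2
  refine ⟨∏ w, c w, prod_pos fun w _ => hc w, ?_⟩
  have h4 : ((Algebra.norm ℚ x : ℚ) : ℂ) = ((∏ w, c w * (if h : w.IsReal then (mixedEmbedding K x).1 ⟨w, h⟩ else 1) : ℝ) : ℂ) := by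
    rw [Complex.ofReal_prod, ← prod_congr rfl fun w _ => hc' w]
    exact h1
  have h5 : ((Algebra.norm ℚ x : ℚ) : ℝ) = ∏ w, c w * (if h : w.IsReal then (mixedEmbedding K x).1 ⟨w, h⟩ else 1) := by
    exact_mod_cast h4
  rw [h5, prod_mul_distrib]
  congr 1
  rw [prod_dite, prod_const_one, mul_one]
  exact prod_bij (fun w _ => ⟨w.1, (mem_filter.1 w.2).2⟩) (by simp) (by simp) (by simp) (by simp)

end NormSign

section IdealCount
open MeasureTheory Module NumberField.InfinitePlace NumberField.mixedEmbedding
  NumberField.mixedEmbedding.fundamentalCone NumberField.Units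
open scoped nonZeroDivisors

variable (K : Type*) [Field K] [NumberField K]

/-- Principal multiples of `J` whose norm satisfies a condition correspond to elements of the
fundamental cone, up to torsion. -/
theorem card_isPrincipal_dvd_mul_torsionOrder (J : (Ideal (𝓞 K))⁰) (R : ℕ → Prop) :
    Nat.card {I : (Ideal (𝓞 K))⁰ // (J : Ideal (𝓞 K)) ∣ I ∧ Submodule.IsPrincipal (I : Ideal (𝓞 K)) ∧
      R (absNorm (I : Ideal (𝓞 K)))} * torsionOrder K =
        Nat.card {a : idealSet K J // R (intNorm (idealSetEquiv K J a).1)} := by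
  rw [torsionOrder, ← Nat.card_prod]
  refine Nat.card_congr ?_
  refine Equiv.trans ?_ (Equiv.sigmaSubtypeFiberEquivSubtype (p := fun a : idealSet K J =>
    R (intNorm (idealSetEquiv K J a).1)) (q := R) (fun a => intNorm (idealSetEquiv K J a).1)
    (fun a => Iff.rfl))
  have e2 : ∀ i : ℕ, {a : idealSet K J // intNorm (idealSetEquiv K J a).1 = i} ≃
      {I : (Ideal (𝓞 K))⁰ // (J : Ideal (𝓞 K)) ∣ I ∧ Submodule.IsPrincipal (I : Ideal (𝓞 K)) ∧
        absNorm (I : Ideal (𝓞 K)) = i} × (torsion K) := fun i =>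
    (Equiv.subtypeEquivRight fun a => by
      rw [← intNorm_idealSetEquiv_apply, Nat.cast_inj]).trans (idealSetEquivNorm K J i)
  refine Equiv.trans ?_ (Equiv.sigmaCongrRight fun i : Subtype R => (e2 i).symm)
  refine Equiv.trans ?_ (Equiv.sigmaProdDistrib _ _)
  refine Equiv.prodCongrLeft fun _ => ?_
  refine Equiv.trans ?_ (Equiv.sigmaCongrRight fun i : Subtype R =>
    (Equiv.subtypeSubtypeEquivSubtypeInter (fun I : (Ideal (𝓞 K))⁰ => (J : Ideal (𝓞 K)) ∣ I ∧
      Submodule.IsPrincipal (I : Ideal (𝓞 K))) (fun I => absNorm (I : Ideal (𝓞 K)) = i)).trans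
        (Equiv.subtypeEquivRight fun I => by rw [and_assoc]))
  refine Equiv.trans ?_ (Equiv.sigmaSubtypeFiberEquivSubtype
    (α := {I : (Ideal (𝓞 K))⁰ // (J : Ideal (𝓞 K)) ∣ I ∧ Submodule.IsPrincipal (I : Ideal (𝓞 K))})
    (p := fun I => R (absNorm (I.1 : Ideal (𝓞 K)))) (q := R)
    (fun I => absNorm (I.1 : Ideal (𝓞 K))) (fun a => Iff.rfl)).symm
  exact ((Equiv.subtypeSubtypeEquivSubtypeInter (fun I : (Ideal (𝓞 K))⁰ => (J : Ideal (𝓞 K)) ∣ I ∧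
      Submodule.IsPrincipal (I : Ideal (𝓞 K))) (fun I => R (absNorm (I : Ideal (𝓞 K))))).trans
        (Equiv.subtypeEquivRight fun I => by rw [and_assoc])).symm

/-- Ideals in a class correspond to principal multiples of an ideal in the inverse class. -/
theorem card_mk_eq_eq_card_isPrincipal {C : ClassGroup (𝓞 K)} {J : (Ideal (𝓞 K))⁰}
    (hJ : ClassGroup.mk0 J = C⁻¹) (R : ℕ → Prop) :
    Nat.card {I : (Ideal (𝓞 K))⁰ // R (absNorm (J : Ideal (𝓞 K)) * absNorm (I : Ideal (𝓞 K))) ∧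
        ClassGroup.mk0 I = C}
      = Nat.card {I : (Ideal (𝓞 K))⁰ // (J : Ideal (𝓞 K)) ∣ I ∧
        Submodule.IsPrincipal (I : Ideal (𝓞 K)) ∧ R (absNorm (I : Ideal (𝓞 K)))} := by
  simp_rw [← nonZeroDivisors_dvd_iff_dvd_coe]
  refine Nat.card_congr ?_
  refine ((Equiv.dvd J).subtypeEquiv fun I ↦ ?_).trans
    (Equiv.subtypeSubtypeEquivSubtypeInter (fun I : (Ideal (𝓞 K))⁰ ↦ J ∣ I) _)
  rw [← ClassGroup.mk0_eq_one_iff (SetLike.coe_mem _)]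
  simp_rw [Equiv.dvd_apply, Submonoid.coe_mul, ← Submonoid.mul_def, _root_.map_mul, hJ,
    inv_mul_eq_one, eq_comm, and_comm]

/-- Elements of an ideal are parametrised by integer coordinates. -/
theorem exists_coords_ideal (J : (Ideal (𝓞 K))⁰) :
    ∃ α : (Free.ChooseBasisIndex ℤ (FractionalIdeal.mk0 K J : FractionalIdeal (𝓞 K)⁰ K) → ℤ) → 𝓞 K,
      (∀ c, mixedEmbedding K (α c) =
        ∑ i, c i • fractionalIdealLatticeBasis K (FractionalIdeal.mk0 K J) i) ∧
      (∀ c d, ∀ m : ℕ, α (c + (m : ℤ) • d) = α c + m • α d) := by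
  set b := fractionalIdealLatticeBasis K (FractionalIdeal.mk0 K J)
  have h : ∀ c : Free.ChooseBasisIndex ℤ (FractionalIdeal.mk0 K J : FractionalIdeal (𝓞 K)⁰ K) → ℤ,
      ∃ a : 𝓞 K, mixedEmbedding K a = ∑ i, c i • b i := by
    intro c
    have h1 := (latticeCoord b c).2
    rw [mem_span_fractionalIdealLatticeBasis, coe_latticeCoord] at h1
    obtain ⟨y, hy, hy'⟩ := h1
    simp only [FractionalIdeal.coe_mk0, SetLike.mem_coe, FractionalIdeal.mem_coeIdeal] at hy
    obtain ⟨z, _, rfl⟩ := hy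
    exact ⟨z, hy'⟩
  choose α hα using h
  refine ⟨α, hα, fun c d m => ?_⟩
  apply RingOfIntegers.coe_injective
  apply mixedEmbedding_injective K
  rw [hα]
  push_cast
  rw [map_add, nsmul_eq_mul, map_mul, map_natCast, hα, hα, ← nsmul_eq_mul, Finset.smul_sum,
    ← Finset.sum_add_distrib]
  refine Finset.sum_congr rfl fun i _ => ?_
  have h1 : (c + (m : ℤ) • d) i = c i + m * d i := rfl
  rw [h1, add_smul, mul_smul, natCast_zsmul]

theorem intNorm_idealSetEquiv_eq {J : (Ideal (𝓞 K))⁰} (a : idealSet K J) (α : 𝓞 K)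
    (h : mixedEmbedding K α = a) : intNorm (idealSetEquiv K J a).1 = (Algebra.norm ℤ α).natAbs := by
  have h1 := intNorm_idealSetEquiv_apply a
  rw [← h, mixedEmbedding.norm_eq_norm, ← Algebra.coe_norm_int] at h1
  have h2 : ((intNorm (idealSetEquiv K J a).1 : ℕ) : ℚ) = |((Algebra.norm ℤ α : ℤ) : ℚ)| := by
    exact_mod_cast h1
  rw [← Int.cast_abs, Int.abs_eq_natAbs] at h2
  exact_mod_cast h2

/-- The part of `normLeOne K` where the product of the real coordinates has a given sign. -/
def signedNormLeOne (s : ℤˣ) : Set (mixedSpace K) :=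
  {y | y ∈ normLeOne K ∧ 0 < (((s : ℤ) : ℝ)) * ∏ w, y.1 w}

theorem measurableSet_signedNormLeOne (s : ℤˣ) : MeasurableSet (signedNormLeOne K s) := by
  refine (measurableSet_normLeOne K).inter ?_
  refine measurableSet_lt (f := fun _ : mixedSpace K => (0 : ℝ)) measurable_const ?_
  refine Measurable.const_mul (f := fun y : mixedSpace K => ∏ w, y.1 w) ?_ _
  refine Finset.measurable_prod _ fun w _ => ?_
  exact (measurable_pi_apply w).comp measurable_fst

theorem mem_signedNormLeOne_iff_of_pos (s : ℤˣ) {x y : mixedSpace K} (hx : x ∈ normLeOne K)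
    (hy : y ∈ normLeOne K) (h : ∀ w, 0 < x.1 w * y.1 w) :
    x ∈ signedNormLeOne K s ↔ y ∈ signedNormLeOne K s := by
  have h1 : 0 < (∏ w, x.1 w) * ∏ w, y.1 w := by
    rw [← Finset.prod_mul_distrib]
    exact Finset.prod_pos fun w _ => h w
  simp only [signedNormLeOne, Set.mem_ofPred_eq, hx, hy, true_and]
  rcases pos_and_pos_or_neg_and_neg_of_mul_pos h1 with h2 | h2
  · rw [mul_pos_iff_of_pos_right h2.1, mul_pos_iff_of_pos_right h2.2]
  · constructor
    · intro h3
      have := neg_of_mul_pos_left h3 h2.1.le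
      exact mul_pos_of_neg_of_neg this h2.2
    · intro h3
      have := neg_of_mul_pos_left h3 h2.2.le
      exact mul_pos_of_neg_of_neg this h2.1

theorem card_idealSet_eq_card_sigma (J : (Ideal (𝓞 K))⁰) {ι : Type*} [Fintype ι]
    (b : Basis ι ℝ (mixedSpace K))
    (hb : Submodule.span ℤ (Set.range b) = mixedEmbedding.idealLattice K (FractionalIdeal.mk0 K J))
    {α : (ι → ℤ) → 𝓞 K} (hα : ∀ c, mixedEmbedding K (α c) = ∑ i, c i • b i)
    {t : ℝ} (ht : 0 < t) (Q : ℤ → Prop) :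
    Nat.card {a : idealSet K J // ((intNorm (idealSetEquiv K J a).1 : ℕ) : ℝ) ≤ t ^ finrank ℚ K ∧
        Q (intNorm (idealSetEquiv K J a).1)} =
      Nat.card (Σ s : ℤˣ, {c : ι → ℤ // t⁻¹ • (∑ i, c i • b i) ∈ signedNormLeOne K s ∧
        Q (s * Algebra.norm ℤ (α c))}) := by
  have hspan : ∀ c : ι → ℤ,
      (∑ i, c i • b i) ∈ mixedEmbedding.idealLattice K (FractionalIdeal.mk0 K J) := by
    intro c
    rw [← hb, ← coe_latticeCoord]
    exact (latticeCoord b c).2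
  have hmem : ∀ c : ι → ℤ, t⁻¹ • (∑ i, c i • b i) ∈ normLeOne K ↔
      ∃ h : (∑ i, c i • b i) ∈ idealSet K J,
      ((intNorm (idealSetEquiv K J ⟨_, h⟩).1 : ℕ) : ℝ) ≤ t ^ finrank ℚ K := by
    intro c
    have h1 : mixedEmbedding.norm (t⁻¹ • (∑ i, c i • b i)) ≤ 1 ↔
        mixedEmbedding.norm (∑ i, c i • b i) ≤ t ^ finrank ℚ K := by
      rw [mixedEmbedding.norm_smul, abs_of_pos (inv_pos.2 ht), inv_pow,
        inv_mul_le_iff₀ (by positivity), mul_one]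
    constructor
    · rintro ⟨h2, h3⟩
      refine ⟨⟨(smul_mem_iff_mem (inv_ne_zero ht.ne')).1 h2, hspan c⟩, ?_⟩
      rw [intNorm_idealSetEquiv_apply]
      exact h1.1 h3
    · rintro ⟨h2, h3⟩
      rw [intNorm_idealSetEquiv_apply] at h3
      exact ⟨(smul_mem_iff_mem (inv_ne_zero ht.ne')).2 h2.1, h1.2 h3⟩
  have hsgn : ∀ (s : ℤˣ) (c : ι → ℤ), t⁻¹ • (∑ i, c i • b i) ∈ normLeOne K →
      (t⁻¹ • (∑ i, c i • b i) ∈ signedNormLeOne K s ↔ 0 < s * Algebra.norm ℤ (α c)) := by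
    intro s c hc
    have h0 : (α c : K) ≠ 0 := by
      intro h
      obtain ⟨h1, -⟩ := (hmem c).1 hc
      have := norm_pos_of_mem h1.1
      rw [← hα, h, map_zero, map_zero] at this
      exact lt_irrefl _ this
    obtain ⟨c0, hc0, h1⟩ := exists_norm_eq_prod_real_mul (α c : K) h0
    have h2 : ∏ w, (t⁻¹ • (∑ i, c i • b i)).1 w =
        t⁻¹ ^ Fintype.card {w : InfinitePlace K // w.IsReal} * ∏ w, (mixedEmbedding K (α c)).1 w := by
      rw [hα]
      simp [Finset.prod_mul_distrib]
    have h3 : ((Algebra.norm ℤ (α c) : ℤ) : ℝ) = c0 * ∏ w, (mixedEmbedding K (α c)).1 w := by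
      rw [← h1, ← Algebra.coe_norm_int]; simp
    have h4 : (0 : ℤ) < s * Algebra.norm ℤ (α c) ↔
        (0 : ℝ) < ((s : ℤ) : ℝ) * ∏ w, (mixedEmbedding K (α c)).1 w := by
      rw [← Int.cast_lt (R := ℝ)]
      push_cast
      rw [h3, mul_left_comm, mul_pos_iff_of_pos_left hc0]
    rw [h4, signedNormLeOne]
    simp only [Set.mem_ofPred_eq, hc, true_and]
    rw [h2, mul_left_comm, mul_pos_iff_of_pos_left (by positivity)]
  have hsign : ∀ (s : ℤˣ) (c : ι → ℤ), t⁻¹ • (∑ i, c i • b i) ∈ signedNormLeOne K s →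
      s * Algebra.norm ℤ (α c) = (Algebra.norm ℤ (α c)).natAbs := by
    intro s c hc
    have := (hsgn s c hc.1).1 hc
    rcases Int.units_eq_one_or s with rfl | rfl
    · simp at this ⊢; exact (abs_of_pos this).symm
    · simp at this ⊢; exact (abs_of_neg this).symm
  symm
  refine Nat.card_congr (Equiv.ofBijective
    (fun p => ⟨⟨∑ i, p.2.1 i • b i, ((hmem _).1 p.2.2.1.1).1⟩,
      ((hmem _).1 p.2.2.1.1).2, ?_⟩) ⟨?_, ?_⟩)
  · rw [intNorm_idealSetEquiv_eq K _ (α p.2.1) (hα _), ← hsign p.1 _ p.2.2.1]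
    exact p.2.2.2
  · rintro ⟨s, c, hc⟩ ⟨s', c', hc'⟩ h
    simp only [Subtype.mk.injEq] at h
    rw [← coe_latticeCoord, ← coe_latticeCoord, SetLike.coe_eq_coe, EmbeddingLike.apply_eq_iff_eq] at h
    subst h
    have h1 := (hsgn s c hc.1.1).1 hc.1
    have h2 := (hsgn s' c hc.1.1).1 hc'.1
    have : s = s' := by
      rcases Int.units_eq_one_or s with rfl | rfl <;> rcases Int.units_eq_one_or s' with rfl | rfl <;>
        first | rfl | (simp at h1 h2; omega)
    subst this
    rfl
  · rintro ⟨⟨a, ha⟩, h1, h2⟩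
    have ha' := ha.2
    rw [← hb] at ha'
    obtain ⟨c, hc⟩ := (latticeCoord b).surjective ⟨a, ha'⟩
    have hc' : ∑ i, c i • b i = a := by rw [← coe_latticeCoord, hc]
    subst hc'
    have h3 := (hmem c).2 ⟨ha, h1⟩
    have h5 : Algebra.norm ℤ (α c) ≠ 0 := by
      intro h
      have := norm_pos_of_mem ha.1
      rw [← intNorm_idealSetEquiv_apply ⟨_, ha⟩, intNorm_idealSetEquiv_eq K _ (α c) (hα _), h] at this
      simp at this
    have h4 : ∃ s : ℤˣ, 0 < s * Algebra.norm ℤ (α c) := by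
      rcases lt_or_gt_of_ne h5 with h | h
      · exact ⟨-1, by simpa using h⟩
      · exact ⟨1, by simpa using h⟩
    obtain ⟨s, hs⟩ := h4
    have h6 := (hsgn s c h3).2 hs
    refine ⟨⟨s, c, h6, ?_⟩, rfl⟩
    rw [hsign s c h6]
    rwa [intNorm_idealSetEquiv_eq K _ (α c) (hα _)] at h2

end IdealCount

section IdealAsymp
open MeasureTheory Module NumberField.InfinitePlace NumberField.mixedEmbedding Finset Real
  NumberField.mixedEmbedding.fundamentalCone NumberField.Units
open scoped nonZeroDivisors

variable (K : Type*) [Field K] [NumberField K]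

theorem finrank_rat_pos : 0 < finrank ℚ K := finrank_pos

/-- Counting ideals in a given class by norm in a residue class. -/
theorem exists_card_class_residue (C : ClassGroup (𝓞 K)) :
    ∃ A : ℝ, 0 < A ∧ ∀ (q : ℕ), 0 < q → ∀ a : ZMod q, ∃ κ : ℝ, ∀ x : ℝ, 1 ≤ x →
      |(Nat.card {I : (Ideal (𝓞 K))⁰ // ((absNorm (I : Ideal (𝓞 K)) : ℝ) ≤ x ∧
          ((absNorm (I : Ideal (𝓞 K)) : ℕ) : ZMod q) = a) ∧ ClassGroup.mk0 I = C} : ℝ) - κ * x| ≤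
        A * q ^ finrank ℚ K * x ^ (1 - 1 / (2 * finrank ℚ K : ℝ)) := by
  obtain ⟨J, hJ⟩ := ClassGroup.mk0_surjective C⁻¹
  set N := absNorm (J : Ideal (𝓞 K)) with hN
  have hNpos : 0 < N := absNorm_pos_of_nonZeroDivisors J
  have hN' : (0 : ℝ) < N := by exact_mod_cast hNpos
  set n := finrank ℚ K with hn
  have hnpos : 0 < n := finrank_pos
  have hn' : (0 : ℝ) < n := by exact_mod_cast hnpos
  have hn1 : (1 : ℝ) ≤ n := by exact_mod_cast hnpos
  set b := fractionalIdealLatticeBasis K (FractionalIdeal.mk0 K J) with hb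
  obtain ⟨α, hα, hαadd⟩ := exists_coords_ideal K J
  obtain ⟨C₀, hC₀, hbd⟩ := exists_boundary_layer_normLeOne K
  set ρ := ∑ i, ‖b i‖ with hρ
  have hρpos : 0 ≤ ρ := sum_nonneg fun i _ => norm_nonneg _
  set V := (volume : Measure (mixedSpace K)).real (ZSpan.fundamentalDomain b) with hV
  have hVpos : 0 < V := by
    refine ENNReal.toReal_pos (ZSpan.measure_fundamentalDomain_ne_zero b) ?_
    exact (ZSpan.fundamentalDomain_isBounded b).measure_lt_top.ne
  set T : ℝ := (torsionOrder K : ℝ) with hT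
  have hTpos : 0 < T := by
    rw [hT]
    exact_mod_cast torsionOrder_pos K
  set e₀ : ℝ := N * (ρ + 1) with he₀
  have he₀pos : 0 < e₀ := by positivity
  refine ⟨2 * (N * (C₀ * (e₀ ^ (1 / 2 : ℝ) + e₀ ^ n))) / V / T, by positivity, fun q hq a => ?_⟩
  have hq' : (1 : ℝ) ≤ q := by exact_mod_cast hq
  have : NeZero q := ⟨hq.ne'⟩
  have hm : 0 < N * q := Nat.mul_pos hNpos hq
  set tgt : ZMod (N * q) := ((N * a.val : ℕ) : ZMod (N * q)) with htgt
  have hres : ∀ k : ℕ, ((N * k : ℕ) : ZMod (N * q)) = tgt ↔ (k : ZMod q) = a := by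
    intro k
    rw [htgt, ZMod.natCast_eq_natCast_iff]
    rw [← ZMod.natCast_zmod_val a, ZMod.natCast_eq_natCast_iff, ZMod.natCast_zmod_val]
    exact ⟨fun h => Nat.ModEq.mul_left_cancel' hNpos.ne' h, fun h => Nat.ModEq.mul_left' N h⟩
  have hκ := fun s : ℤˣ => exists_abs_card_lattice_periodic_sub_le (volume : Measure (mixedSpace K)) b
    (D := signedNormLeOne K s) ((isBounded_normLeOne K).subset fun y hy => hy.1)
    (measurableSet_signedNormLeOne K s) hm
    (fun c => ((s * Algebra.norm ℤ (α c) : ℤ) : ZMod (N * q)) = tgt) (fun c d => by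
      rw [hαadd]
      push_cast
      rw [norm_add_nsmul_modEq])
  choose κ hκ using hκ
  refine ⟨(∑ s, κ s) * N / T, fun x hx => ?_⟩
  have hx0 : 0 < x := by linarith
  set t : ℝ := (x * N) ^ (1 / n : ℝ) with ht
  have htpos : 0 < t := by positivity
  have htn : t ^ n = x * N := by
    rw [ht, ← rpow_natCast, ← rpow_mul (by positivity), one_div,
      inv_mul_cancel₀ hn'.ne', rpow_one]
  have hcard : (Nat.card {I : (Ideal (𝓞 K))⁰ // ((absNorm (I : Ideal (𝓞 K)) : ℝ) ≤ x ∧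
          ((absNorm (I : Ideal (𝓞 K)) : ℕ) : ZMod q) = a) ∧ ClassGroup.mk0 I = C}) * torsionOrder K =
      Nat.card (Σ s : ℤˣ, {c : _ → ℤ // t⁻¹ • (∑ i, c i • b i) ∈ signedNormLeOne K s ∧
        ((s * Algebra.norm ℤ (α c) : ℤ) : ZMod (N * q)) = tgt}) := by
    rw [← card_idealSet_eq_card_sigma K J b (span_idealLatticeBasis K _) hα htpos
      (fun k => (k : ZMod (N * q)) = tgt), ← hn, htn]
    rw [← card_isPrincipal_dvd_mul_torsionOrder K J (fun k => (k : ℝ) ≤ x * N ∧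
      ((k : ℤ) : ZMod (N * q)) = tgt), ← card_mk_eq_eq_card_isPrincipal K hJ (fun k => (k : ℝ) ≤ x * N ∧
      ((k : ℤ) : ZMod (N * q)) = tgt)]
    refine congrArg (· * torsionOrder K) (Nat.card_congr (Equiv.subtypeEquivRight fun I => ?_))
    rw [← hN, Int.cast_natCast, hres, Nat.cast_mul, mul_comm x, mul_le_mul_iff_right₀ hN']
  obtain ⟨B, hBf, hB, hBxy⟩ := hbd (((N * q : ℕ) : ℝ) * (ρ + 1) / t) (by positivity)
  have hκ' := fun s => hκ s B t hBf htpos (fun x y hxy => by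
    rcases hBxy x y (hxy.trans (by gcongr; linarith)) with h | h | h
    · left
      exact ⟨fun hx => absurd hx.1 h.1, fun hy => absurd hy.1 h.2⟩
    · left
      exact mem_signedNormLeOne_iff_of_pos K s h.1 h.2.1 h.2.2
    · exact Or.inr h)
  have hfin := fun s => (hκ' s).1
  rw [Nat.card_sigma] at hcard
  have hcard' : (Nat.card {I : (Ideal (𝓞 K))⁰ // ((absNorm (I : Ideal (𝓞 K)) : ℝ) ≤ x ∧
          ((absNorm (I : Ideal (𝓞 K)) : ℕ) : ZMod q) = a) ∧ ClassGroup.mk0 I = C} : ℝ) =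
      (∑ s : ℤˣ, (Nat.card {c : _ → ℤ // t⁻¹ • (∑ i, c i • b i) ∈ signedNormLeOne K s ∧
        ((s * Algebra.norm ℤ (α c) : ℤ) : ZMod (N * q)) = tgt} : ℝ)) / T := by
    rw [eq_div_iff hTpos.ne', hT]
    exact_mod_cast hcard
  rw [hcard']
  have hε : (volume : Measure (mixedSpace K)).real B ≤
      C₀ * (e₀ ^ (1 / 2 : ℝ) + e₀ ^ n) * (q ^ n * x ^ (- (1 / (2 * n : ℝ)))) := by
    have hN1 : (1 : ℝ) ≤ N := by exact_mod_cast hNpos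
    have h1 : ((N * q : ℕ) : ℝ) * (ρ + 1) / t = e₀ * (q / t) := by
      rw [he₀]; push_cast; ring
    have h2 : (q / t) ^ (1 / 2 : ℝ) ≤ q ^ n * x ^ (- (1 / (2 * n : ℝ))) := by
      rw [div_rpow (by positivity) htpos.le, div_eq_mul_inv, ← rpow_neg htpos.le]
      have h3 : (q : ℝ) ^ (1 / 2 : ℝ) ≤ q ^ n := by
        rw [← rpow_natCast]
        exact rpow_le_rpow_of_exponent_le hq' (by linarith)
      have h4 : t ^ (-(1 / 2) : ℝ) ≤ x ^ (- (1 / (2 * n : ℝ))) := by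
        rw [ht, ← rpow_mul (by positivity)]
        have : (1 / n : ℝ) * -(1 / 2) = - (1 / (2 * n : ℝ)) := by field_simp
        rw [this]
        exact rpow_le_rpow_of_nonpos hx0 (by nlinarith) (by simp)
      gcongr
    have h5 : (q / t) ^ n ≤ q ^ n * x ^ (- (1 / (2 * n : ℝ))) := by
      rw [div_pow, htn, div_eq_mul_inv]
      gcongr
      calc (x * N)⁻¹ ≤ x⁻¹ := by
            gcongr
            nlinarith
        _ = x ^ (-1 : ℝ) := (rpow_neg_one x).symm
        _ ≤ x ^ (- (1 / (2 * n : ℝ))) := by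
            apply rpow_le_rpow_of_exponent_le hx
            rw [neg_le_neg_iff, div_le_one (by positivity)]
            linarith
    rw [h1, mul_rpow he₀pos.le (by positivity), mul_pow] at hB
    refine hB.trans ?_
    rw [mul_assoc]
    refine mul_le_mul_of_nonneg_left ?_ hC₀.le
    rw [add_mul]
    gcongr
  rw [mixedEmbedding.finrank, ← hn, htn] at hκ'
  calc _ = |∑ s : ℤˣ, ((Nat.card {c : _ → ℤ // t⁻¹ • (∑ i, c i • b i) ∈ signedNormLeOne K s ∧
        ((s * Algebra.norm ℤ (α c) : ℤ) : ZMod (N * q)) = tgt} : ℝ) - κ s * (x * N))| / T := by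
        rw [← abs_of_pos hTpos, ← abs_div, abs_of_pos hTpos, sum_sub_distrib, sub_div,
          ← sum_mul]
        congr 2
        ring
    _ ≤ (∑ s : ℤˣ, (x * N) * (volume : Measure (mixedSpace K)).real B / V) / T := by
        gcongr
        exact (abs_sum_le_sum_abs _ _).trans (sum_le_sum fun s _ => (hκ' s).2)
    _ ≤ (∑ s : ℤˣ, (x * N) * (C₀ * (e₀ ^ (1 / 2 : ℝ) + e₀ ^ n) *
          (q ^ n * x ^ (- (1 / (2 * n : ℝ))))) / V) / T := by
        gcongr
    _ = _ := by
        rw [sum_const, card_univ, Fintype.card_units_int, sub_eq_add_neg,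
          rpow_add hx0, rpow_one, nsmul_eq_mul]
        push_cast
        ring

/-- The number of ideals of norm `k`. -/
noncomputable def idealCount (k : ℕ) : ℕ := Nat.card {I : Ideal (𝓞 K) // absNorm I = k}

theorem sum_idealCount_eq_card (x : ℝ) (hx : 0 ≤ x) (P : ℕ → Prop) [DecidablePred P] :
    ∑ k ∈ (Icc 1 ⌊x⌋₊).filter P, idealCount K k =
      ∑ C : ClassGroup (𝓞 K), Nat.card {I : (Ideal (𝓞 K))⁰ //
        ((absNorm (I : Ideal (𝓞 K)) : ℝ) ≤ x ∧ P (absNorm (I : Ideal (𝓞 K)))) ∧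
          ClassGroup.mk0 I = C} := by
  have hfin : Finite {I : (Ideal (𝓞 K))⁰ // (absNorm (I : Ideal (𝓞 K)) : ℝ) ≤ x ∧
      P (absNorm (I : Ideal (𝓞 K)))} := by
    have := finite_setOfPred_absNorm_le₀ (S := 𝓞 K) ⌊x⌋₊
    refine Set.Finite.to_subtype (s := {I : (Ideal (𝓞 K))⁰ | _}) (this.subset ?_)
    intro I hI
    exact Nat.le_floor hI.1
  have h1 : ∀ C : ClassGroup (𝓞 K), Finite {I : (Ideal (𝓞 K))⁰ //
        ((absNorm (I : Ideal (𝓞 K)) : ℝ) ≤ x ∧ P (absNorm (I : Ideal (𝓞 K)))) ∧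
          ClassGroup.mk0 I = C} := fun C =>
    Finite.of_injective (fun I => (⟨I.1, I.2.1⟩ : {I : (Ideal (𝓞 K))⁰ //
      (absNorm (I : Ideal (𝓞 K)) : ℝ) ≤ x ∧ P (absNorm (I : Ideal (𝓞 K)))})) (by
        intro a b h; exact Subtype.ext (congrArg Subtype.val h :))
  have h2 : ∀ k, Finite {I : Ideal (𝓞 K) // absNorm I = k} := fun k => finite_setOfPred_absNorm_eq k
  rw [← Nat.card_sigma, ← sum_coe_sort]
  simp only [idealCount]
  rw [← Nat.card_sigma]
  have hp : ∀ p : (Σ k : {k // k ∈ (Icc 1 ⌊x⌋₊).filter P}, {I : Ideal (𝓞 K) // absNorm I = k}),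
      p.2.1 ∈ (Ideal (𝓞 K))⁰ := by
    intro p
    rw [mem_nonZeroDivisors_iff_ne_zero]
    intro h
    have h3 := p.2.2
    rw [h] at h3
    have := (mem_Icc.1 (mem_filter.1 p.1.2).1).1
    simp at h3
    omega
  refine Nat.card_congr (Equiv.ofBijective (fun p => ⟨ClassGroup.mk0 ⟨p.2.1, hp p⟩,
    ⟨⟨p.2.1, hp p⟩, ?_, rfl⟩⟩) ⟨?_, ?_⟩)
  · have h4 := mem_filter.1 p.1.2
    rw [p.2.2]
    exact ⟨(Nat.le_floor_iff hx).1 (mem_Icc.1 h4.1).2, h4.2⟩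
  · rintro ⟨⟨k, hk⟩, ⟨I, hI⟩⟩ ⟨⟨k', hk'⟩, ⟨I', hI'⟩⟩ h
    have h3 : I = I' := by
      have := congrArg (fun z => (z.2.1.1 : Ideal (𝓞 K))) h
      simpa using this
    subst h3
    simp only at hI hI'
    subst hI
    subst hI'
    rfl
  · rintro ⟨C, ⟨⟨I, hI0⟩, ⟨hI1, hI2⟩, hI3⟩⟩
    subst hI3
    refine ⟨⟨⟨absNorm I, ?_⟩, ⟨I, rfl⟩⟩, rfl⟩
    refine mem_filter.2 ⟨mem_Icc.2 ⟨?_, Nat.le_floor hI1⟩, hI2⟩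
    exact absNorm_pos_of_nonZeroDivisors ⟨I, hI0⟩

/-- Counting ideals by norm in a residue class, with a power saving uniform in the modulus. -/
theorem exists_sum_idealCount_residue :
    ∃ A : ℝ, 0 < A ∧ ∀ (q : ℕ), 0 < q → ∀ a : ZMod q, ∃ κ : ℝ, ∀ x : ℝ, 1 ≤ x →
      |(∑ k ∈ (Icc 1 ⌊x⌋₊).filter (fun k : ℕ => (k : ZMod q) = a), (idealCount K k : ℝ)) -
        κ * x| ≤ A * q ^ finrank ℚ K * x ^ (1 - 1 / (2 * finrank ℚ K : ℝ)) := by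
  choose A hA hA' using exists_card_class_residue K
  refine ⟨∑ C, A C, sum_pos (fun C _ => hA C) univ_nonempty, fun q hq a => ?_⟩
  choose κ hκ using fun C => hA' C q hq a
  refine ⟨∑ C, κ C, fun x hx => ?_⟩
  have h1 := sum_idealCount_eq_card K x (by linarith) (fun k : ℕ => (k : ZMod q) = a)
  rw [← Nat.cast_sum, h1, Nat.cast_sum, sum_mul, ← sum_sub_distrib, sum_mul,
    sum_mul]
  exact (abs_sum_le_sum_abs _ _).trans (sum_le_sum fun C _ => hκ C x hx)

/-- Character sums over ideals. -/
theorem exists_sum_idealCount_char :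
    ∃ A : ℝ, 0 < A ∧ ∀ (q : ℕ), 0 < q → ∀ χ : DirichletCharacter ℂ q, ∃ κ : ℂ, ∀ x : ℝ, 1 ≤ x →
      ‖(∑ k ∈ Icc 1 ⌊x⌋₊, χ k * (idealCount K k : ℂ)) - κ * x‖ ≤
        A * q ^ (finrank ℚ K + 1) * x ^ (1 - 1 / (2 * finrank ℚ K : ℝ)) := by
  obtain ⟨A, hA, hA'⟩ := exists_sum_idealCount_residue K
  refine ⟨A, hA, fun q hq χ => ?_⟩
  have : NeZero q := ⟨hq.ne'⟩
  choose κ hκ using hA' q hq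
  refine ⟨∑ a, χ a * κ a, fun x hx => ?_⟩
  have h1 : ∑ k ∈ Icc 1 ⌊x⌋₊, χ k * (idealCount K k : ℂ) =
      ∑ a : ZMod q, χ a * ∑ k ∈ (Icc 1 ⌊x⌋₊).filter (fun k : ℕ => (k : ZMod q) = a),
        (idealCount K k : ℂ) := by
    rw [← sum_fiberwise _ (fun k : ℕ => (k : ZMod q))]
    refine sum_congr rfl fun a _ => ?_
    rw [mul_sum]
    refine sum_congr rfl fun k hk => ?_
    rw [(mem_filter.1 hk).2]
  rw [h1, sum_mul, ← sum_sub_distrib]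
  calc _ ≤ ∑ a : ZMod q, A * q ^ finrank ℚ K * x ^ (1 - 1 / (2 * finrank ℚ K : ℝ)) := by
        refine norm_sum_le_of_le _ fun a _ => ?_
        rw [mul_assoc, ← mul_sub, norm_mul]
        refine (mul_le_of_le_one_left (norm_nonneg _) (DirichletCharacter.norm_le_one χ a)).trans ?_
        refine le_trans (le_of_eq ?_) (hκ a x hx)
        rw [← norm_eq_abs, ← Complex.norm_real]
        push_cast
        rfl
    _ = _ := by
        rw [sum_const, card_univ, ZMod.card, nsmul_eq_mul]
        ring

end IdealAsymp

section Continuation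

open MeasureTheory Set Filter Topology Complex

/-- `f` has mean value `κ` with a power saving error term, and its absolute values have bounded
mean. -/
structure HasMean (f : ℕ → ℂ) (κ : ℂ) (D δ A : ℝ) : Prop where
  pos : 0 < δ
  le_half : δ ≤ 1 / 2
  one_le : 1 ≤ D
  one_le' : 1 ≤ A
  err : ∀ x : ℝ, 1 ≤ x → ‖(∑ k ∈ Finset.Icc 1 ⌊x⌋₊, f k) - κ * x‖ ≤ D * x ^ (1 - δ)
  abs : ∀ x : ℝ, 1 ≤ x → ∑ k ∈ Finset.Icc 1 ⌊x⌋₊, ‖f k‖ ≤ A * x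

/-- The error term of the summatory function, cut off below `1`. -/
noncomputable def meanErr (f : ℕ → ℂ) (κ : ℂ) (u : ℝ) : ℂ :=
  if 1 < u then (∑ k ∈ Finset.Icc 1 ⌊u⌋₊, f k) - κ * u else 0

/-- The L-series of `f` with the pole `κ / (s - 1)` removed. -/
noncomputable def regL (f : ℕ → ℂ) (κ : ℂ) (s : ℂ) : ℂ :=
  κ + s * mellin (meanErr f κ) (-s)

variable {f : ℕ → ℂ} {κ : ℂ} {D δ A : ℝ}

theorem norm_meanErr_le (h : HasMean f κ D δ A) {u : ℝ} (hu : 0 < u) :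
    ‖meanErr f κ u‖ ≤ D * u ^ (1 - δ) := by
  unfold meanErr
  split_ifs with h1
  · exact h.err u h1.le
  · simp only [norm_zero]
    have := h.one_le
    positivity

theorem HasMean.norm_le (h : HasMean f κ D δ A) : ‖κ‖ ≤ A := by
  have h1 : ∀ x : ℝ, 1 ≤ x → ‖κ‖ ≤ A + D * x ^ (-δ) := by
    intro x hx
    have hx0 : 0 < x := by linarith
    have e1 := h.err x hx
    have e2 : ‖∑ k ∈ Finset.Icc 1 ⌊x⌋₊, f k‖ ≤ A * x := (norm_sum_le _ _).trans (h.abs x hx)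
    have e3 : ‖κ * x‖ ≤ A * x + D * x ^ (1 - δ) := by
      have := norm_sub_norm_le (κ * x) (∑ k ∈ Finset.Icc 1 ⌊x⌋₊, f k)
      rw [norm_sub_rev] at this
      linarith
    rw [norm_mul, norm_real, Real.norm_of_nonneg hx0.le, sub_eq_add_neg,
      Real.rpow_add hx0, Real.rpow_one] at e3
    have : ‖κ‖ * x ≤ (A + D * x ^ (-δ)) * x := by nlinarith
    exact le_of_mul_le_mul_right this hx0
  have h2 : Tendsto (fun x : ℝ => A + D * x ^ (-δ)) atTop (𝓝 (A + D * 0)) :=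
    ((tendsto_rpow_neg_atTop h.pos).const_mul D).const_add A
  rw [mul_zero, add_zero] at h2
  refine ge_of_tendsto h2 ?_
  filter_upwards [eventually_ge_atTop 1] with x hx using h1 x hx

theorem measurable_meanErr : Measurable (meanErr f κ) := by
  unfold meanErr
  refine Measurable.ite measurableSet_Ioi ?_ measurable_const
  refine Measurable.sub ?_ (by fun_prop)
  exact (measurable_from_nat (f := fun n => ∑ k ∈ Finset.Icc 1 n, f k)).comp Nat.measurable_floor

theorem locallyIntegrableOn_meanErr (h : HasMean f κ D δ A) :
    LocallyIntegrableOn (meanErr f κ) (Ioi 0) := by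
  have hc : ContinuousOn (fun u : ℝ => D * u ^ (1 - δ)) (Ioi 0) := by
    refine continuousOn_const.mul (continuousOn_id.rpow_const fun x hx => Or.inl ?_)
    exact ne_of_gt hx
  have := hc.locallyIntegrableOn (μ := volume) measurableSet_Ioi
  intro x hx
  obtain ⟨U, hU, hI⟩ := this x hx
  refine ⟨U ∩ Ioi 0, inter_mem hU self_mem_nhdsWithin, ?_⟩
  have hI' := hI.mono_set (inter_subset_left (t := Ioi 0))
  refine Integrable.mono hI' measurable_meanErr.aestronglyMeasurable ?_
  have hm : ∀ᵐ u ∂(volume.restrict (Ioi (0 : ℝ))), ‖meanErr f κ u‖ ≤ ‖D * u ^ (1 - δ)‖ :=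
    (ae_restrict_iff' measurableSet_Ioi).2 (ae_of_all _ fun u hu =>
      (norm_meanErr_le h hu).trans (le_abs_self _))
  exact ae_restrict_of_ae_restrict_of_subset inter_subset_right hm

theorem differentiableAt_regL (h : HasMean f κ D δ A) {s : ℂ} (hs : 1 - δ < s.re) :
    DifferentiableAt ℂ (regL f κ) s := by
  have : DifferentiableAt ℂ (mellin (meanErr f κ)) (-s) := by
    refine mellin_differentiableAt_of_isBigO_rpow (a := -(1 - δ)) (b := -(s.re + 1))
      (locallyIntegrableOn_meanErr h) ?_ (by simp; linarith) ?_ (by simp)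
    · rw [neg_neg]
      refine Asymptotics.IsBigO.of_bound D ?_
      filter_upwards [eventually_gt_atTop 0] with x hx
      rw [Real.norm_of_nonneg (Real.rpow_nonneg hx.le _)]
      exact norm_meanErr_le h hx
    · refine Asymptotics.IsBigO.of_bound 0 ?_
      have : Iio (1 : ℝ) ∈ 𝓝[>] (0 : ℝ) := mem_nhdsWithin_of_mem_nhds (Iio_mem_nhds one_pos)
      filter_upwards [this] with x hx
      simp [meanErr, not_lt.2 (le_of_lt (mem_Iio.1 hx))]
  unfold regL
  have h2 : DifferentiableAt ℂ (fun s => mellin (meanErr f κ) (-s)) s :=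
    this.comp s differentiableAt_id.neg
  fun_prop

theorem mellin_meanErr (s : ℂ) : mellin (meanErr f κ) (-s) =
    ∫ u in Ioi (1 : ℝ), (u : ℂ) ^ (-(s + 1)) *
      ((∑ k ∈ Finset.Icc 1 ⌊u⌋₊, f k) - κ * u) := by
  unfold mellin
  rw [setIntegral_eq_of_subset_of_forall_sdiff_eq_zero measurableSet_Ioi
    (Ioi_subset_Ioi zero_le_one)]
  · refine setIntegral_congr_fun measurableSet_Ioi fun u hu => ?_
    simp only [meanErr, if_pos (mem_Ioi.1 hu), smul_eq_mul]
    congr 2; ring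
  · intro x hx
    have h1 : ¬ (1 < x) := hx.2
    simp [meanErr, h1]

theorem integrableOn_meanErr (h : HasMean f κ D δ A) {s : ℂ} (hs : 1 - δ < s.re) {N : ℝ}
    (hN : 1 ≤ N) : IntegrableOn (fun u : ℝ => (u : ℂ) ^ (-(s + 1)) *
      ((∑ k ∈ Finset.Icc 1 ⌊u⌋₊, f k) - κ * u)) (Ioi N) := by
  have hi : IntegrableOn (fun u : ℝ => D * u ^ (-δ - s.re)) (Ioi N) :=
    (integrableOn_Ioi_rpow_of_lt (by linarith) (by linarith)).const_mul D
  refine Integrable.mono' hi ?_ ?_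
  · refine AEStronglyMeasurable.mul ?_ ?_
    · refine ContinuousOn.aestronglyMeasurable ?_ measurableSet_Ioi
      intro u hu
      refine ContinuousAt.continuousWithinAt ?_
      refine continuousAt_ofReal_cpow_const _ _ (Or.inr ?_)
      have : N < u := hu
      linarith
    · refine (Measurable.sub ?_ (by fun_prop)).aestronglyMeasurable
      exact (measurable_from_nat (f := fun n => ∑ k ∈ Finset.Icc 1 n, f k)).comp
        Nat.measurable_floor
  · refine (ae_restrict_iff' measurableSet_Ioi).2 (ae_of_all _ fun u hu => ?_)
    have hu1 : 1 < u := lt_of_le_of_lt hN hu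
    have hu0 : 0 < u := by linarith
    rw [norm_mul, norm_cpow_eq_rpow_re_of_pos hu0]
    calc _ ≤ u ^ (-(s + 1)).re * (D * u ^ (1 - δ)) := by
          gcongr; exact h.err u hu1.le
      _ = D * (u ^ (-(s + 1)).re * u ^ (1 - δ)) := by ring
      _ = _ := by
          rw [← Real.rpow_add hu0]
          congr 2; simp; ring

theorem norm_integral_meanErr_le (h : HasMean f κ D δ A) {s : ℂ} (hs : 1 - δ < s.re) {N : ℝ}
    (hN : 1 ≤ N) : ‖∫ u in Ioi N, (u : ℂ) ^ (-(s + 1)) *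
      ((∑ k ∈ Finset.Icc 1 ⌊u⌋₊, f k) - κ * u)‖ ≤
      D * (N ^ (1 - δ - s.re) / (s.re - (1 - δ))) := by
  have hi : IntegrableOn (fun u : ℝ => D * u ^ (-δ - s.re)) (Ioi N) :=
    (integrableOn_Ioi_rpow_of_lt (by linarith) (by linarith)).const_mul D
  refine (norm_integral_le_of_norm_le hi ?_).trans (le_of_eq ?_)
  · refine (ae_restrict_iff' measurableSet_Ioi).2 (ae_of_all _ fun u hu => ?_)
    have hu1 : 1 < u := lt_of_le_of_lt hN hu
    have hu0 : 0 < u := by linarith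
    rw [norm_mul, norm_cpow_eq_rpow_re_of_pos hu0]
    calc _ ≤ u ^ (-(s + 1)).re * (D * u ^ (1 - δ)) := by
          gcongr; exact h.err u hu1.le
      _ = D * (u ^ (-(s + 1)).re * u ^ (1 - δ)) := by ring
      _ = _ := by
          rw [← Real.rpow_add hu0]
          congr 2; simp; ring
  · rw [integral_const_mul, integral_Ioi_rpow_of_lt (by linarith) (by linarith)]
    congr 1
    rw [show -δ - s.re + 1 = 1 - δ - s.re by ring,
      show 1 - δ - s.re = -(s.re - (1 - δ)) by ring, div_neg, neg_div, neg_neg]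

theorem norm_regL_le (h : HasMean f κ D δ A) {s : ℂ} (hs : 1 - δ < s.re) :
    ‖regL f κ s‖ ≤ A + ‖s‖ * (D / (s.re - (1 - δ))) := by
  have := norm_integral_meanErr_le h hs le_rfl
  rw [Real.one_rpow, ← mul_div_assoc, mul_one] at this
  unfold regL
  rw [mellin_meanErr]
  refine (norm_add_le _ _).trans (add_le_add h.norm_le ?_)
  rw [norm_mul]
  gcongr

theorem HasMean.lseriesSummable (h : HasMean f κ D δ A) {s : ℂ} (hs : 1 < s.re) :
    LSeriesSummable f s := by
  refine LSeriesSummable_of_sum_norm_bigO (r := 1) ?_ zero_le_one hs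
  refine Asymptotics.IsBigO.of_bound A ?_
  filter_upwards [eventually_ge_atTop 1] with n hn
  have := h.abs n (by exact_mod_cast hn)
  rw [Nat.floor_natCast] at this
  simp only [Real.rpow_one, Real.norm_natCast]
  rwa [Real.norm_of_nonneg (Finset.sum_nonneg fun _ _ => norm_nonneg _)]

theorem LSeries_eq_regL (h : HasMean f κ D δ A) {s : ℂ} (hs : 1 < s.re) :
    LSeries f s = κ / (s - 1) + regL f κ s := by
  have hs1 : s - 1 ≠ 0 := by
    intro h0
    have := congrArg re h0
    simp at this; linarith
  have hδ := h.pos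
  rw [LSeries_eq_mul_integral f zero_le_one hs (h.lseriesSummable hs)]
  · unfold regL
    rw [mellin_meanErr]
    have hI1 := integrableOn_meanErr h (s := s) (by linarith) le_rfl
    have hI2 : IntegrableOn (fun u : ℝ => (u : ℂ) ^ (-s)) (Ioi 1) :=
      integrableOn_Ioi_cpow_of_lt (by simpa using hs) one_pos
    have e1 : ∫ t in Ioi (1 : ℝ), (∑ k ∈ Finset.Icc 1 ⌊t⌋₊, f k) * (t : ℂ) ^ (-(s + 1)) =
        (∫ u in Ioi (1 : ℝ), (u : ℂ) ^ (-(s + 1)) *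
          ((∑ k ∈ Finset.Icc 1 ⌊u⌋₊, f k) - κ * u)) + κ * ∫ u in Ioi (1 : ℝ), (u : ℂ) ^ (-s) := by
      rw [← integral_const_mul, ← integral_add hI1 (hI2.const_mul κ)]
      refine setIntegral_congr_fun measurableSet_Ioi fun u hu => ?_
      have hu0 : (u : ℂ) ≠ 0 := by
        have : (1 : ℝ) < u := hu
        exact_mod_cast (by linarith : u ≠ 0)
      have : (u : ℂ) ^ (-s) = (u : ℂ) ^ (-(s + 1)) * u := by
        rw [show -s = -(s + 1) + 1 by ring, cpow_add _ _ hu0, cpow_one]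
      simp only [this]; ring
    rw [e1, integral_Ioi_cpow_of_lt (by simpa using hs) one_pos]
    simp only [ofReal_one, one_cpow]
    have hs2 : -s + 1 ≠ 0 := by
      rw [show -s + 1 = -(s - 1) by ring]; exact neg_ne_zero.2 hs1
    field_simp
    ring
  · refine Asymptotics.IsBigO.of_bound A ?_
    filter_upwards [eventually_ge_atTop 1] with n hn
    have := h.abs n (by exact_mod_cast hn)
    rw [Nat.floor_natCast] at this
    simp only [Real.rpow_one, Real.norm_natCast]
    exact (norm_sum_le _ _).trans this

theorem sum_mul_cpow_eq (f : ℕ → ℂ) {s : ℂ} (hs : s ≠ 0) {N : ℕ} :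
    ∑ k ∈ Finset.Icc 1 N, f k * (k : ℂ) ^ (-s) =
      (∑ k ∈ Finset.Icc 1 N, f k) * (N : ℂ) ^ (-s) +
        s * ∫ u in Ioc (1 : ℝ) N, (u : ℂ) ^ (-(s + 1)) * ∑ k ∈ Finset.Icc 1 ⌊u⌋₊, f k := by
  let c : ℕ → ℂ := fun k => if k = 0 then 0 else f k
  have hc : ∀ n, ∀ g : ℕ → ℂ, ∑ k ∈ Finset.Icc 0 n, g k * c k =
      ∑ k ∈ Finset.Icc 1 n, g k * f k := by
    intro n g
    rw [← Finset.insert_Icc_add_one_left_eq_Icc n.zero_le, Finset.sum_insert (by simp)]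
    simp only [c, if_true, mul_zero, zero_add]
    refine Finset.sum_congr rfl fun k hk => ?_
    rw [if_neg]
    have := (Finset.mem_Icc.1 hk).1
    omega
  have hc' : ∀ n, ∑ k ∈ Finset.Icc 0 n, c k = ∑ k ∈ Finset.Icc 1 n, f k := by
    intro n; simpa using hc n 1
  have hdiff : ∀ t ∈ Icc (1 : ℝ) N, DifferentiableAt ℝ (fun x : ℝ => (x : ℂ) ^ (-s)) t :=
    fun t ht => differentiableAt_id.ofReal_cpow_const (zero_lt_one.trans_le ht.1).ne'
      (neg_ne_zero.mpr hs)
  have hder : ∀ t ∈ Icc (1 : ℝ) N, deriv (fun x : ℝ => (x : ℂ) ^ (-s)) t =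
      -s * (t : ℂ) ^ (-(s + 1)) := fun t ht => by
    rw [deriv_ofReal_cpow_const (zero_lt_one.trans_le ht.1).ne' (neg_ne_zero.2 hs)]
    congr 2; ring
  have hInt : IntegrableOn (deriv fun x : ℝ => (x : ℂ) ^ (-s)) (Icc (1 : ℝ) N) := by
    refine (IntegrableOn.congr_fun (f := fun t : ℝ => -s * (t : ℂ) ^ (-(s + 1))) ?_
      (fun t ht => (hder t ht).symm) measurableSet_Icc)
    refine ContinuousOn.integrableOn_Icc ?_
    intro t ht
    refine (continuousAt_const.mul (continuousAt_ofReal_cpow_const _ _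
      (Or.inr ?_))).continuousWithinAt
    have := ht.1
    linarith
  have key := sum_mul_eq_sub_integral_mul₀' c (f := fun x : ℝ => (x : ℂ) ^ (-s)) (by simp [c]) N
    hdiff hInt
  have h2 := hc N (fun k => ((k : ℝ) : ℂ) ^ (-s))
  rw [h2, hc'] at key
  simp only [mul_comm (f _)]
  simp only [ofReal_natCast] at key
  rw [key, mul_comm, sub_eq_add_neg, ← integral_neg, ← integral_const_mul]
  congr 1
  refine setIntegral_congr_fun measurableSet_Ioc fun u hu => ?_
  simp only [hc', hder u ⟨hu.1.le, hu.2⟩]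
  ring

theorem regL_eq_truncated (h : HasMean f κ D δ A) {s : ℂ} (hs : 1 - δ < s.re) {N : ℕ}
    (hN : 1 ≤ N) : regL f κ s = (∑ k ∈ Finset.Icc 1 N, f k * (k : ℂ) ^ (-s))
      - ((∑ k ∈ Finset.Icc 1 N, f k) - κ * N) * (N : ℂ) ^ (-s)
      - κ * (∫ u in Ioc (1 : ℝ) N, (u : ℂ) ^ (-s))
      + s * ∫ u in Ioi (N : ℝ), (u : ℂ) ^ (-(s + 1)) *
        ((∑ k ∈ Finset.Icc 1 ⌊u⌋₊, f k) - κ * u) := by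
  have hδ := h.le_half
  have hs0 : s ≠ 0 := by
    rintro rfl
    simp at hs; linarith
  have hN' : (1 : ℝ) ≤ N := by exact_mod_cast hN
  have hcont : ∀ z : ℂ, ContinuousOn (fun u : ℝ => (u : ℂ) ^ z) (Icc (1 : ℝ) N) := by
    intro z t ht
    refine (continuousAt_ofReal_cpow_const _ _ (Or.inr ?_)).continuousWithinAt
    have := ht.1
    linarith
  have hI2 : IntegrableOn (fun u : ℝ => (u : ℂ) ^ (-s)) (Ioc (1 : ℝ) N) :=
    (hcont _).integrableOn_Icc.mono_set Ioc_subset_Icc_self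
  have hIall := integrableOn_meanErr h hs le_rfl
  have hI1 := hIall.mono_set (fun u (hu : u ∈ Ioc (1 : ℝ) N) => hu.1)
  have hI3 := integrableOn_meanErr h hs hN'
  have e1 : ∫ u in Ioc (1 : ℝ) N, (u : ℂ) ^ (-(s + 1)) * (∑ k ∈ Finset.Icc 1 ⌊u⌋₊, f k) =
      (∫ u in Ioc (1 : ℝ) N, (u : ℂ) ^ (-(s + 1)) *
        ((∑ k ∈ Finset.Icc 1 ⌊u⌋₊, f k) - κ * u)) + κ * ∫ u in Ioc (1 : ℝ) N, (u : ℂ) ^ (-s) := by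
    rw [← integral_const_mul, ← integral_add hI1 (hI2.const_mul κ)]
    refine setIntegral_congr_fun measurableSet_Ioc fun u hu => ?_
    have hu0 : (u : ℂ) ≠ 0 := by
      have : (1 : ℝ) < u := hu.1
      exact_mod_cast (by linarith : u ≠ 0)
    have : (u : ℂ) ^ (-s) = (u : ℂ) ^ (-(s + 1)) * u := by
      rw [show -s = -(s + 1) + 1 by ring, cpow_add _ _ hu0, cpow_one]
    simp only [this]; ring
  have e2 : (∫ u in Ioi (1 : ℝ), (u : ℂ) ^ (-(s + 1)) *
        ((∑ k ∈ Finset.Icc 1 ⌊u⌋₊, f k) - κ * u)) =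
      (∫ u in Ioc (1 : ℝ) N, (u : ℂ) ^ (-(s + 1)) *
        ((∑ k ∈ Finset.Icc 1 ⌊u⌋₊, f k) - κ * u)) + ∫ u in Ioi (N : ℝ), (u : ℂ) ^ (-(s + 1)) *
        ((∑ k ∈ Finset.Icc 1 ⌊u⌋₊, f k) - κ * u) := by
    rw [← Ioc_union_Ioi_eq_Ioi hN', setIntegral_union
      (Ioc_disjoint_Ioi le_rfl) measurableSet_Ioi hI1 hI3]
  have e3 : (1 - s) * ∫ u in Ioc (1 : ℝ) N, (u : ℂ) ^ (-s) = (N : ℂ) * (N : ℂ) ^ (-s) - 1 := by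
    rw [← intervalIntegral.integral_of_le hN']
    have hNC : (N : ℂ) ≠ 0 := by exact_mod_cast (by omega : N ≠ 0)
    by_cases h1 : s = 1
    · subst h1
      rw [cpow_neg_one, mul_inv_cancel₀ hNC]; simp
    · have h1s : -s + 1 ≠ 0 := by
        intro h0; apply h1; linear_combination -h0
      rw [integral_cpow (Or.inr ⟨by intro h0; apply h1; linear_combination -h0, by
        rw [uIcc_of_le hN']; intro h0; have := h0.1; linarith⟩)]
      rw [show (1 - s) = -s + 1 by ring, mul_div_cancel₀ _ h1s, cpow_add _ _ (by simpa using hNC)]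
      simp [mul_comm]
  have e4 := sum_mul_cpow_eq f hs0 (N := N)
  unfold regL
  rw [mellin_meanErr, e2, e4, e1]
  linear_combination κ * e3

end Continuation

section RegBound

open MeasureTheory Set Filter Topology Real

theorem sum_div_le_log {r : ℕ → ℝ} {A : ℝ} (hA : 0 ≤ A)
    (h : ∀ n : ℕ, 1 ≤ n → ∑ k ∈ Finset.Icc 1 n, r k ≤ A * n) {N : ℕ} (hN : 1 ≤ N) :
    ∑ k ∈ Finset.Icc 1 N, r k / k ≤ A * (2 + log N) := by
  have key : ∀ n : ℕ, ∑ k ∈ Finset.Icc 1 n, r k / k =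
      (∑ k ∈ Finset.Icc 1 n, r k) / (n + 1) +
        ∑ j ∈ Finset.Icc 1 n, (∑ k ∈ Finset.Icc 1 j, r k) / (j * (j + 1)) := by
    intro n
    induction n with
    | zero => simp
    | succ n ih =>
      rw [Finset.sum_Icc_succ_top (by omega), Finset.sum_Icc_succ_top (by omega), ih,
        Finset.sum_Icc_succ_top (by omega) (f := fun j : ℕ =>
          (∑ k ∈ Finset.Icc 1 j, r k) / ((j : ℝ) * (j + 1))), Finset.sum_Icc_succ_top (by omega)]
      push_cast
      have h1 : (n : ℝ) + 1 ≠ 0 := by positivity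
      have h2 : (n : ℝ) + 1 + 1 ≠ 0 := by positivity
      field_simp
      ring
  rw [key]
  have h1 : (∑ k ∈ Finset.Icc 1 N, r k) / (N + 1) ≤ A := by
    rw [div_le_iff₀ (by positivity)]
    have := h N hN
    nlinarith
  have h2 : ∑ j ∈ Finset.Icc 1 N, (∑ k ∈ Finset.Icc 1 j, r k) / (j * (j + 1)) ≤
      A * (harmonic N : ℝ) := by
    rw [harmonic_eq_sum_Icc]
    push_cast
    rw [Finset.mul_sum]
    refine Finset.sum_le_sum fun j hj => ?_
    have hj1 := (Finset.mem_Icc.1 hj).1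
    have hj0 : (0 : ℝ) < j := by exact_mod_cast hj1
    rw [div_le_iff₀ (by positivity)]
    calc _ ≤ A * j := h j hj1
      _ ≤ A * (j + 1) := by nlinarith
      _ = _ := by field_simp
  have h3 := harmonic_le_one_add_log N
  nlinarith

variable {f : ℕ → ℂ} {κ : ℂ} {D δ A : ℝ}

theorem norm_regL_le_log (h : HasMean f κ D δ A) {s : ℂ} {N : ℕ} (hN : 3 ≤ N)
    (hs : 1 - 1 / log N ≤ s.re) (hδN : 2 ≤ δ * log N)
    (hsN : ‖s‖ * D ≤ (N : ℝ) ^ (δ / 2)) : ‖regL f κ s‖ ≤ 18 * A * log N := by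
  have hδ := h.pos
  have hA := h.one_le'
  have hN1 : (1 : ℝ) ≤ N := by exact_mod_cast (by omega : 1 ≤ N)
  have hN3 : (3 : ℝ) ≤ N := by exact_mod_cast hN
  have hN0 : (0 : ℝ) < N := by linarith
  set T := log N with hT
  have hT1 : 1 ≤ T := by
    rw [hT, le_log_iff_exp_le hN0]
    linarith [exp_one_lt_d9]
  have hT0 : 0 < T := by linarith
  have hTδ : 1 / T ≤ δ / 2 := by
    rw [div_le_div_iff₀ hT0 two_pos]; linarith
  have hσ : 1 - δ / 2 ≤ s.re := by linarith
  have hpow : ∀ u : ℝ, 1 ≤ u → u ≤ N → u ^ (-s.re) ≤ 2.72 * u⁻¹ := by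
    intro u hu huN
    have hu0 : 0 < u := by linarith
    have : u ^ (-s.re) = u ^ (1 - s.re) * u⁻¹ := by
      rw [← rpow_neg_one u, ← rpow_add hu0]; congr 1; ring
    rw [this]
    gcongr
    calc u ^ (1 - s.re) ≤ u ^ (1 / T) := rpow_le_rpow_of_exponent_le hu (by linarith)
      _ ≤ (N : ℝ) ^ (1 / T) := rpow_le_rpow hu0.le huN (by positivity)
      _ = exp 1 := by
          rw [rpow_def_of_pos hN0, ← hT, mul_one_div_cancel hT0.ne']
      _ ≤ 2.72 := by linarith [exp_one_lt_d9]
  have habs : ∀ n : ℕ, 1 ≤ n → ∑ k ∈ Finset.Icc 1 n, ‖f k‖ ≤ A * n := by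
    intro n hn
    have := h.abs n (by exact_mod_cast hn)
    rwa [Nat.floor_natCast] at this
  have b1 : ‖∑ k ∈ Finset.Icc 1 N, f k * (k : ℂ) ^ (-s)‖ ≤ 2.72 * (A * (2 + T)) := by
    calc _ ≤ ∑ k ∈ Finset.Icc 1 N, 2.72 * (‖f k‖ / k) := by
          refine (norm_sum_le _ _).trans (Finset.sum_le_sum fun k hk => ?_)
          obtain ⟨hk1, hk2⟩ := Finset.mem_Icc.1 hk
          have hk0 : 0 < k := hk1
          rw [norm_mul, Complex.norm_natCast_cpow_of_pos hk0, Complex.neg_re]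
          have := hpow k (by exact_mod_cast hk1) (by exact_mod_cast hk2)
          calc _ ≤ ‖f k‖ * (2.72 * (k : ℝ)⁻¹) := by gcongr
            _ = _ := by ring
      _ = 2.72 * ∑ k ∈ Finset.Icc 1 N, (‖f k‖ / k) := by rw [Finset.mul_sum]
      _ ≤ _ := by
          gcongr
          exact sum_div_le_log (by linarith) habs (by omega)
  have b2 : ‖((∑ k ∈ Finset.Icc 1 N, f k) - κ * N) * (N : ℂ) ^ (-s)‖ ≤ 2.72 * (2 * A) := by
    rw [norm_mul, Complex.norm_natCast_cpow_of_pos (by omega), Complex.neg_re]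
    have h1 : ‖(∑ k ∈ Finset.Icc 1 N, f k) - κ * N‖ ≤ 2 * A * N := by
      refine (norm_sub_le _ _).trans ?_
      have e1 := (norm_sum_le _ _).trans (habs N (by omega))
      have e2 : ‖κ * N‖ ≤ A * N := by
        rw [norm_mul, Complex.norm_natCast]
        gcongr; exact h.norm_le
      linarith
    calc _ ≤ (2 * A * N) * (2.72 * (N : ℝ)⁻¹) := by
          gcongr; exact hpow N hN1 le_rfl
      _ = _ := by field_simp
  have b3 : ‖κ * (∫ u in Ioc (1 : ℝ) N, (u : ℂ) ^ (-s))‖ ≤ A * (2.72 * T) := by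
    rw [norm_mul]
    refine mul_le_mul h.norm_le ?_ (norm_nonneg _) (by linarith)
    have hi : IntegrableOn (fun u : ℝ => 2.72 * u⁻¹) (Ioc (1 : ℝ) N) := by
      refine (ContinuousOn.integrableOn_Icc ?_).mono_set Ioc_subset_Icc_self
      refine continuousOn_const.mul (continuousOn_id.inv₀ fun u hu => ?_)
      have : (1 : ℝ) ≤ u := hu.1
      exact (by positivity : u ≠ 0)
    refine (norm_integral_le_of_norm_le hi ?_).trans (le_of_eq ?_)
    · refine (ae_restrict_iff' measurableSet_Ioc).2 (ae_of_all _ fun u hu => ?_)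
      have hu0 : (0 : ℝ) < u := by linarith [hu.1]
      rw [Complex.norm_cpow_eq_rpow_re_of_pos hu0, Complex.neg_re]
      exact hpow u hu.1.le hu.2
    · rw [integral_const_mul, ← intervalIntegral.integral_of_le hN1, integral_inv_of_pos one_pos hN0,
        div_one]
  have b4 : ‖s * ∫ u in Ioi (N : ℝ), (u : ℂ) ^ (-(s + 1)) *
        ((∑ k ∈ Finset.Icc 1 ⌊u⌋₊, f k) - κ * u)‖ ≤ T := by
    rw [norm_mul]
    have e1 := norm_integral_meanErr_le h (s := s) (by linarith) hN1
    have e2 : (N : ℝ) ^ (1 - δ - s.re) / (s.re - (1 - δ)) ≤ (N : ℝ) ^ (-(δ / 2)) / (δ / 2) := by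
      refine div_le_div₀ (by positivity) ?_ (by positivity) (by linarith)
      exact rpow_le_rpow_of_exponent_le hN1 (by linarith)
    have hD := h.one_le
    calc _ ≤ ‖s‖ * (D * ((N : ℝ) ^ (-(δ / 2)) / (δ / 2))) := by
          refine mul_le_mul_of_nonneg_left (e1.trans ?_) (norm_nonneg _)
          gcongr
      _ = (‖s‖ * D) * (N : ℝ) ^ (-(δ / 2)) * (2 / δ) := by field_simp
      _ ≤ (N : ℝ) ^ (δ / 2) * (N : ℝ) ^ (-(δ / 2)) * (2 / δ) := by gcongr
      _ = 2 / δ := by rw [← rpow_add hN0]; simp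
      _ ≤ T := by rw [div_le_iff₀ hδ]; linarith
  rw [regL_eq_truncated h (by linarith) (by omega : 1 ≤ N)]
  refine (norm_add_le _ _).trans ?_
  have c1 := norm_sub_le ((∑ k ∈ Finset.Icc 1 N, f k * (k : ℂ) ^ (-s))
      - ((∑ k ∈ Finset.Icc 1 N, f k) - κ * N) * (N : ℂ) ^ (-s))
      (κ * (∫ u in Ioc (1 : ℝ) N, (u : ℂ) ^ (-s)))
  have c2 := norm_sub_le (∑ k ∈ Finset.Icc 1 N, f k * (k : ℂ) ^ (-s))
      (((∑ k ∈ Finset.Icc 1 N, f k) - κ * N) * (N : ℂ) ^ (-s))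
  have : A ≤ A * T := by nlinarith
  nlinarith

/-- The logarithmic size of modulus and height. -/
noncomputable def logSize (q : ℕ) (t : ℝ) : ℝ := log (q * (|t| + 3))

theorem one_le_logSize {q : ℕ} (hq : 1 ≤ q) (t : ℝ) : 1 ≤ logSize q t := by
  have hq' : (1 : ℝ) ≤ q := by exact_mod_cast hq
  have : (3 : ℝ) ≤ q * (|t| + 3) := by nlinarith [abs_nonneg t]
  unfold logSize
  rw [le_log_iff_exp_le (by linarith)]
  linarith [exp_one_lt_d9]

theorem exists_norm_regL_le {D₀ δ A : ℝ} (hδ : 0 < δ) (hD : 1 ≤ D₀) (hA : 1 ≤ A) (m : ℕ) :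
    ∃ C : ℝ, 1 ≤ C ∧ ∀ (q : ℕ) (f : ℕ → ℂ) (κ : ℂ), 1 ≤ q → HasMean f κ (D₀ * q ^ m) δ A →
      ∀ s : ℂ, 1 - 1 / (C * logSize q s.im) ≤ s.re → s.re ≤ 3 →
        ‖regL f κ s‖ ≤ C * logSize q s.im := by
  set B : ℝ := 2 * (m + 1 + log D₀) / δ with hB
  have hlD : 0 ≤ log D₀ := log_nonneg hD
  have hB0 : 2 / δ ≤ B := by
    rw [hB]; gcongr; nlinarith [(Nat.cast_nonneg m : (0 : ℝ) ≤ m)]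
  have hBpos : 0 < B := lt_of_lt_of_le (by positivity) hB0
  refine ⟨18 * A * (B + 1), by nlinarith, ?_⟩
  intro q f κ hq h s hs1 hs3
  have hδ2 := h.le_half
  have hB1 : 1 ≤ B := by
    refine le_trans ?_ hB0
    rw [le_div_iff₀ hδ]; linarith
  set P : ℝ := q * (|s.im| + 3) with hP
  have hq' : (1 : ℝ) ≤ q := by exact_mod_cast hq
  have hP3 : 3 ≤ P := by rw [hP]; nlinarith [abs_nonneg s.im]
  have hP0 : 0 < P := by linarith
  have hℓ : logSize q s.im = log P := rfl
  have hℓ1 := one_le_logSize hq s.im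
  rw [hℓ] at hs1 hℓ1 ⊢
  have hPe : exp 1 ≤ P := by linarith [exp_one_lt_d9]
  set N : ℕ := ⌈P ^ B⌉₊ with hN
  have hPB : P ≤ P ^ B := by
    conv_lhs => rw [← rpow_one P]
    exact rpow_le_rpow_of_exponent_le (by linarith) hB1
  have hNle : P ^ B ≤ N := Nat.le_ceil _
  have hN3 : 3 ≤ N := by
    have : (3 : ℝ) ≤ N := by linarith
    exact_mod_cast this
  have hNpos : (0 : ℝ) < N := by linarith
  have hNlt : (N : ℝ) ≤ P ^ (B + 1) := by
    have := (Nat.ceil_lt_add_one (by positivity : 0 ≤ P ^ B)).le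
    rw [rpow_add hP0, rpow_one]
    calc (N : ℝ) ≤ P ^ B + 1 := this
      _ ≤ P ^ B * P := by nlinarith
  have hlogN : log N ≤ (B + 1) * log P := by
    rw [← log_rpow hP0]; exact log_le_log hNpos hNlt
  have hlogN' : B * log P ≤ log N := by
    rw [← log_rpow hP0]; exact log_le_log (by positivity) hNle
  have hlogN1 : 0 < log N := lt_of_lt_of_le (by nlinarith) hlogN'
  have hbig : log N ≤ 18 * A * (B + 1) * log P := by nlinarith
  have := norm_regL_le_log h hN3 (s := s) ?_ ?_ ?_
  · refine this.trans ?_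
    calc 18 * A * log N ≤ 18 * A * ((B + 1) * log P) := by gcongr
      _ = _ := by ring
  · refine le_trans ?_ hs1
    gcongr
  · have : 2 ≤ δ * B := by rw [div_le_iff₀ hδ] at hB0; linarith
    nlinarith
  · have hsn : ‖s‖ ≤ |s.im| + 3 := by
      have hre : 0 ≤ s.re := by
        refine le_trans ?_ hs1
        rw [sub_nonneg, div_le_one (by positivity)]
        nlinarith
      have := Complex.norm_le_abs_re_add_abs_im s
      rw [abs_of_nonneg hre] at this
      linarith
    have hD₀ : D₀ ≤ P ^ (log D₀) := by
      calc D₀ = exp (log D₀) := (exp_log (by linarith)).symm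
        _ = exp 1 ^ log D₀ := (exp_one_rpow _).symm
        _ ≤ _ := rpow_le_rpow (exp_pos _).le hPe hlD
    calc ‖s‖ * (D₀ * q ^ m) ≤ P * (P ^ log D₀ * P ^ m) := by
          refine mul_le_mul ?_ ?_ (by positivity) hP0.le
          · rw [hP]; nlinarith [abs_nonneg s.im]
          · refine mul_le_mul hD₀ ?_ (by positivity) (by positivity)
            refine pow_le_pow_left₀ (by positivity) ?_ _
            rw [hP]; nlinarith [abs_nonneg s.im]
      _ = P ^ (B * (δ / 2)) := by
          rw [← rpow_natCast, ← rpow_add hP0]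
          conv_lhs => rw [← rpow_one_add' hP0.le (by positivity)]
          congr 1
          rw [hB]; field_simp; ring
      _ = (P ^ B) ^ (δ / 2) := rpow_mul hP0.le _ _
      _ ≤ _ := rpow_le_rpow (by positivity) hNle (by positivity)

end RegBound

section VonMangoldtK

open UniqueFactorizationMonoid Finset ArithmeticFunction

variable (K : Type*) [Field K] [NumberField K]

/-- The finite set of ideals of norm `n`. -/
noncomputable def idealsOfNorm (n : ℕ) : Finset (Ideal (𝓞 K)) :=
  (Ideal.finite_setOfPred_absNorm_eq n).toFinset

variable {K} in
theorem mem_idealsOfNorm {n : ℕ} {I : Ideal (𝓞 K)} : I ∈ idealsOfNorm K n ↔ absNorm I = n := by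
  simp [idealsOfNorm]

theorem idealCount_eq_card (n : ℕ) : idealCount K n = (idealsOfNorm K n).card := by
  unfold idealCount idealsOfNorm
  exact (Set.ncard_eq_toFinset_card _ (Ideal.finite_setOfPred_absNorm_eq n))

/-- The von Mangoldt function of `K` summed over the ideals of norm `n`. -/
noncomputable def vmK (n : ℕ) : ℝ := ∑ I ∈ idealsOfNorm K n, LambdaK K I

variable {K}

theorem LambdaK_nonneg (I : Ideal (𝓞 K)) : 0 ≤ LambdaK K I := by
  unfold LambdaK
  split_ifs
  · exact Real.log_natCast_nonneg _
  · exact le_rfl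

theorem LambdaK_prime_pow {P : Ideal (𝓞 K)} (hP : P.IsPrime) (h0 : P ≠ ⊥) {m : ℕ} (hm : 1 ≤ m) :
    LambdaK K (P ^ m) = Real.log (absNorm P) := by
  unfold LambdaK
  rw [if_pos ⟨P, m, hP, h0, hm, rfl⟩, Ideal.radical_pow P (by omega), hP.radical]

theorem LambdaK_bot : LambdaK K ⊥ = 0 := by
  unfold LambdaK
  rw [if_neg]
  rintro ⟨P, m, -, h0, hm, h⟩
  exact h0 (eq_zero_of_pow_eq_zero (h.symm))

theorem absNorm_ne_zero_iff_ne_bot {I : Ideal (𝓞 K)} : absNorm I ≠ 0 ↔ I ≠ ⊥ := by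
  rw [Ne, absNorm_eq_zero_iff]

/-- `log N𝔞` is the sum of `Λ` over the divisors of `𝔞`. -/
theorem sum_LambdaK_dvd {I : Ideal (𝓞 K)} (hI : I ≠ ⊥) (S : Finset (Ideal (𝓞 K)))
    (hS : ∀ J, J ∈ S ↔ J ∣ I) : ∑ J ∈ S, LambdaK K J = Real.log (absNorm I) := by
  have h1 : Real.log (absNorm I) =
      ∑ P ∈ (normalizedFactors I).toFinset, ((normalizedFactors I).count P : ℝ) *
        Real.log (absNorm P) := by
    conv_lhs => rw [← Ideal.prod_normalizedFactors_eq_self hI, prod_multiset_count, map_prod]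
    push_cast
    rw [Real.log_prod]
    · refine sum_congr rfl fun P _ => ?_
      rw [map_pow]; push_cast; rw [Real.log_pow]
    · intro P hP
      have := prime_of_normalized_factor P (Multiset.mem_toFinset.1 hP)
      rw [map_pow]; push_cast
      refine pow_ne_zero _ ?_
      exact_mod_cast absNorm_ne_zero_iff_ne_bot.2 this.ne_zero
  have h2 : ∑ P ∈ (normalizedFactors I).toFinset, ((normalizedFactors I).count P : ℝ) *
        Real.log (absNorm P) =
      ∑ x ∈ (normalizedFactors I).toFinset.sigma
        (fun P => Icc 1 ((normalizedFactors I).count P)), Real.log (absNorm x.1) := by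
    rw [sum_sigma]
    simp
  rw [h1, h2]
  symm
  refine sum_bij_ne_zero (fun x _ _ => x.1 ^ x.2) ?_ ?_ ?_ ?_
  · rintro ⟨P, m⟩ hx -
    simp only [mem_sigma, Multiset.mem_toFinset, mem_Icc] at hx
    have hp := prime_of_normalized_factor P hx.1
    rw [hS, pow_dvd_iff_le_emultiplicity, emultiplicity_eq_count_normalizedFactors hp.irreducible hI]
    simpa using hx.2.2
  · rintro ⟨P, m⟩ hx - ⟨Q, k⟩ hy - h
    simp only [mem_sigma, Multiset.mem_toFinset, mem_Icc] at hx hy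
    have hp := prime_of_normalized_factor P hx.1
    have hq := prime_of_normalized_factor Q hy.1
    simp only at h
    have h3 := hp.irreducible.normalizedFactors_pow m
    rw [h, hq.irreducible.normalizedFactors_pow] at h3
    have hc := congrArg Multiset.card h3
    simp only [Multiset.card_replicate] at hc
    subst hc
    have : Q = P := by
      have := (Multiset.replicate_right_inj (by omega)).1 h3
      simpa using this
    rw [this]
  · intro J hJ hne
    have hpp : IsPrimeIdealPower J := by
      by_contra h
      simp [LambdaK, h] at hne
    obtain ⟨P, m, hP, h0, hm, rfl⟩ := hpp
    have hp := prime_of_isPrime h0 hP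
    rw [LambdaK_prime_pow hP h0 hm] at hne
    rw [hS, pow_dvd_iff_le_emultiplicity,
      emultiplicity_eq_count_normalizedFactors hp.irreducible hI, normalize_eq] at hJ
    have hJ' : m ≤ (normalizedFactors I).count P := by exact_mod_cast hJ
    refine ⟨⟨P, m⟩, ?_, hne, rfl⟩
    simp only [mem_sigma, Multiset.mem_toFinset, mem_Icc]
    exact ⟨Multiset.one_le_count_iff_mem.1 (hm.trans hJ'), hm, hJ'⟩
  · rintro ⟨P, m⟩ hx -
    simp only [mem_sigma, Multiset.mem_toFinset, mem_Icc] at hx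
    have hp := prime_of_normalized_factor P hx.1
    rw [LambdaK_prime_pow (isPrime_of_prime hp) hp.ne_zero hx.2.1]

variable (K)

theorem vmK_nonneg (n : ℕ) : 0 ≤ vmK K n := sum_nonneg fun _ _ => LambdaK_nonneg _

/-- The convolution identity `r(n) log n = ∑_{de = n} r(d) Λ(e)`. -/
theorem idealCount_mul_log {n : ℕ} (hn : n ≠ 0) :
    (idealCount K n : ℝ) * Real.log n =
      ∑ p ∈ n.divisorsAntidiagonal, (idealCount K p.1 : ℝ) * vmK K p.2 := by
  have h1 : (idealCount K n : ℝ) * Real.log n = ∑ I ∈ idealsOfNorm K n,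
      ∑ e ∈ n.divisors, ∑ J ∈ idealsOfNorm K e, if J ∣ I then LambdaK K J else 0 := by
    rw [idealCount_eq_card, ← nsmul_eq_mul, ← sum_const]
    refine sum_congr rfl fun I hI => ?_
    have hIn := mem_idealsOfNorm.1 hI
    have hI0 : I ≠ ⊥ := absNorm_ne_zero_iff_ne_bot.1 (hIn ▸ hn)
    let S := (n.divisors.biUnion (idealsOfNorm K)).filter (· ∣ I)
    rw [← hIn, ← sum_LambdaK_dvd hI0 S, hIn, sum_filter, sum_biUnion]
    · intro d _ e _ hde
      rw [Function.onFun, disjoint_left]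
      intro J h1 h2
      exact hde ((mem_idealsOfNorm.1 h1).symm.trans (mem_idealsOfNorm.1 h2))
    · intro J
      simp only [S, mem_filter, mem_biUnion, Nat.mem_divisors, mem_idealsOfNorm]
      refine ⟨fun h => h.2, fun h => ⟨⟨absNorm J, ⟨?_, hn⟩, rfl⟩, h⟩⟩
      rw [← hIn]
      exact map_dvd absNorm h
  rw [h1, sum_comm, Nat.sum_divisorsAntidiagonal' (fun a b => (idealCount K a : ℝ) * vmK K b)]
  refine sum_congr rfl fun e he => ?_
  have hen := Nat.dvd_of_mem_divisors he
  have he0 : e ≠ 0 := by rintro rfl; exact hn (zero_dvd_iff.1 hen)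
  rw [sum_comm, vmK, mul_sum]
  refine sum_congr rfl fun J hJ => ?_
  have hJe := mem_idealsOfNorm.1 hJ
  have hJ0 : J ≠ ⊥ := absNorm_ne_zero_iff_ne_bot.1 (hJe ▸ he0)
  rw [← sum_filter, sum_const, nsmul_eq_mul, idealCount_eq_card]
  congr 2
  symm
  refine card_bij (fun I _ => J * I) ?_ ?_ ?_
  · intro I hI
    rw [mem_filter, mem_idealsOfNorm, map_mul, hJe, mem_idealsOfNorm.1 hI]
    exact ⟨Nat.mul_div_cancel' hen, dvd_mul_right _ _⟩
  · intro I _ I' _ h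
    exact mul_left_cancel₀ hJ0 h
  · intro I hI
    rw [mem_filter, mem_idealsOfNorm] at hI
    obtain ⟨hI, I', rfl⟩ := hI
    refine ⟨I', ?_, rfl⟩
    rw [map_mul, hJe] at hI
    rw [mem_idealsOfNorm, ← hI, Nat.mul_div_cancel_left _ (Nat.pos_of_ne_zero he0)]

theorem idealCount_one : idealCount K 1 = 1 := by
  rw [idealCount_eq_card, card_eq_one]
  refine ⟨⊤, ?_⟩
  ext I
  rw [mem_idealsOfNorm, absNorm_eq_one_iff, mem_singleton]

theorem vmK_le (n : ℕ) : vmK K n ≤ Module.finrank ℚ K * vonMangoldt n := by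
  by_cases hz : ∀ I ∈ idealsOfNorm K n, LambdaK K I = 0
  · rw [vmK, sum_eq_zero hz]
    exact mul_nonneg (by positivity) vonMangoldt_nonneg
  push Not at hz
  obtain ⟨I, hI, hne⟩ := hz
  have hpp : ∀ {J : Ideal (𝓞 K)}, LambdaK K J ≠ 0 → IsPrimeIdealPower J := by
    intro J hJ
    by_contra h
    simp [LambdaK, h] at hJ
  obtain ⟨P, m, hP, h0, hm, rfl⟩ := hpp hne
  have hIn := mem_idealsOfNorm.1 hI
  have hPmax := hP.isMaximal h0
  obtain ⟨p, j, hp, hj, hpj⟩ : ∃ p j, p.Prime ∧ 1 ≤ j ∧ absNorm P = p ^ j := by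
    have := Ideal.finiteQuotientOfFreeOfNeBot P h0
    have : Fintype (𝓞 K ⧸ P) := Fintype.ofFinite _
    let := Ideal.Quotient.field P
    obtain ⟨p, hpc⟩ := CharP.exists (𝓞 K ⧸ P)
    obtain ⟨k, hp, hk⟩ := FiniteField.card (𝓞 K ⧸ P) p
    refine ⟨p, k, hp, k.2, ?_⟩
    rw [← hk, absNorm_apply, Submodule.cardQuot_apply, Nat.card_eq_fintype_card]
  rw [map_pow, hpj, ← pow_mul] at hIn
  rw [← hIn, vonMangoldt_apply_pow (Nat.mul_ne_zero (by omega) (by omega)),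
    vonMangoldt_apply_prime hp]
  set I₀ : Ideal (𝓞 K) := span {(p : 𝓞 K)} with hI₀
  have hN0 : absNorm I₀ = p ^ Module.finrank ℚ K := by
    rw [hI₀, absNorm_span_natCast, RingOfIntegers.rank]
  have hI₀0 : I₀ ≠ ⊥ := by
    rw [← absNorm_ne_zero_iff_ne_bot, hN0]; exact pow_ne_zero _ hp.ne_zero
  let S := ((p ^ Module.finrank ℚ K).divisors.biUnion (idealsOfNorm K)).filter (· ∣ I₀)
  have hS : ∀ J, J ∈ S ↔ J ∣ I₀ := by
    intro J
    simp only [S, mem_filter, mem_biUnion, Nat.mem_divisors, mem_idealsOfNorm]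
    refine ⟨fun h => h.2, fun h => ⟨⟨absNorm J, ⟨?_, pow_ne_zero _ hp.ne_zero⟩, rfl⟩, h⟩⟩
    rw [← hN0]; exact map_dvd absNorm h
  have hlog := sum_LambdaK_dvd hI₀0 S hS
  rw [hN0] at hlog
  push_cast at hlog
  rw [Real.log_pow] at hlog
  rw [← hlog, vmK]
  have hdec : ∀ J ∈ idealsOfNorm K (p ^ (j * m)), LambdaK K J ≠ 0 → ∃ (Q : Ideal (𝓞 K)) (k : ℕ),
      Q.IsPrime ∧ Q ≠ ⊥ ∧ 1 ≤ k ∧ J = Q ^ k ∧ J.radical = Q ∧ absNorm Q ^ k = p ^ (j * m) ∧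
        absNorm Q ≠ 1 := by
    intro J hJ hJne
    obtain ⟨Q, k, hQ, hQ0, hk, rfl⟩ := hpp hJne
    refine ⟨Q, k, hQ, hQ0, hk, rfl, ?_, ?_, ?_⟩
    · rw [Ideal.radical_pow Q (by omega), hQ.radical]
    · rw [← map_pow, mem_idealsOfNorm.1 hJ]
    · rw [Ne, absNorm_eq_one_iff]; exact hQ.ne_top
  rw [← sum_filter_ne_zero]
  refine le_trans (le_of_eq ?_) (sum_le_sum_of_subset_of_nonneg (s :=
    ((idealsOfNorm K (p ^ (j * m))).filter fun J => LambdaK K J ≠ 0).image Ideal.radical) ?_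
    fun _ _ _ => LambdaK_nonneg _)
  · rw [sum_image]
    · refine sum_congr rfl fun J hJ => ?_
      obtain ⟨hJ1, hJ2⟩ := mem_filter.1 hJ
      obtain ⟨Q, k, hQ, hQ0, hk, rfl, hr, -⟩ := hdec J hJ1 hJ2
      rw [hr, LambdaK_prime_pow hQ hQ0 hk]
      conv_rhs => rw [← pow_one Q, LambdaK_prime_pow hQ hQ0 le_rfl]
    · intro J hJ J' hJ' h
      obtain ⟨hJ1, hJ2⟩ := mem_filter.1 hJ
      obtain ⟨hJ1', hJ2'⟩ := mem_filter.1 hJ'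
      obtain ⟨Q, k, hQ, hQ0, hk, rfl, hr, hq, hq1⟩ := hdec J hJ1 hJ2
      obtain ⟨Q', k', hQ', hQ0', hk', rfl, hr', hq', hq1'⟩ := hdec J' hJ1' hJ2'
      rw [hr, hr'] at h
      subst h
      rw [← hq'] at hq
      have h2 : 2 ≤ absNorm Q := by
        have := absNorm_ne_zero_iff_ne_bot.2 hQ0
        omega
      rw [Nat.pow_right_injective h2 hq]
  · intro R hR
    obtain ⟨J, hJ, rfl⟩ := mem_image.1 hR
    obtain ⟨hJ1, hJ2⟩ := mem_filter.1 hJ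
    obtain ⟨Q, k, hQ, hQ0, hk, rfl, hr, hq, -⟩ := hdec J hJ1 hJ2
    rw [hr, hS, Ideal.dvd_iff_le, hI₀, Ideal.span_singleton_le_iff_mem]
    have h1 : ((absNorm (Q ^ k) : ℕ) : 𝓞 K) ∈ Q ^ k := Ideal.absNorm_mem _
    have h2 := Ideal.pow_le_self (by omega : k ≠ 0) h1
    rw [map_pow, hq] at h2
    push_cast at h2
    exact hQ.mem_of_pow_mem _ h2

end VonMangoldtK

section LogPair

open Filter Topology Real Finset
open scoped ComplexOrder

/-- `f` is the coefficient sequence of a Dirichlet series with constant term `1` whose negative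
logarithmic derivative has coefficients `g`. -/
structure LogPair (f g : ℕ → ℂ) : Prop where
  one : f 1 = 1
  conv : ∀ n : ℕ, n ≠ 0 → f n * (log n : ℂ) =
    ∑ p ∈ n.divisorsAntidiagonal, f p.1 * g p.2

variable {f g f' g' : ℕ → ℂ}

theorem LogPair.twist (h : LogPair f g) (χ : ℕ → ℂ) (h1 : χ 1 = 1)
    (hmul : ∀ m n, χ (m * n) = χ m * χ n) :
    LogPair (fun n => χ n * f n) (fun n => χ n * g n) := by
  refine ⟨by simp [h1, h.one], fun n hn => ?_⟩
  rw [mul_assoc, h.conv n hn, mul_sum]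
  refine sum_congr rfl fun p hp => ?_
  rw [← (Nat.mem_divisorsAntidiagonal.1 hp).1, hmul]
  ring

theorem LogPair.mul (h : LogPair f g) (h' : LogPair f' g') :
    LogPair (LSeries.convolution f f') (g + g') := by
  let F := toArithmeticFunction f
  let F' := toArithmeticFunction f'
  let G := toArithmeticFunction g
  let G' := toArithmeticFunction g'
  have hF : ∀ n, n ≠ 0 → F n = f n := fun n hn => by simp [F, toArithmeticFunction, hn]
  have hF' : ∀ n, n ≠ 0 → F' n = f' n := fun n hn => by simp [F', toArithmeticFunction, hn]
  have hG : ∀ n, n ≠ 0 → G n = g n := fun n hn => by simp [G, toArithmeticFunction, hn]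
  have hG' : ∀ n, n ≠ 0 → G' n = g' n := fun n hn => by simp [G', toArithmeticFunction, hn]
  have hne : ∀ {n : ℕ} {p : ℕ × ℕ}, p ∈ n.divisorsAntidiagonal → p.1 ≠ 0 ∧ p.2 ≠ 0 := by
    intro n p hp
    obtain ⟨h1, h2⟩ := Nat.mem_divisorsAntidiagonal.1 hp
    rw [← h1] at h2
    exact ⟨left_ne_zero_of_mul h2, right_ne_zero_of_mul h2⟩
  have e1 : ∀ n, n ≠ 0 → F n * (log n : ℂ) = (F * G) n := by
    intro n hn
    rw [hF n hn, h.conv n hn, ArithmeticFunction.mul_apply]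
    refine sum_congr rfl fun p hp => ?_
    rw [hF _ (hne hp).1, hG _ (hne hp).2]
  have e2 : ∀ n, n ≠ 0 → F' n * (log n : ℂ) = (F' * G') n := by
    intro n hn
    rw [hF' n hn, h'.conv n hn, ArithmeticFunction.mul_apply]
    refine sum_congr rfl fun p hp => ?_
    rw [hF' _ (hne hp).1, hG' _ (hne hp).2]
  have hconv : LSeries.convolution f f' = ⇑(F * F') := rfl
  rw [hconv]
  refine ⟨?_, fun n hn => ?_⟩
  · rw [ArithmeticFunction.mul_apply, Nat.divisorsAntidiagonal_one, sum_singleton,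
      hF 1 one_ne_zero, hF' 1 one_ne_zero, h.one, h'.one, one_mul]
  · have : ∑ p ∈ n.divisorsAntidiagonal, (F * F') p.1 * (g + g') p.2 =
        ((F * F') * (G + G')) n := by
      rw [ArithmeticFunction.mul_apply]
      refine sum_congr rfl fun p hp => ?_
      rw [ArithmeticFunction.add_apply, hG _ (hne hp).2, hG' _ (hne hp).2, Pi.add_apply]
    rw [this, show F * F' * (G + G') = (F * G) * F' + F * (F' * G') by ring,
      ArithmeticFunction.add_apply, ArithmeticFunction.mul_apply, ArithmeticFunction.mul_apply,
      ArithmeticFunction.mul_apply, sum_mul, ← sum_add_distrib]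
    refine sum_congr rfl fun p hp => ?_
    obtain ⟨hp1, hp2⟩ := hne hp
    rw [← e1 _ hp1, ← e2 _ hp2, ← (Nat.mem_divisorsAntidiagonal.1 hp).1, Nat.cast_mul,
      log_mul (by exact_mod_cast hp1) (by exact_mod_cast hp2)]
    push_cast
    ring

theorem LogPair.nonneg (h : LogPair f g) (hg : ∀ n, 0 ≤ g n) (n : ℕ) (hn : n ≠ 0) : 0 ≤ f n := by
  induction n using Nat.strong_induction_on with
  | _ n ih =>
    by_cases h1 : n = 1
    · rw [h1, h.one]; exact zero_le_one
    have hg1 : g 1 = 0 := by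
      have := h.conv 1 one_ne_zero
      simpa [h.one] using this.symm
    have hlog : 0 < log n := log_pos (by exact_mod_cast (by omega : 1 < n))
    have hs : 0 ≤ f n * (log n : ℂ) := by
      rw [h.conv n hn]
      refine sum_nonneg fun p hp => ?_
      obtain ⟨hp1, hp2⟩ := Nat.mem_divisorsAntidiagonal.1 hp
      by_cases hp3 : p.2 = 1
      · rw [hp3, hg1, mul_zero]
      · have hp0 : p.1 ≠ 0 := by rintro h0; rw [h0, zero_mul] at hp1; exact hn hp1.symm
        have hp20 : p.2 ≠ 0 := by rintro h0; rw [h0, mul_zero] at hp1; exact hn hp1.symm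
        refine mul_nonneg (ih _ ?_ hp0) (hg _)
        rw [← hp1]
        exact lt_mul_of_one_lt_right (by omega) (by omega)
    have : f n = (f n * (log n : ℂ)) * ((log n)⁻¹ : ℝ) := by
      push_cast
      rw [mul_assoc, mul_inv_cancel₀ (by exact_mod_cast hlog.ne'), mul_one]
    rw [this]
    refine mul_nonneg hs ?_
    exact_mod_cast (inv_pos.2 hlog).le

variable (hf : ∀ s : ℂ, 1 < s.re → LSeriesSummable f s)
  (hg : ∀ s : ℂ, 1 < s.re → LSeriesSummable g s)

theorem abscissa_le_one {f : ℕ → ℂ} (hf : ∀ s : ℂ, 1 < s.re → LSeriesSummable f s) :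
    LSeries.abscissaOfAbsConv f ≤ 1 := by
  refine LSeries.abscissaOfAbsConv_le_of_forall_lt_LSeriesSummable (x := 1) fun y hy => ?_
  exact hf _ (by simpa using hy)

theorem abscissa_lt {f : ℕ → ℂ} (hf : ∀ s : ℂ, 1 < s.re → LSeriesSummable f s) {s : ℂ}
    (hs : 1 < s.re) : LSeries.abscissaOfAbsConv f < s.re :=
  lt_of_le_of_lt (abscissa_le_one hf) (by exact_mod_cast hs)

include hf hg in
theorem LogPair.hasDerivAt (h : LogPair f g) {s : ℂ} (hs : 1 < s.re) :
    HasDerivAt (LSeries f) (-(LSeries f s * LSeries g s)) s := by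
  rw [← LSeries_convolution' (hf s hs) (hg s hs)]
  convert! LSeries_hasDerivAt (abscissa_lt hf hs) using 2
  refine LSeries_congr (fun {n} hn => ?_) s
  rw [LSeries.convolution_def]
  simp only []
  rw [← h.conv n hn, LSeries.logMul, ← Complex.natCast_log, mul_comm]

theorem norm_div_log_le (g : ℕ → ℂ) (n : ℕ) :
    ‖g n / (log n : ℂ)‖ ≤ 2 * ‖g n‖ := by
  rw [norm_div, Complex.norm_real, norm_of_nonneg (log_natCast_nonneg n)]
  rcases Nat.lt_or_ge n 2 with h | h
  · interval_cases n <;> simp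
  · have : 1 / 2 < log n := by
      have h2 : log 2 ≤ log n := log_le_log two_pos (by exact_mod_cast h)
      linarith [log_two_gt_d9]
    rw [div_le_iff₀ (by linarith)]
    nlinarith [norm_nonneg (g n)]

include hg in
theorem summable_div_log {s : ℂ} (hs : 1 < s.re) :
    LSeriesSummable (fun n => g n / (log n : ℂ)) s := by
  refine Summable.of_norm_bounded ((hg s hs).norm.mul_left 2) fun n => ?_
  rw [LSeries.term_def, LSeries.term_def]
  split_ifs
  · simp
  · rw [norm_div (g n / _), norm_div (g n) ((n : ℂ) ^ s), ← mul_div_assoc]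
    gcongr
    exact norm_div_log_le g n

include hf hg in
theorem LogPair.eq_exp (h : LogPair f g) {s : ℂ} (hs : 1 < s.re) :
    LSeries f s = Complex.exp (LSeries (fun n => g n / (log n : ℂ)) s) := by
  set w : ℕ → ℂ := fun n => g n / (log n : ℂ) with hw
  have hws : ∀ s : ℂ, 1 < s.re → LSeriesSummable w s := fun s hs => summable_div_log hg hs
  have hg1 : g 1 = 0 := by
    have := h.conv 1 one_ne_zero
    simpa [h.one] using this.symm
  have hdw : ∀ s : ℂ, 1 < s.re → HasDerivAt (LSeries w) (-LSeries g s) s := by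
    intro s hs
    convert! LSeries_hasDerivAt (abscissa_lt hws hs) using 2
    refine LSeries_congr (fun {n} hn => ?_) s
    rw [LSeries.logMul, ← Complex.natCast_log, hw]
    rcases eq_or_ne n 1 with rfl | h1
    · simp [hg1]
    · have : (log n : ℂ) ≠ 0 := by
        have := log_pos (x := n) (by exact_mod_cast (by omega : 1 < n))
        exact_mod_cast this.ne'
      field_simp
  set U : Set ℂ := {s | 1 < s.re} with hU
  have hUo : IsOpen U := isOpen_lt continuous_const Complex.continuous_re
  have hUc : IsPreconnected U := (convex_halfSpace_re_gt 1).isPreconnected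
  have hd : ∀ s ∈ U, HasDerivAt (fun s => LSeries f s * Complex.exp (-LSeries w s)) 0 s := by
    intro s hs
    have := (h.hasDerivAt hf hg hs).mul ((hdw s hs).neg.cexp)
    convert! this using 1
    ring
  have hconst : ∀ s ∈ U, ∀ t ∈ U, LSeries f s * Complex.exp (-LSeries w s) =
      LSeries f t * Complex.exp (-LSeries w t) := by
    intro s hs t ht
    refine hUo.is_const_of_deriv_eq_zero hUc
      (fun z hz => (hd z hz).differentiableAt.differentiableWithinAt) (fun z hz => (hd z hz).deriv)
      hs ht
  have hlim : Tendsto (fun x : ℝ => LSeries f x * Complex.exp (-LSeries w x)) atTop (𝓝 1) := by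
    have h1 := LSeries.tendsto_atTop (f := f) (lt_of_le_of_lt (abscissa_le_one hf) (by
      exact_mod_cast EReal.coe_lt_top 1))
    have h2 := LSeries.tendsto_atTop (f := w) (lt_of_le_of_lt (abscissa_le_one hws) (by
      exact_mod_cast EReal.coe_lt_top 1))
    have := h1.mul h2.neg.cexp
    simpa [h.one, hw, hg1] using this
  have hval : LSeries f s * Complex.exp (-LSeries w s) = 1 := by
    refine tendsto_nhds_unique (Tendsto.congr' ?_ tendsto_const_nhds) hlim
    filter_upwards [eventually_gt_atTop 1] with x hx
    exact hconst s hs x (by simpa [hU] using hx)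
  rw [Complex.exp_neg] at hval
  exact eq_of_div_eq_one (by rw [div_eq_mul_inv]; exact hval)

end LogPair

section CoefL

open Real Finset

variable (K : Type*) [Field K] [NumberField K]

/-- The coefficients `χ(n) r_K(n)` of the L-function of `χ ∘ N`. -/
noncomputable def coefL {q : ℕ} (χ : DirichletCharacter ℂ q) (n : ℕ) : ℂ :=
  χ n * (idealCount K n : ℂ)

/-- The coefficients `χ(n) Λ_K(n)`. -/
noncomputable def coefLam {q : ℕ} (χ : DirichletCharacter ℂ q) (n : ℕ) : ℂ :=
  χ n * (vmK K n : ℂ)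

theorem logPair_coefL {q : ℕ} (χ : DirichletCharacter ℂ q) :
    LogPair (coefL K χ) (coefLam K χ) := by
  have : LogPair (fun n => (idealCount K n : ℂ)) (fun n => (vmK K n : ℂ)) := by
    refine ⟨by simp [idealCount_one], fun n hn => ?_⟩
    have := idealCount_mul_log K hn
    exact_mod_cast congrArg (fun x : ℝ => (x : ℂ)) this
  exact this.twist (fun n => χ n) (by simp) (by simp)

theorem summable_coefLam {q : ℕ} (χ : DirichletCharacter ℂ q) {s : ℂ} (hs : 1 < s.re) :
    LSeriesSummable (coefLam K χ) s := by
  refine Summable.of_norm_bounded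
    ((ArithmeticFunction.LSeriesSummable_vonMangoldt hs).norm.mul_left (Module.finrank ℚ K : ℝ))
    fun n => ?_
  rw [LSeries.term_def, LSeries.term_def]
  split_ifs
  · simp
  · rw [norm_div, norm_div, ← mul_div_assoc]
    gcongr
    rw [coefLam, norm_mul, Complex.norm_real, Complex.norm_real,
      norm_of_nonneg (vmK_nonneg K n), norm_of_nonneg
      ArithmeticFunction.vonMangoldt_nonneg]
    calc _ ≤ 1 * vmK K n := by
          gcongr
          · exact vmK_nonneg K n
          · exact χ.norm_le_one n
      _ ≤ _ := by rw [one_mul]; exact vmK_le K n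

theorem exists_hasMean : ∃ (D A : ℝ) (res : ∀ q : ℕ, DirichletCharacter ℂ q → ℂ),
    1 ≤ D ∧ 1 ≤ A ∧ ∀ (q : ℕ) (χ : DirichletCharacter ℂ q), 0 < q →
      HasMean (coefL K χ) (res q χ) (D * q ^ (Module.finrank ℚ K + 1))
        (1 / (2 * Module.finrank ℚ K)) A := by
  obtain ⟨A₁, hA₁, h₁⟩ := exists_sum_idealCount_char K
  obtain ⟨A₂, hA₂, h₂⟩ := exists_sum_idealCount_residue K
  obtain ⟨κ, hκ⟩ := h₂ 1 one_pos 0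
  have : ∀ (q : ℕ) (χ : DirichletCharacter ℂ q), ∃ κ : ℂ, 0 < q → ∀ x : ℝ, 1 ≤ x →
      ‖(∑ k ∈ Icc 1 ⌊x⌋₊, χ k * (idealCount K k : ℂ)) - κ * x‖ ≤
        A₁ * q ^ (Module.finrank ℚ K + 1) * x ^ (1 - 1 / (2 * Module.finrank ℚ K : ℝ)) := by
    intro q χ
    by_cases hq : 0 < q
    · obtain ⟨κ, hκ⟩ := h₁ q hq χ
      exact ⟨κ, fun _ => hκ⟩
    · exact ⟨0, fun h => absurd h hq⟩
  choose res hres using this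
  have hn : (1 : ℝ) ≤ Module.finrank ℚ K := by exact_mod_cast finrank_rat_pos K
  refine ⟨max A₁ 1, |κ| + A₂ + 1, res, le_max_right _ _, by
    have := abs_nonneg κ; linarith, fun q χ hq => ?_⟩
  have hq1 : (1 : ℝ) ≤ q := by exact_mod_cast hq
  refine ⟨by positivity, ?_, ?_, by have := abs_nonneg κ; linarith, fun x hx => ?_, fun x hx => ?_⟩
  · gcongr; linarith
  · have := one_le_pow₀ hq1 (n := Module.finrank ℚ K + 1)
    nlinarith [le_max_right A₁ 1]
  · refine (hres q χ hq x hx).trans ?_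
    gcongr
    exact le_max_left _ _
  · have h3 := hκ x hx
    have h4 : ((Icc 1 ⌊x⌋₊).filter fun k : ℕ => (k : ZMod 1) = 0) = Icc 1 ⌊x⌋₊ :=
      filter_true_of_mem fun k _ => Subsingleton.elim _ _
    rw [h4] at h3
    have h5 : x ^ (1 - 1 / (2 * Module.finrank ℚ K : ℝ)) ≤ x := by
      conv_rhs => rw [← rpow_one x]
      refine rpow_le_rpow_of_exponent_le hx ?_
      rw [sub_le_self_iff]; positivity
    have h6 := (abs_le.1 h3).2
    simp only [Nat.cast_one, one_pow, mul_one] at h6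
    calc ∑ k ∈ Icc 1 ⌊x⌋₊, ‖coefL K χ k‖ ≤
        ∑ k ∈ Icc 1 ⌊x⌋₊, (idealCount K k : ℝ) := by
          refine sum_le_sum fun k _ => ?_
          rw [coefL, norm_mul, Complex.norm_natCast]
          exact mul_le_of_le_one_left (by positivity) (χ.norm_le_one k)
      _ ≤ κ * x + A₂ * x := by nlinarith
      _ ≤ _ := by nlinarith [le_abs_self κ]

/-- The implied constant of the error term in `hasMean_coefL`. -/
noncomputable def meanD : ℝ := (exists_hasMean K).choose

/-- The bound for the mean of absolute values in `hasMean_coefL`. -/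
noncomputable def meanA : ℝ := (exists_hasMean K).choose_spec.choose

/-- The residue of the L-function of `χ ∘ N` at `1`. -/
noncomputable def resL {q : ℕ} (χ : DirichletCharacter ℂ q) : ℂ :=
  (exists_hasMean K).choose_spec.choose_spec.choose q χ

theorem one_le_meanD : 1 ≤ meanD K := (exists_hasMean K).choose_spec.choose_spec.choose_spec.1

theorem one_le_meanA : 1 ≤ meanA K := (exists_hasMean K).choose_spec.choose_spec.choose_spec.2.1

theorem hasMean_coefL {q : ℕ} (hq : 0 < q) (χ : DirichletCharacter ℂ q) :
    HasMean (coefL K χ) (resL K χ) (meanD K * q ^ (Module.finrank ℚ K + 1))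
      (1 / (2 * Module.finrank ℚ K)) (meanA K) :=
  (exists_hasMean K).choose_spec.choose_spec.choose_spec.2.2 q χ hq

end CoefL

section PrimeSums

open Filter Topology ArithmeticFunction Complex

theorem summable_mul_rpow_of_le {f : ℕ → ℝ} {c : ℝ} (hf : ∀ n, |f n| ≤ c * vonMangoldt n) {σ : ℝ}
    (hσ : 1 < σ) : Summable fun n : ℕ => f n * (n : ℝ) ^ (-σ) := by
  have h := (ArithmeticFunction.LSeriesSummable_vonMangoldt (s := (σ : ℂ)) (by simpa using hσ)).norm
  refine Summable.of_norm_bounded (h.mul_left c) fun n => ?_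
  rw [LSeries.norm_term_eq]
  split_ifs with h0
  · subst h0
    have := hf 0
    simp only [ArithmeticFunction.map_zero, mul_zero, abs_nonpos_iff] at this
    simp [this]
  · rw [norm_mul, norm_real, ofReal_re, Real.norm_of_nonneg vonMangoldt_nonneg,
      Real.rpow_neg (by positivity), Real.norm_of_nonneg (r := ((n : ℝ) ^ σ)⁻¹) (by positivity),
      ← mul_div_assoc, ← div_eq_mul_inv]
    gcongr
    exact hf n

/-- Sums over prime powers are controlled, up to a bounded error, by their terms at almost all
primes. -/
theorem exists_tsum_le_tsum_add {f g : ℕ → ℝ} {c : ℝ} (hf : ∀ n, |f n| ≤ c * vonMangoldt n)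
    (hg : ∀ n, |g n| ≤ c * vonMangoldt n) {S : Set ℕ} (hS : S.Finite)
    (h : ∀ p, p.Prime → p ∉ S → f p ≤ g p) :
    ∃ C : ℝ, ∀ σ : ℝ, 1 < σ → ∑' n : ℕ, f n * (n : ℝ) ^ (-σ) ≤
      (∑' n : ℕ, g n * (n : ℝ) ^ (-σ)) + C := by
  have hc : 0 ≤ c := by
    have := (abs_nonneg _).trans (hf 2)
    exact nonneg_of_mul_nonneg_left this (vonMangoldt_pos_iff.2 Nat.prime_two.isPrimePow)
  set e : ℕ → ℝ := fun n => if n.Prime ∧ n ∉ S then 0 else 2 * c * vonMangoldt n with he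
  have he0 : ∀ n, 0 ≤ e n := fun n => by
    rw [he]; dsimp only; split_ifs
    · exact le_rfl
    · exact mul_nonneg (by positivity) vonMangoldt_nonneg
  have hsum : Summable fun n : ℕ => e n / n := by
    have h1 := (vonMangoldt.summable_residueClass_non_primes_div (0 : ZMod 1)).mul_left (2 * c)
    have h2 : Summable fun n : ℕ => if n ∈ S then e n / n else 0 :=
      summable_of_hasFiniteSupport (hS.subset fun n hn => by
        by_contra h0; simp [h0] at hn)
    refine Summable.of_nonneg_of_le (fun n => div_nonneg (he0 n) (by positivity)) (fun n => ?_)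
      (h1.add h2)
    have hres : vonMangoldt.residueClass (0 : ZMod 1) n = vonMangoldt n := by
      rw [vonMangoldt.residueClass, Set.indicator_of_mem]
      exact Subsingleton.elim _ _
    rw [hres]
    by_cases hn : n ∈ S
    · rw [if_pos hn]
      refine le_add_of_nonneg_left ?_
      have : (0 : ℝ) ≤ if n.Prime then 0 else vonMangoldt n := by
        split_ifs; exacts [le_rfl, vonMangoldt_nonneg]
      positivity
    · by_cases hp : n.Prime
      · simp [he, hp, hn]
      · simp only [he, hp, hn, if_false, false_and, add_zero]
        exact (mul_div_assoc _ _ _).le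
  refine ⟨∑' n, e n / n, fun σ hσ => ?_⟩
  have hle : ∀ n : ℕ, f n * (n : ℝ) ^ (-σ) ≤ g n * (n : ℝ) ^ (-σ) + e n / n := by
    intro n
    rcases Nat.eq_zero_or_pos n with rfl | hn
    · have h1 := hf 0
      have h2 := hg 0
      simp only [ArithmeticFunction.map_zero, mul_zero, abs_nonpos_iff] at h1 h2
      simp [h1, h2]
    have hn1 : (1 : ℝ) ≤ n := by exact_mod_cast hn
    have h3 : f n ≤ g n + e n := by
      simp only [he]
      split_ifs with h4
      · rw [add_zero]; exact h n h4.1 h4.2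
      · linarith [(abs_le.1 (hf n)).2, (abs_le.1 (hg n)).1]
    have h5 : (n : ℝ) ^ (-σ) ≤ (n : ℝ)⁻¹ := by
      rw [← Real.rpow_neg_one]
      exact Real.rpow_le_rpow_of_exponent_le hn1 (by linarith)
    calc _ ≤ (g n + e n) * (n : ℝ) ^ (-σ) := by gcongr
      _ = g n * (n : ℝ) ^ (-σ) + e n * (n : ℝ) ^ (-σ) := by ring
      _ ≤ _ := by
        rw [div_eq_mul_inv]
        gcongr
  have hsg := summable_mul_rpow_of_le hg hσ
  rw [← hsg.tsum_add hsum]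
  exact (summable_mul_rpow_of_le hf hσ).tsum_le_tsum hle (hsg.add hsum)

variable (K : Type*) [Field K] [NumberField K]

/-- The coefficients of `log ζ_K`. -/
noncomputable def wtK (n : ℕ) : ℝ := vmK K n / Real.log n

theorem wtK_nonneg (n : ℕ) : 0 ≤ wtK K n :=
  div_nonneg (vmK_nonneg K n) (Real.log_natCast_nonneg n)

theorem wtK_le (n : ℕ) : wtK K n ≤ 2 * Module.finrank ℚ K * vonMangoldt n := by
  have h := norm_div_log_le (fun n => (vmK K n : ℂ)) n
  rw [← ofReal_div, norm_real, norm_real,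
    Real.norm_of_nonneg (vmK_nonneg K n)] at h
  refine (le_abs_self _).trans (h.trans ?_)
  rw [mul_assoc]
  gcongr
  exact vmK_le K n

theorem abs_mul_wtK_le {a : ℝ} (ha : |a| ≤ 1) (n : ℕ) :
    |a * wtK K n| ≤ 2 * Module.finrank ℚ K * vonMangoldt n := by
  rw [abs_mul, abs_of_nonneg (wtK_nonneg K n)]
  exact (mul_le_of_le_one_left (wtK_nonneg K n) ha).trans (wtK_le K n)

theorem wtK_prime {p : ℕ} (hp : p.Prime) : wtK K p = idealCount K p := by
  have h := idealCount_mul_log K hp.ne_zero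
  have h1 : vmK K 1 = 0 := le_antisymm ((vmK_le K 1).trans (by simp)) (vmK_nonneg K 1)
  rw [Nat.sum_divisorsAntidiagonal (f := fun a b => (idealCount K a : ℝ) * vmK K b),
    hp.sum_divisors, Nat.div_self hp.pos, Nat.div_one] at h
  simp only [h1, mul_zero, zero_add, idealCount_one, Nat.cast_one, one_mul] at h
  have : 0 < Real.log p := Real.log_pos (by exact_mod_cast hp.one_lt)
  rw [wtK, div_eq_iff this.ne', ← h]

theorem summable_coefL {q : ℕ} (hq : 0 < q) (χ : DirichletCharacter ℂ q) {s : ℂ} (hs : 1 < s.re) :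
    LSeriesSummable (coefL K χ) s := (hasMean_coefL K hq χ).lseriesSummable hs

theorem LSeries_coefL_ne_zero {q : ℕ} (hq : 0 < q) (χ : DirichletCharacter ℂ q) {s : ℂ}
    (hs : 1 < s.re) : LSeries (coefL K χ) s ≠ 0 := by
  rw [LogPair.eq_exp (fun s hs => summable_coefL K hq χ hs) (fun s hs => summable_coefLam K χ hs)
    (logPair_coefL K χ) hs]
  exact exp_ne_zero _

theorem log_norm_LSeries_coefL {q : ℕ} (hq : 0 < q) (χ : DirichletCharacter ℂ q) {s : ℂ}
    (hs : 1 < s.re) : Real.log ‖LSeries (coefL K χ) s‖ =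
      ∑' n : ℕ, ((χ n) * (n : ℂ) ^ (-(s.im * I))).re * wtK K n * (n : ℝ) ^ (-s.re) := by
  have hg : ∀ s : ℂ, 1 < s.re → LSeriesSummable (coefLam K χ) s := fun s hs =>
    summable_coefLam K χ hs
  rw [LogPair.eq_exp (fun s hs => summable_coefL K hq χ hs) hg
    (logPair_coefL K χ) hs, norm_exp, Real.log_exp, LSeries,
    re_tsum (summable_div_log hg hs)]
  refine tsum_congr fun n => ?_
  rw [LSeries.term_def]
  split_ifs with h0
  · subst h0
    have : wtK K 0 = 0 := by simp [wtK]
    simp [this]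
  · have h1 : ((n : ℂ) ^ s)⁻¹ = (n : ℂ) ^ (-(s.im * I)) * (((n : ℝ) ^ (-s.re) : ℝ) : ℂ) := by
      rw [← cpow_neg, ofReal_cpow (by positivity), ofReal_natCast,
        ← cpow_add _ _ (by exact_mod_cast h0)]
      congr 1
      conv_lhs => rw [← re_add_im s]
      push_cast
      ring
    rw [div_eq_mul_inv _ ((n : ℂ) ^ s), h1, coefLam, wtK, ← re_mul_ofReal,
      ← re_mul_ofReal]
    push_cast
    congr 1
    ring

theorem log_norm_LSeries_coefL_real {q : ℕ} (hq : 0 < q) (χ : DirichletCharacter ℂ q) {σ : ℝ}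
    (hσ : 1 < σ) : Real.log ‖LSeries (coefL K χ) σ‖ =
      ∑' n : ℕ, (χ n).re * wtK K n * (n : ℝ) ^ (-σ) := by
  rw [log_norm_LSeries_coefL K hq χ (by simpa using hσ)]
  simp

end PrimeSums

section NearOne

open Filter Topology Complex

variable {f : ℕ → ℂ} {κ : ℂ} {D δ A : ℝ}

theorem HasMean.tendsto_sub_one_mul (h : HasMean f κ D δ A) :
    Tendsto (fun σ : ℝ => ((σ : ℂ) - 1) * LSeries f σ) (𝓝[>] 1) (𝓝 κ) := by
  have h1 : ContinuousAt (fun σ : ℝ => κ + ((σ : ℂ) - 1) * regL f κ σ) 1 := by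
    have : ContinuousAt (regL f κ) ((1 : ℝ) : ℂ) :=
      (differentiableAt_regL h (by simp [h.pos])).continuousAt
    have h2 : ContinuousAt (fun σ : ℝ => regL f κ σ) 1 :=
      ContinuousAt.comp (f := fun σ : ℝ => (σ : ℂ)) this continuous_ofReal.continuousAt
    exact continuousAt_const.add
      ((continuous_ofReal.continuousAt.sub continuousAt_const).mul h2)
  have h2 := h1.tendsto
  simp only [ofReal_one, sub_self, zero_mul, add_zero] at h2
  refine (h2.mono_left nhdsWithin_le_nhds).congr' ?_
  filter_upwards [self_mem_nhdsWithin] with σ hσ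
  have hσ' : 1 < σ := hσ
  have h3 : (σ : ℂ) - 1 ≠ 0 := by
    rw [sub_ne_zero]; exact_mod_cast hσ'.ne'
  rw [LSeries_eq_regL h (by simpa using hσ')]
  field_simp

theorem HasMean.tendsto_of_zero (h : HasMean f 0 D δ A) :
    Tendsto (fun σ : ℝ => LSeries f σ) (𝓝[>] 1) (𝓝 (regL f 0 1)) := by
  have : ContinuousAt (regL f 0) ((1 : ℝ) : ℂ) :=
    (differentiableAt_regL h (by simp [h.pos])).continuousAt
  have h2 : ContinuousAt (fun σ : ℝ => regL f 0 σ) 1 :=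
    ContinuousAt.comp (f := fun σ : ℝ => (σ : ℂ)) this continuous_ofReal.continuousAt
  have h3 := h2.tendsto
  simp only [ofReal_one] at h3
  refine (h3.mono_left nhdsWithin_le_nhds).congr' ?_
  filter_upwards [self_mem_nhdsWithin] with σ hσ
  rw [LSeries_eq_regL h (by simpa using hσ), zero_div, zero_add]

theorem exists_abs_log_norm_le {F : ℝ → ℂ} {l : Filter ℝ} {a : ℂ} (ha : a ≠ 0)
    (h : Tendsto F l (𝓝 a)) : ∃ C : ℝ, ∀ᶠ σ in l, F σ ≠ 0 ∧ |Real.log ‖F σ‖| ≤ C := by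
  have h1 : Tendsto (fun σ => |Real.log ‖F σ‖|) l (𝓝 |Real.log ‖a‖|) :=
    ((Real.continuousAt_log (norm_ne_zero_iff.2 ha)).tendsto.comp h.norm).abs
  refine ⟨|Real.log ‖a‖| + 1, ?_⟩
  filter_upwards [h1.eventually_le_const (lt_add_one _), h.eventually_ne ha] with σ h2 h3
  exact ⟨h3, h2⟩

theorem HasMean.log_of_ne_zero (h : HasMean f κ D δ A) (hκ : κ ≠ 0) :
    ∃ C : ℝ, ∀ᶠ σ : ℝ in 𝓝[>] 1, |Real.log ‖LSeries f σ‖ + Real.log (σ - 1)| ≤ C := by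
  obtain ⟨C, hC⟩ := exists_abs_log_norm_le hκ h.tendsto_sub_one_mul
  refine ⟨C, ?_⟩
  filter_upwards [hC, self_mem_nhdsWithin] with σ ⟨h1, h2⟩ hσ
  have hσ' : 1 < σ := hσ
  rw [norm_mul, Real.log_mul (norm_ne_zero_iff.2 (left_ne_zero_of_mul h1))
    (norm_ne_zero_iff.2 (right_ne_zero_of_mul h1))] at h2
  have : ‖(σ : ℂ) - 1‖ = σ - 1 := by
    rw [← ofReal_one, ← ofReal_sub, norm_real,
      Real.norm_of_nonneg (by linarith)]
  rwa [this, add_comm] at h2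

theorem HasMean.log_of_zero_ne_zero (h : HasMean f 0 D δ A) (h1 : regL f 0 1 ≠ 0) :
    ∃ C : ℝ, ∀ᶠ σ : ℝ in 𝓝[>] 1, |Real.log ‖LSeries f σ‖| ≤ C := by
  obtain ⟨C, hC⟩ := exists_abs_log_norm_le h1 h.tendsto_of_zero
  exact ⟨C, hC.mono fun σ h => h.2⟩

theorem HasMean.log_of_zero_zero (h : HasMean f 0 D δ A) (h1 : regL f 0 1 = 0)
    (hne : ∀ σ : ℝ, 1 < σ → LSeries f σ ≠ 0) :
    ∃ C : ℝ, ∀ᶠ σ : ℝ in 𝓝[>] 1, Real.log ‖LSeries f σ‖ ≤ Real.log (σ - 1) + C := by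
  have hd : DifferentiableAt ℂ (regL f 0) 1 := differentiableAt_regL h (by simp [h.pos])
  have hO := hd.isBigO_sub
  rw [h1] at hO
  obtain ⟨c, hc, hb⟩ := hO.exists_pos
  rw [Asymptotics.IsBigOWith] at hb
  have ht : Tendsto (fun σ : ℝ => (σ : ℂ)) (𝓝[>] 1) (𝓝 1) := by
    have := (continuous_ofReal.tendsto 1).mono_left
      (nhdsWithin_le_nhds (a := (1 : ℝ)) (s := Set.Ioi 1))
    simpa using this
  refine ⟨Real.log c, ?_⟩
  filter_upwards [ht.eventually hb, self_mem_nhdsWithin] with σ h2 hσ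
  have hσ' : 1 < σ := hσ
  have h3 : LSeries f σ = regL f 0 σ := by
    rw [LSeries_eq_regL h (by simpa using hσ'), zero_div, zero_add]
  have : ‖(σ : ℂ) - 1‖ = σ - 1 := by
    rw [← ofReal_one, ← ofReal_sub, norm_real,
      Real.norm_of_nonneg (by linarith)]
  rw [this, sub_zero, ← h3] at h2
  rw [← Real.log_mul (by linarith) hc.ne', mul_comm]
  exact Real.log_le_log (norm_pos_iff.2 (hne σ hσ')) h2

variable (K : Type*) [Field K] [NumberField K]

theorem coefL_one_eq (n : ℕ) : coefL K (1 : DirichletCharacter ℂ 1) n = idealCount K n := by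
  rw [coefL, MulChar.one_apply (by exact isUnit_of_subsingleton _), one_mul]

theorem resL_one_pos : ∃ κ : ℝ, 0 < κ ∧ resL K (1 : DirichletCharacter ℂ 1) = κ := by
  refine ⟨dedekindZeta_residue K, dedekindZeta_residue_pos K, ?_⟩
  have h1 := (hasMean_coefL K one_pos (1 : DirichletCharacter ℂ 1)).tendsto_sub_one_mul
  have h2 := tendsto_sub_one_mul_dedekindZeta_nhdsGT K
  refine tendsto_nhds_unique h1 ?_
  convert! h2 using 3
  exact LSeries_congr (fun {n} _ => coefL_one_eq K n) _

end NearOne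

section CyclotomicK

set_option linter.unusedSectionVars false

open scoped Pointwise

variable {K L : Type*} [Field K] [NumberField K] [Field L] [NumberField L] [Algebra K L]

theorem root_eq_of_sub_mem {R : Type*} [CommRing R] [IsDomain R] {Q : Ideal R} [hQ : Q.IsPrime]
    {q : ℕ} (hq : 0 < q) {μ ν : R} (hμ : μ ^ q = 1) (hν : ν ^ q = 1) (h : μ - ν ∈ Q)
    (hqQ : (q : R) ∉ Q) : μ = ν := by
  by_contra hne
  have h1 := (Commute.all μ ν).geom_sum₂_mul q
  rw [hμ, hν, sub_self, mul_eq_zero, or_iff_left (sub_ne_zero.2 hne)] at h1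
  have h2 : Ideal.Quotient.mk Q μ = Ideal.Quotient.mk Q ν := Ideal.Quotient.eq.2 h
  have h3 := congrArg (Ideal.Quotient.mk Q) h1
  simp only [map_sum, map_mul, map_pow, h2, map_zero, geom_sum₂_self] at h3
  rw [mul_eq_zero, ← map_natCast (Ideal.Quotient.mk Q), Ideal.Quotient.eq_zero_iff_mem,
    or_iff_right hqQ] at h3
  have h4 : (Ideal.Quotient.mk Q ν) ^ q = 1 := by rw [← map_pow, hν, map_one]
  rw [← Nat.sub_add_cancel hq, pow_succ, h3, zero_mul] at h4
  exact zero_ne_one h4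

theorem natCast_notMem_of_coprime {R : Type*} [CommRing R] {Q : Ideal R} [hQ : Q.IsPrime]
    {q N : ℕ} (h : N.Coprime q) (hN : (N : R) ∈ Q) : (q : R) ∉ Q := by
  intro hq
  have h1 : IsCoprime (N : R) (q : R) := by
    have := (Nat.isCoprime_iff_coprime.2 h).map (Int.castRingHom R)
    simpa using this
  obtain ⟨a, b, hab⟩ := h1
  exact hQ.ne_top ((eq_top_iff_one Q).2 (hab ▸ Q.add_mem (Q.mul_mem_left a hN)
    (Q.mul_mem_left b hq)))

theorem card_quotient_eq (I : Ideal (𝓞 K)) : Nat.card (𝓞 K ⧸ I) = absNorm I := by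
  rw [absNorm_apply, Submodule.cardQuot_apply]

theorem finite_quotient_of_absNorm {I : Ideal (𝓞 K)} (h : absNorm I ≠ 0) : Finite (𝓞 K ⧸ I) :=
  Nat.finite_of_card_ne_zero (by rwa [card_quotient_eq])

theorem absNorm_under_dvd (Q : Ideal (𝓞 L)) : absNorm (Q.under (𝓞 K)) ∣ absNorm Q := by
  rw [← card_quotient_eq, ← card_quotient_eq]
  exact AddSubgroup.card_dvd_of_injective
    (algebraMap (𝓞 K ⧸ Q.under (𝓞 K)) (𝓞 L ⧸ Q)).toAddMonoidHom algebraMap_quotient_injective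

theorem absNorm_under_eq_of_prime {Q : Ideal (𝓞 L)} {p : ℕ} (hp : p.Prime) (hQ : absNorm Q = p) :
    absNorm (Q.under (𝓞 K)) = p := by
  have h1 := absNorm_under_dvd (K := K) Q
  rw [hQ] at h1
  refine ((Nat.dvd_prime hp).1 h1).resolve_left fun h => ?_
  rw [absNorm_eq_one_iff, eq_top_iff_one, under_def, mem_comap, map_one,
    ← eq_top_iff_one, ← absNorm_eq_one_iff, hQ] at h
  exact hp.one_lt.ne' h

theorem exists_sub_intCast_mem {Q : Ideal (𝓞 L)} {p : ℕ} (hp : p.Prime) (hQ : absNorm Q = p)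
    (x : 𝓞 L) : ∃ k : ℤ, x - k ∈ Q := by
  have : Fact p.Prime := ⟨hp⟩
  have h1 : Nat.card (𝓞 L ⧸ Q) = p := by rw [card_quotient_eq, hQ]
  have hne : (1 : 𝓞 L ⧸ Q) ≠ 0 := by
    rw [← map_one (Ideal.Quotient.mk Q), Ne, Ideal.Quotient.eq_zero_iff_mem,
      ← eq_top_iff_one, ← absNorm_eq_one_iff, hQ]
    exact hp.one_lt.ne'
  obtain ⟨k, hk⟩ := AddSubgroup.mem_zmultiples_iff.1
    (mem_zmultiples_of_prime_card h1 hne (g' := Ideal.Quotient.mk Q x))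
  refine ⟨k, Ideal.Quotient.eq.1 ?_⟩
  rw [← hk, map_intCast, zsmul_one]

theorem exists_frob [IsGalois K L] (Q : Ideal (𝓞 L)) [Q.IsPrime] (h0 : absNorm Q ≠ 0) :
    ∃ σ : L ≃ₐ[K] L, IsArithFrobAt (𝓞 K) σ Q := by
  have := finite_quotient_of_absNorm h0
  exact IsArithFrobAt.exists_of_isInvariant (𝓞 K) (L ≃ₐ[K] L) Q

variable {q : ℕ} [NeZero q] {ζ : L} (hζ : IsPrimitiveRoot ζ q)

include hζ in
theorem frob_apply_zeta [IsGalois K L] {Q : Ideal (𝓞 L)} {σ : L ≃ₐ[K] L}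
    (h : IsArithFrobAt (𝓞 K) σ Q) (hqQ : (q : 𝓞 L) ∉ Q) :
    σ ζ = ζ ^ absNorm (Q.under (𝓞 K)) := by
  have h1 := AlgHom.IsArithFrobAt.apply_of_pow_eq_one h (ζ := hζ.toInteger)
    (hζ.toInteger_isPrimitiveRoot.pow_eq_one) hqQ
  rw [card_quotient_eq] at h1
  exact congrArg (fun x : 𝓞 L => (x : L)) h1

theorem exists_prime_over (P : Ideal (𝓞 K)) [P.IsPrime] :
    ∃ Q : Ideal (𝓞 L), Q.IsPrime ∧ Q.under (𝓞 K) = P := by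
  obtain ⟨Q, hQ1, hQ2⟩ := nonempty_primesOver (S := 𝓞 L) P
  exact ⟨Q, hQ1, hQ2.over.symm⟩

theorem absNorm_ne_zero_of_under {Q : Ideal (𝓞 L)} (h : absNorm (Q.under (𝓞 K)) ≠ 0) :
    absNorm Q ≠ 0 := by
  rw [absNorm_ne_zero_iff_ne_bot] at h ⊢
  rintro rfl
  exact h (under_bot _ _)

include hζ in
theorem natCast_eq_of_pow_eq {a b : ℕ} (h : ζ ^ a = ζ ^ b) : (a : ZMod q) = b := by
  have h1 := (isOfFinOrder_iff_pow_eq_one.2 ⟨q, NeZero.pos q, hζ.pow_eq_one⟩).pow_eq_pow_iff_modEq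
    (n := a) (m := b)
  rw [← hζ.eq_orderOf] at h1
  exact (ZMod.natCast_eq_natCast_iff _ _ _).2 (h1.1 h)

include hζ in
theorem exists_mem_range_autToPow [IsGalois K L] {P : Ideal (𝓞 K)} [P.IsPrime]
    (hP : (absNorm P).Coprime q) (h0 : absNorm P ≠ 0) :
    ∃ u ∈ (hζ.autToPow K).range, ((u : (ZMod q)ˣ) : ZMod q) = absNorm P := by
  obtain ⟨Q, hQ, hQP⟩ := exists_prime_over (L := L) P
  have hN : ((absNorm P : ℕ) : 𝓞 L) ∈ Q := by
    have h1 := absNorm_mem P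
    rw [← hQP, under_def, mem_comap, map_natCast] at h1
    rwa [← hQP]
  obtain ⟨σ, hσ⟩ := exists_frob (K := K) Q (absNorm_ne_zero_of_under (K := K) (by rwa [hQP]))
  have h2 := frob_apply_zeta hζ hσ (natCast_notMem_of_coprime hP hN)
  refine ⟨hζ.autToPow K σ, ⟨σ, rfl⟩, ?_⟩
  have h3 := hζ.autToPow_spec K σ
  rw [h2, hQP] at h3
  have h4 := natCast_eq_of_pow_eq hζ h3
  rwa [ZMod.natCast_zmod_val] at h4

theorem smul_sub_mem {Q : Ideal (𝓞 L)} {p : ℕ} (hp : p.Prime) (hQ : absNorm Q = p)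
    {σ : L ≃ₐ[K] L} (hσ : σ • Q = Q) (x : 𝓞 L) : σ • x - x ∈ Q := by
  obtain ⟨k, hk⟩ := exists_sub_intCast_mem hp hQ x
  have h1 : σ • (x - k) ∈ Q := by
    rw [← hσ]
    exact smul_mem_pointwise_smul _ _ _ hk
  have h2 : σ • (x - (k : 𝓞 L)) = σ • x - k := by
    rw [smul_sub]
    congr 1
    exact map_intCast (MulSemiringAction.toRingHom (L ≃ₐ[K] L) (𝓞 L) σ) k
  rw [h2] at h1
  have := Q.sub_mem h1 hk
  rwa [sub_sub_sub_cancel_right] at this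

include hζ in
theorem apply_zeta_eq {Q : Ideal (𝓞 L)} [Q.IsPrime] {p : ℕ} (hp : p.Prime) (hQ : absNorm Q = p)
    (hqQ : (q : 𝓞 L) ∉ Q) {σ : L ≃ₐ[K] L} (hσ : σ • Q = Q) : σ ζ = ζ := by
  have h1 := smul_sub_mem hp hQ hσ hζ.toInteger
  have hr := hζ.toInteger_isPrimitiveRoot.pow_eq_one
  have h2 := root_eq_of_sub_mem (NeZero.pos q) (by rw [← smul_pow', hr, smul_one]) hr h1 hqQ
  exact congrArg (fun x : 𝓞 L => (x : L)) h2

include hζ in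
theorem eq_one_of_apply_zeta [IsCyclotomicExtension {q} K L] {σ : L ≃ₐ[K] L} (h : σ ζ = ζ) :
    σ = 1 := by
  refine IsCyclotomicExtension.algEquiv_eq_of_apply_eq {q} K L fun n hn _ => ⟨ζ, ?_, h⟩
  rw [Set.mem_singleton_iff] at hn
  rwa [hn]

theorem coprime_of_prime_notMem {p q : ℕ} (hp : p.Prime) (hpq : ¬ p ∣ q) : p.Coprime q :=
  (Nat.Prime.coprime_iff_not_dvd hp).2 hpq

include hζ in
theorem natCast_eq_one_of_absNorm [IsGalois K L] {Q : Ideal (𝓞 L)} {p : ℕ}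
    (hp : p.Prime) (hpq : ¬ p ∣ q) (hQ : absNorm Q = p) : (p : ZMod q) = 1 := by
  have hQp : Q.IsPrime := isPrime_of_irreducible_absNorm (by rw [hQ]; exact hp)
  have hqQ : (q : 𝓞 L) ∉ Q := natCast_notMem_of_coprime (coprime_of_prime_notMem hp hpq)
    (hQ ▸ absNorm_mem Q)
  obtain ⟨σ, hσ⟩ := exists_frob (K := K) Q (hQ ▸ hp.ne_zero)
  have h1 := frob_apply_zeta hζ hσ hqQ
  rw [absNorm_under_eq_of_prime hp hQ, apply_zeta_eq hζ hp hQ hqQ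
    (MulAction.mem_stabilizer_iff.1 hσ.mem_stabilizer)] at h1
  have := natCast_eq_of_pow_eq hζ (a := 1) (b := p) (by rw [pow_one, ← h1])
  rw [← this, Nat.cast_one]

include hζ in
theorem absNorm_eq_of_under [IsGalois K L] [IsCyclotomicExtension {q} K L] {Q : Ideal (𝓞 L)}
    [hQ : Q.IsPrime] {p : ℕ} (hp : p.Prime) (hpq : ¬ p ∣ q) (hp1 : (p : ZMod q) = 1)
    (hQP : absNorm (Q.under (𝓞 K)) = p) : absNorm Q = p := by
  have hN : ((p : ℕ) : 𝓞 L) ∈ Q := by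
    have h1 := absNorm_mem (Q.under (𝓞 K))
    rwa [hQP, under_def, mem_comap, map_natCast] at h1
  have hqQ : (q : 𝓞 L) ∉ Q := natCast_notMem_of_coprime (coprime_of_prime_notMem hp hpq) hN
  have h0 : absNorm Q ≠ 0 := absNorm_ne_zero_of_under (K := K) (hQP ▸ hp.ne_zero)
  obtain ⟨σ, hσ⟩ := exists_frob (K := K) Q h0
  have h1 := frob_apply_zeta hζ hσ hqQ
  have h2 : ζ ^ p = ζ := by
    have h3 : p ≡ 1 [MOD q] := (ZMod.natCast_eq_natCast_iff _ _ _).1 (by simpa using hp1)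
    have h4 := (isOfFinOrder_iff_pow_eq_one.2 ⟨q, NeZero.pos q, hζ.pow_eq_one⟩).pow_eq_pow_iff_modEq
      (n := p) (m := 1)
    rw [← hζ.eq_orderOf] at h4
    simpa using h4.2 h3
  rw [hQP, h2] at h1
  have h3 := eq_one_of_apply_zeta hζ h1
  have hfin := finite_quotient_of_absNorm h0
  have : Fintype (𝓞 L ⧸ Q) := Fintype.ofFinite _
  have hpow : ∀ x : 𝓞 L ⧸ Q, x ^ p = x := by
    intro x
    obtain ⟨y, rfl⟩ := Ideal.Quotient.mk_surjective x
    have h5 := AlgHom.IsArithFrobAt.mk_apply hσ y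
    rw [card_quotient_eq, hQP, h3] at h5
    rw [← h5]
    congr 1
  have hcard : Fintype.card (𝓞 L ⧸ Q) ≤ p := by
    have : IsDomain (𝓞 L ⧸ Q) := Ideal.Quotient.isDomain Q
    let _ : Field (𝓞 L ⧸ Q) := Fintype.fieldOfDomain _
    have hne : (Polynomial.X ^ p - Polynomial.X : Polynomial (𝓞 L ⧸ Q)) ≠ 0 :=
      FiniteField.X_pow_card_sub_X_ne_zero _ hp.one_lt
    have hdeg := FiniteField.X_pow_card_sub_X_natDegree_eq (𝓞 L ⧸ Q) hp.one_lt
    calc Fintype.card (𝓞 L ⧸ Q) ≤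
        (Polynomial.X ^ p - Polynomial.X : Polynomial (𝓞 L ⧸ Q)).roots.toFinset.card := by
          refine Finset.card_le_card fun x _ => ?_
          rw [Multiset.mem_toFinset, Polynomial.mem_roots hne]
          simp [hpow x]
      _ ≤ _ := Multiset.toFinset_card_le _
      _ ≤ _ := (Polynomial.card_roots' _).trans hdeg.le
  rw [← Nat.card_eq_fintype_card, card_quotient_eq] at hcard
  refine le_antisymm hcard (Nat.le_of_dvd (Nat.pos_of_ne_zero h0) ?_)
  rw [← hQP]
  exact absNorm_under_dvd Q

include hζ in
theorem idealCount_eq_of_cast_eq_one [IsGalois K L] [IsCyclotomicExtension {q} K L] {p : ℕ}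
    (hp : p.Prime) (hpq : ¬ p ∣ q) (hp1 : (p : ZMod q) = 1) :
    idealCount L p = Nat.card (L ≃ₐ[K] L) * idealCount K p := by
  have hprime : ∀ P : {I : Ideal (𝓞 K) // absNorm I = p}, P.1.IsPrime := fun P =>
    isPrime_of_irreducible_absNorm (by rw [P.2]; exact hp)
  choose Q hQ1 hQ2 using fun P : {I : Ideal (𝓞 K) // absNorm I = p} =>
    have := hprime P
    exists_prime_over (L := L) P.1
  have hQN : ∀ P (σ : L ≃ₐ[K] L), absNorm (σ • Q P) = p := fun P σ => by
    have := hQ1 P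
    have : (σ • Q P).IsPrime := inferInstance
    refine absNorm_eq_of_under (K := K) hζ hp hpq hp1 ?_
    rw [under_smul, hQ2, P.2]
  unfold idealCount
  rw [← Nat.card_prod]
  refine (Nat.card_congr (Equiv.ofBijective
    (fun x : (L ≃ₐ[K] L) × {I : Ideal (𝓞 K) // absNorm I = p} =>
      (⟨x.1 • Q x.2, hQN x.2 x.1⟩ : {I : Ideal (𝓞 L) // absNorm I = p})) ⟨?_, ?_⟩)).symm
  · rintro ⟨σ, P⟩ ⟨τ, P'⟩ h
    have h1 : σ • Q P = τ • Q P' := congrArg Subtype.val h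
    have h2 := congrArg (under (𝓞 K)) h1
    rw [under_smul, under_smul, hQ2, hQ2] at h2
    obtain rfl := Subtype.ext h2
    have h3 : (τ⁻¹ * σ) • Q P = Q P := by rw [mul_smul, h1, inv_smul_smul]
    have := hQ1 P
    have hN : absNorm (Q P) = p := by simpa using hQN P 1
    have hqQ : (q : 𝓞 L) ∉ Q P := natCast_notMem_of_coprime (coprime_of_prime_notMem hp hpq)
      (hN ▸ absNorm_mem (Q P))
    have h4 := eq_one_of_apply_zeta hζ (apply_zeta_eq hζ hp hN hqQ h3)
    rw [inv_mul_eq_one] at h4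
    rw [h4]
  · rintro ⟨I, hI⟩
    have hIp : I.IsPrime := isPrime_of_irreducible_absNorm (by rw [hI]; exact hp)
    let P : {I : Ideal (𝓞 K) // absNorm I = p} := ⟨I.under (𝓞 K), absNorm_under_eq_of_prime hp hI⟩
    have := hQ1 P
    obtain ⟨σ, hσ⟩ := Algebra.IsInvariant.exists_smul_of_under_eq (𝓞 K) (𝓞 L) (L ≃ₐ[K] L)
      (Q P) I (hQ2 P)
    exact ⟨⟨σ, P⟩, Subtype.ext hσ.symm⟩

include hζ in
theorem idealCount_eq_ite [IsGalois K L] [IsCyclotomicExtension {q} K L] {p : ℕ}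
    (hp : p.Prime) (hpq : ¬ p ∣ q) :
    idealCount L p = if (p : ZMod q) = 1 then Nat.card (L ≃ₐ[K] L) * idealCount K p else 0 := by
  split_ifs with h
  · exact idealCount_eq_of_cast_eq_one hζ hp hpq h
  · by_contra h0
    unfold idealCount at h0
    obtain ⟨⟨Q, hQ⟩, _⟩ := Nat.card_ne_zero.1 h0
    exact h (natCast_eq_one_of_absNorm (K := K) hζ hp hpq hQ)

end CyclotomicK

section Principal

open Filter Topology ArithmeticFunction Finset

variable (K : Type*) [Field K] [NumberField K]

/-- `χ` is trivial on `G_q`. -/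
def TrivG {q : ℕ} (χ : DirichletCharacter ℂ q) : Prop := ∀ a ∈ Gq K q, χ (a : ZMod q) = 1

theorem Gq_eq (q : ℕ) [NeZero q] :
    Gq K q = ((IsCyclotomicExtension.zeta_spec q K (CyclotomicField q K)).autToPow K).range := by
  rw [Gq, dif_pos (NeZero.pos q)]

theorem phiK_eq_card (q : ℕ) [NeZero q] :
    phiK K q = Nat.card (CyclotomicField q K ≃ₐ[K] CyclotomicField q K) := by
  rw [phiK, Gq_eq]
  exact (Nat.card_congr (MonoidHom.ofInjective
    (IsPrimitiveRoot.autToPow_injective K (IsCyclotomicExtension.zeta_spec q K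
      (CyclotomicField q K)))).toEquiv).symm

theorem phiK_pos (q : ℕ) [NeZero q] : 0 < phiK K q := Nat.card_pos

theorem totient_le_mul_phiK (q : ℕ) [NeZero q] :
    q.totient ≤ Module.finrank ℚ K * phiK K q := by
  have hG : IsGalois K (CyclotomicField q K) := IsCyclotomicExtension.isGalois {q} K _
  have hz := IsCyclotomicExtension.zeta_spec q K (CyclotomicField q K)
  rw [phiK_eq_card, IsGalois.card_aut_eq_finrank, Module.finrank_mul_finrank]
  rw [← Polynomial.natDegree_cyclotomic q ℚ, Polynomial.cyclotomic_eq_minpoly_rat hz (NeZero.pos q)]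
  exact minpoly.natDegree_le _

theorem exists_mem_Gq {q : ℕ} [NeZero q] {P : Ideal (𝓞 K)} (hP : P.IsPrime)
    (hc : (absNorm P).Coprime q) (h0 : absNorm P ≠ 0) :
    ∃ u ∈ Gq K q, (u : ZMod q) = absNorm P := by
  have hG : IsGalois K (CyclotomicField q K) := IsCyclotomicExtension.isGalois {q} K _
  rw [Gq_eq]
  exact exists_mem_range_autToPow (IsCyclotomicExtension.zeta_spec q K (CyclotomicField q K)) hc h0

theorem card_trivG (q : ℕ) [NeZero q] :
    Nat.card {χ : DirichletCharacter ℂ q // TrivG K χ} * phiK K q = q.totient := by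
  have h1 : Nat.card {χ : DirichletCharacter ℂ q // TrivG K χ} =
      Nat.card ((ZMod q)ˣ ⧸ Gq K q →* ℂˣ) := by
    refine (Nat.card_congr (Equiv.ofBijective (fun φ : (ZMod q)ˣ ⧸ Gq K q →* ℂˣ =>
      (⟨MulChar.ofUnitHom (φ.comp (QuotientGroup.mk' (Gq K q))), fun a ha => ?_⟩ :
        {χ : DirichletCharacter ℂ q // TrivG K χ})) ⟨fun φ ψ h => ?_, fun χ => ?_⟩)).symm
    · rw [MulChar.ofUnitHom_coe, MonoidHom.comp_apply, QuotientGroup.mk'_apply,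
        (QuotientGroup.eq_one_iff a).2 ha, map_one, Units.val_one]
    · have h2 := MulChar.equivToUnitHom.symm.injective (congrArg Subtype.val h)
      refine MonoidHom.ext fun x => ?_
      obtain ⟨a, rfl⟩ := QuotientGroup.mk_surjective x
      exact DFunLike.congr_fun h2 a
    · have hk : Gq K q ≤ (χ.1.toUnitHom).ker := fun a ha => by
        rw [MonoidHom.mem_ker]
        exact Units.ext (χ.2 a ha)
      refine ⟨QuotientGroup.lift _ χ.1.toUnitHom hk, Subtype.ext ?_⟩
      refine MulChar.ext fun a => ?_
      rw [MulChar.ofUnitHom_coe, MonoidHom.comp_apply, QuotientGroup.mk'_apply,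
        QuotientGroup.lift_mk, MulChar.coe_toUnitHom]
  have h3 : HasEnoughRootsOfUnity ℂ (Monoid.exponent ((ZMod q)ˣ ⧸ Gq K q)) :=
    HasEnoughRootsOfUnity.of_dvd ℂ (Group.exponent_quotient_dvd (Gq K q))
  have h2 := CommGroup.card_monoidHom_of_hasEnoughRootsOfUnity ((ZMod q)ˣ ⧸ Gq K q) ℂ
  rw [h1]
  refine (congrArg (· * phiK K q) h2).trans ?_
  rw [phiK, ← Subgroup.card_eq_card_quotient_mul_card_subgroup,
    Nat.card_eq_fintype_card, ZMod.card_units_eq_totient]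

/-- The part of `log ζ_K` supported on the residue class of `1`. -/
noncomputable def classSum (q : ℕ) (σ : ℝ) : ℝ :=
  ∑' n : ℕ, (if (n : ZMod q) = 1 then 1 else 0) * wtK K n * (n : ℝ) ^ (-σ)

theorem abs_ite_le (q n : ℕ) : |(if (n : ZMod q) = 1 then 1 else 0 : ℝ)| ≤ 1 := by
  split_ifs <;> simp

theorem sum_log_norm_eq {q : ℕ} [NeZero q] {σ : ℝ} (hσ : 1 < σ) :
    ∑ χ : DirichletCharacter ℂ q, Real.log ‖LSeries (coefL K χ) σ‖ =
      q.totient * classSum K q σ := by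
  simp_rw [fun χ => log_norm_LSeries_coefL_real K (NeZero.pos q) χ hσ]
  rw [← Summable.tsum_finsetSum fun χ _ => summable_mul_rpow_of_le
    (fun n => abs_mul_wtK_le K ((Complex.abs_re_le_norm _).trans (χ.norm_le_one n)) n) hσ,
    classSum, ← tsum_mul_left]
  refine tsum_congr fun n => ?_
  rw [← sum_mul, ← sum_mul, ← Complex.re_sum, DirichletCharacter.sum_characters_eq]
  split_ifs <;> simp [mul_assoc]

theorem eventually_one_lt : ∀ᶠ σ : ℝ in 𝓝[>] 1, 1 < σ := self_mem_nhdsWithin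

theorem exists_log_zeta : ∃ C : ℝ, ∀ᶠ σ : ℝ in 𝓝[>] 1,
    |(∑' n : ℕ, wtK K n * (n : ℝ) ^ (-σ)) + Real.log (σ - 1)| ≤ C := by
  obtain ⟨κ, hκ, hκ'⟩ := resL_one_pos K
  have h := hasMean_coefL K one_pos (1 : DirichletCharacter ℂ 1)
  obtain ⟨C, hC⟩ := h.log_of_ne_zero (by rw [hκ']; exact_mod_cast hκ.ne')
  refine ⟨C, ?_⟩
  filter_upwards [hC, eventually_one_lt] with σ h1 hσ
  rw [log_norm_LSeries_coefL_real K one_pos _ hσ] at h1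
  convert! h1 using 5 with n
  rw [MulChar.one_apply (isUnit_of_subsingleton _), Complex.one_re, one_mul]

theorem exists_classSum (q : ℕ) [NeZero q] : ∃ C : ℝ, ∀ᶠ σ : ℝ in 𝓝[>] 1,
    |phiK K q * classSum K q σ + Real.log (σ - 1)| ≤ C := by
  have hG : IsGalois K (CyclotomicField q K) := IsCyclotomicExtension.isGalois {q} K _
  have hz := IsCyclotomicExtension.zeta_spec q K (CyclotomicField q K)
  set L := CyclotomicField q K with hL
  obtain ⟨C, hC⟩ := exists_log_zeta L
  have key : ∀ p : ℕ, p.Prime → p ∉ {p : ℕ | p ∣ q} →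
      wtK L p = phiK K q * ((if (p : ZMod q) = 1 then 1 else 0) * wtK K p) := by
    intro p hp hpq
    rw [wtK_prime L hp, wtK_prime K hp, idealCount_eq_ite (K := K) hz hp hpq, phiK_eq_card]
    split_ifs <;> simp
  have hS : {p : ℕ | p ∣ q}.Finite := by
    refine (finite_toSet q.divisors).subset fun p hp => ?_
    simpa using ⟨hp, NeZero.ne q⟩
  set c : ℝ := 2 * Module.finrank ℚ L + phiK K q * (2 * Module.finrank ℚ K) with hc
  have hf : ∀ n, |wtK L n| ≤ c * vonMangoldt n := fun n => by
    rw [abs_of_nonneg (wtK_nonneg L n), hc, add_mul]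
    have : 0 ≤ vonMangoldt n := vonMangoldt_nonneg
    have := wtK_le L n
    have : 0 ≤ phiK K q * (2 * Module.finrank ℚ K) * vonMangoldt n := by positivity
    linarith
  have hg : ∀ n : ℕ, |phiK K q * ((if (n : ZMod q) = 1 then 1 else 0) * wtK K n)| ≤
      c * vonMangoldt n := fun n => by
    have h0 : 0 ≤ vonMangoldt n := vonMangoldt_nonneg
    have h1 := abs_mul_wtK_le K (abs_ite_le q n) n
    rw [abs_mul, abs_of_nonneg (by positivity : (0 : ℝ) ≤ phiK K q), hc, add_mul, mul_assoc _ (2 * _)]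
    have h2 : 0 ≤ 2 * Module.finrank ℚ L * vonMangoldt n := by positivity
    have h3 : (phiK K q : ℝ) * |(if (n : ZMod q) = 1 then 1 else 0) * wtK K n| ≤
      phiK K q * (2 * Module.finrank ℚ K * vonMangoldt n) := by gcongr
    linarith
  obtain ⟨C₁, h₁⟩ := exists_tsum_le_tsum_add hf hg hS fun p hp h => (key p hp h).le
  obtain ⟨C₂, h₂⟩ := exists_tsum_le_tsum_add hg hf hS fun p hp h => (key p hp h).ge
  refine ⟨C + |C₁| + |C₂|, ?_⟩
  filter_upwards [hC, eventually_one_lt] with σ h3 hσ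
  have h4 := h₁ σ hσ
  have h5 := h₂ σ hσ
  have h6 : ∑' n : ℕ, phiK K q * ((if (n : ZMod q) = 1 then 1 else 0) * wtK K n) *
      (n : ℝ) ^ (-σ) = phiK K q * classSum K q σ := by
    rw [classSum, ← tsum_mul_left]
    exact tsum_congr fun n => by ring
  rw [h6] at h4 h5
  rw [abs_le] at h3 ⊢
  constructor <;> linarith [le_abs_self C₁, le_abs_self C₂, abs_nonneg C₁, abs_nonneg C₂]

/-- Norms of ideals prime to `q` are killed by characters trivial on `G_q`. -/
theorem TrivG.apply_eq_one {q : ℕ} [NeZero q] {χ : DirichletCharacter ℂ q} (h : TrivG K χ)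
    {P : Ideal (𝓞 K)} (hP : P.IsPrime) (hc : (absNorm P).Coprime q) (h0 : absNorm P ≠ 0) :
    χ (absNorm P : ZMod q) = 1 := by
  obtain ⟨u, hu, h1⟩ := exists_mem_Gq K hP hc h0
  rw [← h1]
  exact h u hu

theorem TrivG.exists_log_ge {q : ℕ} [NeZero q] {χ : DirichletCharacter ℂ q} (h : TrivG K χ) :
    ∃ C : ℝ, ∀ᶠ σ : ℝ in 𝓝[>] 1, -Real.log (σ - 1) - C ≤ Real.log ‖LSeries (coefL K χ) σ‖ := by
  obtain ⟨C, hC⟩ := exists_log_zeta K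
  have hS : {p : ℕ | p ∣ q}.Finite := by
    refine (finite_toSet q.divisors).subset fun p hp => ?_
    simpa using ⟨hp, NeZero.ne q⟩
  obtain ⟨C₁, h₁⟩ := exists_tsum_le_tsum_add (S := {p : ℕ | p ∣ q})
    (f := wtK K) (g := fun n => (χ n).re * wtK K n) (fun n => by
      rw [abs_of_nonneg (wtK_nonneg K n)]; exact wtK_le K n)
    (fun n => abs_mul_wtK_le K ((Complex.abs_re_le_norm _).trans (χ.norm_le_one n)) n) hS
    fun p hp hpq => by
      rw [wtK_prime K hp]
      by_cases h0 : idealCount K p = 0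
      · simp [h0]
      · unfold idealCount at h0
        obtain ⟨⟨P, hP⟩, _⟩ := Nat.card_ne_zero.1 h0
        have := h.apply_eq_one K (P := P) (Ideal.isPrime_of_irreducible_absNorm (by rw [hP]; exact hp))
          (by rw [hP]; exact coprime_of_prime_notMem hp hpq) (by rw [hP]; exact hp.ne_zero)
        rw [hP] at this
        simp [this]
  refine ⟨C + C₁, ?_⟩
  filter_upwards [hC, eventually_one_lt] with σ h3 hσ
  rw [log_norm_LSeries_coefL_real K (NeZero.pos q) _ hσ]
  linarith [(abs_le.1 h3).1, h₁ σ hσ]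

theorem tendsto_neg_log_sub_one : Tendsto (fun σ : ℝ => -Real.log (σ - 1)) (𝓝[>] 1) atTop := by
  refine tendsto_neg_atBot_atTop.comp (Real.tendsto_log_nhdsGT_zero.comp ?_)
  refine tendsto_nhdsWithin_iff.2 ⟨?_, ?_⟩
  · have : Tendsto (fun σ : ℝ => σ - 1) (𝓝 1) (𝓝 (1 - 1)) := tendsto_id.sub tendsto_const_nhds
    rw [sub_self] at this
    exact this.mono_left nhdsWithin_le_nhds
  · filter_upwards [eventually_one_lt] with σ hσ using sub_pos.2 hσ

/-- If `L(s, χ)` has no pole at `1` then it does not vanish there. -/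
theorem regL_one_ne_zero {q : ℕ} [NeZero q] {χ : DirichletCharacter ℂ q} (hres : resL K χ = 0) :
    regL (coefL K χ) 0 1 ≠ 0 := by
  intro hz
  have hm := hasMean_coefL K (NeZero.pos q) χ
  rw [hres] at hm
  obtain ⟨C₁, h₁⟩ := hm.log_of_zero_zero hz
    fun σ hσ => LSeries_coefL_ne_zero K (NeZero.pos q) χ (by simpa using hσ)
  obtain ⟨C₂, h₂⟩ := exists_log_zeta K
  obtain ⟨C₃, h₃⟩ := exists_classSum K q
  have hφ : (0 : ℝ) < phiK K q := by exact_mod_cast phiK_pos K q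
  obtain ⟨σ, h1, h2, h3, hσ, h4⟩ := (h₁.and (h₂.and (h₃.and (eventually_one_lt.and
    (tendsto_neg_log_sub_one.eventually_gt_atTop |phiK K q * (C₁ + C₂) + 2 * C₃|))))).exists
  rw [log_norm_LSeries_coefL_real K (NeZero.pos q) _ hσ] at h1
  have s0 := summable_mul_rpow_of_le (f := wtK K) (fun n => by
      rw [abs_of_nonneg (wtK_nonneg K n)]; exact wtK_le K n) hσ
  have s1 := summable_mul_rpow_of_le
    (fun n => abs_mul_wtK_le K ((Complex.abs_re_le_norm _).trans (χ.norm_le_one n)) n) hσ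
  have s2 := summable_mul_rpow_of_le (fun n => abs_mul_wtK_le K (abs_ite_le q n) n) hσ
  have h5 : 2 * classSum K q σ ≤ (∑' n : ℕ, wtK K n * (n : ℝ) ^ (-σ)) +
      ∑' n : ℕ, (χ n).re * wtK K n * (n : ℝ) ^ (-σ) := by
    rw [classSum, ← tsum_mul_left, ← s0.tsum_add s1]
    refine (s2.mul_left 2).tsum_le_tsum (fun n => ?_) (s0.add s1)
    have hw : 0 ≤ wtK K n * (n : ℝ) ^ (-σ) := mul_nonneg (wtK_nonneg K n) (by positivity)
    split_ifs with h6
    · rw [h6]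
      simp only [map_one, Complex.one_re, one_mul]
      linarith
    · have h7 : -1 ≤ (χ n).re := by
        have := (Complex.abs_re_le_norm _).trans (χ.norm_le_one n)
        exact (abs_le.1 this).1
      nlinarith
  have h6 := (abs_le.1 h3).1
  have h7 := (abs_le.1 h2).2
  have h8 : phiK K q * (2 * classSum K q σ) ≤ phiK K q * (C₁ + C₂) :=
    mul_le_mul_of_nonneg_left (by linarith) hφ.le
  linarith [le_abs_self (phiK K q * (C₁ + C₂) + 2 * C₃), abs_nonneg (phiK K q * (C₁ + C₂) + 2 * C₃)]

/-- The L-function of a character that is nontrivial on `G_q` has no pole at `1`. -/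
theorem resL_eq_zero {q : ℕ} [NeZero q] {χ : DirichletCharacter ℂ q} (h : ¬ TrivG K χ) :
    resL K χ = 0 := by
  by_contra hres
  have hlow : ∀ ψ : DirichletCharacter ℂ q, ∃ C : ℝ, ∀ᶠ σ : ℝ in 𝓝[>] 1,
      (if TrivG K ψ ∨ ψ = χ then 1 else 0) * (-Real.log (σ - 1)) - C ≤
        Real.log ‖LSeries (coefL K ψ) σ‖ := by
    intro ψ
    have hm := hasMean_coefL K (NeZero.pos q) ψ
    by_cases h1 : resL K ψ = 0
    · rw [h1] at hm
      have hT : ¬ (TrivG K ψ ∨ ψ = χ) := by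
        rintro (h2 | rfl)
        · obtain ⟨C₁, h₁⟩ := h2.exists_log_ge K
          obtain ⟨C₂, h₂⟩ := hm.log_of_zero_ne_zero (regL_one_ne_zero K h1)
          obtain ⟨σ, h3, h4, h5⟩ := (h₁.and (h₂.and
            (tendsto_neg_log_sub_one.eventually_gt_atTop (C₁ + C₂)))).exists
          linarith [(abs_le.1 h4).2]
        · exact hres h1
      obtain ⟨C, hC⟩ := hm.log_of_zero_ne_zero (regL_one_ne_zero K h1)
      refine ⟨C, hC.mono fun σ h3 => ?_⟩
      rw [if_neg hT]
      linarith [(abs_le.1 h3).1]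
    · obtain ⟨C, hC⟩ := hm.log_of_ne_zero h1
      refine ⟨C, ?_⟩
      filter_upwards [hC, tendsto_neg_log_sub_one.eventually_gt_atTop 0] with σ h3 h4
      split_ifs <;> linarith [(abs_le.1 h3).1]
  choose C hC using hlow
  obtain ⟨C', hC'⟩ := exists_classSum K q
  have hcard : ∑ ψ : DirichletCharacter ℂ q, (if TrivG K ψ ∨ ψ = χ then 1 else 0 : ℝ) =
      Nat.card {χ : DirichletCharacter ℂ q // TrivG K χ} + 1 := by
    have h2 : ∀ ψ : DirichletCharacter ℂ q, (if TrivG K ψ ∨ ψ = χ then 1 else 0 : ℝ) =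
        (if TrivG K ψ then 1 else 0) + if ψ = χ then 1 else 0 := by
      intro ψ
      by_cases h3 : ψ = χ
      · subst h3; simp [h]
      · simp [h3]
    simp_rw [h2]
    rw [sum_add_distrib, sum_ite_eq' univ χ, if_pos (mem_univ _),
      sum_boole, Nat.card_eq_fintype_card, Fintype.card_subtype]
  have hN := card_trivG K q
  set N := Nat.card {χ : DirichletCharacter ℂ q // TrivG K χ} with hNdef
  have hall : ∀ᶠ σ : ℝ in 𝓝[>] 1, ∀ ψ ∈ (univ : Finset (DirichletCharacter ℂ q)),
      (if TrivG K ψ ∨ ψ = χ then 1 else 0) * (-Real.log (σ - 1)) - C ψ ≤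
        Real.log ‖LSeries (coefL K ψ) σ‖ := (Finset.eventually_all _).2 fun ψ _ => hC ψ
  obtain ⟨σ, h1, h2, hσ, h4⟩ := (hall.and (hC'.and (eventually_one_lt.and
    (tendsto_neg_log_sub_one.eventually_gt_atTop (∑ ψ, C ψ + N * C'))))).exists
  have h5 := sum_le_sum h1
  rw [sum_log_norm_eq K hσ, sum_sub_distrib, ← sum_mul, hcard, ← hN, Nat.cast_mul,
    mul_assoc] at h5
  have h6 : (N : ℝ) * (phiK K q * classSum K q σ) ≤ N * (-Real.log (σ - 1) + C') := by
    gcongr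
    linarith [(abs_le.1 h2).2]
  linarith

end Principal

section SiegelTaylor

open Filter Topology Metric Complex

open scoped ComplexOrder in
theorem one_le_re_LSeries {a : ℕ → ℂ} (ha : 0 ≤ a) (ha1 : a 1 = 1)
    (hs : LSeriesSummable a 2) : 1 ≤ (LSeries a 2).re := by
  have h0 : ∀ n, 0 ≤ LSeries.term a 2 n := fun n => by
    have := LSeries.term_nonneg (ha n) (2 : ℝ)
    exact_mod_cast this
  have h1 := hs.le_tsum 1 fun n _ => h0 n
  rw [LSeries.term_of_ne_zero one_ne_zero, ha1] at h1
  simpa [LSeries] using (Complex.le_def.1 h1).1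

open scoped ComplexOrder in
/-- Lower bound, left of `1`, for a Dirichlet series with nonnegative coefficients and a simple
pole at `1`. -/
theorem taylor_lower {a : ℕ → ℂ} (ha : 0 ≤ a) (ha1 : a 1 = 1)
    (hs : ∀ s : ℂ, 1 < s.re → LSeriesSummable a s) {G : ℂ → ℂ} {l : ℂ} {R B : ℝ} (hR : 0 < R)
    (hG : DiffContOnCl ℂ G (ball 2 R)) (hB : ∀ z ∈ sphere (2 : ℂ) R, ‖G z‖ ≤ B)
    (hL : ∀ s : ℂ, 1 < s.re → LSeries a s = l / (s - 1) + G s) {y : ℝ} (hy : 1 < y) (hyR : y < R)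
    {M : ℕ} (hM : 1 ≤ M) :
    1 - l.re * (y ^ M / (y - 1)) - B * ((y / R) ^ M / (1 - y / R)) ≤
      (l / ((2 - y : ℝ) - 1) + G (2 - y : ℝ)).re := by
  set d : ℕ → ℂ := fun m => (-1) ^ m * ((m.factorial : ℂ)⁻¹ * iteratedDeriv m G 2) with hd
  have hdG : DifferentiableOn ℂ G (ball 2 R) := hG.differentiableOn
  have hsum : HasSum (fun m => (d m).re * y ^ m) (G (2 - y : ℝ)).re := by
    have h1 : ((2 - y : ℝ) : ℂ) ∈ ball (2 : ℂ) R := by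
      rw [mem_ball_iff_norm, ofReal_sub]
      simpa [abs_of_pos (zero_lt_one.trans hy)] using hyR
    have h2 := reCLM.hasSum (hasSum_taylorSeries_on_ball hdG h1)
    convert! h2 using 2 with m
    have h3 : (m.factorial : ℂ)⁻¹ • (((2 - y : ℝ) : ℂ) - 2) ^ m • iteratedDeriv m G 2 =
        d m * (y ^ m : ℝ) := by
      have : ((2 - y : ℝ) : ℂ) - 2 = -1 * y := by push_cast; ring
      rw [this, mul_pow, hd]
      push_cast
      simp only [smul_eq_mul]
      ring
    simp only [h3, reCLM_apply, re_mul_ofReal]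
  have hnorm : ∀ m, -(B / R ^ m) ≤ (d m).re := by
    intro m
    have h1 := norm_iteratedDeriv_le_of_forall_mem_sphere_norm_le m hR hG hB
    have h2 : ‖d m‖ ≤ B / R ^ m := by
      rw [hd]
      simp only [norm_mul, norm_pow, norm_neg, norm_one, one_pow, one_mul, norm_inv,
        RCLike.norm_natCast]
      rw [inv_mul_le_iff₀ (by positivity), ← mul_div_assoc]
      exact h1
    exact (abs_le.1 ((abs_re_le_norm _).trans h2)).1
  have hpos : ∀ m, -l.re + (if m = 0 then 1 else 0) ≤ (d m).re := by
    intro m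
    have hab : LSeries.abscissaOfAbsConv a < ((2 : ℝ) : ℂ).re :=
      abscissa_lt hs (by simp)
    have h1 := LSeries.iteratedDeriv_alternating ha hab m
    have h2 : iteratedDeriv m (LSeries a) ((2 : ℝ) : ℂ) =
        l * ((-1) ^ m * m.factorial) + iteratedDeriv m G 2 := by
      have h3 : LSeries a =ᶠ[𝓝 ((2 : ℝ) : ℂ)] (fun s => l * (1 * s - 1)⁻¹) + G := by
        have : {s : ℂ | 1 < s.re} ∈ 𝓝 ((2 : ℝ) : ℂ) :=
          (isOpen_lt continuous_const continuous_re).mem_nhds (by simp)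
        filter_upwards [this] with s h
        simp [hL s h, div_eq_mul_inv]
      rw [h3.iteratedDeriv_eq, iteratedDeriv_add]
      · rw [iteratedDeriv_const_mul_field, iteratedDeriv_eq_iterate, iter_deriv_inv_linear_sub]
        norm_num
      · refine ContDiffAt.mul contDiffAt_const (ContDiffAt.inv ?_ ?_)
        · fun_prop
        · norm_num
      · rw [ofReal_ofNat]
        exact (hdG.analyticAt (ball_mem_nhds _ hR)).contDiffAt
    have h4 : (0 : ℝ) ≤ (l + d m).re := by
      have h5 : (l + d m) = (m.factorial : ℝ)⁻¹ * ((-1) ^ m * iteratedDeriv m (LSeries a) ((2 : ℝ) : ℂ)) := by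
        rw [h2, hd]
        have h6 : ((-1 : ℂ) ^ m) * (-1) ^ m = 1 := by rw [← mul_pow]; simp
        have h7 : (m.factorial : ℂ) ≠ 0 := by exact_mod_cast m.factorial_ne_zero
        push_cast
        field_simp
        linear_combination (-l * (m.factorial : ℂ)) * h6
      rw [h5, re_ofReal_mul]
      exact mul_nonneg (by positivity) (Complex.le_def.1 h1).1
    rw [add_re] at h4
    split_ifs with h0
    · subst h0
      have h5 := one_le_re_LSeries ha ha1 (hs 2 (by simp))
      have h6 := h2
      simp only [iteratedDeriv_zero, pow_zero, Nat.factorial_zero, Nat.cast_one, mul_one,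
        ofReal_ofNat] at h6
      rw [h6, add_re] at h5
      simp only [hd, pow_zero, Nat.factorial_zero, Nat.cast_one, inv_one, one_mul, iteratedDeriv_zero]
      linarith
    · linarith
  have hyR' : y / R < 1 := (div_lt_one hR).2 hyR
  have hy0 : 0 < y := zero_lt_one.trans hy
  have hgeo := hasSum_geometric_of_lt_one (by positivity) hyR'
  have h1 : ∑ m ∈ Finset.range M, (d m).re * y ^ m ≥ 1 - l.re * ((y ^ M - 1) / (y - 1)) := by
    rw [← geom_sum_eq hy.ne', Finset.mul_sum]
    have h2 : (1 : ℝ) = ∑ m ∈ Finset.range M, if m = 0 then 1 else 0 := by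
      rw [Finset.sum_ite_eq', if_pos (Finset.mem_range.2 hM)]
    rw [h2, ← Finset.sum_sub_distrib]
    refine Finset.sum_le_sum fun m _ => ?_
    have := mul_le_mul_of_nonneg_right (hpos m) (by positivity : 0 ≤ y ^ m)
    refine le_trans (le_of_eq ?_) this
    split_ifs with h0
    · subst h0; ring
    · ring
  have h2 : ∑' m, (d (m + M)).re * y ^ (m + M) ≥ - (B * ((y / R) ^ M / (1 - y / R))) := by
    have h3 : HasSum (fun m => -(B * (y / R) ^ M) * (y / R) ^ m)
        (-(B * (y / R) ^ M) * (1 - y / R)⁻¹) := hgeo.mul_left _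
    have h4 := (summable_nat_add_iff M).2 hsum.summable
    refine le_trans (le_of_eq ?_) (hasSum_le (fun m => ?_) h3 h4.hasSum)
    · ring
    · have := mul_le_mul_of_nonneg_right (hnorm (m + M)) (by positivity : 0 ≤ y ^ (m + M))
      refine le_trans (le_of_eq ?_) this
      rw [div_pow, div_pow, pow_add, pow_add]
      field_simp
  have h3 := hsum.summable.sum_add_tsum_nat_add M
  rw [hsum.tsum_eq] at h3
  have h4 : (l / ((2 - y : ℝ) - 1)).re = - (l.re / (y - 1)) := by
    have : ((2 - y : ℝ) : ℂ) - 1 = ((-(y - 1) : ℝ) : ℂ) := by push_cast; ring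
    rw [this, div_ofReal_re, div_neg]
  rw [add_re, h4, ← h3]
  have h5 : l.re * (y ^ M / (y - 1)) = l.re * ((y ^ M - 1) / (y - 1)) + l.re / (y - 1) := by ring
  linarith

theorem exists_pow_le {B ρ : ℝ} (hB : 1 ≤ B) (hρ : 0 < ρ) (hρ1 : ρ < 1) (m : ℕ) :
    ∃ C : ℝ, 1 ≤ C ∧ ∀ q : ℕ, 1 ≤ q → ∃ M : ℕ, 1 ≤ M ∧ B * q ^ m * ρ ^ M ≤ 1 / 2 ∧
      ∀ y : ℝ, 1 ≤ y → y ^ M ≤ C * (q : ℝ) ^ (C * (y - 1)) ∨ 2 < y := by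
  have hl : 0 < -Real.log ρ := by linarith [Real.log_neg hρ hρ1]
  set c : ℝ := (Real.log (2 * B) + m) / -Real.log ρ with hc
  have hlB : 0 ≤ Real.log (2 * B) := Real.log_nonneg (by linarith)
  have hc0 : 0 ≤ c := by positivity
  refine ⟨Real.exp (c + 2), Real.one_le_exp (by linarith), fun q hq => ?_⟩
  have hq' : (1 : ℝ) ≤ q := by exact_mod_cast hq
  have hlq : 0 ≤ Real.log q := Real.log_nonneg hq'
  set M := ⌈c * (1 + Real.log q)⌉₊ + 1 with hM
  have hM1 : c * (1 + Real.log q) ≤ M := by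
    rw [hM]; push_cast; linarith [Nat.le_ceil (c * (1 + Real.log q))]
  have hM2 : (M : ℝ) ≤ c * (1 + Real.log q) + 2 := by
    rw [hM]; push_cast; linarith [Nat.ceil_lt_add_one (by positivity : 0 ≤ c * (1 + Real.log q))]
  refine ⟨M, by omega, ?_, fun y hy => or_iff_not_imp_right.2 fun hy2 => ?_⟩
  · have h1 : 2 * B * (q : ℝ) ^ m * ρ ^ M ≤ 1 := by
      rw [← Real.log_nonpos_iff (by positivity), Real.log_mul (by positivity) (by positivity),
        Real.log_mul (by positivity) (by positivity), Real.log_pow, Real.log_pow]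
      have h2 : c * (-Real.log ρ) = Real.log (2 * B) + m := by
        rw [hc, div_mul_cancel₀ _ hl.ne']
      nlinarith [mul_le_mul_of_nonneg_right hM1 hl.le, mul_nonneg hlB hlq]
    linarith
  · push Not at hy2
    have h1 : y ≤ Real.exp (y - 1) := by linarith [Real.add_one_le_exp (y - 1)]
    have h2 : y ^ M ≤ Real.exp ((y - 1) * M) := by
      rw [mul_comm, Real.exp_nat_mul]
      gcongr
    refine h2.trans ?_
    rw [Real.rpow_def_of_pos (by linarith), ← Real.exp_add, Real.exp_le_exp]
    have h3 : c ≤ Real.exp (c + 2) := by linarith [Real.add_one_le_exp (c + 2)]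
    have h4 : (y - 1) * M ≤ (y - 1) * (c * (1 + Real.log q) + 2) := by gcongr
    have h5 : (y - 1) * (c + 2) ≤ 1 * (c + 2) := by gcongr; linarith
    have h6 : (y - 1) * Real.log q * c ≤ (y - 1) * Real.log q * Real.exp (c + 2) := by
      have : 0 ≤ y - 1 := by linarith
      gcongr
    nlinarith

open scoped ComplexOrder in
/-- A nonpositive value left of `1` forces a large residue. -/
theorem exists_residue_ge {δ B₀ : ℝ} (hδ : 0 < δ) (hδ' : δ ≤ 1 / 2) (hB₀ : 1 ≤ B₀) (m : ℕ) :
    ∃ C : ℝ, 1 ≤ C ∧ ∀ (q : ℕ) (a : ℕ → ℂ) (κ : ℂ) (R₀ P : ℂ → ℂ), 1 ≤ q → 0 ≤ a → a 1 = 1 →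
      (∀ s : ℂ, 1 < s.re → LSeriesSummable a s) → ‖κ‖ ≤ B₀ →
      DifferentiableOn ℂ R₀ {s | 1 - δ < s.re} → DifferentiableOn ℂ P {s | 1 - δ < s.re} →
      (∀ s : ℂ, 1 - δ / 2 ≤ s.re → ‖s‖ ≤ 4 → ‖R₀ s‖ ≤ B₀ ∧ ‖P s‖ ≤ B₀ * q ^ m) →
      (∀ s : ℂ, 1 < s.re → LSeries a s = (κ / (s - 1) + R₀ s) * P s) →
      ∀ β : ℝ, 1 - δ / 4 ≤ β → β < 1 → ((κ / (β - 1) + R₀ β) * P β).re ≤ 0 →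
        (1 - β) / C * (q : ℝ) ^ (-(C * (1 - β))) ≤ (κ * P 1).re := by
  set R : ℝ := 1 + δ / 2 with hR
  set ρ : ℝ := (1 + δ / 4) / R with hρ
  have hR0 : 0 < R := by positivity
  have hρ0 : 0 < ρ := by positivity
  have hρ1 : ρ < 1 := by rw [hρ, div_lt_one hR0, hR]; linarith
  have hB1 : 1 ≤ 5 * B₀ ^ 2 / δ / (1 - ρ) := by
    rw [one_le_div (by linarith), le_div_iff₀ hδ]
    nlinarith
  obtain ⟨C, hC, hM⟩ := exists_pow_le hB1 hρ0 hρ1 m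
  refine ⟨2 * C, by linarith, ?_⟩
  intro q a κ R₀ P hq ha ha1 hs hκ hdR hdP hb hL β hβ hβ1 hneg
  have hq' : (1 : ℝ) ≤ q := by exact_mod_cast hq
  obtain ⟨M, hM1, hM2, hM3⟩ := hM q hq
  have hU : IsOpen {s : ℂ | 1 - δ < s.re} := isOpen_lt continuous_const continuous_re
  set G : ℂ → ℂ := fun s => κ * dslope P 1 s + R₀ s * P s with hG
  have hdG : DifferentiableOn ℂ G {s | 1 - δ < s.re} := by
    refine DifferentiableOn.add (DifferentiableOn.const_mul ?_ _) (hdR.mul hdP)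
    exact (differentiableOn_dslope (hU.mem_nhds (by simp [hδ]))).2 hdP
  have hGe : ∀ s : ℂ, s ≠ 1 → (κ / (s - 1) + R₀ s) * P s = κ * P 1 / (s - 1) + G s := by
    intro s hs
    have : s - 1 ≠ 0 := sub_ne_zero.2 hs
    simp only [hG]
    rw [dslope_of_ne _ hs, slope_def_field]
    field_simp
    ring
  have hre : ∀ s ∈ closedBall (2 : ℂ) R, 1 - δ / 2 ≤ s.re ∧ ‖s‖ ≤ 4 := by
    intro s h
    rw [mem_closedBall_iff_norm] at h
    have h1 := (abs_le.1 ((abs_re_le_norm _).trans h)).1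
    rw [sub_re, re_ofNat] at h1
    have h2 : ‖s‖ ≤ ‖s - 2‖ + ‖(2 : ℂ)‖ := by simpa using norm_add_le (s - 2) 2
    rw [norm_ofNat] at h2
    constructor <;> linarith
  have hcl : DiffContOnCl ℂ G (ball 2 R) := by
    refine DifferentiableOn.diffContOnCl (hdG.mono fun s h => ?_)
    have := (hre s (closure_ball_subset_closedBall h)).1
    show 1 - δ < s.re
    linarith
  have hB : ∀ z ∈ sphere (2 : ℂ) R, ‖G z‖ ≤ 5 * B₀ ^ 2 / δ * q ^ m := by
    intro z hz
    have h1 := hre z (sphere_subset_closedBall hz)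
    obtain ⟨hb1, hb2⟩ := hb z h1.1 h1.2
    have hb3 := (hb 1 (by simp; positivity) (by simp)).2
    rw [mem_sphere_iff_norm] at hz
    have h2 : δ / 2 ≤ ‖z - 1‖ := by
      have h3 : ‖z - 2‖ ≤ ‖z - 1‖ + ‖(-1 : ℂ)‖ := by
        refine le_trans (le_of_eq ?_) (norm_add_le (z - 1) (-1))
        congr 1; ring
      rw [norm_neg, norm_one, hz] at h3
      linarith
    have hz1 : z ≠ 1 := by
      rintro rfl
      rw [sub_self, norm_zero] at h2
      linarith
    have h4 : ‖dslope P 1 z‖ ≤ 2 * (B₀ * q ^ m) / (δ / 2) := by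
      rw [dslope_of_ne _ hz1, slope_def_field, norm_div]
      have : ‖P z - P 1‖ ≤ 2 * (B₀ * q ^ m) := (norm_sub_le _ _).trans (by linarith)
      gcongr
    calc ‖G z‖ ≤ ‖κ‖ * ‖dslope P 1 z‖ + ‖R₀ z‖ * ‖P z‖ := by
          simp only [hG]
          refine (norm_add_le _ _).trans ?_
          rw [norm_mul, norm_mul]
      _ ≤ B₀ * (2 * (B₀ * q ^ m) / (δ / 2)) + B₀ * (B₀ * q ^ m) := by gcongr
      _ = (4 / δ + 1) * (B₀ ^ 2 * q ^ m) := by field_simp; ring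
      _ ≤ (5 / δ) * (B₀ ^ 2 * q ^ m) := by
          gcongr
          rw [div_add_one hδ.ne']
          gcongr
          linarith
      _ = _ := by ring
  have hy : 1 < 2 - β := by linarith
  have hyR : 2 - β < R := by linarith
  have key := taylor_lower (l := κ * P 1) ha ha1 hs hR0 hcl hB
    (fun s h => by rw [hL s h, hGe s (by rintro rfl; simp at h)]) hy hyR hM1
  have hβ' : ((2 - (2 - β) : ℝ) : ℂ) = β := by push_cast; ring
  have hβ1' : (β : ℂ) ≠ 1 := by exact_mod_cast hβ1.ne
  rw [hβ', ← hGe _ hβ1'] at key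
  set y := 2 - β with hydef
  set l := (κ * P 1).re with hl
  have hyρ : y / R ≤ ρ := by rw [hρ]; gcongr; linarith
  have h1 : 5 * B₀ ^ 2 / δ * q ^ m * ((y / R) ^ M / (1 - y / R)) ≤ 1 / 2 := by
    refine le_trans ?_ hM2
    have h0 : 0 < 1 - ρ := by linarith
    have : (y / R) ^ M / (1 - y / R) ≤ ρ ^ M / (1 - ρ) := by gcongr
    calc _ ≤ 5 * B₀ ^ 2 / δ * q ^ m * (ρ ^ M / (1 - ρ)) := by gcongr
      _ = _ := by ring
  have h2 : 1 / 2 ≤ l * (y ^ M / (y - 1)) := by linarith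
  have hy1 : 0 < y - 1 := by linarith
  have hyM : 0 < y ^ M / (y - 1) := by positivity
  have hl0 : 0 < l := by
    by_contra h
    push Not at h
    linarith [mul_nonpos_of_nonpos_of_nonneg h hyM.le]
  have h3 : y ^ M ≤ C * (q : ℝ) ^ (C * (y - 1)) := (hM3 y hy.le).resolve_right (by linarith)
  have h4 : (1 - β) / 2 ≤ l * y ^ M := by
    rw [← mul_div_assoc, le_div_iff₀ hy1] at h2
    linarith
  have h5 : (1 - β) / 2 ≤ l * (C * (q : ℝ) ^ (C * (y - 1))) := h4.trans (by gcongr)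
  have h6 : (q : ℝ) ^ (-(2 * C * (1 - β))) ≤ (q : ℝ) ^ (-(C * (y - 1))) := by
    refine Real.rpow_le_rpow_of_exponent_le hq' ?_
    nlinarith
  calc (1 - β) / (2 * C) * (q : ℝ) ^ (-(2 * C * (1 - β)))
      ≤ (1 - β) / (2 * C) * (q : ℝ) ^ (-(C * (y - 1))) := by
        have : 0 ≤ 1 - β := by linarith
        gcongr
    _ ≤ l := by
        have hqp : 0 < (q : ℝ) ^ (C * (y - 1)) := Real.rpow_pos_of_pos (by linarith) _
        rw [Real.rpow_neg (by linarith), ← div_eq_mul_inv, div_le_iff₀ hqp, div_le_iff₀ (by linarith)]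
        nlinarith

end SiegelTaylor

section QuadChar

open Filter Topology Finset DirichletCharacter

variable (K : Type*) [Field K] [NumberField K]

/-- The width of the strip to which the L-functions continue. -/
noncomputable def deltaK : ℝ := 1 / (2 * Module.finrank ℚ K)

/-- The regular part of the L-function of `χ` over `K`. -/
noncomputable def Lfun {q : ℕ} (χ : DirichletCharacter ℂ q) : ℂ → ℂ := regL (coefL K χ) (resL K χ)

theorem hasMean' {q : ℕ} [NeZero q] (χ : DirichletCharacter ℂ q) :
    HasMean (coefL K χ) (resL K χ) (meanD K * q ^ (Module.finrank ℚ K + 1)) (deltaK K) (meanA K) :=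
  hasMean_coefL K (NeZero.pos q) χ

theorem deltaK_pos : 0 < deltaK K := (hasMean' K (1 : DirichletCharacter ℂ 1)).pos

theorem deltaK_le : deltaK K ≤ 1 / 2 := (hasMean' K (1 : DirichletCharacter ℂ 1)).le_half

theorem differentiableAt_Lfun {q : ℕ} [NeZero q] (χ : DirichletCharacter ℂ q) {s : ℂ}
    (hs : 1 - deltaK K < s.re) : DifferentiableAt ℂ (Lfun K χ) s :=
  differentiableAt_regL (hasMean' K χ) hs

theorem differentiableOn_Lfun {q : ℕ} [NeZero q] (χ : DirichletCharacter ℂ q) :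
    DifferentiableOn ℂ (Lfun K χ) {s | 1 - deltaK K < s.re} :=
  fun _ hs => (differentiableAt_Lfun K χ hs).differentiableWithinAt

theorem exists_norm_Lfun_le_pow : ∃ B : ℝ, 1 ≤ B ∧ ∀ (q : ℕ) [NeZero q]
    (χ : DirichletCharacter ℂ q) (s : ℂ), 1 - deltaK K / 2 ≤ s.re → ‖s‖ ≤ 4 →
      ‖Lfun K χ s‖ ≤ B * q ^ (Module.finrank ℚ K + 1) := by
  have hδ := deltaK_pos K
  have hA := one_le_meanA K
  have hD := one_le_meanD K
  have h0 : 0 ≤ 8 * meanD K / deltaK K := by positivity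
  refine ⟨meanA K + 8 * meanD K / deltaK K, by linarith, fun q _ χ s hs hs4 => ?_⟩
  refine (norm_regL_le (hasMean' K χ) (by linarith)).trans ?_
  have hq : (1 : ℝ) ≤ (q : ℝ) ^ (Module.finrank ℚ K + 1) :=
    one_le_pow₀ (by exact_mod_cast NeZero.pos q)
  have h1 : meanD K * q ^ (Module.finrank ℚ K + 1) / (s.re - (1 - deltaK K)) ≤
      meanD K * q ^ (Module.finrank ℚ K + 1) / (deltaK K / 2) := by
    gcongr
    linarith
  calc _ ≤ meanA K * q ^ (Module.finrank ℚ K + 1) +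
        4 * (meanD K * q ^ (Module.finrank ℚ K + 1) / (deltaK K / 2)) := by
        have : 0 < s.re - (1 - deltaK K) := by linarith
        gcongr
        exact le_mul_of_one_le_right (by linarith) hq
    _ = _ := by ring

theorem LSeries_eq_Lfun {q : ℕ} [NeZero q] {χ : DirichletCharacter ℂ q} (h : ¬ TrivG K χ) {s : ℂ}
    (hs : 1 < s.re) : LSeries (coefL K χ) s = Lfun K χ s := by
  rw [LSeries_eq_regL (hasMean' K χ) hs, resL_eq_zero K h, zero_div, zero_add, Lfun, resL_eq_zero K h]

theorem exists_mem_Gq_ideal {q : ℕ} [NeZero q] {I : Ideal (𝓞 K)} (hI : I ≠ ⊥)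
    (hc : (absNorm I).Coprime q) : ∃ u ∈ Gq K q, (u : ZMod q) = absNorm I := by
  induction I using UniqueFactorizationMonoid.induction_on_prime with
  | h₁ => exact absurd rfl hI
  | h₂ x hx =>
    rw [Ideal.isUnit_iff.1 hx]
    exact ⟨1, one_mem _, by simp⟩
  | h₃ a p ha hp ih =>
    rw [map_mul] at hc ⊢
    obtain ⟨u, hu, hu'⟩ := ih ha (hc.coprime_mul_left)
    have hp0 : p ≠ ⊥ := hp.ne_zero
    obtain ⟨v, hv, hv'⟩ := exists_mem_Gq K (Ideal.isPrime_of_prime hp) hc.coprime_mul_right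
      ((absNorm_ne_zero_iff_ne_bot).2 hp0)
    exact ⟨v * u, mul_mem hv hu, by push_cast; rw [hu', hv']⟩

theorem exists_mem_Gq_of_idealCount {q : ℕ} [NeZero q] {n : ℕ} (hn : n ≠ 0)
    (h : idealCount K n ≠ 0) (hc : n.Coprime q) : ∃ u ∈ Gq K q, (u : ZMod q) = n := by
  rw [idealCount_eq_card, card_ne_zero] at h
  obtain ⟨I, hI⟩ := h
  rw [mem_idealsOfNorm] at hI
  subst hI
  exact exists_mem_Gq_ideal K ((absNorm_ne_zero_iff_ne_bot).1 hn) hc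

theorem idealCount_ne_zero_of_vmK {n : ℕ} (h : vmK K n ≠ 0) : idealCount K n ≠ 0 := by
  rw [idealCount_eq_card, card_ne_zero]
  by_contra h1
  rw [not_nonempty_iff_eq_empty] at h1
  exact h (by rw [vmK, h1, sum_empty])

theorem vmK_zero : vmK K 0 = 0 :=
  le_antisymm (by simpa using vmK_le K 0) (vmK_nonneg K 0)

/-- `χ` takes values `±1` on `G_q`. -/
def SignG {q : ℕ} (χ : DirichletCharacter ℂ q) : Prop := ∀ a ∈ Gq K q, χ (a : ZMod q) ^ 2 = 1

theorem SignG.apply {q : ℕ} [NeZero q] {χ : DirichletCharacter ℂ q} (h : SignG K χ) {n : ℕ}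
    (hn : n ≠ 0) (hi : idealCount K n ≠ 0) : χ n = 0 ∨ χ n = 1 ∨ χ n = -1 := by
  by_cases hc : n.Coprime q
  · obtain ⟨u, hu, hu'⟩ := exists_mem_Gq_of_idealCount K hn hi hc
    rw [← hu']
    exact Or.inr (sq_eq_one_iff.1 (h u hu))
  · exact Or.inl (MulChar.map_nonunit _ fun h => hc ((ZMod.isUnit_iff_coprime n q).1 h))

theorem SignG.coefL_eq {q : ℕ} [NeZero q] {χ : DirichletCharacter ℂ q} (h : SignG K χ) {n : ℕ}
    (hn : n ≠ 0) : coefL K χ n = ((coefL K χ n).re : ℂ) := by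
  rw [coefL]
  by_cases hi : idealCount K n = 0
  · simp [hi]
  · rcases h.apply K hn hi with h1 | h1 | h1 <;> simp [h1]

theorem SignG.im_Lfun {q : ℕ} [NeZero q] {χ : DirichletCharacter ℂ q} (h : SignG K χ)
    (hT : ¬ TrivG K χ) (σ : ℝ) : (Lfun K χ σ).im = 0 := by
  rw [Lfun, resL_eq_zero K hT, regL, mellin_meanErr, zero_add]
  have h1 : ∀ u ∈ Set.Ioi (1 : ℝ), (u : ℂ) ^ (-((σ : ℂ) + 1)) *
      ((∑ k ∈ Icc 1 ⌊u⌋₊, coefL K χ k) - 0 * u) =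
      ((u ^ (-(σ + 1)) * ∑ k ∈ Icc 1 ⌊u⌋₊, (coefL K χ k).re : ℝ) : ℂ) := by
    intro u hu
    have hu0 : 0 ≤ u := zero_le_one.trans (le_of_lt hu)
    push_cast
    rw [Complex.ofReal_cpow hu0, zero_mul, sub_zero]
    push_cast
    congr 1
    refine sum_congr rfl fun k hk => h.coefL_eq K ?_
    rw [mem_Icc] at hk
    omega
  rw [MeasureTheory.setIntegral_congr_fun measurableSet_Ioi h1, integral_complex_ofReal,
    ← Complex.ofReal_mul, Complex.ofReal_im]

/-- The product of two characters, to the product of their moduli. -/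
noncomputable def prodChar {q r : ℕ} (χ : DirichletCharacter ℂ q) (ψ : DirichletCharacter ℂ r) :
    DirichletCharacter ℂ (q * r) :=
  changeLevel (dvd_mul_right q r) χ *
    changeLevel (dvd_mul_left r q) ψ

theorem prodChar_apply {q r : ℕ} [NeZero q] [NeZero r] (χ : DirichletCharacter ℂ q)
    (ψ : DirichletCharacter ℂ r) (n : ℕ) : prodChar χ ψ n = χ n * ψ n := by
  by_cases hc : n.Coprime (q * r)
  · have hu : IsUnit (n : ZMod (q * r)) := (ZMod.isUnit_iff_coprime _ _).2 hc
    rw [prodChar, MulChar.mul_apply]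
    have h1 := changeLevel_eq_cast_of_dvd χ (dvd_mul_right q r) hu.unit
    have h2 := changeLevel_eq_cast_of_dvd ψ (dvd_mul_left r q) hu.unit
    rw [IsUnit.unit_spec] at h1 h2
    rw [h1, h2, ZMod.cast_natCast (dvd_mul_right q r), ZMod.cast_natCast (dvd_mul_left r q)]
  · rw [MulChar.map_nonunit _ fun h => hc ((ZMod.isUnit_iff_coprime _ _).1 h)]
    rw [Nat.coprime_mul_iff_right, not_and_or] at hc
    rcases hc with hc | hc
    · rw [MulChar.map_nonunit χ fun h => hc ((ZMod.isUnit_iff_coprime _ _).1 h), zero_mul]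
    · rw [MulChar.map_nonunit ψ fun h => hc ((ZMod.isUnit_iff_coprime _ _).1 h), mul_zero]

end QuadChar

section Siegel

open Filter Topology Complex Finset
open scoped ComplexOrder

variable (K : Type*) [Field K] [NumberField K]

theorem convolution_nonneg_of_logPair {f g : ℕ → ℂ} (h : LogPair f g) (hf : f 0 = 0)
    (hg : ∀ n, 0 ≤ g n) : 0 ≤ f := by
  intro n
  by_cases hn : n = 0
  · rw [hn, hf]; exact le_rfl
  · exact h.nonneg hg n hn

theorem coefLam_one_eq (n : ℕ) : coefLam K (1 : DirichletCharacter ℂ 1) n = vmK K n := by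
  rw [coefLam, MulChar.one_apply (isUnit_of_subsingleton _), one_mul]

theorem SignG.coefLam_cases {q : ℕ} [NeZero q] {χ : DirichletCharacter ℂ q} (h : SignG K χ) {n : ℕ}
    (hv : vmK K n ≠ 0) : χ n = 0 ∨ χ n = 1 ∨ χ n = -1 :=
  h.apply K (fun hn => hv (by rw [hn, vmK_zero])) (idealCount_ne_zero_of_vmK K hv)

theorem SignG.re_LSeries_pos {q : ℕ} [NeZero q] {χ : DirichletCharacter ℂ q} (h : SignG K χ)
    {σ : ℝ} (hσ : 1 < σ) : 0 < (LSeries (coefL K χ) σ).re := by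
  have hs : 1 < (σ : ℂ).re := by simpa using hσ
  rw [(logPair_coefL K χ).eq_exp (fun s h => summable_coefL K (NeZero.pos q) χ h)
    (fun s h => summable_coefLam K χ h) hs]
  have h1 : (LSeries (fun n => coefLam K χ n / (Real.log n : ℂ)) σ).im = 0 := by
    rw [LSeries, im_tsum]
    · refine (tsum_congr fun n => ?_).trans tsum_zero
      by_cases hn : n = 0
      · simp [hn]
      rw [LSeries.term_of_ne_zero hn, coefLam]
      have h2 : ((n : ℂ) ^ (σ : ℂ)) = ((n : ℝ) ^ σ : ℝ) := by
        rw [ofReal_cpow (by positivity)]; simp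
      rw [h2]
      by_cases hv : vmK K n = 0
      · simp [hv]
      · rcases h.coefLam_cases K hv with h3 | h3 | h3 <;> rw [h3] <;>
          simp [← ofReal_div, ← ofReal_neg, -natCast_log]
    · exact summable_div_log (fun s h => summable_coefLam K χ h) hs
  rw [exp_re, h1, Real.cos_zero, mul_one]
  exact Real.exp_pos _

theorem SignG.re_Lfun_one_pos {q : ℕ} [NeZero q] {χ : DirichletCharacter ℂ q} (h : SignG K χ)
    (hT : ¬ TrivG K χ) : 0 < (Lfun K χ 1).re := by
  have hne : Lfun K χ 1 ≠ 0 := by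
    rw [Lfun, resL_eq_zero K hT]; exact regL_one_ne_zero K (resL_eq_zero K hT)
  have h0 : 0 ≤ (Lfun K χ 1).re := by
    have hm := hasMean' K χ
    have h1 := hm
    rw [resL_eq_zero K hT] at h1
    have h2 := (continuous_re.tendsto _).comp h1.tendsto_of_zero
    rw [Lfun, resL_eq_zero K hT]
    refine ge_of_tendsto h2 (eventually_one_lt.mono fun σ hσ => ?_)
    exact (h.re_LSeries_pos K hσ).le
  refine lt_of_le_of_ne h0 fun h1 => hne ?_
  have h2 := h.im_Lfun K hT 1
  rw [ofReal_one] at h2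
  exact Complex.ext h1.symm h2

theorem SignG.re_Lfun_pos {q : ℕ} [NeZero q] {χ : DirichletCharacter ℂ q} (h : SignG K χ)
    (hT : ¬ TrivG K χ) {β : ℝ} (hβ : 1 - deltaK K < β) (hβ1 : β < 1)
    (hz : ∀ σ : ℝ, β ≤ σ → σ < 1 → Lfun K χ σ ≠ 0) : 0 < (Lfun K χ β).re := by
  by_contra hneg
  push Not at hneg
  have hc : ContinuousOn (fun σ : ℝ => (Lfun K χ σ).re) (Set.Icc β 1) := by
    refine continuous_re.comp_continuousOn fun σ hσ => ?_
    refine ContinuousAt.continuousWithinAt ?_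
    exact (differentiableAt_Lfun K χ (by simpa using hβ.trans_le hσ.1)).continuousAt.comp
      continuous_ofReal.continuousAt
  have h1 := h.re_Lfun_one_pos K hT
  obtain ⟨σ, hσ, h2⟩ := intermediate_value_Icc hβ1.le hc
    (show (0 : ℝ) ∈ Set.Icc _ _ from ⟨hneg, by rw [ofReal_one]; exact h1.le⟩)
  have h3 : Lfun K χ σ = 0 := Complex.ext h2 (h.im_Lfun K hT σ)
  rcases hσ.2.lt_or_eq with h4 | h4
  · exact hz σ hσ.1 h4 h3
  · rw [h4, ofReal_one] at h3
    rw [h3, zero_re] at h1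
    exact lt_irrefl _ h1

theorem exists_norm_le_quad : ∃ B : ℝ, 1 ≤ B ∧ ‖resL K (1 : DirichletCharacter ℂ 1)‖ ≤ B ∧
    ∀ (q : ℕ) [NeZero q] (χ : DirichletCharacter ℂ q) (s : ℂ), 1 - deltaK K / 2 ≤ s.re →
      ‖s‖ ≤ 4 → ‖Lfun K χ s‖ ≤ B * q ^ (Module.finrank ℚ K + 1) := by
  obtain ⟨B, hB, h⟩ := exists_norm_Lfun_le_pow K
  have hκ := norm_nonneg (resL K (1 : DirichletCharacter ℂ 1))
  refine ⟨B + ‖resL K (1 : DirichletCharacter ℂ 1)‖, by linarith, by linarith,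
    fun q _ χ s hs h4 => (h q χ s hs h4).trans ?_⟩
  gcongr
  linarith

theorem LSeries_one_eq {s : ℂ} (hs : 1 < s.re) : LSeries (coefL K (1 : DirichletCharacter ℂ 1)) s =
    resL K (1 : DirichletCharacter ℂ 1) / (s - 1) + Lfun K (1 : DirichletCharacter ℂ 1) s :=
  LSeries_eq_regL (hasMean' K _) hs

theorem nonneg_two {q : ℕ} [NeZero q] {χ : DirichletCharacter ℂ q} (h : SignG K χ) :
    0 ≤ LSeries.convolution (coefL K (1 : DirichletCharacter ℂ 1)) (coefL K χ) := by
  refine convolution_nonneg_of_logPair ((logPair_coefL K _).mul (logPair_coefL K χ)) (by simp)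
    fun n => ?_
  rw [Pi.add_apply, coefLam_one_eq, coefLam]
  by_cases hv : vmK K n = 0
  · simp [hv]
  have h0 : (0 : ℂ) ≤ vmK K n := by exact_mod_cast vmK_nonneg K n
  rcases h.coefLam_cases K hv with h3 | h3 | h3 <;> rw [h3] <;> simp [h0, add_nonneg]

theorem nonneg_four {q r : ℕ} [NeZero q] [NeZero r] {χ : DirichletCharacter ℂ q}
    {ψ : DirichletCharacter ℂ r} (h : SignG K χ) (h' : SignG K ψ) :
    0 ≤ LSeries.convolution (LSeries.convolution (coefL K (1 : DirichletCharacter ℂ 1)) (coefL K χ))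
      (LSeries.convolution (coefL K ψ) (coefL K (prodChar χ ψ))) := by
  refine convolution_nonneg_of_logPair (((logPair_coefL K _).mul (logPair_coefL K χ)).mul
    ((logPair_coefL K ψ).mul (logPair_coefL K (prodChar χ ψ)))) (by simp) fun n => ?_
  simp only [Pi.add_apply]
  rw [coefLam_one_eq, coefLam, coefLam, coefLam, prodChar_apply]
  by_cases hv : vmK K n = 0
  · simp [hv]
  have h0 : (0 : ℂ) ≤ vmK K n := by exact_mod_cast vmK_nonneg K n
  rcases h.coefLam_cases K hv with h3 | h3 | h3 <;>
  rcases h'.coefLam_cases K hv with h4 | h4 | h4 <;> rw [h3, h4] <;> simp [h0, add_nonneg]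

theorem exists_siegel_nozero : ∃ ε C : ℝ, 0 < ε ∧ 1 ≤ C ∧ ∀ β : ℝ, 1 - ε ≤ β → β < 1 →
    ∀ (q : ℕ) [NeZero q] (χ : DirichletCharacter ℂ q), SignG K χ → ¬ TrivG K χ →
      (∀ σ : ℝ, β ≤ σ → σ < 1 → Lfun K χ σ ≠ 0) →
      (1 - β) / C * (q : ℝ) ^ (-(C * (1 - β))) ≤ ‖Lfun K χ 1‖ := by
  obtain ⟨B, hB, hκB, hb⟩ := exists_norm_le_quad K
  have hδ := deltaK_pos K
  obtain ⟨κ, hκ, hκ'⟩ := resL_one_pos K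
  obtain ⟨C, hC, hmain⟩ := exists_residue_ge hδ (deltaK_le K) hB (Module.finrank ℚ K + 1)
  refine ⟨min (deltaK K / 4) (κ / (2 * B)), C * (κ + 1), by positivity, by nlinarith,
    fun β hβ hβ1 q _ χ hS hT hz => ?_⟩
  have hβ2 : 1 - deltaK K / 4 ≤ β := by linarith [min_le_left (deltaK K / 4) (κ / (2 * B))]
  have hβ3 : 1 - β ≤ κ / (2 * B) := by linarith [min_le_right (deltaK K / 4) (κ / (2 * B))]
  have hβ4 : ‖(β : ℂ)‖ ≤ 4 := by
    rw [norm_real, Real.norm_eq_abs, abs_le]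
    constructor <;> linarith [deltaK_le K]
  have hre : 1 - deltaK K / 2 ≤ (β : ℂ).re := by rw [ofReal_re]; linarith
  have hpos := hS.re_Lfun_pos K hT (by linarith) hβ1 hz
  have hP : Lfun K χ β = ((Lfun K χ β).re : ℂ) := Complex.ext rfl (hS.im_Lfun K hT β)
  have hb0 : ∀ s : ℂ, 1 - deltaK K / 2 ≤ s.re → ‖s‖ ≤ 4 →
      ‖Lfun K (1 : DirichletCharacter ℂ 1) s‖ ≤ B := fun s h1 h2 => by
    simpa using hb 1 (1 : DirichletCharacter ℂ 1) s h1 h2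
  have key := hmain q _ (resL K (1 : DirichletCharacter ℂ 1)) (Lfun K (1 : DirichletCharacter ℂ 1))
    (Lfun K χ) (NeZero.pos q) (nonneg_two K hS)
    ((logPair_coefL K _).mul (logPair_coefL K χ)).one
    (fun s hs => (summable_coefL K one_pos _ hs).convolution (summable_coefL K (NeZero.pos q) χ hs))
    hκB (differentiableOn_Lfun K _) (differentiableOn_Lfun K χ)
    (fun s h1 h2 => ⟨hb0 s h1 h2, hb q χ s h1 h2⟩)
    (fun s hs => by
      rw [LSeries_convolution' (summable_coefL K one_pos _ hs)
        (summable_coefL K (NeZero.pos q) χ hs), LSeries_eq_Lfun K hT hs, LSeries_one_eq K hs])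
    β hβ2 hβ1 (by
      rw [hP, re_mul_ofReal]
      refine mul_nonpos_of_nonpos_of_nonneg ?_ hpos.le
      have h1 : ((β : ℂ) - 1) = ((β - 1 : ℝ) : ℂ) := by push_cast; rfl
      rw [add_re, hκ', h1, ← ofReal_div, ofReal_re]
      have h2 := (re_le_norm _).trans (hb0 β hre hβ4)
      have h3 : κ / (β - 1) ≤ -B := by
        rw [div_le_iff_of_neg (by linarith)]
        rw [le_div_iff₀ (by positivity)] at hβ3
        nlinarith
      linarith)
  have hq : (1 : ℝ) ≤ q := by exact_mod_cast NeZero.pos q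
  have h1 : (resL K (1 : DirichletCharacter ℂ 1) * Lfun K χ 1).re ≤ (κ + 1) * ‖Lfun K χ 1‖ := by
    rw [hκ', re_ofReal_mul]
    have := re_le_norm (Lfun K χ 1)
    nlinarith [norm_nonneg (Lfun K χ 1)]
  have h2 : (q : ℝ) ^ (-(C * (κ + 1) * (1 - β))) ≤ (q : ℝ) ^ (-(C * (1 - β))) := by
    refine Real.rpow_le_rpow_of_exponent_le hq ?_
    have : 0 ≤ C * (1 - β) * κ := mul_nonneg (mul_nonneg (by linarith) (by linarith)) hκ.le
    linarith
  have h3 := key.trans h1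
  have h4 : 0 ≤ (1 - β) / (C * (κ + 1)) := div_nonneg (by linarith) (by positivity)
  calc _ ≤ (1 - β) / (C * (κ + 1)) * (q : ℝ) ^ (-(C * (1 - β))) := by gcongr
    _ = ((1 - β) / C * (q : ℝ) ^ (-(C * (1 - β)))) / (κ + 1) := by field_simp
    _ ≤ _ := by rw [div_le_iff₀ (by positivity)]; linarith

theorem exists_siegel_zero : ∃ C : ℝ, 1 ≤ C ∧ ∀ β : ℝ, 1 - deltaK K / 4 ≤ β → β < 1 →
    ∀ (q r : ℕ) [NeZero q] [NeZero r] (χ : DirichletCharacter ℂ q) (ψ : DirichletCharacter ℂ r),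
      SignG K χ → SignG K ψ → ¬ TrivG K χ → ¬ TrivG K ψ → ¬ TrivG K (prodChar χ ψ) →
      Lfun K χ β = 0 → (1 - β) / C * ((q * r : ℕ) : ℝ) ^ (-(C * (1 - β))) ≤
        C * (‖Lfun K χ 1‖ * ‖Lfun K ψ 1‖ * ‖Lfun K (prodChar χ ψ) 1‖) := by
  obtain ⟨B, hB, hκB, hb⟩ := exists_norm_le_quad K
  set m := Module.finrank ℚ K + 1
  obtain ⟨C, hC, hmain⟩ := exists_residue_ge (deltaK_pos K) (deltaK_le K)
    (one_le_pow₀ hB : 1 ≤ B ^ 3) (3 * m)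
  have hB3 : B ≤ B ^ 3 := le_self_pow₀ hB (by norm_num)
  refine ⟨max C B, hC.trans (le_max_left _ _), fun β hβ hβ1 q r _ _ χ ψ hS hS' hT hT' hT3 hz => ?_⟩
  have : NeZero (q * r) := ⟨mul_ne_zero (NeZero.ne q) (NeZero.ne r)⟩
  have hq : (1 : ℝ) ≤ q := by exact_mod_cast NeZero.pos q
  have hr : (1 : ℝ) ≤ r := by exact_mod_cast NeZero.pos r
  have hqr0 : 0 < q * r := NeZero.pos (q * r)
  have key := hmain (q * r) _ (resL K (1 : DirichletCharacter ℂ 1))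
    (Lfun K (1 : DirichletCharacter ℂ 1))
    (fun s => Lfun K χ s * (Lfun K ψ s * Lfun K (prodChar χ ψ) s)) hqr0
    (nonneg_four K hS hS')
    (((logPair_coefL K _).mul (logPair_coefL K χ)).mul
    ((logPair_coefL K ψ).mul (logPair_coefL K (prodChar χ ψ)))).one
    (fun s hs => ((summable_coefL K one_pos _ hs).convolution
      (summable_coefL K (NeZero.pos q) χ hs)).convolution
      ((summable_coefL K (NeZero.pos r) ψ hs).convolution (summable_coefL K hqr0 _ hs)))
    (hκB.trans hB3) (differentiableOn_Lfun K _)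
    ((differentiableOn_Lfun K χ).mul ((differentiableOn_Lfun K ψ).mul (differentiableOn_Lfun K _)))
    (fun s h1 h2 => ⟨by simpa using (hb 1 (1 : DirichletCharacter ℂ 1) s h1 h2).trans (by simpa using hB3), by
      rw [norm_mul, norm_mul]
      have e1 := hb q χ s h1 h2
      have e2 := hb r ψ s h1 h2
      have e3 := hb (q * r) (prodChar χ ψ) s h1 h2
      calc _ ≤ (B * (q : ℝ) ^ m) * ((B * (r : ℝ) ^ m) * (B * ((q * r : ℕ) : ℝ) ^ m)) := by gcongr
        _ = B ^ 3 * ((q * r : ℕ) : ℝ) ^ (2 * m) := by push_cast; ring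
        _ ≤ _ := by
          gcongr
          · exact_mod_cast NeZero.pos (q * r)
          · norm_num⟩)
    (fun s hs => by
      rw [LSeries_convolution' ((summable_coefL K one_pos _ hs).convolution
        (summable_coefL K (NeZero.pos q) χ hs)) ((summable_coefL K (NeZero.pos r) ψ hs).convolution
        (summable_coefL K hqr0 _ hs)), LSeries_convolution' (summable_coefL K one_pos _ hs)
        (summable_coefL K (NeZero.pos q) χ hs), LSeries_convolution'
        (summable_coefL K (NeZero.pos r) ψ hs) (summable_coefL K hqr0 _ hs),
        LSeries_eq_Lfun K hT hs, LSeries_eq_Lfun K hT' hs, LSeries_eq_Lfun K hT3 hs,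
        LSeries_one_eq K hs]
      ring)
    β hβ hβ1 (by simp [hz])
  have hqr : (1 : ℝ) ≤ ((q * r : ℕ) : ℝ) := by exact_mod_cast NeZero.pos (q * r)
  have h1 : (1 - β) / max C B * ((q * r : ℕ) : ℝ) ^ (-(max C B * (1 - β))) ≤
      (1 - β) / C * ((q * r : ℕ) : ℝ) ^ (-(C * (1 - β))) := by
    have : 0 ≤ 1 - β := by linarith
    gcongr
    · exact le_max_left _ _
    · exact le_max_left _ _
  refine h1.trans (key.trans ((re_le_norm _).trans ?_))
  rw [norm_mul, norm_mul, norm_mul, mul_assoc]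
  gcongr
  exact hκB.trans (le_max_right _ _)

theorem exists_hasSum_prime_powers {p : ℕ} (hp : p.Prime) {σ : ℝ} (hσ : 1 < σ) : ∃ S : ℝ,
    S ≤ 2 / p ∧ HasSum (fun n : ℕ => if n ∈ Set.range (fun k : ℕ => p ^ (k + 1)) then
      (n : ℝ) ^ (-σ) else 0) S := by
  have hinj : Function.Injective fun k : ℕ => p ^ (k + 1) := fun a b h => by
    simpa using Nat.pow_right_injective hp.two_le h
  have hp2 : (2 : ℝ) ≤ p := by exact_mod_cast hp.two_le
  have h1 : ∀ k : ℕ, ((p ^ (k + 1) : ℕ) : ℝ) ^ (-σ) ≤ (1 / p : ℝ) * (1 / p) ^ k := by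
    intro k
    rw [← pow_succ', one_div, inv_pow, ← Nat.cast_pow, ← Real.rpow_neg_one]
    refine Real.rpow_le_rpow_of_exponent_le ?_ (by linarith)
    exact_mod_cast Nat.one_le_pow _ _ hp.pos
  have hlt : (1 / p : ℝ) < 1 := by rw [div_lt_one (by linarith)]; linarith
  have hg := (hasSum_geometric_of_lt_one (by positivity) hlt).mul_left (1 / p : ℝ)
  have h2 : Summable fun k : ℕ => ((p ^ (k + 1) : ℕ) : ℝ) ^ (-σ) :=
    Summable.of_nonneg_of_le (fun k => by positivity) h1 hg.summable
  refine ⟨∑' k : ℕ, ((p ^ (k + 1) : ℕ) : ℝ) ^ (-σ), ?_, (hinj.hasSum_iff ?_).1 ?_⟩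
  · refine (hasSum_le h1 h2.hasSum hg).trans ?_
    have : (2 : ℝ)⁻¹ ≤ 1 - 1 / p := by
      have : (1 : ℝ) / p ≤ 1 / 2 := by gcongr
      linarith
    calc (1 / p : ℝ) * (1 - 1 / (p : ℝ))⁻¹ ≤ (1 / p) * (2⁻¹)⁻¹ := by gcongr
      _ = 2 / p := by rw [inv_inv]; ring
  · intro n hn
    rw [if_neg hn]
  · convert h2.hasSum using 2 with k
    simp

theorem wtK_le_finrank (n : ℕ) : wtK K n ≤ Module.finrank ℚ K := by
  rw [wtK]
  by_cases h : Real.log n ≤ 0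
  · exact (div_nonpos_of_nonneg_of_nonpos (vmK_nonneg K n) h).trans (by positivity)
  · push Not at h
    rw [div_le_iff₀ h]
    refine (vmK_le K n).trans ?_
    gcongr
    exact ArithmeticFunction.vonMangoldt_le_log

theorem sum_inv_primeFactors_le {Q : ℕ} (hQ : Q ≠ 0) {P : ℝ} (hP : 1 ≤ P) :
    ∑ p ∈ Q.primeFactors, (1 : ℝ) / p ≤ P + 2 * Real.log Q / P := by
  have hcard : (Q.primeFactors.card : ℝ) ≤ 2 * Real.log Q := by
    have h1 : 2 ^ Q.primeFactors.card ≤ Q :=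
      (pow_card_le_prod _ _ _ fun p hp => (Nat.prime_of_mem_primeFactors hp).two_le).trans
        (Nat.le_of_dvd (Nat.pos_of_ne_zero hQ) (Nat.prod_primeFactors_dvd Q))
    have h2 := Real.log_le_log (by positivity) (by exact_mod_cast h1 : (2 : ℝ) ^ Q.primeFactors.card ≤ Q)
    rw [Real.log_pow] at h2
    have := Real.log_two_gt_d9
    nlinarith [(Nat.cast_nonneg Q.primeFactors.card : (0 : ℝ) ≤ _)]
  have hP0 : 0 < P := by linarith
  rw [← sum_filter_add_sum_filter_not _ (fun p : ℕ => (p : ℝ) ≤ P)]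
  refine add_le_add ?_ ?_
  · calc _ ≤ ∑ p ∈ Icc 1 ⌊P⌋₊, (1 : ℝ) := by
          refine (sum_le_sum fun p hp => ?_).trans
            (sum_le_sum_of_subset_of_nonneg ?_ fun _ _ _ => zero_le_one)
          · rw [mem_filter] at hp
            have : (1 : ℝ) ≤ p := by exact_mod_cast (Nat.prime_of_mem_primeFactors hp.1).one_lt.le
            exact (div_le_one (by linarith)).2 this
          · intro p hp
            rw [mem_filter] at hp
            exact mem_Icc.2 ⟨(Nat.prime_of_mem_primeFactors hp.1).one_lt.le,
              Nat.le_floor hp.2⟩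
      _ ≤ P := by simpa using Nat.floor_le hP0.le
  · calc _ ≤ ∑ p ∈ Q.primeFactors.filter (fun p : ℕ => ¬ (p : ℝ) ≤ P), 1 / P := by
          refine sum_le_sum fun p hp => ?_
          rw [mem_filter, not_le] at hp
          gcongr
          exact hp.2.le
      _ ≤ ∑ p ∈ Q.primeFactors, 1 / P := sum_le_sum_of_subset_of_nonneg
          (filter_subset _ _) fun _ _ _ => by positivity
      _ ≤ 2 * Real.log Q / P := by
          rw [sum_const, nsmul_eq_mul, mul_one_div]
          gcongr

theorem norm_Lfun_le_of_prod {q r : ℕ} [NeZero q] [NeZero r] {χ : DirichletCharacter ℂ q}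
    {ψ : DirichletCharacter ℂ r} (hS : SignG K χ) (hS' : SignG K ψ) (hT : ¬ TrivG K χ)
    (hT' : ¬ TrivG K ψ) (hT3 : TrivG K (prodChar χ ψ)) {P : ℝ} (hP : 1 ≤ P) :
    ‖Lfun K χ 1‖ ≤ ‖Lfun K ψ 1‖ *
      Real.exp (4 * Module.finrank ℚ K * (P + 2 * Real.log (q * r : ℕ) / P)) := by
  have hqr : q * r ≠ 0 := mul_ne_zero (NeZero.ne q) (NeZero.ne r)
  have : NeZero (q * r) := ⟨hqr⟩
  set d : ℝ := ((Module.finrank ℚ K : ℕ) : ℝ) with hd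
  have hfin : ∀ σ : ℝ, 1 < σ → ‖LSeries (coefL K χ) σ‖ ≤ ‖LSeries (coefL K ψ) σ‖ *
      Real.exp (4 * d * (P + 2 * Real.log (q * r : ℕ) / P)) := by
    intro σ hσ
    have hne : 0 < ‖LSeries (coefL K χ) σ‖ :=
      norm_pos_iff.2 (LSeries_coefL_ne_zero K (NeZero.pos q) χ (by simpa using hσ))
    have hne' : 0 < ‖LSeries (coefL K ψ) σ‖ :=
      norm_pos_iff.2 (LSeries_coefL_ne_zero K (NeZero.pos r) ψ (by simpa using hσ))
    rw [← Real.log_le_log_iff hne (by positivity), Real.log_mul hne'.ne' (Real.exp_pos _).ne',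
      Real.log_exp, log_norm_LSeries_coefL_real K (NeZero.pos q) χ hσ,
      log_norm_LSeries_coefL_real K (NeZero.pos r) ψ hσ]
    have s1 := summable_mul_rpow_of_le
      (fun n => abs_mul_wtK_le K ((abs_re_le_norm _).trans (χ.norm_le_one n)) n) hσ
    have s2 := summable_mul_rpow_of_le
      (fun n => abs_mul_wtK_le K ((abs_re_le_norm _).trans (ψ.norm_le_one n)) n) hσ
    choose! S hS1 hS2 using fun p (hp : p ∈ (q * r).primeFactors) =>
      exists_hasSum_prime_powers (Nat.prime_of_mem_primeFactors hp) hσ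
    have s3 := (hasSum_sum fun p hp => hS2 p hp).mul_left (2 * d)
    have h1 : 2 * d * ∑ p ∈ (q * r).primeFactors, S p ≤
        4 * d * (P + 2 * Real.log (q * r : ℕ) / P) := by
      have h2 := sum_inv_primeFactors_le hqr hP
      have h3 : ∑ p ∈ (q * r).primeFactors, S p ≤ 2 * ∑ p ∈ (q * r).primeFactors, (1 : ℝ) / p := by
        rw [mul_sum]
        refine sum_le_sum fun p hp => (hS1 p hp).trans (le_of_eq (by ring))
      have hd0 : 0 ≤ d := by positivity
      calc _ ≤ 2 * d * (2 * (P + 2 * Real.log (q * r : ℕ) / P)) := by gcongr; linarith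
        _ = _ := by ring
    refine le_trans ?_ (add_le_add_right h1 _)
    refine hasSum_le (fun n => ?_) s1.hasSum (s2.hasSum.add s3)
    have hw0 := wtK_nonneg K n
    have hr0 : 0 ≤ (n : ℝ) ^ (-σ) := by positivity
    have hnn : 0 ≤ 2 * d * ∑ p ∈ (q * r).primeFactors,
        if n ∈ Set.range (fun k : ℕ => p ^ (k + 1)) then (n : ℝ) ^ (-σ) else 0 := by
      refine mul_nonneg (by positivity) (sum_nonneg fun p _ => ?_)
      split_ifs <;> positivity
    by_cases hv : vmK K n = 0
    · have : wtK K n = 0 := by rw [wtK, hv, zero_div]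
      simp only [this, mul_zero, zero_mul, zero_add]
      exact hnn
    by_cases hc : n.Coprime (q * r)
    · have hn0 : n ≠ 0 := fun hn => hv (by rw [hn, vmK_zero])
      obtain ⟨u, hu, hu'⟩ := exists_mem_Gq_of_idealCount K hn0 (idealCount_ne_zero_of_vmK K hv) hc
      have h2 := hT3 u hu
      rw [hu', prodChar_apply] at h2
      have h3 : χ n = ψ n := by
        rcases hS.coefLam_cases K hv with h3 | h3 | h3 <;>
        rcases hS'.coefLam_cases K hv with h4 | h4 | h4 <;> rw [h3, h4] at h2 <;>
          first | (exfalso; norm_num at h2; done) | rw [h3, h4]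
      rw [h3]
      linarith
    · have hL : ArithmeticFunction.vonMangoldt n ≠ 0 := by
        intro h
        have := vmK_le K n
        rw [h, mul_zero] at this
        exact hv (le_antisymm this (vmK_nonneg K n))
      rw [Ne, ArithmeticFunction.vonMangoldt_eq_zero_iff, not_not] at hL
      obtain ⟨p, k, hp, hk, rfl⟩ := (isPrimePow_nat_iff n).1 hL
      have hpd : p ∣ q * r := by
        by_contra hpd
        exact hc (Nat.Coprime.pow_left _ ((Nat.Prime.coprime_iff_not_dvd hp).2 hpd))
      have hpm : p ∈ (q * r).primeFactors := Nat.mem_primeFactors.2 ⟨hp, hpd, hqr⟩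
      have h2 : ((p ^ k : ℕ) : ℝ) ^ (-σ) ≤ ∑ p' ∈ (q * r).primeFactors,
          if p ^ k ∈ Set.range (fun k : ℕ => p' ^ (k + 1)) then ((p ^ k : ℕ) : ℝ) ^ (-σ) else 0 := by
        refine le_trans (le_of_eq ?_) (single_le_sum (fun p' _ => ?_) hpm)
        · rw [if_pos ⟨k - 1, by simp [Nat.sub_add_cancel hk]⟩]
        · split_ifs <;> positivity
      have h3 := wtK_le_finrank K (p ^ k)
      have h4 := (abs_re_le_norm _).trans (χ.norm_le_one ((p ^ k : ℕ) : ZMod q))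
      have h5 := (abs_re_le_norm _).trans (ψ.norm_le_one ((p ^ k : ℕ) : ZMod r))
      rw [abs_le] at h4 h5
      set w := wtK K (p ^ k) with hw
      set y := ((p ^ k : ℕ) : ℝ) ^ (-σ) with hy
      set T := ∑ p' ∈ (q * r).primeFactors,
          if p ^ k ∈ Set.range (fun k : ℕ => p' ^ (k + 1)) then y else 0 with hT
      have hwy : w * y ≤ d * T := by gcongr
      have hwy0 : 0 ≤ w * y := by positivity
      nlinarith
  have hlim : ∀ {m : ℕ} [NeZero m] {φ : DirichletCharacter ℂ m}, ¬ TrivG K φ →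
      Tendsto (fun σ : ℝ => ‖LSeries (coefL K φ) σ‖) (𝓝[>] 1) (𝓝 ‖Lfun K φ 1‖) := by
    intro m _ φ h
    have hm := hasMean' K φ
    rw [resL_eq_zero K h] at hm
    rw [Lfun, resL_eq_zero K h]
    exact hm.tendsto_of_zero.norm
  exact le_of_tendsto_of_tendsto (hlim hT) ((hlim hT').mul_const _)
    (eventually_one_lt.mono fun σ hσ => hfin σ hσ)

theorem exists_norm_Lfun_one_le {ε : ℝ} (hε : 0 < ε) : ∃ C : ℝ, 1 ≤ C ∧ ∀ (q : ℕ) [NeZero q]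
    (χ : DirichletCharacter ℂ q), ‖Lfun K χ 1‖ ≤ C * (q : ℝ) ^ ε := by
  obtain ⟨C, hC, h⟩ := exists_norm_regL_le (deltaK_pos K) (one_le_meanD K) (one_le_meanA K)
    (Module.finrank ℚ K + 1)
  refine ⟨C * (3 ^ ε / ε) + 1, by have : 0 ≤ C * (3 ^ ε / ε) := by positivity
                                  linarith, fun q _ χ => ?_⟩
  have h1 := h q (coefL K χ) (resL K χ) (NeZero.pos q) (hasMean' K χ) 1 (by
    have := one_le_logSize (NeZero.pos q) (1 : ℂ).im
    have : 0 ≤ 1 / (C * logSize q (1 : ℂ).im) := by positivity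
    rw [one_re]; linarith) (by norm_num)
  refine h1.trans ?_
  have hq : (1 : ℝ) ≤ q := by exact_mod_cast NeZero.pos q
  have h2 : logSize q (1 : ℂ).im ≤ 3 ^ ε / ε * (q : ℝ) ^ ε := by
    rw [logSize, one_im, abs_zero, zero_add]
    refine (Real.log_le_rpow_div (by positivity) hε).trans (le_of_eq ?_)
    rw [Real.mul_rpow (by positivity) (by norm_num)]
    ring
  have h3 : 0 ≤ (q : ℝ) ^ ε := by positivity
  nlinarith [mul_le_mul_of_nonneg_left h2 (zero_le_one.trans hC)]

/-- **Siegel's theorem** over `K`. -/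
theorem exists_siegel {ε : ℝ} (hε : 0 < ε) : ∃ c : ℝ, 0 < c ∧ ∀ (q : ℕ) [NeZero q]
    (χ : DirichletCharacter ℂ q), SignG K χ → ¬ TrivG K χ → c * (q : ℝ) ^ (-ε) ≤ ‖Lfun K χ 1‖ := by
  obtain ⟨ε₀, C₁, hε₀, hC₁, h₁⟩ := exists_siegel_nozero K
  obtain ⟨C₂, hC₂, h₂⟩ := exists_siegel_zero K
  obtain ⟨C₃, hC₃, h₃⟩ := exists_norm_Lfun_one_le K (half_pos hε)
  have hδ := deltaK_pos K
  set η := min (min ε₀ (deltaK K / 4)) (min (ε / C₁) (ε / (2 * C₂))) with hη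
  have hη0 : 0 < η := by positivity
  have hη1 : η ≤ ε₀ := (min_le_left _ _).trans (min_le_left _ _)
  have hη2 : η ≤ deltaK K / 4 := (min_le_left _ _).trans (min_le_right _ _)
  have hη3 : C₁ * η ≤ ε := by
    rw [mul_comm, ← le_div_iff₀ (by linarith)]
    exact (min_le_right _ _).trans (min_le_left _ _)
  have hη4 : C₂ * η ≤ ε / 2 := by
    have : η ≤ ε / (2 * C₂) := (min_le_right _ _).trans (min_le_right _ _)
    rw [le_div_iff₀ (by linarith)] at this
    linarith
  by_cases hex : ∃ (q : ℕ) (_ : NeZero q) (χ : DirichletCharacter ℂ q) (σ : ℝ), SignG K χ ∧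
      ¬ TrivG K χ ∧ 1 - η ≤ σ ∧ σ < 1 ∧ Lfun K χ σ = 0
  · obtain ⟨q, _, χ, σ, hS, hT, hσ, hσ1, hz⟩ := hex
    have hq : (1 : ℝ) ≤ q := by exact_mod_cast NeZero.pos q
    have hχ : 0 < ‖Lfun K χ 1‖ := by
      have := hS.re_Lfun_one_pos K hT
      exact this.trans_le (re_le_norm _)
    set d : ℝ := ((Module.finrank ℚ K : ℕ) : ℝ) with hd
    have hd0 : 0 < d := by rw [hd]; exact_mod_cast finrank_rat_pos K
    set P : ℝ := max 1 (8 * d / ε) with hP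
    have hP1 : 1 ≤ P := le_max_left _ _
    have hP2 : 8 * d / P ≤ ε := by
      rw [div_le_iff₀ (by linarith), ← div_le_iff₀' hε]
      exact le_max_right _ _
    set c₁ : ℝ := ‖Lfun K χ 1‖ * Real.exp (-(4 * d * P)) * (q : ℝ) ^ (-ε) with hc₁
    set c₂ : ℝ := (1 - σ) / C₂ / (C₂ * C₃ * ‖Lfun K χ 1‖) * (q : ℝ) ^ (-ε) with hc₂
    have hc₁0 : 0 < c₁ := by positivity
    have hc₂0 : 0 < c₂ := by
      have : 0 < 1 - σ := by linarith
      positivity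
    refine ⟨min c₁ c₂, lt_min hc₁0 hc₂0, fun r _ ψ hS' hT' => ?_⟩
    have hr : (1 : ℝ) ≤ r := by exact_mod_cast NeZero.pos r
    have hqr : (1 : ℝ) ≤ ((q * r : ℕ) : ℝ) := by push_cast; nlinarith
    have : NeZero (q * r) := ⟨mul_ne_zero (NeZero.ne q) (NeZero.ne r)⟩
    have hsplit : ((q * r : ℕ) : ℝ) ^ (-ε) = (q : ℝ) ^ (-ε) * (r : ℝ) ^ (-ε) := by
      push_cast
      exact Real.mul_rpow (by positivity) (by positivity)
    by_cases hT3 : TrivG K (prodChar χ ψ)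
    · have h4 := norm_Lfun_le_of_prod K hS hS' hT hT' hT3 hP1
      refine (mul_le_mul_of_nonneg_right (min_le_left _ _) (by positivity)).trans ?_
      rw [hc₁, mul_assoc, ← hsplit, mul_assoc, Real.rpow_def_of_pos (by linarith), ← Real.exp_add,
        ← div_inv_eq_mul, ← Real.exp_neg, div_le_iff₀ (Real.exp_pos _)]
      refine h4.trans ?_
      gcongr
      have h5 : 8 * d / P * Real.log (q * r : ℕ) ≤ ε * Real.log (q * r : ℕ) := by
        gcongr
      have h6 : 4 * d * (P + 2 * Real.log (q * r : ℕ) / P) =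
        4 * d * P + 8 * d / P * Real.log (q * r : ℕ) := by ring
      rw [h6]
      linarith
    · have h4 := h₂ σ (by linarith) hσ1 q r χ ψ hS hS' hT hT' hT3 hz
      have h5 := h₃ (q * r) (prodChar χ ψ)
      refine (mul_le_mul_of_nonneg_right (min_le_right _ _) (by positivity)).trans ?_
      rw [hc₂, mul_assoc, ← hsplit, div_mul_eq_mul_div, div_le_iff₀ (by positivity)]
      have h6 : ((q * r : ℕ) : ℝ) ^ (-(ε / 2)) ≤ ((q * r : ℕ) : ℝ) ^ (-(C₂ * (1 - σ))) := by
        refine Real.rpow_le_rpow_of_exponent_le hqr (neg_le_neg (le_trans ?_ hη4))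
        gcongr
        linarith
      have h7 : ((q * r : ℕ) : ℝ) ^ (-ε) =
          ((q * r : ℕ) : ℝ) ^ (-(ε / 2)) * ((q * r : ℕ) : ℝ) ^ (-(ε / 2)) := by
        rw [← Real.rpow_add (by linarith)]; congr 1; ring
      have h8 : ((q * r : ℕ) : ℝ) ^ (ε / 2) * ((q * r : ℕ) : ℝ) ^ (-(ε / 2)) = 1 := by
        rw [← Real.rpow_add (by linarith), add_neg_cancel, Real.rpow_zero]
      have h9 : 0 ≤ (1 - σ) / C₂ := div_nonneg (by linarith) (by linarith)
      calc (1 - σ) / C₂ * ((q * r : ℕ) : ℝ) ^ (-ε)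
          = (1 - σ) / C₂ * ((q * r : ℕ) : ℝ) ^ (-(ε / 2)) * ((q * r : ℕ) : ℝ) ^ (-(ε / 2)) := by
            rw [h7]; ring
        _ ≤ (1 - σ) / C₂ * ((q * r : ℕ) : ℝ) ^ (-(C₂ * (1 - σ))) *
              ((q * r : ℕ) : ℝ) ^ (-(ε / 2)) := by gcongr
        _ ≤ C₂ * (‖Lfun K χ 1‖ * ‖Lfun K ψ 1‖ * (C₃ * ((q * r : ℕ) : ℝ) ^ (ε / 2))) *
              ((q * r : ℕ) : ℝ) ^ (-(ε / 2)) := by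
            refine mul_le_mul_of_nonneg_right (h4.trans ?_) (by positivity)
            gcongr
        _ = ‖Lfun K ψ 1‖ * (C₂ * C₃ * ‖Lfun K χ 1‖) *
              (((q * r : ℕ) : ℝ) ^ (ε / 2) * ((q * r : ℕ) : ℝ) ^ (-(ε / 2))) := by ring
        _ = _ := by rw [h8, mul_one]
  · push Not at hex
    refine ⟨η / C₁, by positivity, fun q _ χ hS hT => ?_⟩
    have h4 := h₁ (1 - η) (by linarith) (by linarith) q χ hS hT fun σ hσ hσ1 =>
      hex q inferInstance χ σ hS hT hσ hσ1
    rw [sub_sub_cancel] at h4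
    refine le_trans ?_ h4
    gcongr
    exact_mod_cast NeZero.pos q

end Siegel

section ZeroFree

open Complex

/-- The power `(q (|t| + 3)) ^ ε` of the analytic conductor. -/
noncomputable def ySize (q : ℕ) (ε t : ℝ) : ℝ := (q * (|t| + 3)) ^ ε

theorem one_le_conductor {q : ℕ} (hq : 1 ≤ q) (t : ℝ) : 1 ≤ (q : ℝ) * (|t| + 3) := by
  have : (1 : ℝ) ≤ q := by exact_mod_cast hq
  nlinarith [abs_nonneg t]

theorem one_le_ySize {q : ℕ} (hq : 1 ≤ q) {ε : ℝ} (hε : 0 ≤ ε) (t : ℝ) : 1 ≤ ySize q ε t :=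
  Real.one_le_rpow (one_le_conductor hq t) hε

theorem rpow_le_ySize {q : ℕ} {ε : ℝ} (hε : 0 ≤ ε) (t : ℝ) : (q : ℝ) ^ ε ≤ ySize q ε t :=
  Real.rpow_le_rpow (by positivity) (by nlinarith [abs_nonneg t, (Nat.cast_nonneg q : (0 : ℝ) ≤ q)])
    hε

theorem ySize_mono {q : ℕ} {ε : ℝ} (hε : 0 ≤ ε) {t t' : ℝ} (h : |t'| ≤ |t|) :
    ySize q ε t' ≤ ySize q ε t :=
  Real.rpow_le_rpow (by positivity) (by gcongr) hε

theorem ySize_le_two_mul {q : ℕ} {ε : ℝ} (hε : 0 ≤ ε) (hε1 : ε ≤ 1) {t t' : ℝ}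
    (h : |t'| ≤ 2 * |t| + 3) : ySize q ε t' ≤ 2 * ySize q ε t := by
  calc ySize q ε t' ≤ (2 * (q * (|t| + 3)) : ℝ) ^ ε := by
        refine Real.rpow_le_rpow (by positivity) ?_ hε
        calc (q : ℝ) * (|t'| + 3) ≤ q * (2 * (|t| + 3)) := by gcongr; linarith
          _ = _ := by ring
    _ = 2 ^ ε * ySize q ε t := Real.mul_rpow (by positivity) (by positivity)
    _ ≤ 2 ^ (1 : ℝ) * ySize q ε t := by
        have : 0 ≤ ySize q ε t := Real.rpow_nonneg (by positivity) _
        gcongr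
        norm_num
    _ = _ := by rw [Real.rpow_one]

theorem logSize_le_ySize {q : ℕ} {ε : ℝ} (hε : 0 < ε) (t : ℝ) :
    logSize q t ≤ ySize q ε t / ε :=
  Real.log_le_rpow_div (by positivity) hε

/-- A holomorphic function near the line `Re s = 1` with the upper bound of an `L`-function of
conductor `q`. -/
structure LUpper (q : ℕ) (ε C : ℝ) (f : ℂ → ℂ) : Prop where
  diff : ∀ s : ℂ, 1 - 2 / C < s.re → DifferentiableAt ℂ f s
  upper : ∀ s : ℂ, 1 - 1 / (C * ySize q ε s.im) ≤ s.re → s.re ≤ 3 → ‖f s‖ ≤ C * ySize q ε s.im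

/-- A function with the upper bound, the `3-4-1` lower bound, and either a lower bound at `1` or an
improved `3-4-1` bound. -/
structure LBound (q : ℕ) (ε C c : ℝ) (f : ℂ → ℂ) : Prop extends LUpper q ε C f where
  lower : ∀ s : ℂ, 1 < s.re → s.re ≤ 3 →
    c * (s.re - 1) ^ 3 * (min 1 ‖s - 1‖) ^ 5 ≤ ‖f s‖ ^ 4 * ySize q ε s.im ^ 4
  lower_one : c ≤ ‖f 1‖ * (q : ℝ) ^ ε ∨ ∀ s : ℂ, 1 < s.re → s.re ≤ 3 →
    c * (s.re - 1) ^ 3 ≤ ‖f s‖ ^ 4 * ySize q ε s.im ^ 4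

variable {q : ℕ} {ε C c : ℝ} {f : ℂ → ℂ}

theorem LUpper.norm_iteratedDeriv_le (h : LUpper q ε C f) (J : ℕ) (hq : 1 ≤ q) (hε : 0 ≤ ε) (hε1 : ε ≤ 1)
    (hC : 1 ≤ C) {s : ℂ} (hs : 1 - 1 / (4 * C * ySize q ε s.im) ≤ s.re) (hs' : s.re ≤ 5 / 2) :
    ‖iteratedDeriv J f s‖ ≤ J.factorial * (C * (2 * ySize q ε s.im)) * (4 * C * ySize q ε s.im) ^ J := by
  set Y := ySize q ε s.im with hY
  have hY1 : 1 ≤ Y := one_le_ySize hq hε _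
  have hCY : 1 ≤ C * Y := by nlinarith
  set R := 1 / (4 * C * Y) with hR
  have hR0 : 0 < R := by positivity
  have hR4 : R ≤ 1 / 4 := by
    rw [hR]
    gcongr
    nlinarith
  have hmem : ∀ z ∈ Metric.closedBall s R, 1 - 2 * R ≤ z.re ∧ z.re ≤ 3 ∧ |z.im| ≤ 2 * |s.im| + 3 := by
    intro z hz
    rw [Metric.mem_closedBall, dist_eq_norm] at hz
    have h1 := abs_le.1 ((abs_re_le_norm (z - s)).trans hz)
    have h2 := (abs_im_le_norm (z - s)).trans hz
    rw [sub_re] at h1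
    rw [sub_im] at h2
    refine ⟨by linarith [h1.1], by linarith [h1.2], ?_⟩
    have : |z.im| ≤ |z.im - s.im| + |s.im| := by
      simpa using abs_add_le (z.im - s.im) s.im
    linarith [abs_nonneg s.im]
  have h2R : 2 * R < 2 / C := by
    have : 2 * R = 1 / (2 * (C * Y)) := by rw [hR]; field_simp; ring
    rw [this, div_lt_div_iff₀ (by positivity) (by positivity)]
    nlinarith
  have hd : DiffContOnCl ℂ f (Metric.ball s R) := by
    have : DifferentiableOn ℂ f (Metric.closedBall s R) := fun z hz =>
      (h.diff z (by linarith [(hmem z hz).1])).differentiableWithinAt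
    exact this.diffContOnCl_ball subset_rfl
  refine (norm_iteratedDeriv_le_of_forall_mem_sphere_norm_le J hR0 hd (C := C * (2 * Y))
    fun z hz => ?_).trans (le_of_eq ?_)
  · obtain ⟨h1, h2, h3⟩ := hmem z (Metric.sphere_subset_closedBall hz)
    have h4 := ySize_le_two_mul hε hε1 h3 (q := q)
    have h5 : 1 ≤ ySize q ε z.im := one_le_ySize hq hε _
    refine (h.upper z (le_trans ?_ h1) h2).trans (by gcongr)
    have : 2 * R = 1 / (C * (2 * Y)) := by rw [hR]; field_simp; norm_num
    rw [this]
    gcongr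
  · rw [hR, one_div, inv_pow, div_inv_eq_mul]

theorem LUpper.norm_deriv_le (h : LUpper q ε C f) (hq : 1 ≤ q) (hε : 0 ≤ ε) (hε1 : ε ≤ 1)
    (hC : 1 ≤ C) {s : ℂ} (hs : 1 - 1 / (4 * C * ySize q ε s.im) ≤ s.re) (hs' : s.re ≤ 5 / 2) :
    ‖deriv f s‖ ≤ 8 * C ^ 2 * ySize q ε s.im ^ 2 := by
  have := h.norm_iteratedDeriv_le 1 hq hε hε1 hC hs hs'
  rw [iteratedDeriv_one] at this
  refine this.trans (le_of_eq ?_)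
  rw [Nat.factorial_one, Nat.cast_one]
  ring

theorem LUpper.exists_norm_iteratedDeriv_le (J : ℕ) (hC : 1 ≤ C) :
    ∃ C' : ℝ, 0 < C' ∧ ∀ (q : ℕ) (f : ℂ → ℂ), 1 ≤ q →
      LUpper q (1 / (2 * (J + 1))) C f → ∀ s : ℂ, 1 ≤ s.re → s.re ≤ 2 →
        ‖iteratedDeriv J f s‖ ≤ C' * ySize q (1 / 2) s.im := by
  refine ⟨J.factorial * (C * 2) * (4 * C) ^ J, by positivity, fun q f hq h s hs hs' => ?_⟩
  have hY : 0 ≤ ySize q (1 / (2 * (J + 1))) s.im := Real.rpow_nonneg (by positivity) _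
  refine (h.norm_iteratedDeriv_le J hq (by positivity) ?_ hC ?_ (by linarith)).trans (le_of_eq ?_)
  · rw [div_le_one (by positivity)]
    linarith [(Nat.cast_nonneg J : (0 : ℝ) ≤ J)]
  · have : 0 ≤ 1 / (4 * C * ySize q (1 / (2 * (J + 1))) s.im) := by positivity
    linarith
  · have h1 : ySize q (1 / 2) s.im = ySize q (1 / (2 * (J + 1))) s.im ^ (J + 1) := by
      rw [ySize, ySize, ← Real.rpow_natCast, ← Real.rpow_mul (by positivity)]
      congr 1
      push_cast
      field_simp
    rw [h1]
    ring

theorem LUpper.norm_sub_le (h : LUpper q ε C f) (hq : 1 ≤ q) (hε : 0 ≤ ε) (hε1 : ε ≤ 1)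
    (hC : 1 ≤ C) {s z : ℂ} (hs : 1 - 1 / (4 * C * ySize q ε s.im) ≤ s.re) (hs' : s.re ≤ 5 / 2)
    (hz : 1 - 1 / (4 * C * ySize q ε s.im) ≤ z.re) (hz' : z.re ≤ 5 / 2) (him : |z.im| ≤ |s.im|) :
    ‖f s - f z‖ ≤ 8 * C ^ 2 * ySize q ε s.im ^ 2 * ‖s - z‖ := by
  have hY1 : 1 ≤ ySize q ε s.im := one_le_ySize hq hε _
  set V : Set ℂ := {w | 1 - 1 / (4 * C * ySize q ε s.im) ≤ w.re} ∩ {w | w.re ≤ 5 / 2} ∩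
    ({w | -|s.im| ≤ w.im} ∩ {w | w.im ≤ |s.im|}) with hV
  have hconv : Convex ℝ V := ((convex_halfSpace_re_ge _).inter (convex_halfSpace_re_le _)).inter
    ((convex_halfSpace_im_ge _).inter (convex_halfSpace_im_le _))
  have hle : ∀ w ∈ V, ySize q ε w.im ≤ ySize q ε s.im := fun w hw =>
    ySize_mono hε (abs_le.2 hw.2)
  have hreg : ∀ w ∈ V, 1 - 1 / (4 * C * ySize q ε w.im) ≤ w.re := fun w hw => by
    refine le_trans ?_ hw.1.1
    have := hle w hw
    have : 0 < ySize q ε w.im := by linarith [one_le_ySize hq hε w.im]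
    gcongr
  have hlt : 1 - 2 / C < 1 - 1 / (4 * C * ySize q ε s.im) := by
    have : 1 / (4 * C * ySize q ε s.im) < 2 / C := by
      rw [div_lt_div_iff₀ (by positivity) (by positivity)]
      nlinarith
    linarith
  refine hconv.norm_image_sub_le_of_norm_deriv_le (fun w hw => h.diff w (hlt.trans_le hw.1.1))
    (fun w hw => (h.norm_deriv_le hq hε hε1 hC (hreg w hw) hw.1.2).trans ?_)
    ⟨⟨hz, hz'⟩, abs_le.1 him⟩ ⟨⟨hs, hs'⟩, abs_le.1 (le_refl |s.im|)⟩
  have := hle w hw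
  have : 0 < ySize q ε w.im := by linarith [one_le_ySize hq hε w.im]
  gcongr

theorem LBound.exists_le_norm (hC : 1 ≤ C) (hc : 0 < c) (hc1 : c ≤ 1) : ∃ b : ℝ, 0 < b ∧ b ≤ 1 ∧
    ∀ (q : ℕ) (ε : ℝ) (f : ℂ → ℂ), 1 ≤ q → 0 ≤ ε → ε ≤ 1 → LBound q ε C c f → ∀ s : ℂ,
      1 - b * (ySize q ε s.im)⁻¹ ^ 27 ≤ s.re → s.re ≤ 5 / 2 →
        1 - 1 / (4 * C * ySize q ε s.im) ≤ s.re ∧ b * (ySize q ε s.im)⁻¹ ^ 25 ≤ ‖f s‖ := by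
  set D := 8 * C ^ 2 with hD
  have hD8 : 8 ≤ D := by nlinarith
  set c₁ := c / (4 * D) with hc₁
  have hc₁0 : 0 < c₁ := by positivity
  have hc₁1 : c₁ ≤ 1 := by
    rw [hc₁, div_le_one (by positivity)]
    linarith
  set b := min (min (1 / (4 * C)) c₁) (min (c * c₁ ^ 5 / (256 * D ^ 4)) (c / 2)) with hb
  have hb0 : 0 < b := by positivity
  have hb1 : b ≤ 1 / (4 * C) := (min_le_left _ _).trans (min_le_left _ _)
  have hb2 : b ≤ c₁ := (min_le_left _ _).trans (min_le_right _ _)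
  have hb3 : b * (256 * D ^ 4) ≤ c * c₁ ^ 5 := by
    rw [← le_div_iff₀ (by positivity)]
    exact (min_le_right _ _).trans (min_le_left _ _)
  have hb4 : b ≤ c / 2 := (min_le_right _ _).trans (min_le_right _ _)
  refine ⟨b, hb0, by linarith, fun q ε f hq hε hε1 h s hs hs' => ?_⟩
  set Y := ySize q ε s.im with hY
  have hY1 : 1 ≤ Y := one_le_ySize hq hε _
  set u := Y⁻¹ with hu
  have hu0 : 0 < u := by positivity
  have hu1 : u ≤ 1 := inv_le_one_of_one_le₀ hY1
  have hYu : Y * u = 1 := mul_inv_cancel₀ (by positivity)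
  have hu27 : u ^ 27 ≤ u := pow_le_of_le_one hu0.le hu1 (by norm_num)
  have hu3 : u ^ 27 ≤ u ^ 3 := pow_le_pow_of_le_one hu0.le hu1 (by norm_num)
  have hu25 : u ^ 25 ≤ u := pow_le_of_le_one hu0.le hu1 (by norm_num)
  have hreg : 1 / (4 * C * Y) = 1 / (4 * C) * u := by rw [hu]; field_simp
  have hηle : b * u ^ 27 ≤ 1 / (4 * C * Y) := by
    rw [hreg]; gcongr
  have hregs : 1 - 1 / (4 * C * Y) ≤ s.re := by linarith
  refine ⟨hregs, ?_⟩
  have hη3 : b * u ^ 27 ≤ c₁ * u ^ 3 := by gcongr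
  by_cases hnear : (s.re ≤ 1 + c₁ * u ^ 3 ∧ |s.im| ≤ c₁ * u ^ 3) ∧ c ≤ ‖f 1‖ * (q : ℝ) ^ ε
  · have hdist : ‖s - 1‖ ≤ 2 * c₁ * u ^ 3 := by
      refine (norm_le_abs_re_add_abs_im _).trans ?_
      have h1 : |(s - 1).re| ≤ c₁ * u ^ 3 := by
        rw [sub_re, one_re, abs_le]
        constructor <;> linarith [hnear.1.1]
      have h2 : |(s - 1).im| ≤ c₁ * u ^ 3 := by simpa using hnear.1.2
      linarith
    have h1 := h.norm_sub_le hq hε hε1 hC hregs hs' (z := 1)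
      (by rw [one_re]; linarith [(by positivity : 0 < 1 / (4 * C * Y))])
      (by rw [one_re]; norm_num) (by simp)
    have h2 : 8 * C ^ 2 * Y ^ 2 * ‖s - 1‖ ≤ c / 2 * u := by
      calc 8 * C ^ 2 * Y ^ 2 * ‖s - 1‖ ≤ D * Y ^ 2 * (2 * c₁ * u ^ 3) := by gcongr
        _ = 2 * (D * c₁) * (Y * u) ^ 2 * u := by ring
        _ = c / 2 * u := by
            rw [hYu, hc₁]
            field_simp
            norm_num
    have h3 : c * u ≤ ‖f 1‖ := by
      have h4 : c ≤ ‖f 1‖ * Y := hnear.2.trans (by gcongr; exact rpow_le_ySize hε _)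
      calc c * u ≤ ‖f 1‖ * Y * u := by gcongr
        _ = ‖f 1‖ := by rw [mul_assoc, hYu, mul_one]
    have h4 : ‖f 1‖ ≤ ‖f s‖ + ‖f s - f 1‖ := by
      rw [norm_sub_rev]; exact norm_le_norm_add_norm_sub' _ _
    have h5 : b * u ^ 25 ≤ c / 2 * u := by gcongr
    linarith
  · set σ := max s.re (1 + b * u ^ 27) with hσ
    set w : ℂ := ⟨σ, s.im⟩ with hw
    have hη1 : b * u ^ 27 ≤ 1 := by
      have : u ^ 27 ≤ 1 := pow_le_one₀ hu0.le hu1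
      nlinarith
    have hη0 : 0 < b * u ^ 27 := by positivity
    have hσ1 : 1 + b * u ^ 27 ≤ σ := le_max_right _ _
    have hσ2 : σ ≤ 5 / 2 := max_le hs' (by linarith)
    have hw3 : 0 ≤ w.re - 1 := by change 0 ≤ σ - 1; linarith
    have hw1 : 1 < w.re := by change 1 < σ; linarith
    have hw2 : w.re ≤ 3 := by change σ ≤ 3; linarith
    have hc1u : c₁ * u ^ 3 ≤ 1 := by
      have : u ^ 3 ≤ 1 := pow_le_one₀ hu0.le hu1
      nlinarith
    have hm : c * (w.re - 1) ^ 3 * (c₁ * u ^ 3) ^ 5 ≤ ‖f w‖ ^ 4 * Y ^ 4 := by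
      rcases h.lower_one with h1 | h1
      · refine le_trans ?_ (h.lower w hw1 hw2)
        gcongr
        refine le_min hc1u ?_
        rw [not_and_or, not_and_or, not_le, not_le] at hnear
        rcases hnear with (h2 | h2) | h2
        · refine le_trans ?_ (re_le_norm _)
          rw [sub_re, one_re]
          have : s.re ≤ w.re := le_max_left _ _
          linarith
        · refine h2.le.trans (le_trans (le_of_eq ?_) (abs_im_le_norm _))
          rw [sub_im, one_im, sub_zero]
        · exact absurd h1 h2
      · refine le_trans ?_ (h1 w hw1 hw2)
        exact mul_le_of_le_one_right (by positivity) (pow_le_one₀ (by positivity) hc1u)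
    have h1 : 4 * D * b * u ^ 25 ≤ ‖f w‖ := by
      refine le_of_pow_le_pow_left₀ (n := 4) (by norm_num) (norm_nonneg _) ?_
      have h3 : c * (b * u ^ 27) ^ 3 * (c₁ * u ^ 3) ^ 5 ≤ ‖f w‖ ^ 4 * Y ^ 4 := by
        refine le_trans ?_ hm
        have : b * u ^ 27 ≤ w.re - 1 := by change _ ≤ σ - 1; linarith
        gcongr
      calc (4 * D * b * u ^ 25) ^ 4 = b * (256 * D ^ 4) * (b ^ 3 * u ^ 100) := by ring
        _ ≤ c * c₁ ^ 5 * (b ^ 3 * u ^ 100) := by gcongr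
        _ = c * (b * u ^ 27) ^ 3 * (c₁ * u ^ 3) ^ 5 * u ^ 4 := by ring
        _ ≤ ‖f w‖ ^ 4 * Y ^ 4 * u ^ 4 := by gcongr
        _ = ‖f w‖ ^ 4 * (Y * u) ^ 4 := by ring
        _ = ‖f w‖ ^ 4 := by rw [hYu]; ring
    have h2 := h.norm_sub_le hq hε hε1 hC hregs hs' (z := w)
      (by change _ ≤ σ; linarith [(by positivity : 0 < 1 / (4 * C * Y))]) hσ2 le_rfl
    have h3 : ‖s - w‖ ≤ 2 * (b * u ^ 27) := by
      have h4 : s - w = ((s.re - σ : ℝ) : ℂ) := by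
        apply Complex.ext <;> simp [hw]
      rw [h4, norm_real, Real.norm_eq_abs, abs_le]
      constructor
      · have : σ ≤ s.re + 2 * (b * u ^ 27) := max_le (by linarith) (by linarith)
        linarith
      · have : s.re ≤ σ := le_max_left _ _
        linarith
    have h4 : 8 * C ^ 2 * Y ^ 2 * ‖s - w‖ ≤ 2 * D * b * u ^ 25 := by
      calc 8 * C ^ 2 * Y ^ 2 * ‖s - w‖ ≤ D * Y ^ 2 * (2 * (b * u ^ 27)) := by gcongr
        _ = 2 * D * b * u ^ 25 * (Y * u) ^ 2 := by ring
        _ = _ := by rw [hYu]; ring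
    have h5 : ‖f w‖ ≤ ‖f s‖ + ‖f s - f w‖ := by
      rw [norm_sub_rev]; exact norm_le_norm_add_norm_sub' _ _
    have h6 : b * u ^ 25 * 1 ≤ b * u ^ 25 * (2 * D) := by gcongr; linarith
    linarith

theorem LBound.exists_norm_iteratedDeriv_le (J : ℕ) (hC : 1 ≤ C) (hc : 0 < c) (hc1 : c ≤ 1) :
    ∃ C' : ℝ, 0 < C' ∧ ∀ (q : ℕ) (f : ℂ → ℂ), 1 ≤ q →
      LBound q (1 / (54 * (J + 1))) C c f → ∀ s : ℂ, 1 ≤ s.re → s.re ≤ 2 →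
        (∃ r > 0, ∀ z ∈ Metric.ball s r, f z ≠ 0) ∧
        ‖iteratedDeriv J (fun z => deriv f z / f z) s‖ ≤ C' * ySize q (1 / 2) s.im := by
  obtain ⟨b, hb0, hb1, hb⟩ := LBound.exists_le_norm hC hc hc1
  set ε : ℝ := 1 / (54 * (J + 1)) with hεdef
  have hε : 0 < ε := by positivity
  have hε1 : ε ≤ 1 := by
    rw [hεdef, div_le_one (by positivity)]
    linarith [(Nat.cast_nonneg J : (0 : ℝ) ≤ J)]
  set D := 8 * C ^ 2 with hD
  refine ⟨J.factorial * (D / b * 2 ^ 27) / (b / 2 ^ 28) ^ J, by positivity, fun q f hq h s hs hs' => ?_⟩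
  have hb' := fun s h1 h2 => hb q ε f hq hε.le hε1 h s h1 h2
  set Y := ySize q ε s.im with hY
  have hY1 : 1 ≤ Y := one_le_ySize hq hε.le _
  have hY0 : 0 < Y := by linarith
  set r := b / 2 ^ 28 * Y⁻¹ ^ 27 with hr
  have hr0 : 0 < r := by positivity
  have hr4 : r ≤ 1 / 4 := by
    have h1 : Y⁻¹ ^ 27 ≤ 1 := pow_le_one₀ (by positivity) (inv_le_one_of_one_le₀ hY1)
    have h2 : b / 2 ^ 28 ≤ 1 / 4 := by linarith
    calc r ≤ 1 / 4 * 1 := by rw [hr]; gcongr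
      _ = _ := by norm_num
  have hmem : ∀ z ∈ Metric.closedBall s r, ySize q ε z.im ≤ 2 * Y ∧
      1 - b * (ySize q ε z.im)⁻¹ ^ 27 < z.re ∧ z.re ≤ 5 / 2 := by
    intro z hz
    rw [Metric.mem_closedBall, dist_eq_norm] at hz
    have h1 := abs_le.1 ((abs_re_le_norm (z - s)).trans hz)
    have h2 := (abs_im_le_norm (z - s)).trans hz
    rw [sub_re] at h1
    rw [sub_im] at h2
    have h3 : |z.im| ≤ 2 * |s.im| + 3 := by
      have : |z.im| ≤ |z.im - s.im| + |s.im| := by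
        simpa using abs_add_le (z.im - s.im) s.im
      linarith [abs_nonneg s.im]
    have h4 := ySize_le_two_mul hε.le hε1 h3 (q := q)
    have h5 : 0 < ySize q ε z.im := by linarith [one_le_ySize hq hε.le z.im]
    refine ⟨h4, ?_, by linarith [h1.2]⟩
    have h6 : 2 * r ≤ b * (ySize q ε z.im)⁻¹ ^ 27 := by
      calc 2 * r = b * (2 * Y)⁻¹ ^ 27 := by rw [hr, mul_inv, mul_pow]; ring
        _ ≤ _ := by gcongr
    linarith [h1.1]
  have hne : ∀ z ∈ Metric.closedBall s r, f z ≠ 0 := by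
    intro z hz h0
    obtain ⟨h1, h2, h3⟩ := hmem z hz
    have h4 := (hb' z h2.le h3).2
    have h5 : 0 < ySize q ε z.im := by linarith [one_le_ySize hq hε.le z.im]
    rw [h0, norm_zero] at h4
    have : 0 < b * (ySize q ε z.im)⁻¹ ^ 25 := by positivity
    linarith
  refine ⟨⟨r, hr0, fun z hz => hne z (Metric.ball_subset_closedBall hz)⟩, ?_⟩
  have hopen : IsOpen {z : ℂ | 1 - 2 / C < z.re} := isOpen_lt continuous_const continuous_re
  have hdf : DifferentiableOn ℂ f {z : ℂ | 1 - 2 / C < z.re} := fun z hz =>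
    (h.diff z hz).differentiableWithinAt
  have hsub : Metric.closedBall s r ⊆ {z : ℂ | 1 - 2 / C < z.re} := by
    intro z hz
    obtain ⟨h1, h2, h3⟩ := hmem z hz
    refine lt_of_lt_of_le ?_ (hb' z h2.le h3).1
    have h5 := one_le_ySize hq hε.le z.im
    have : 1 / (4 * C * ySize q ε z.im) < 2 / C := by
      rw [div_lt_div_iff₀ (by positivity) (by positivity)]
      nlinarith
    linarith
  have hd : DiffContOnCl ℂ (fun z => deriv f z / f z) (Metric.ball s r) := by
    have : DifferentiableOn ℂ (fun z => deriv f z / f z) (Metric.closedBall s r) :=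
      ((hdf.deriv hopen).mono hsub).div (hdf.mono hsub) hne
    exact this.diffContOnCl_ball subset_rfl
  refine (norm_iteratedDeriv_le_of_forall_mem_sphere_norm_le J hr0 hd
    (C := D / b * 2 ^ 27 * Y ^ 27) fun z hz => ?_).trans (le_of_eq ?_)
  · obtain ⟨h1, h2, h3⟩ := hmem z (Metric.sphere_subset_closedBall hz)
    obtain ⟨h4, h5⟩ := hb' z h2.le h3
    have h6 := h.norm_deriv_le hq hε.le hε1 hC h4 h3
    set W := ySize q ε z.im with hW
    have hW0 : 0 < W := by linarith [one_le_ySize hq hε.le z.im]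
    rw [norm_div]
    calc ‖deriv f z‖ / ‖f z‖ ≤ D * W ^ 2 / (b * W⁻¹ ^ 25) := by gcongr
      _ = D / b * W ^ 27 := by field_simp
      _ ≤ D / b * (2 * Y) ^ 27 := by gcongr
      _ = _ := by ring
  · have h1 : ySize q (1 / 2) s.im = Y ^ (27 * (J + 1)) := by
      rw [hY, ySize, ySize, ← Real.rpow_natCast, ← Real.rpow_mul (by positivity)]
      congr 1
      rw [hεdef]
      push_cast
      field_simp
      norm_num
    rw [h1, hr, mul_pow, ← pow_mul, inv_pow, mul_add, mul_one, pow_add]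
    field_simp

end ZeroFree

section LFunBounds

open Complex

theorem exists_LUpper_regL {D₀ δ A : ℝ} (hδ : 0 < δ) (hD : 1 ≤ D₀) (hA : 1 ≤ A) (m : ℕ) {ε : ℝ}
    (hε : 0 < ε) : ∃ C : ℝ, 4 ≤ C ∧ A ≤ C ∧ ∀ (q : ℕ) (f : ℕ → ℂ) (κ : ℂ), 1 ≤ q →
      HasMean f κ (D₀ * q ^ m) δ A → LUpper q ε C (regL f κ) := by
  obtain ⟨C₀, hC₀, h₀⟩ := exists_norm_regL_le hδ hD hA m
  set C := max (max 4 A) (max (2 / δ) (C₀ / ε)) with hC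
  have hC4 : 4 ≤ C := (le_max_left _ _).trans (le_max_left _ _)
  refine ⟨C, hC4, (le_max_right _ _).trans (le_max_left _ _),
    fun q f κ hq h => ⟨fun s hs => differentiableAt_regL h ?_, fun s hs hs' => ?_⟩⟩
  · have h1 : 2 / δ ≤ C := (le_max_left _ _).trans (le_max_right _ _)
    rw [div_le_iff₀ hδ] at h1
    have : 2 / C ≤ δ := by rw [div_le_iff₀ (by linarith)]; linarith
    linarith
  · have h1 : C₀ / ε ≤ C := (le_max_right _ _).trans (le_max_right _ _)
    have h2 := one_le_logSize hq s.im
    have h3 : C₀ * logSize q s.im ≤ C * ySize q ε s.im := by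
      have hY := one_le_ySize hq hε.le s.im
      calc C₀ * logSize q s.im ≤ C₀ * (ySize q ε s.im / ε) := by
            gcongr
            exact logSize_le_ySize hε _
        _ = C₀ / ε * ySize q ε s.im := by ring
        _ ≤ _ := by gcongr
    refine (h₀ q f κ hq h s (le_trans ?_ hs) hs').trans h3
    gcongr

theorem HasMean.const_one : HasMean (fun _ => 1) 1 1 (1 / 2) 1 where
  pos := by norm_num
  le_half := le_rfl
  one_le := le_rfl
  one_le' := le_rfl
  err x hx := by
    rw [Finset.sum_const, Nat.card_Icc, Nat.add_sub_cancel, nsmul_one, one_mul, one_mul]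
    have h1 : ((⌊x⌋₊ : ℂ) - x) = ((⌊x⌋₊ - x : ℝ) : ℂ) := by push_cast; rfl
    rw [h1, norm_real, Real.norm_eq_abs]
    refine le_trans ?_ (Real.one_le_rpow hx (by norm_num))
    rw [abs_le]
    constructor
    · linarith [Nat.lt_floor_add_one x]
    · linarith [Nat.floor_le (by linarith : 0 ≤ x)]
  abs x hx := by
    simp only [norm_one, Finset.sum_const, Nat.card_Icc, Nat.add_sub_cancel, nsmul_one, one_mul]
    exact Nat.floor_le (by linarith)

theorem div_add_le_div_min {A B r : ℝ} (hA : 0 ≤ A) (hB : 0 ≤ B) (hr : 0 < r) :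
    A / r + B ≤ (A + B) / min 1 r := by
  have hm : 0 < min 1 r := lt_min one_pos hr
  rw [add_div]
  refine add_le_add ?_ ?_
  · gcongr
    exact min_le_right _ _
  · rw [le_div_iff₀ hm]
    exact mul_le_of_le_one_right hB (min_le_left _ _)

variable (K : Type*) [Field K] [NumberField K]

theorem three_four_one {q : ℕ} [NeZero q] (χ : DirichletCharacter ℂ q) {σ : ℝ} (hσ : 1 < σ) (t : ℝ) :
    1 ≤ ‖LSeries (coefL K (1 : DirichletCharacter ℂ q)) σ‖ ^ 3 * ‖LSeries (coefL K χ) ⟨σ, t⟩‖ ^ 4 *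
      ‖LSeries (coefL K (χ ^ 2)) ⟨σ, 2 * t⟩‖ := by
  have hq := NeZero.pos q
  have p0 : 0 < ‖LSeries (coefL K (1 : DirichletCharacter ℂ q)) σ‖ :=
    norm_pos_iff.2 (LSeries_coefL_ne_zero K hq _ hσ)
  have p1 : 0 < ‖LSeries (coefL K χ) ⟨σ, t⟩‖ :=
    norm_pos_iff.2 (LSeries_coefL_ne_zero K hq _ hσ)
  have p2 : 0 < ‖LSeries (coefL K (χ ^ 2)) ⟨σ, 2 * t⟩‖ :=
    norm_pos_iff.2 (LSeries_coefL_ne_zero K hq _ hσ)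
  have hsum : ∀ (ψ : DirichletCharacter ℂ q) (v : ℝ), Summable fun n : ℕ =>
      ((ψ n) * (n : ℂ) ^ (-(v * I))).re * wtK K n * (n : ℝ) ^ (-σ) := by
    intro ψ v
    refine summable_mul_rpow_of_le (c := 2 * Module.finrank ℚ K) (fun n => ?_) hσ
    by_cases hn : n = 0
    · subst hn
      have : wtK K 0 = 0 := by rw [wtK, vmK_zero, zero_div]
      simp [this]
    · refine abs_mul_wtK_le K ((abs_re_le_norm _).trans ?_) n
      rw [norm_mul, norm_natCast_cpow_of_pos (Nat.pos_of_ne_zero hn)]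
      simpa using ψ.norm_le_one n
  rw [← Real.log_nonneg_iff (by positivity), Real.log_mul (by positivity) p2.ne',
    Real.log_mul (by positivity) (by positivity), Real.log_pow, Real.log_pow,
    log_norm_LSeries_coefL K hq _ (s := σ) hσ, log_norm_LSeries_coefL K hq _ (s := ⟨σ, t⟩) hσ,
    log_norm_LSeries_coefL K hq _ (s := ⟨σ, 2 * t⟩) hσ]
  refine HasSum.nonneg (fun n => ?_) ((((hsum 1 0).hasSum.mul_left ((3 : ℕ) : ℝ)).add
    ((hsum χ t).hasSum.mul_left ((4 : ℕ) : ℝ))).add (hsum (χ ^ 2) (2 * t)).hasSum)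
  by_cases hn : n = 0
  · subst hn
    simp [wtK, vmK_zero]
  have hw := wtK_nonneg K n
  have hr : 0 ≤ (n : ℝ) ^ (-σ) := by positivity
  have h2 : (n : ℂ) ^ (-((2 * t : ℝ) * I)) = ((n : ℂ) ^ (-(t * I))) ^ 2 := by
    rw [← cpow_nat_mul]
    push_cast
    ring_nf
  by_cases hu : IsUnit (n : ZMod q)
  · set z := χ n * (n : ℂ) ^ (-(t * I)) with hz
    have hz1 : ‖z‖ = 1 := by
      rw [hz, norm_mul, norm_natCast_cpow_of_pos (Nat.pos_of_ne_zero hn),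
        ← hu.unit_spec, χ.unit_norm_eq_one]
      simp
    have hsq : z.re ^ 2 + z.im ^ 2 = 1 := by
      have := Complex.sq_norm z
      rw [hz1, normSq_apply] at this
      linarith
    have h3 : (χ ^ 2) n * (n : ℂ) ^ (-((2 * t : ℝ) * I)) = z ^ 2 := by
      rw [h2, MulChar.pow_apply' _ two_ne_zero, hz, mul_pow]
    rw [h3, MulChar.one_apply hu]
    have h4 : 0 ≤ 3 + 4 * z.re + (z ^ 2).re := by
      rw [pow_two, mul_re z z]
      nlinarith [sq_nonneg (1 + z.re)]
    have := mul_nonneg (mul_nonneg h4 hw) hr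
    simp only [Nat.cast_ofNat, ofReal_zero, zero_mul, neg_zero, cpow_zero, mul_one,
      one_re, one_mul]
    linarith
  · rw [MulChar.map_nonunit _ hu, MulChar.map_nonunit _ hu, MulChar.map_nonunit _ hu]
    simp

theorem exists_LUpper_Lfun {ε : ℝ} (hε : 0 < ε) : ∃ C : ℝ, 4 ≤ C ∧ meanA K ≤ C ∧
    ∀ (q : ℕ) [NeZero q] (χ : DirichletCharacter ℂ q), LUpper q ε C (Lfun K χ) := by
  obtain ⟨C, h1, h2, h3⟩ := exists_LUpper_regL (deltaK_pos K) (one_le_meanD K) (one_le_meanA K)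
    (Module.finrank ℚ K + 1) hε
  exact ⟨C, h1, h2, fun q _ χ => h3 q _ _ (NeZero.pos q) (hasMean' K χ)⟩

variable {K} in
theorem norm_LSeries_coefL_le {q : ℕ} [NeZero q] {ε C : ℝ} (hε : 0 ≤ ε) (hC : 4 ≤ C)
    (hA : meanA K ≤ C) {χ : DirichletCharacter ℂ q} (h : LUpper q ε C (Lfun K χ)) {s : ℂ}
    (hs : 1 < s.re) (hs' : s.re ≤ 3) :
    ‖LSeries (coefL K χ) s‖ ≤ 2 * C * ySize q ε s.im / min 1 ‖s - 1‖ ∧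
      (resL K χ = 0 → ‖LSeries (coefL K χ) s‖ ≤ 2 * C * ySize q ε s.im) := by
  have hY := one_le_ySize (NeZero.pos q) hε s.im
  have hpos : 0 < ‖s - 1‖ := by
    refine lt_of_lt_of_le ?_ (re_le_norm _)
    rw [sub_re, one_re]
    linarith
  have h1 : ‖Lfun K χ s‖ ≤ C * ySize q ε s.im := by
    refine h.upper s ?_ hs'
    have : 0 ≤ 1 / (C * ySize q ε s.im) := by positivity
    linarith
  have heq := LSeries_eq_regL (hasMean' K χ) hs
  rw [← Lfun] at heq
  constructor
  · rw [heq]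
    refine (norm_add_le _ _).trans ?_
    rw [norm_div]
    refine (add_le_add_right h1 _).trans ((div_add_le_div_min (norm_nonneg _) (by positivity)
      hpos).trans ?_)
    have h2 := (hasMean' K χ).norm_le
    have : 0 < min 1 ‖s - 1‖ := lt_min one_pos hpos
    gcongr
    nlinarith
  · intro h0
    rw [heq, h0, zero_div, zero_add]
    nlinarith

theorem TrivG_sq_iff {q : ℕ} {χ : DirichletCharacter ℂ q} : TrivG K (χ ^ 2) ↔ SignG K χ := by
  simp only [TrivG, SignG, MulChar.pow_apply' _ two_ne_zero]

theorem exists_LBound_data {ε : ℝ} (hε : 0 < ε) (hε1 : ε ≤ 1) : ∃ C c : ℝ, 4 ≤ C ∧ meanA K ≤ C ∧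
    0 < c ∧ c ≤ 1 ∧ ∀ (q : ℕ) [NeZero q] (χ : DirichletCharacter ℂ q), LUpper q ε C (Lfun K χ) ∧
      ∀ s : ℂ, 1 < s.re → s.re ≤ 3 →
        (c * (s.re - 1) ^ 3 * min 1 ‖s - 1‖ ≤ ‖LSeries (coefL K χ) s‖ ^ 4 * ySize q ε s.im ^ 4) ∧
        (¬ SignG K χ →
          c * (s.re - 1) ^ 3 ≤ ‖LSeries (coefL K χ) s‖ ^ 4 * ySize q ε s.im ^ 4) := by
  obtain ⟨C, hC4, hCA, h⟩ := exists_LUpper_Lfun K hε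
  refine ⟨C, 1 / (4 * C) ^ 4, hC4, hCA, by positivity, ?_, fun q _ χ => ⟨h q χ, fun s hs hs' => ?_⟩⟩
  · rw [div_le_one (by positivity)]
    exact one_le_pow₀ (by linarith)
  have h341 := three_four_one K χ hs s.im
  have hs0 : 0 < s.re - 1 := by linarith
  set Y := ySize q ε s.im with hYdef
  have hY : 1 ≤ Y := one_le_ySize (NeZero.pos q) hε.le s.im
  set L := ‖LSeries (coefL K χ) s‖ with hL
  have hL0 : 0 ≤ L := norm_nonneg _
  have b0 : ‖LSeries (coefL K (1 : DirichletCharacter ℂ q)) s.re‖ ≤ 4 * C * Y / (s.re - 1) := by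
    refine (norm_LSeries_coefL_le hε.le hC4 hCA (h q 1) (s := s.re) hs hs').1.trans ?_
    have h1 : ySize q ε (s.re : ℂ).im ≤ Y := ySize_mono hε.le (by simp)
    have h2 : ‖(s.re : ℂ) - 1‖ = s.re - 1 := by
      rw [← ofReal_one, ← ofReal_sub, norm_real,
        Real.norm_of_nonneg hs0.le]
    rw [h2]
    have h3 : (s.re - 1) / 2 ≤ min 1 (s.re - 1) := le_min (by linarith) (by linarith)
    calc 2 * C * ySize q ε (s.re : ℂ).im / min 1 (s.re - 1) ≤ 2 * C * Y / ((s.re - 1) / 2) := by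
          gcongr
      _ = _ := by field_simp; norm_num
  have hY2 : ySize q ε (2 * s.im) ≤ 2 * Y := ySize_le_two_mul hε.le hε1 (by
    rw [abs_mul, abs_two]; linarith)
  have hN := norm_LSeries_coefL_le hε.le hC4 hCA (h q (χ ^ 2)) (s := ⟨s.re, 2 * s.im⟩) hs hs'
  have hm0 : 0 < min 1 ‖s - 1‖ := by
    refine lt_min one_pos (lt_of_lt_of_le ?_ (re_le_norm _))
    rw [sub_re, one_re]
    linarith
  have fin : ∀ m : ℝ, 0 < m → ‖LSeries (coefL K (χ ^ 2)) ⟨s.re, 2 * s.im⟩‖ ≤ 4 * C * Y / m →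
      1 / (4 * C) ^ 4 * (s.re - 1) ^ 3 * m ≤ L ^ 4 * Y ^ 4 := by
    intro m hm hb
    have h1 : 1 ≤ (4 * C * Y / (s.re - 1)) ^ 3 * L ^ 4 * (4 * C * Y / m) :=
      h341.trans (by gcongr)
    have h2 : (4 * C * Y / (s.re - 1)) ^ 3 * L ^ 4 * (4 * C * Y / m) =
        L ^ 4 * Y ^ 4 / (1 / (4 * C) ^ 4 * (s.re - 1) ^ 3 * m) := by
      field_simp
    rw [h2, le_div_iff₀ (by positivity)] at h1
    linarith
  refine ⟨fin _ hm0 (hN.1.trans ?_), fun hS => ?_⟩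
  · have h1 : ‖s - 1‖ ≤ ‖(⟨s.re, 2 * s.im⟩ : ℂ) - 1‖ := by
      rw [norm_def, norm_def]
      refine Real.sqrt_le_sqrt ?_
      rw [normSq_apply, normSq_apply]
      simp only [sub_re, sub_im, one_im, one_re, sub_zero]
      nlinarith [mul_self_nonneg s.im]
    calc _ ≤ 2 * C * (2 * Y) / min 1 ‖s - 1‖ := by
          gcongr
      _ = _ := by ring
  · have := fin 1 one_pos ((hN.2 (resL_eq_zero K (by rwa [TrivG_sq_iff]))).trans ?_)
    · linarith
    · calc _ ≤ 2 * C * (2 * Y) := by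
            gcongr
        _ = _ := by ring

theorem exists_LBound_Lfun {ε : ℝ} (hε : 0 < ε) (hε1 : ε ≤ 1) : ∃ C c : ℝ, 1 ≤ C ∧ 0 < c ∧ c ≤ 1 ∧
    ∀ (q : ℕ) [NeZero q] (χ : DirichletCharacter ℂ q), ¬ TrivG K χ → LBound q ε C c (Lfun K χ) := by
  obtain ⟨C, c, hC, hA, hc, hc1, h⟩ := exists_LBound_data K hε hε1
  obtain ⟨c', hc', h'⟩ := exists_siegel K hε
  refine ⟨C, min c c', by linarith, lt_min hc hc', (min_le_left _ _).trans hc1,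
    fun q _ χ hT => ⟨(h q χ).1, fun s hs hs' => ?_, ?_⟩⟩
  · rw [← LSeries_eq_Lfun K hT hs]
    have hs0 : 0 ≤ s.re - 1 := by linarith
    refine le_trans ?_ ((h q χ).2 s hs hs').1
    have h0 : 0 ≤ min 1 ‖s - 1‖ := le_min zero_le_one (norm_nonneg _)
    gcongr
    · exact min_le_left _ _
    · exact pow_le_of_le_one h0 (min_le_left _ _) (by norm_num)
  · by_cases hS : SignG K χ
    · left
      have hq : (0 : ℝ) < q := by exact_mod_cast NeZero.pos q
      calc min c c' ≤ c' := min_le_right _ _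
        _ = c' * (q : ℝ) ^ (-ε) * (q : ℝ) ^ ε := by
          rw [mul_assoc, ← Real.rpow_add hq, neg_add_cancel, Real.rpow_zero, mul_one]
        _ ≤ _ := by
          gcongr
          exact h' q χ hS hT
    · right
      intro s hs hs'
      rw [← LSeries_eq_Lfun K hT hs]
      have hs0 : 0 ≤ s.re - 1 := by linarith
      refine le_trans ?_ (((h q χ).2 s hs hs').2 hS)
      gcongr
      exact min_le_left _ _

/-- The Dedekind zeta function with its pole removed. -/
noncomputable def zetaReg (s : ℂ) : ℂ :=
  (resL K (1 : DirichletCharacter ℂ 1) + (s - 1) * Lfun K (1 : DirichletCharacter ℂ 1) s) / (s + 1)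

theorem zetaReg_eq {s : ℂ} (hs : 1 < s.re) :
    zetaReg K s = (s - 1) / (s + 1) * LSeries (coefL K (1 : DirichletCharacter ℂ 1)) s := by
  have h1 : s - 1 ≠ 0 := fun h => by
    have := congrArg re h
    rw [sub_re, one_re, zero_re] at this
    linarith
  rw [zetaReg, LSeries_eq_regL (hasMean' K _) hs, ← Lfun]
  field_simp

theorem exists_LBound_zetaReg {ε : ℝ} (hε : 0 < ε) (hε1 : ε ≤ 1) : ∃ C c : ℝ, 1 ≤ C ∧ 0 < c ∧
    c ≤ 1 ∧ LBound 1 ε C c (zetaReg K) := by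
  obtain ⟨C, c, hC, hA, hc, hc1, h⟩ := exists_LBound_data K hε hε1
  obtain ⟨κ, hκ, hres⟩ := resL_one_pos K
  have hc3 : c / 81 ≤ c := by linarith
  have hup := (h 1 1).1
  refine ⟨2 * C, min (c / 81) (κ / 2), by linarith, by positivity, (min_le_left _ _).trans
    (hc3.trans hc1), ⟨?_, ?_⟩, ?_, Or.inl ?_⟩
  · intro s hs
    have h1 : 2 / (2 * C) ≤ 1 / 4 := by
      rw [div_le_div_iff₀ (by positivity) (by norm_num)]
      linarith
    have h2 : s + 1 ≠ 0 := fun h => by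
      have := congrArg re h
      rw [add_re, one_re, zero_re] at this
      linarith
    have h3 : DifferentiableAt ℂ (Lfun K (1 : DirichletCharacter ℂ 1)) s := hup.diff s (by
      refine lt_of_le_of_lt ?_ hs
      gcongr
      linarith)
    unfold zetaReg
    fun_prop (disch := exact h2)
  · intro s hs hs'
    have hY := one_le_ySize le_rfl hε.le s.im (q := 1)
    have h1 : 1 / (2 * C * ySize 1 ε s.im) ≤ 1 / (C * ySize 1 ε s.im) := by
      gcongr
      linarith
    have h2 : 1 / (2 * C * ySize 1 ε s.im) ≤ 1 := by
      rw [div_le_one (by positivity)]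
      nlinarith
    have h3 : 0 ≤ s.re := by linarith
    have h4 : 1 ≤ ‖s + 1‖ := by
      refine le_trans ?_ (re_le_norm _)
      rw [add_re, one_re]
      linarith
    have h5 : ‖s - 1‖ ≤ ‖s + 1‖ := by
      rw [norm_def, norm_def]
      refine Real.sqrt_le_sqrt ?_
      rw [normSq_apply, normSq_apply]
      simp only [sub_re, sub_im, one_im, one_re, sub_zero,
        add_re, add_im, add_zero]
      nlinarith
    rw [zetaReg, norm_div, div_le_iff₀ (by linarith)]
    have h6 := (hasMean' K (1 : DirichletCharacter ℂ 1)).norm_le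
    have h7 := hup.upper s (by linarith) hs'
    calc _ ≤ ‖resL K (1 : DirichletCharacter ℂ 1)‖ + ‖s - 1‖ * ‖Lfun K (1 : DirichletCharacter ℂ 1) s‖ := by
          refine (norm_add_le _ _).trans (le_of_eq ?_)
          rw [norm_mul]
      _ ≤ C * ySize 1 ε s.im * ‖s + 1‖ + ‖s + 1‖ * (C * ySize 1 ε s.im) := by
          gcongr
          calc _ ≤ C * 1 * 1 := by linarith
            _ ≤ _ := by gcongr
      _ = _ := by ring
  · intro s hs hs'
    have h1 := ((h 1 1).2 s hs hs').1
    rw [zetaReg_eq K hs, norm_mul, mul_pow]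
    have hs0 : 0 < s.re - 1 := by linarith
    have h4 : 0 < ‖s + 1‖ := by
      refine lt_of_lt_of_le ?_ (re_le_norm _)
      rw [add_re, one_re]
      linarith
    have h0 : 0 ≤ min 1 ‖s - 1‖ := le_min zero_le_one (norm_nonneg _)
    have h5 : min 1 ‖s - 1‖ / 3 ≤ ‖(s - 1) / (s + 1)‖ := by
      rw [norm_div, div_le_div_iff₀ (by norm_num) h4]
      have h6 : ‖s + 1‖ ≤ ‖s - 1‖ + 2 := by
        calc ‖s + 1‖ = ‖(s - 1) + 2‖ := by ring_nf
          _ ≤ _ := (norm_add_le _ _).trans (by simp)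
      rcases le_total 1 ‖s - 1‖ with h7 | h7
      · rw [min_eq_left h7]; linarith
      · rw [min_eq_right h7]; nlinarith [norm_nonneg (s - 1)]
    calc min (c / 81) (κ / 2) * (s.re - 1) ^ 3 * min 1 ‖s - 1‖ ^ 5
        ≤ c / 81 * (s.re - 1) ^ 3 * min 1 ‖s - 1‖ ^ 5 := by
          gcongr
          exact min_le_left _ _
      _ = (min 1 ‖s - 1‖ / 3) ^ 4 * (c * (s.re - 1) ^ 3 * min 1 ‖s - 1‖) := by ring
      _ ≤ ‖(s - 1) / (s + 1)‖ ^ 4 * (‖LSeries (coefL K (1 : DirichletCharacter ℂ 1)) s‖ ^ 4 *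
          ySize 1 ε s.im ^ 4) := by gcongr
      _ = _ := by ring
  · have : zetaReg K 1 = ((κ / 2 : ℝ) : ℂ) := by
      rw [zetaReg, hres]
      push_cast
      norm_num
    rw [this, norm_real, Real.norm_of_nonneg (by positivity), Nat.cast_one, Real.one_rpow,
      mul_one]
    exact min_le_right _ _

end LFunBounds

section LogDerivBounds

open Filter Topology Complex

variable (K : Type*) [Field K] [NumberField K]

theorem eventually_one_lt_re {s : ℂ} (hs : 1 < s.re) : ∀ᶠ z : ℂ in 𝓝 s, 1 < z.re :=
  (isOpen_lt continuous_const continuous_re).mem_nhds hs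

theorem hasDerivAt_LSeries_coefL {q : ℕ} [NeZero q] (χ : DirichletCharacter ℂ q) {s : ℂ}
    (hs : 1 < s.re) : HasDerivAt (LSeries (coefL K χ))
      (-(LSeries (coefL K χ) s * LSeries (coefLam K χ) s)) s :=
  LogPair.hasDerivAt (fun _ h => summable_coefL K (NeZero.pos q) χ h)
    (fun _ h => summable_coefLam K χ h) (logPair_coefL K χ) hs

theorem LSeries_coefLam_eq {q : ℕ} [NeZero q] {χ : DirichletCharacter ℂ q} (h : ¬ TrivG K χ) {s : ℂ}
    (hs : 1 < s.re) : LSeries (coefLam K χ) s = -(deriv (Lfun K χ) s / Lfun K χ s) := by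
  have h1 : Lfun K χ =ᶠ[𝓝 s] LSeries (coefL K χ) :=
    (eventually_one_lt_re hs).mono fun z hz => (LSeries_eq_Lfun K h hz).symm
  have h2 := LSeries_coefL_ne_zero K (NeZero.pos q) χ hs
  rw [h1.deriv_eq, h1.eq_of_nhds, (hasDerivAt_LSeries_coefL K χ hs).deriv]
  field_simp

theorem exists_norm_iteratedDeriv_coefLam_le (J : ℕ) : ∃ C : ℝ, 0 < C ∧ ∀ (q : ℕ) [NeZero q]
    (χ : DirichletCharacter ℂ q), ¬ TrivG K χ → ∀ s : ℂ, 1 < s.re → s.re ≤ 2 →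
      ‖iteratedDeriv J (LSeries (coefLam K χ)) s‖ ≤ C * ySize q (1 / 2) s.im := by
  have hε1 : (1 : ℝ) / (54 * (J + 1)) ≤ 1 := by
    rw [div_le_one (by positivity)]
    linarith [(Nat.cast_nonneg J : (0 : ℝ) ≤ J)]
  obtain ⟨C, c, hC, hc, hc1, h⟩ := exists_LBound_Lfun K (by positivity) hε1
  obtain ⟨C', hC', h'⟩ := LBound.exists_norm_iteratedDeriv_le J hC hc hc1
  refine ⟨C', hC', fun q _ χ hT s hs hs' => ?_⟩
  have h1 : LSeries (coefLam K χ) =ᶠ[𝓝 s] fun z => -(deriv (Lfun K χ) z / Lfun K χ z) :=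
    (eventually_one_lt_re hs).mono fun z hz => LSeries_coefLam_eq K hT hz
  rw [h1.iteratedDeriv_eq, iteratedDeriv_fun_neg, norm_neg]
  exact (h' q _ (NeZero.pos q) (h q χ hT) s hs.le hs').2

/-- The coefficients `Λ_K(n) - 1`. -/
noncomputable def coefPrin (n : ℕ) : ℂ := (vmK K n : ℂ) - 1

theorem coefPrin_eq : coefPrin K = coefLam K (1 : DirichletCharacter ℂ 1) - fun _ => 1 := by
  ext n
  have : IsUnit (n : ZMod 1) := isUnit_of_subsingleton _
  rw [Pi.sub_apply, coefPrin, coefLam, MulChar.one_apply this, one_mul]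

theorem summable_coefPrin {s : ℂ} (hs : 1 < s.re) : LSeriesSummable (coefPrin K) s := by
  rw [coefPrin_eq]
  exact (summable_coefLam K _ hs).sub (HasMean.const_one.lseriesSummable hs)

theorem LSeries_coefPrin_add {s : ℂ} (hs : 1 < s.re) :
    LSeries (coefPrin K) s + (1 / (s + 1) + regL (fun _ => 1) 1 s) =
      -(deriv (zetaReg K) s / zetaReg K s) := by
  have hL := LSeries_coefL_ne_zero K one_pos (1 : DirichletCharacter ℂ 1) hs
  have hm : s - 1 ≠ 0 := fun h => by
    have := congrArg re h
    rw [sub_re, one_re, zero_re] at this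
    linarith
  have hp : s + 1 ≠ 0 := fun h => by
    have := congrArg re h
    rw [add_re, one_re, zero_re] at this
    linarith
  have h1 : zetaReg K =ᶠ[𝓝 s] fun z => (z - 1) / (z + 1) *
      LSeries (coefL K (1 : DirichletCharacter ℂ 1)) z :=
    (eventually_one_lt_re hs).mono fun z hz => zetaReg_eq K hz
  have h2 := ((((hasDerivAt_id s).sub_const 1).div ((hasDerivAt_id s).add_const 1) hp).mul
    (hasDerivAt_LSeries_coefL K (1 : DirichletCharacter ℂ 1) hs)).deriv
  have h3 : deriv (zetaReg K) s = _ := h1.deriv_eq.trans h2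
  have h4 : LSeries (coefPrin K) s = LSeries (coefLam K (1 : DirichletCharacter ℂ 1)) s -
      LSeries (fun _ => 1) s := by
    rw [coefPrin_eq]
    exact LSeries_sub (summable_coefLam K _ hs) (HasMean.const_one.lseriesSummable hs)
  rw [h3, h1.eq_of_nhds, h4, LSeries_eq_regL HasMean.const_one hs]
  simp only [id, Pi.div_apply]
  field_simp
  ring

theorem exists_norm_iteratedDeriv_coefPrin_le (J : ℕ) : ∃ C : ℝ, 0 < C ∧ ∀ s : ℂ, 1 < s.re →
    s.re ≤ 2 → ‖iteratedDeriv J (LSeries (coefPrin K)) s‖ ≤ C * ySize 1 (1 / 2) s.im := by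
  have hε1 : (1 : ℝ) / (54 * (J + 1)) ≤ 1 := by
    rw [div_le_one (by positivity)]
    linarith [(Nat.cast_nonneg J : (0 : ℝ) ≤ J)]
  obtain ⟨C, c, hC, hc, hc1, h⟩ := exists_LBound_zetaReg K (by positivity) hε1
  obtain ⟨C', hC', h'⟩ := LBound.exists_norm_iteratedDeriv_le J hC hc hc1
  have hε : (0 : ℝ) < 1 / (2 * (J + 1)) := by positivity
  obtain ⟨C₁, hC₁, -, h₁⟩ := exists_LUpper_regL (D₀ := 1) (δ := 1 / 2) (A := 1) (by norm_num)
    le_rfl le_rfl 0 hε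
  have h₁' := h₁ 1 (fun _ => 1) 1 le_rfl (by simpa using HasMean.const_one)
  have hU : LUpper 1 (1 / (2 * (J + 1))) (C₁ + 1) fun z => 1 / (z + 1) + regL (fun _ => 1) 1 z := by
    refine ⟨fun s hs => ?_, fun s hs hs' => ?_⟩
    · have h2 : 2 / (C₁ + 1) ≤ 2 / C₁ := by gcongr; linarith
      have h3 : 2 / C₁ ≤ 1 / 2 := by
        rw [div_le_div_iff₀ (by linarith) (by norm_num)]
        linarith
      have hp : s + 1 ≠ 0 := fun h => by
        have := congrArg re h
        rw [add_re, one_re, zero_re] at this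
        linarith
      have h4 := h₁'.diff s (by linarith)
      fun_prop (disch := exact hp)
    · have hY := one_le_ySize le_rfl hε.le s.im (q := 1)
      have h1 : 1 / ((C₁ + 1) * ySize 1 (1 / (2 * (J + 1))) s.im) ≤
          1 / (C₁ * ySize 1 (1 / (2 * (J + 1))) s.im) := by
        gcongr
        linarith
      have h2 : 1 / (C₁ * ySize 1 (1 / (2 * (J + 1))) s.im) ≤ 1 := by
        rw [div_le_one (by positivity)]
        nlinarith
      have h4 : 1 ≤ ‖s + 1‖ := by
        refine le_trans ?_ (re_le_norm _)
        rw [add_re, one_re]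
        linarith
      refine (norm_add_le _ _).trans ?_
      rw [add_mul, add_comm]
      refine add_le_add (h₁'.upper s (by linarith) hs') ?_
      rw [norm_div, norm_one, one_mul]
      exact ((div_le_one (by linarith)).2 h4).trans hY
  obtain ⟨C₂, hC₂, h₂⟩ := LUpper.exists_norm_iteratedDeriv_le J (by linarith : 1 ≤ C₁ + 1)
  refine ⟨C' + C₂, by positivity, fun s hs hs' => ?_⟩
  have e1 := (h' 1 _ le_rfl h s hs.le hs').2
  have e2 := h₂ 1 _ le_rfl hU s hs.le hs'
  have hopen : IsOpen {z : ℂ | 1 < z.re} := isOpen_lt continuous_const continuous_re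
  have c1 : ContDiffAt ℂ J (LSeries (coefPrin K)) s := by
    refine (LSeries_analyticOnNhd (coefPrin K) s ?_).contDiffAt
    exact abscissa_lt (fun z hz => summable_coefPrin K hz) hs
  have c2 : ContDiffAt ℂ J (fun z => 1 / (z + 1) + regL (fun _ => 1) 1 z) s := by
    have : DifferentiableOn ℂ (fun z => 1 / (z + 1) + regL (fun _ => 1) 1 z) {z : ℂ | 1 < z.re} :=
      fun z hz => (hU.diff z (by
        have : (1 : ℝ) < z.re := hz
        have : 0 < 2 / (C₁ + 1) := by positivity
        linarith)).differentiableWithinAt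
    exact (this.analyticAt (hopen.mem_nhds hs)).contDiffAt
  have h3 : (fun z => LSeries (coefPrin K) z + (1 / (z + 1) + regL (fun _ => 1) 1 z)) =ᶠ[𝓝 s]
      fun z => -(deriv (zetaReg K) z / zetaReg K z) :=
    (eventually_one_lt_re hs).mono fun z hz => LSeries_coefPrin_add K hz
  have h4 := h3.iteratedDeriv_eq J
  rw [iteratedDeriv_fun_add c1 c2, iteratedDeriv_fun_neg] at h4
  rw [eq_sub_of_add_eq h4]
  refine (norm_sub_le _ _).trans ?_
  rw [norm_neg, add_mul]
  exact add_le_add e1 e2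

end LogDerivBounds

section Perron

open MeasureTheory Complex LSeries

/-- The weight `(1 - y)₊`, supported on `(0, 1]`. -/
noncomputable def rieszWeight : ℝ → ℂ := fun y =>
  (Set.Ioc 0 1).indicator (fun _ => (1 : ℂ)) y - (Set.Ioc 0 1).indicator (fun t : ℝ => (t : ℂ) ^ (1 : ℂ)) y

theorem rieszWeight_of_pos {y : ℝ} (hy : 0 < y) : rieszWeight y = ((max (1 - y) 0 : ℝ) : ℂ) := by
  unfold rieszWeight
  by_cases h : y ≤ 1
  · have hm : y ∈ Set.Ioc (0 : ℝ) 1 := ⟨hy, h⟩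
    rw [Set.indicator_of_mem hm, Set.indicator_of_mem hm, max_eq_left (by linarith), cpow_one]
    push_cast
    rfl
  · have hm : y ∉ Set.Ioc (0 : ℝ) 1 := fun h' => h h'.2
    rw [Set.indicator_of_notMem hm, Set.indicator_of_notMem hm, max_eq_right (by linarith)]
    simp

theorem hasMellin_rieszWeight {s : ℂ} (hs : 0 < s.re) :
    HasMellin rieszWeight s (1 / s - 1 / (s + 1)) := by
  have h1 := hasMellin_one_Ioc hs
  have h2 := hasMellin_cpow_Ioc (s := s) 1 (by simp; linarith)
  have h := hasMellin_sub h1.1 h2.1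
  rwa [h1.2, h2.2] at h

theorem norm_kernel_le {s : ℂ} (hs : 1 ≤ s.re) :
    ‖1 / s - 1 / (s + 1)‖ ≤ (1 + s.im ^ 2)⁻¹ := by
  have h0 : s ≠ 0 := fun h => by rw [h, zero_re] at hs; linarith
  have h1 : s + 1 ≠ 0 := fun h => by
    have := congrArg re h
    rw [add_re, one_re, zero_re] at this
    linarith
  have e : 1 / s - 1 / (s + 1) = (s * (s + 1))⁻¹ := by field_simp; ring
  rw [e, norm_inv, norm_mul]
  have hsq : 1 + s.im ^ 2 ≤ ‖s‖ ^ 2 := by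
    rw [Complex.sq_norm, normSq_apply]
    nlinarith
  have hle : ‖s‖ ≤ ‖s + 1‖ := by
    rw [← abs_of_nonneg (norm_nonneg s), ← abs_of_nonneg (norm_nonneg (s + 1)), ← sq_le_sq,
      Complex.sq_norm, normSq_apply, Complex.sq_norm, normSq_apply, add_re, add_im,
      one_re, one_im]
    nlinarith
  gcongr
  nlinarith [norm_nonneg s]

theorem integral_kernel_cpow {σ : ℝ} (hσ : 1 < σ) {y : ℝ} (hy : 0 < y) :
    ∫ t : ℝ, (y : ℂ) ^ (-((σ : ℂ) + t * I)) * (1 / (σ + t * I) - 1 / (σ + t * I + 1)) =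
      2 * Real.pi * rieszWeight y := by
  have hv : ∀ t : ℝ, mellin rieszWeight (σ + t * I) = 1 / (σ + t * I) - 1 / (σ + t * I + 1) :=
    fun t => (hasMellin_rieszWeight (s := σ + t * I) (by simp; linarith)).2
  have hc : ContinuousAt rieszWeight y := by
    have h : ContinuousAt (fun y : ℝ => ((max (1 - y) 0 : ℝ) : ℂ)) y := by fun_prop
    refine h.congr ?_
    filter_upwards [lt_mem_nhds hy] with z hz using (rieszWeight_of_pos hz).symm
  have hi : VerticalIntegrable (mellin rieszWeight) σ := by
    unfold VerticalIntegrable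
    simp_rw [hv]
    refine integrable_inv_one_add_sq.mono' ?_ (Filter.Eventually.of_forall fun t => ?_)
    · refine Continuous.aestronglyMeasurable ?_
      have h0 : ∀ t : ℝ, (σ : ℂ) + t * I ≠ 0 := fun t h => by
        have := congrArg re h
        simp at this
        linarith
      have h1 : ∀ t : ℝ, (σ : ℂ) + t * I + 1 ≠ 0 := fun t h => by
        have := congrArg re h
        simp at this
        linarith
      fun_prop (disch := assumption)
    · simpa using norm_kernel_le (s := σ + t * I) (by simp; linarith)
  have h := mellinInv_mellin_eq σ rieszWeight hy
    (hasMellin_rieszWeight (s := σ) (by simp; linarith)).1 hi hc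
  unfold mellinInv at h
  simp_rw [hv, smul_eq_mul] at h
  rw [← h, one_div, real_smul]
  push_cast
  rw [← mul_assoc, mul_inv_cancel₀ (by simp [Real.pi_ne_zero]), one_mul]

theorem integrable_sqrt_mul_kernel :
    Integrable fun t : ℝ => (|t| + 3) ^ (1 / 2 : ℝ) * (1 + t ^ 2)⁻¹ := by
  have h := (integrable_rpow_neg_one_add_norm_sq (E := ℝ) (μ := volume) (r := 3 / 2)
    (by simp; norm_num)).const_mul ((18 : ℝ) ^ (1 / 4 : ℝ))
  refine h.mono' (Measurable.aestronglyMeasurable (by fun_prop))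
    (Filter.Eventually.of_forall fun t => ?_)
  have h1 : (|t| + 3) ^ (1 / 2 : ℝ) ≤ (18 : ℝ) ^ (1 / 4 : ℝ) * (1 + t ^ 2) ^ (1 / 4 : ℝ) := by
    rw [← Real.mul_rpow (by norm_num) (by positivity)]
    have : (|t| + 3) ^ (1 / 2 : ℝ) = ((|t| + 3) ^ 2) ^ (1 / 4 : ℝ) := by
      rw [← Real.rpow_natCast, ← Real.rpow_mul (by positivity)]
      norm_num
    rw [this]
    refine Real.rpow_le_rpow (by positivity) ?_ (by norm_num)
    nlinarith [sq_abs t, sq_nonneg (|t| - 3)]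
  rw [Real.norm_of_nonneg (by positivity), Real.norm_eq_abs, sq_abs]
  calc _ ≤ (18 : ℝ) ^ (1 / 4 : ℝ) * (1 + t ^ 2) ^ (1 / 4 : ℝ) * (1 + t ^ 2)⁻¹ := by gcongr
    _ = _ := by
      rw [mul_assoc, ← Real.rpow_neg_one, ← Real.rpow_add (by positivity)]
      norm_num

/-- The smoothed Perron formula, as an upper bound for Riesz means. -/
theorem exists_norm_riesz_le : ∃ C : ℝ, 0 < C ∧ ∀ (a : ℕ → ℂ) (σ M x : ℝ), 1 < σ →
    LSeriesSummable a σ → (∀ t : ℝ, ‖LSeries a (σ + t * I)‖ ≤ M * (|t| + 3) ^ (1 / 2 : ℝ)) →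
    0 < x → ‖∑ n ∈ Finset.Icc 1 ⌊x⌋₊, a n * (1 - n / x)‖ ≤ C * M * x ^ σ := by
  set I₀ := ∫ t : ℝ, (|t| + 3) ^ (1 / 2 : ℝ) * (1 + t ^ 2)⁻¹
  have hI : 0 ≤ I₀ := integral_nonneg fun t => by positivity
  refine ⟨I₀ + 1, by linarith, fun a σ M x hσ hs hM hx => ?_⟩
  have hM0 : 0 ≤ M := by
    have := (norm_nonneg _).trans (hM 0)
    exact nonneg_of_mul_nonneg_left this (by positivity)
  set k : ℝ → ℂ := fun t => 1 / (σ + t * I) - 1 / (σ + t * I + 1) with hk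
  have hkn : ∀ t : ℝ, ‖k t‖ ≤ (1 + t ^ 2)⁻¹ := fun t => by
    have h := norm_kernel_le (s := σ + t * I) (by simp; linarith)
    rwa [show ((σ : ℂ) + t * I).im = t by simp] at h
  have hkc : Continuous k := by
    have h0 : ∀ t : ℝ, (σ : ℂ) + t * I ≠ 0 := fun t h => by
      have := congrArg re h
      simp at this
      linarith
    have h1 : ∀ t : ℝ, (σ : ℂ) + t * I + 1 ≠ 0 := fun t h => by
      have := congrArg re h
      simp at this
      linarith
    simp only [hk]
    fun_prop (disch := assumption)
  set F : ℕ → ℝ → ℂ := fun n t => term a (σ + t * I) n * ((x : ℂ) ^ ((σ : ℂ) + t * I) * k t)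
    with hF
  have hxc : (x : ℂ) ≠ 0 := by exact_mod_cast hx.ne'
  have hxn : ∀ t : ℝ, ‖(x : ℂ) ^ ((σ : ℂ) + t * I)‖ = x ^ σ := fun t => by
    rw [norm_cpow_eq_rpow_re_of_pos hx]
    simp
  have htn : ∀ n (t : ℝ), ‖term a (σ + t * I) n‖ = ‖term a σ n‖ := fun n t => by
    rw [norm_term_eq, norm_term_eq]
    simp
  have hFn : ∀ n t, ‖F n t‖ ≤ ‖term a σ n‖ * x ^ σ * (1 + t ^ 2)⁻¹ := fun n t => by
    simp only [hF]
    rw [norm_mul, norm_mul, htn, hxn, ← mul_assoc]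
    gcongr
    exact hkn t
  have hFc : ∀ n, Continuous (F n) := fun n => by
    have hx' : Continuous fun t : ℝ => (x : ℂ) ^ ((σ : ℂ) + t * I) :=
      Continuous.const_cpow (by fun_prop) (Or.inl hxc)
    have ht : Continuous fun t : ℝ => term a (σ + t * I) n := by
      by_cases hn : n = 0
      · simp only [hn, term_zero]
        fun_prop
      · simp only [term_of_ne_zero hn]
        have hc : Continuous fun t : ℝ => (n : ℂ) ^ ((σ : ℂ) + t * I) :=
          Continuous.const_cpow (by fun_prop) (Or.inl (by exact_mod_cast hn))
        exact continuous_const.div hc fun t => by simp [cpow_eq_zero_iff, hn]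
    exact ht.mul (hx'.mul hkc)
  have hFi : ∀ n, Integrable (F n) := fun n =>
    (integrable_inv_one_add_sq.const_mul (‖term a σ n‖ * x ^ σ)).mono'
      (hFc n).aestronglyMeasurable (Filter.Eventually.of_forall (hFn n))
  have hsum : Summable fun n => ∫ t, ‖F n t‖ := by
    refine Summable.of_nonneg_of_le (fun n => integral_nonneg fun t => norm_nonneg _)
      (fun n => integral_mono (hFi n).norm (integrable_inv_one_add_sq.const_mul _) (hFn n)) ?_
    simp_rw [integral_const_mul]
    exact (hs.norm.mul_right _).mul_right _
  have key := hasSum_integral_of_summable_integral_norm hFi hsum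
  have hterm : ∀ n, ∫ t, F n t = if n ∈ Finset.Icc 1 ⌊x⌋₊ then 2 * Real.pi * (a n * (1 - n / x))
      else 0 := fun n => by
    by_cases hn : n = 0
    · simp [hF, hn]
    have hn' : (0 : ℝ) < n := by exact_mod_cast Nat.pos_of_ne_zero hn
    have e : ∀ t, F n t = a n * ((((n / x : ℝ) : ℂ)) ^ (-((σ : ℂ) + t * I)) * k t) := fun t => by
      simp only [hF, term_of_ne_zero hn]
      have hnx : (n : ℂ) = ((n / x : ℝ) : ℂ) * (x : ℂ) := by
        push_cast
        field_simp
      have h0 : (x : ℂ) ^ ((σ : ℂ) + t * I) ≠ 0 := by simp [cpow_eq_zero_iff, hxc]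
      rw [hnx, mul_cpow_ofReal_nonneg (by positivity) hx.le, cpow_neg]
      field_simp
    simp_rw [e]
    rw [integral_const_mul, integral_kernel_cpow hσ (by positivity),
      rieszWeight_of_pos (by positivity)]
    split_ifs with h
    · rw [Finset.mem_Icc, Nat.le_floor_iff hx.le] at h
      rw [max_eq_left (by rw [sub_nonneg, div_le_one hx]; exact h.2)]
      push_cast
      ring
    · rw [Finset.mem_Icc, Nat.le_floor_iff hx.le, not_and, not_le] at h
      rw [max_eq_right (by rw [sub_nonpos, one_le_div hx]; exact (h (Nat.pos_of_ne_zero hn)).le)]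
      simp
  simp_rw [hterm] at key
  have h2 := (hasSum_sum_of_ne_finset_zero (s := Finset.Icc 1 ⌊x⌋₊) (fun n hn => if_neg hn)).unique key
  rw [Finset.sum_congr rfl fun n hn => if_pos hn, ← Finset.mul_sum] at h2
  have h3 : ∀ t, ∑' n, F n t = LSeries a (σ + t * I) * ((x : ℂ) ^ ((σ : ℂ) + t * I) * k t) :=
    fun t => by
      simp only [hF]
      rw [tsum_mul_right]
      rfl
  simp_rw [h3] at h2
  have h4 : ‖∫ t : ℝ, LSeries a (σ + t * I) * ((x : ℂ) ^ ((σ : ℂ) + t * I) * k t)‖ ≤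
      M * x ^ σ * I₀ := by
    rw [← integral_const_mul]
    refine norm_integral_le_of_norm_le (integrable_sqrt_mul_kernel.const_mul _)
      (Filter.Eventually.of_forall fun t => ?_)
    rw [norm_mul, norm_mul, hxn]
    calc _ ≤ M * (|t| + 3) ^ (1 / 2 : ℝ) * (x ^ σ * (1 + t ^ 2)⁻¹) := by
          gcongr
          · exact hM t
          · exact hkn t
      _ = _ := by ring
  rw [← h2, norm_mul, norm_mul, norm_ofNat, norm_real,
    Real.norm_of_nonneg Real.pi_pos.le] at h4
  have h5 : 1 ≤ 2 * Real.pi := by linarith [Real.pi_gt_three]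
  have h6 : 0 ≤ M * x ^ σ := by positivity
  nlinarith [norm_nonneg (∑ n ∈ Finset.Icc 1 ⌊x⌋₊, a n * (1 - n / x))]

end Perron

section SiegelWalfisz

open Finset Real

theorem norm_sum_mul_antitone_le {b : ℕ → ℂ} {w : ℕ → ℝ} {T : ℝ} (hw : Antitone w)
    (hw0 : ∀ n, 0 ≤ w n) (k : ℕ) (hT : ∀ i ≤ k, ‖∑ j ∈ range i, b j‖ ≤ T) :
    ‖∑ j ∈ range k, b j * w j‖ ≤ T * w 0 := by
  have e : ∀ k, ∑ j ∈ range k, b j * w j = (∑ j ∈ range k, b j) * w k +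
      ∑ i ∈ range k, (∑ j ∈ range (i + 1), b j) * ((w i - w (i + 1) : ℝ) : ℂ) := by
    intro k
    induction k with
    | zero => simp
    | succ k ih =>
      rw [sum_range_succ, ih, sum_range_succ (fun i => (∑ j ∈ range (i + 1), b j) *
        ((w i - w (i + 1) : ℝ) : ℂ)), sum_range_succ b]
      push_cast
      ring
  rw [e]
  refine (norm_add_le _ _).trans ?_
  have h1 : ‖(∑ j ∈ range k, b j) * (w k : ℂ)‖ ≤ T * w k := by
    rw [norm_mul, Complex.norm_real, norm_of_nonneg (hw0 k)]
    exact mul_le_mul_of_nonneg_right (hT k le_rfl) (hw0 k)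
  have h2 : ‖∑ i ∈ range k, (∑ j ∈ range (i + 1), b j) * ((w i - w (i + 1) : ℝ) : ℂ)‖ ≤
      ∑ i ∈ range k, T * (w i - w (i + 1)) := by
    refine norm_sum_le_of_le _ fun i hi => ?_
    have := hw (Nat.le_succ i)
    rw [norm_mul, Complex.norm_real, norm_of_nonneg (sub_nonneg.2 this)]
    exact mul_le_mul_of_nonneg_right (hT _ (mem_range.1 hi)) (sub_nonneg.2 this)
  rw [← mul_sum, sum_range_sub'] at h2
  linarith

theorem card_Ioc_floor_le {y h : ℝ} (hy : 0 ≤ y) (hh : 0 ≤ h) :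
    ((Ioc ⌊y⌋₊ ⌊y + h⌋₊).card : ℝ) ≤ h + 1 := by
  rw [Nat.card_Ioc, Nat.cast_sub (Nat.floor_mono (by linarith))]
  linarith [Nat.floor_le (show 0 ≤ y + h by linarith), Nat.lt_floor_add_one y]

/-- Recovering a partial sum from a difference of Riesz means. -/
theorem mul_norm_sum_le_of_riesz {b : ℕ → ℂ} {y h P G : ℝ} (hy : 0 < y) (hh : 0 < h)
    (hG : ∀ n ∈ Ioc ⌊y⌋₊ ⌊y + h⌋₊, ‖b n‖ ≤ G) (hG0 : 0 ≤ G)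
    (h₁ : y * ‖∑ n ∈ Icc 1 ⌊y⌋₊, b n * (1 - n / (y : ℂ))‖ ≤ P)
    (h₂ : (y + h) * ‖∑ n ∈ Icc 1 ⌊y + h⌋₊, b n * (1 - n / ((y + h : ℝ) : ℂ))‖ ≤ P) :
    h * ‖∑ n ∈ Icc 1 ⌊y⌋₊, b n‖ ≤ 2 * P + h * (h + 1) * G := by
  have e : ∀ z : ℝ, 0 < z → z * ‖∑ n ∈ Icc 1 ⌊z⌋₊, b n * (1 - n / (z : ℂ))‖ =
      ‖∑ n ∈ Icc 1 ⌊z⌋₊, b n * (z - n)‖ := fun z hz => by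
    have hz' : (z : ℂ) ≠ 0 := by exact_mod_cast hz.ne'
    have h : ∀ w : ℂ, z * ‖w‖ = ‖(z : ℂ) * w‖ := fun w => by
      rw [norm_mul, Complex.norm_real, norm_of_nonneg hz.le]
    rw [h, mul_sum]
    congr 1
    refine sum_congr rfl fun n _ => ?_
    field_simp
  rw [e _ hy] at h₁
  rw [e _ (by linarith)] at h₂
  have hsplit : ∑ n ∈ Icc 1 ⌊y + h⌋₊, b n * (((y + h : ℝ) : ℂ) - n) =
      ∑ n ∈ Icc 1 ⌊y⌋₊, b n * (y - n) + h * ∑ n ∈ Icc 1 ⌊y⌋₊, b n +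
      ∑ n ∈ Ioc ⌊y⌋₊ ⌊y + h⌋₊, b n * (((y + h : ℝ) : ℂ) - n) := by
    have hle : ⌊y⌋₊ ≤ ⌊y + h⌋₊ := Nat.floor_mono (by linarith)
    rw [mul_sum, ← sum_add_distrib]
    rw [show Icc 1 ⌊y + h⌋₊ = Ioc 0 ⌊y + h⌋₊ from rfl,
      show Icc 1 ⌊y⌋₊ = Ioc 0 ⌊y⌋₊ from rfl,
      ← sum_Ioc_consecutive _ (Nat.zero_le _) hle]
    congr 1
    refine sum_congr rfl fun n _ => ?_
    push_cast
    ring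
  have htail : ‖∑ n ∈ Ioc ⌊y⌋₊ ⌊y + h⌋₊, b n * (((y + h : ℝ) : ℂ) - n)‖ ≤
      h * (h + 1) * G := by
    calc _ ≤ ∑ n ∈ Ioc ⌊y⌋₊ ⌊y + h⌋₊, G * h := by
          refine norm_sum_le_of_le _ fun n hn => ?_
          rw [norm_mul, ← Complex.ofReal_natCast, ← Complex.ofReal_sub, Complex.norm_real]
          have hn' := mem_Ioc.1 hn
          have h3 := (Nat.floor_lt hy.le).1 hn'.1
          have h4 := (Nat.le_floor_iff (by linarith)).1 hn'.2
          refine mul_le_mul (hG n hn) ?_ (norm_nonneg _) hG0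
          rw [norm_eq_abs, abs_le]
          constructor <;> linarith
      _ = ((Ioc ⌊y⌋₊ ⌊y + h⌋₊).card : ℝ) * (G * h) := by rw [sum_const, nsmul_eq_mul]
      _ ≤ (h + 1) * (G * h) := by
          gcongr
          exact card_Ioc_floor_le hy.le hh.le
      _ = _ := by ring
  have e2 : (h : ℂ) * ∑ n ∈ Icc 1 ⌊y⌋₊, b n =
      ∑ n ∈ Icc 1 ⌊y + h⌋₊, b n * (((y + h : ℝ) : ℂ) - n) -
      ∑ n ∈ Icc 1 ⌊y⌋₊, b n * (y - n) -
      ∑ n ∈ Ioc ⌊y⌋₊ ⌊y + h⌋₊, b n * (((y + h : ℝ) : ℂ) - n) := by rw [hsplit]; ring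
  have e3 := congrArg norm e2
  rw [norm_mul, Complex.norm_real, norm_of_nonneg hh.le] at e3
  rw [e3]
  refine (norm_sub_le _ _).trans ?_
  have := norm_sub_le (∑ n ∈ Icc 1 ⌊y + h⌋₊, b n * (((y + h : ℝ) : ℂ) - n))
    (∑ n ∈ Icc 1 ⌊y⌋₊, b n * (y - n))
  linarith

theorem one_le_log_of_three_le {x : ℝ} (hx : 3 ≤ x) : 1 ≤ log x := by
  rw [le_log_iff_exp_le (by linarith)]
  linarith [exp_one_lt_d9]

theorem log_pow_le_mul (k : ℕ) {x : ℝ} (hx : 1 ≤ x) : log x ^ k ≤ k.factorial * x := by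
  have h := pow_div_factorial_le_exp (log x) (log_nonneg hx) k
  rw [exp_log (by linarith), div_le_iff₀ (by positivity)] at h
  linarith

theorem iterate_logMul_apply (a : ℕ → ℂ) (J n : ℕ) :
    LSeries.logMul^[J] a n = a n * ((log n ^ J : ℝ) : ℂ) := by
  induction J with
  | zero => simp
  | succ J ih =>
    rw [Function.iterate_succ_apply', LSeries.logMul, ih, ← Complex.natCast_log]
    push_cast
    ring

/-- Partial sums of `a(n) (log n)^J` from a bound for the `J`-th derivative of its Dirichlet series. -/
theorem exists_norm_sum_logPow_le (J E : ℕ) (hEJ : E ≤ J + 1) : ∃ C : ℝ, 0 < C ∧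
    ∀ (a : ℕ → ℂ) (D M X : ℝ), 3 ≤ X → 0 ≤ D → (∀ s : ℂ, 1 < s.re → LSeriesSummable a s) →
    (∀ n : ℕ, 1 ≤ n → ‖a n‖ ≤ D * (1 + log n)) →
    (∀ s : ℂ, 1 < s.re → s.re ≤ 2 →
      ‖iteratedDeriv J (LSeries a) s‖ ≤ M * (|s.im| + 3) ^ (1 / 2 : ℝ)) →
    ∀ y : ℝ, 0 < y → y ≤ X →
    ‖∑ n ∈ Icc 1 ⌊y⌋₊, a n * ((log n ^ J : ℝ) : ℂ)‖ ≤
      C * X * (M * log X ^ E + D * log X ^ (J + 1 - E)) := by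
  obtain ⟨C₀, hC₀, hP⟩ := exists_norm_riesz_le
  refine ⟨48 * C₀ + 3 ^ (J + 1) * (1 + E.factorial), by positivity,
    fun a D M X hX hD hs ha hM y hy hyX => ?_⟩
  set L := log X with hLdef
  have hL : 1 ≤ L := one_le_log_of_three_le hX
  have hM0 : 0 ≤ M := by
    have := (norm_nonneg _).trans (hM 2 (by norm_num) (by norm_num))
    exact nonneg_of_mul_nonneg_left this (by positivity)
  have hX0 : 0 < X := by linarith
  set σ := 1 + 1 / L with hσ
  have hσ1 : 1 < σ := by rw [hσ]; have : 0 < 1 / L := by positivity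
                         linarith
  have hσ2 : σ ≤ 2 := by
    have : 1 / L ≤ 1 := by rw [div_le_one (by linarith)]; exact hL
    linarith
  set b : ℕ → ℂ := fun n => a n * ((log n ^ J : ℝ) : ℂ) with hb
  have hbf : LSeries.logMul^[J] a = b := funext fun n => iterate_logMul_apply a J n
  have hXσ : X ^ σ ≤ 3 * X := by
    rw [hσ, rpow_add hX0, rpow_one, rpow_def_of_pos hX0, ← hLdef,
      mul_one_div_cancel (by linarith)]
    nlinarith [exp_one_lt_d9]
  have hR : ∀ z : ℝ, 0 < z → z ≤ 2 * X →
      z * ‖∑ n ∈ Icc 1 ⌊z⌋₊, b n * (1 - n / (z : ℂ))‖ ≤ 24 * C₀ * M * X ^ 2 := by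
    intro z hz hzX
    have h1 : ‖∑ n ∈ Icc 1 ⌊z⌋₊, b n * (1 - n / (z : ℂ))‖ ≤ C₀ * M * z ^ σ := by
      refine hP b σ M z hσ1 ?_ (fun t => ?_) hz
      · rw [← hbf]
        refine LSeriesSummable_of_abscissaOfAbsConv_lt_re ?_
        rw [LSeries.absicssaOfAbsConv_logPowMul]
        exact abscissa_lt hs (by simpa using hσ1)
      · have h := hM (σ + t * Complex.I) (by simpa using hσ1) (by simpa using hσ2)
        rw [LSeries_iteratedDeriv J (abscissa_lt hs (by simpa using hσ1)), hbf, norm_mul] at h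
        simpa using h
    have h2 : z ^ σ ≤ 12 * X := by
      calc z ^ σ ≤ (2 * X) ^ σ := rpow_le_rpow hz.le hzX (by linarith)
        _ = 2 ^ σ * X ^ σ := mul_rpow (by norm_num) hX0.le
        _ ≤ 2 ^ (2 : ℝ) * (3 * X) := by
          gcongr
          norm_num
        _ = 12 * X := by norm_num; ring
    calc _ ≤ (2 * X) * (C₀ * M * (12 * X)) := by
          refine mul_le_mul hzX (h1.trans ?_) (norm_nonneg _) (by positivity)
          gcongr
      _ = _ := by ring
  set h := X / L ^ E with hh
  have hh0 : 0 < h := by positivity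
  have hhX : h ≤ X := div_le_self hX0.le (one_le_pow₀ hL)
  have hone : 1 ≤ E.factorial * h := by
    rw [hh, mul_div_assoc', le_div_iff₀ (by positivity), one_mul]
    exact log_pow_le_mul E (by linarith)
  have hG : ∀ n ∈ Ioc ⌊y⌋₊ ⌊y + h⌋₊, ‖b n‖ ≤ D * (3 * L) ^ (J + 1) := by
    intro n hn
    have hn' := mem_Ioc.1 hn
    have h1 : 1 ≤ n := by omega
    have h1' : (1 : ℝ) ≤ n := by exact_mod_cast h1
    have h2 : (n : ℝ) ≤ X * X :=
      ((Nat.le_floor_iff (by linarith)).1 hn'.2).trans (by nlinarith)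
    have h3 : log n ≤ 2 * L := by
      have := log_le_log (by linarith) h2
      rwa [log_mul hX0.ne' hX0.ne', ← two_mul] at this
    have h4 : 0 ≤ log n := log_nonneg h1'
    simp only [hb]
    rw [norm_mul, Complex.norm_real, norm_of_nonneg (by positivity)]
    calc _ ≤ D * (1 + log n) * log n ^ J := by
          gcongr
          exact ha n h1
      _ ≤ D * (3 * L) * (3 * L) ^ J := by
          gcongr <;> linarith
      _ = _ := by ring
  have key := mul_norm_sum_le_of_riesz (b := b) hy hh0 hG (by positivity)
    (hR y hy (by linarith)) (hR (y + h) (by linarith) (by linarith))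
  rw [← le_div_iff₀' hh0] at key
  refine key.trans ?_
  have e1 : (2 * (24 * C₀ * M * X ^ 2) + h * (h + 1) * (D * (3 * L) ^ (J + 1))) / h =
      48 * C₀ * X * (M * L ^ E) + (h + 1) * (D * (3 * L) ^ (J + 1)) := by
    have : X ^ 2 / h = X * L ^ E := by
      rw [hh]
      field_simp
    rw [add_div, show 2 * (24 * C₀ * M * X ^ 2) / h = 48 * C₀ * M * (X ^ 2 / h) by ring, this]
    field_simp
  rw [e1]
  have e2 : (h + 1) * (D * (3 * L) ^ (J + 1)) ≤
      3 ^ (J + 1) * (1 + E.factorial) * X * (D * L ^ (J + 1 - E)) := by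
    have : h * L ^ (J + 1) = X * L ^ (J + 1 - E) := by
      rw [hh, ← Nat.sub_add_cancel hEJ, pow_add, Nat.add_sub_cancel]
      field_simp
    calc _ ≤ (h + E.factorial * h) * (D * (3 * L) ^ (J + 1)) := by gcongr
      _ = 3 ^ (J + 1) * (1 + E.factorial) * D * (h * L ^ (J + 1)) := by ring
      _ = _ := by rw [this]; ring
  have p1 : 0 ≤ 3 ^ (J + 1) * (1 + (E.factorial : ℝ)) * X * (M * L ^ E) := by positivity
  have p2 : 0 ≤ 48 * C₀ * X * (D * L ^ (J + 1 - E)) := by positivity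
  linarith

/-- Partial sums of `a(n)` from a bound for the `2E`-th derivative of its Dirichlet series. -/
theorem exists_norm_sum_le_of_iteratedDeriv (E : ℕ) : ∃ C : ℝ, 0 < C ∧
    ∀ (a : ℕ → ℂ) (D M X : ℝ), 3 ≤ X → 0 ≤ D → (∀ s : ℂ, 1 < s.re → LSeriesSummable a s) →
    (∀ n : ℕ, 1 ≤ n → ‖a n‖ ≤ D * (1 + log n)) →
    (∀ s : ℂ, 1 < s.re → s.re ≤ 2 →
      ‖iteratedDeriv (2 * E) (LSeries a) s‖ ≤ M * (|s.im| + 3) ^ (1 / 2 : ℝ)) →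
    ‖∑ n ∈ Icc 1 ⌊X⌋₊, a n‖ ≤ C * X * ((M + D * log X) / log X ^ E) := by
  obtain ⟨C, hC, h⟩ := exists_norm_sum_logPow_le (2 * E) E (by omega)
  refine ⟨2 * 4 ^ E * C + 2 * (2 ^ E * E.factorial), by positivity,
    fun a D M X hX hD hs ha hM => ?_⟩
  set L := log X with hLdef
  have hL : 1 ≤ L := one_le_log_of_three_le hX
  have hX0 : 0 < X := by linarith
  have hM0 : 0 ≤ M := by
    have := (norm_nonneg _).trans (hM 2 (by norm_num) (by norm_num))
    exact nonneg_of_mul_nonneg_left this (by positivity)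
  have hS := h a D M X hX hD hs ha hM
  set T := C * X * (M * L ^ E + D * L ^ (2 * E + 1 - E)) with hT
  have hT' : T / L ^ (2 * E) = C * X * ((M + D * L) / L ^ E) := by
    rw [hT, show 2 * E + 1 - E = E + 1 by omega]
    field_simp
    ring
  set m := ⌊sqrt X⌋₊ with hm
  have hmX : m ≤ ⌊X⌋₊ := Nat.floor_mono (sqrt_le_iff.2 ⟨hX0.le, by nlinarith⟩)
  have hsplit : ∑ n ∈ Icc 1 ⌊X⌋₊, a n =
      ∑ n ∈ Icc 1 m, a n + ∑ n ∈ Ioc m ⌊X⌋₊, a n :=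
    (sum_Ioc_consecutive a (Nat.zero_le m) hmX).symm
  have hsq : 0 < sqrt X := sqrt_pos.2 hX0
  have hfirst : ‖∑ n ∈ Icc 1 m, a n‖ ≤ 2 * (2 ^ E * E.factorial) * X * ((D * L) / L ^ E) := by
    have h1 : ‖∑ n ∈ Icc 1 m, a n‖ ≤ ∑ n ∈ Icc 1 m, D * (2 * L) := by
      refine norm_sum_le_of_le _ fun n hn => ?_
      have hn' := mem_Icc.1 hn
      refine (ha n hn'.1).trans ?_
      have : log n ≤ L := log_le_log (by exact_mod_cast hn'.1)
        ((Nat.le_floor_iff hX0.le).1 (hn'.2.trans hmX))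
      gcongr
      linarith
    rw [sum_const, nsmul_eq_mul, Nat.card_Icc, Nat.add_sub_cancel] at h1
    have h2 : (m : ℝ) ≤ sqrt X := Nat.floor_le hsq.le
    have h3 : L ^ E ≤ 2 ^ E * E.factorial * sqrt X := by
      have := log_pow_le_mul E (x := sqrt X) (one_le_sqrt.2 (by linarith))
      rw [log_sqrt hX0.le, div_pow, div_le_iff₀ (by positivity)] at this
      linarith
    have h4 : sqrt X ≤ 2 ^ E * E.factorial * X / L ^ E := by
      rw [le_div_iff₀ (by positivity)]
      calc _ ≤ sqrt X * (2 ^ E * E.factorial * sqrt X) := by gcongr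
        _ = 2 ^ E * E.factorial * (sqrt X * sqrt X) := by ring
        _ = _ := by rw [mul_self_sqrt hX0.le]
    calc _ ≤ (m : ℝ) * (D * (2 * L)) := h1
      _ ≤ 2 ^ E * E.factorial * X / L ^ E * (D * (2 * L)) := by
          gcongr
          exact h2.trans h4
      _ = _ := by ring
  have hpart : ∀ k ≤ ⌊X⌋₊, ‖∑ n ∈ Icc 1 k, a n * ((log n ^ (2 * E) : ℝ) : ℂ)‖ ≤ T := by
    intro k hk
    rcases Nat.eq_zero_or_pos k with rfl | hk0
    · simp only [show Icc 1 0 = (∅ : Finset ℕ) from rfl, sum_empty, norm_zero]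
      positivity
    · have := hS k (by exact_mod_cast hk0) ((Nat.le_floor_iff hX0.le).1 hk)
      rwa [Nat.floor_natCast] at this
  have hlog : L / 2 ≤ log ((m : ℝ) + 1) := by
    rw [hLdef, ← log_sqrt hX0.le]
    exact log_le_log hsq (Nat.lt_floor_add_one _).le
  have hlogpos : ∀ j : ℕ, L / 2 ≤ log ((m + 1 + j : ℕ) : ℝ) := fun j => by
    refine hlog.trans (log_le_log (by positivity) ?_)
    push_cast
    linarith [(Nat.cast_nonneg j : (0 : ℝ) ≤ j)]
  have hsecond : ‖∑ n ∈ Ioc m ⌊X⌋₊, a n‖ ≤ 2 * T * (4 ^ E / L ^ (2 * E)) := by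
    set w : ℕ → ℝ := fun j => (log ((m + 1 + j : ℕ) : ℝ) ^ (2 * E))⁻¹ with hw
    set b : ℕ → ℂ := fun j => a (m + 1 + j) * ((log ((m + 1 + j : ℕ) : ℝ) ^ (2 * E) : ℝ) : ℂ)
      with hb
    have hre : ∀ k (f : ℕ → ℂ), ∑ j ∈ range k, f (m + 1 + j) =
        ∑ n ∈ Ioc m (m + k), f n := fun k f => by
      rw [show Ioc m (m + k) = Ico (m + 1) (m + 1 + k) by
        ext; simp only [mem_Ioc, mem_Ico]; omega, sum_Ico_eq_sum_range,
        Nat.add_sub_cancel_left]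
    have hab : ∀ j, a (m + 1 + j) = b j * w j := fun j => by
      have : log ((m + 1 + j : ℕ) : ℝ) ^ (2 * E) ≠ 0 :=
        pow_ne_zero _ (by linarith [hlogpos j] : (0 : ℝ) < _).ne'
      simp only [hb, hw]
      rw [mul_assoc, ← Complex.ofReal_mul, mul_inv_cancel₀ this, Complex.ofReal_one, mul_one]
    have e : ∑ n ∈ Ioc m ⌊X⌋₊, a n = ∑ j ∈ range (⌊X⌋₊ - m), b j * w j := by
      rw [← sum_congr rfl fun j _ => hab j, hre, Nat.add_sub_cancel' hmX]
    rw [e]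
    refine (norm_sum_mul_antitone_le (T := 2 * T) ?_ (fun j => ?_) _ fun i hi => ?_).trans ?_
    · intro i j hij
      have h0 : 0 < log ((m + 1 + i : ℕ) : ℝ) := by linarith [hlogpos i]
      have h1 : log ((m + 1 + i : ℕ) : ℝ) ≤ log ((m + 1 + j : ℕ) : ℝ) :=
        log_le_log (by positivity) (by exact_mod_cast (by omega))
      exact inv_anti₀ (by positivity) (by gcongr)
    · have : 0 < log ((m + 1 + j : ℕ) : ℝ) := by linarith [hlogpos j]
      simp only [hw]
      positivity
    · have h1 : ∑ j ∈ range i, b j =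
          ∑ n ∈ Icc 1 (m + i), a n * ((log n ^ (2 * E) : ℝ) : ℂ) -
          ∑ n ∈ Icc 1 m, a n * ((log n ^ (2 * E) : ℝ) : ℂ) := by
        rw [hre i fun n => a n * ((log n ^ (2 * E) : ℝ) : ℂ), eq_sub_iff_add_eq']
        exact sum_Ioc_consecutive _ (Nat.zero_le m) (Nat.le_add_right m i)
      rw [h1]
      refine (norm_sub_le _ _).trans ?_
      linarith [hpart (m + i) (by omega), hpart m hmX]
    · have hTn : 0 ≤ T := by positivity
      refine mul_le_mul_of_nonneg_left ?_ (by positivity)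
      have h0 := hlogpos 0
      calc w 0 ≤ ((L / 2) ^ (2 * E))⁻¹ := by
            simp only [hw]
            gcongr
        _ = 4 ^ E / L ^ (2 * E) := by
            rw [div_pow, inv_div, pow_mul 2 2 E]
            norm_num
  rw [hsplit]
  refine (norm_add_le _ _).trans ?_
  have e1 : 2 * T * (4 ^ E / L ^ (2 * E)) = 2 * 4 ^ E * C * X * ((M + D * L) / L ^ E) := by
    rw [show 2 * T * (4 ^ E / L ^ (2 * E)) = 2 * 4 ^ E * (T / L ^ (2 * E)) by ring, hT']
    ring
  rw [e1] at hsecond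
  have e2 : 2 * (2 ^ E * (E.factorial : ℝ)) * X * ((D * L) / L ^ E) ≤
      2 * (2 ^ E * E.factorial) * X * ((M + D * L) / L ^ E) := by
    gcongr
    linarith
  linarith

variable (K : Type*) [Field K] [NumberField K]

theorem norm_coefLam_le {q : ℕ} (χ : DirichletCharacter ℂ q) (n : ℕ) :
    ‖coefLam K χ n‖ ≤ (Module.finrank ℚ K : ℕ) * log n := by
  rw [coefLam, norm_mul, Complex.norm_real, norm_of_nonneg (vmK_nonneg K n)]
  calc _ ≤ 1 * vmK K n := by
        gcongr
        · exact vmK_nonneg K n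
        · exact DirichletCharacter.norm_le_one χ _
    _ = vmK K n := one_mul _
    _ ≤ _ := vmK_le K n
    _ ≤ _ := by
        gcongr
        exact ArithmeticFunction.vonMangoldt_le_log

/-- The Siegel–Walfisz theorem over `K`. -/
theorem exists_siegel_walfisz [IsGalois ℚ K] (A B : ℕ) : ∃ C : ℝ, 0 < C ∧ ∀ (x : ℝ) (q : ℕ) [NeZero q]
    (χ : DirichletCharacter ℂ q), 3 ≤ x → (q : ℝ) ≤ log x ^ A → ¬ TrivG K χ →
    ‖∑ n ∈ Icc 1 ⌊x⌋₊, coefLam K χ n‖ ≤ C * x / log x ^ B := by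
  obtain ⟨C₁, hC₁, h₁⟩ := exists_norm_sum_le_of_iteratedDeriv (A + B + 1)
  obtain ⟨C₂, hC₂, h₂⟩ := exists_norm_iteratedDeriv_coefLam_le K (2 * (A + B + 1))
  set d : ℝ := ((Module.finrank ℚ K : ℕ) : ℝ) with hd
  refine ⟨C₁ * (C₂ + d), by positivity, fun x q _ χ hx hq hχ => ?_⟩
  have hL : 1 ≤ log x := one_le_log_of_three_le hx
  set L := log x
  have hq1 : (1 : ℝ) ≤ q := by exact_mod_cast NeZero.one_le
  have h := h₁ (coefLam K χ) d (C₂ * (q : ℝ) ^ (1 / 2 : ℝ)) x hx (by positivity)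
    (fun s hs => summable_coefLam K χ hs) (fun n hn => ?_) fun s hs hs' => ?_
  · refine h.trans ?_
    have e : (C₂ * (q : ℝ) ^ (1 / 2 : ℝ) + d * L) / L ^ (A + B + 1) ≤ (C₂ + d) / L ^ B := by
      rw [div_le_div_iff₀ (by positivity) (by positivity)]
      have h3 : (q : ℝ) ^ (1 / 2 : ℝ) ≤ L ^ (A + 1) := by
        calc (q : ℝ) ^ (1 / 2 : ℝ) ≤ (q : ℝ) ^ (1 : ℝ) :=
              rpow_le_rpow_of_exponent_le hq1 (by norm_num)
          _ = q := rpow_one _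
          _ ≤ L ^ A := hq
          _ ≤ L ^ (A + 1) := pow_le_pow_right₀ hL (by omega)
      have h4 : L ≤ L ^ (A + 1) := le_self_pow₀ hL (by omega)
      calc _ ≤ (C₂ * L ^ (A + 1) + d * L ^ (A + 1)) * L ^ B := by gcongr
        _ = _ := by ring
    calc _ ≤ C₁ * x * ((C₂ + d) / L ^ B) := by gcongr
      _ = _ := by ring
  · refine (norm_coefLam_le K χ n).trans ?_
    gcongr
    linarith
  · refine (h₂ q χ hχ s hs hs').trans (le_of_eq ?_)
    rw [ySize, mul_rpow (by positivity) (by positivity)]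
    ring

/-- The prime ideal theorem with the error term `O(x / (log x)^B)`. -/
theorem exists_prime_ideal_theorem [IsGalois ℚ K] (B : ℕ) : ∃ C : ℝ, 0 < C ∧ ∀ x : ℝ, 3 ≤ x →
    |∑ n ∈ Icc 1 ⌊x⌋₊, vmK K n - x| ≤ C * x / log x ^ B := by
  obtain ⟨C₁, hC₁, h₁⟩ := exists_norm_sum_le_of_iteratedDeriv (B + 1)
  obtain ⟨C₂, hC₂, h₂⟩ := exists_norm_iteratedDeriv_coefPrin_le K (2 * (B + 1))
  set d : ℝ := ((Module.finrank ℚ K : ℕ) : ℝ) with hd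
  refine ⟨C₁ * (C₂ + (d + 1)) + B.factorial, by positivity, fun x hx => ?_⟩
  have hL : 1 ≤ log x := one_le_log_of_three_le hx
  set L := log x with hLdef
  have h := h₁ (coefPrin K) (d + 1) C₂ x hx (by positivity)
    (fun s hs => summable_coefPrin K hs) (fun n hn => ?_) fun s hs hs' => ?_
  · have e : ∑ n ∈ Icc 1 ⌊x⌋₊, coefPrin K n =
        ((∑ n ∈ Icc 1 ⌊x⌋₊, vmK K n - ⌊x⌋₊ : ℝ) : ℂ) := by
      simp [coefPrin, sum_sub_distrib]
    rw [e, Complex.norm_real, norm_eq_abs] at h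
    have h3 : C₁ * x * ((C₂ + (d + 1) * L) / L ^ (B + 1)) ≤ C₁ * (C₂ + (d + 1)) * x / L ^ B := by
      have : (C₂ + (d + 1) * L) / L ^ (B + 1) ≤ (C₂ + (d + 1)) / L ^ B := by
        rw [div_le_div_iff₀ (by positivity) (by positivity)]
        calc _ ≤ (C₂ * L + (d + 1) * L) * L ^ B := by
              gcongr
              exact le_mul_of_one_le_right hC₂.le hL
          _ = _ := by ring
      calc _ ≤ C₁ * x * ((C₂ + (d + 1)) / L ^ B) := by gcongr
        _ = _ := by ring
    have h4 : 1 ≤ B.factorial * x / L ^ B := by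
      rw [le_div_iff₀ (by positivity), one_mul]
      exact log_pow_le_mul B (by linarith)
    have h5 : |(⌊x⌋₊ : ℝ) - x| ≤ 1 := by
      rw [abs_le]
      constructor <;> linarith [Nat.floor_le (show 0 ≤ x by linarith), Nat.lt_floor_add_one x]
    have h6 := abs_sub_le (∑ n ∈ Icc 1 ⌊x⌋₊, vmK K n) ⌊x⌋₊ x
    rw [add_mul, add_div]
    linarith
  · have h0 : 0 ≤ log n := log_nonneg (by exact_mod_cast hn)
    have h3 := norm_coefLam_le K (1 : DirichletCharacter ℂ 1) n
    rw [coefPrin_eq]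
    refine (norm_sub_le _ _).trans ?_
    rw [norm_one]
    nlinarith
  · refine (h₂ s hs hs').trans (le_of_eq ?_)
    rw [ySize]
    simp

end SiegelWalfisz

section LargeSieve

open MeasureTheory Finset Complex

/-- The additive character `e(nβ)`. -/
noncomputable def expC (n : ℤ) (β : ℝ) : ℂ := exp (((2 * Real.pi * n * β : ℝ) : ℂ) * I)

@[fun_prop]
theorem continuous_expC (n : ℤ) : Continuous (expC n) := by unfold expC; fun_prop

theorem expC_add (n : ℤ) (α β : ℝ) : expC n (α + β) = expC n α * expC n β := by
  rw [expC, expC, expC, ← exp_add]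
  push_cast
  ring_nf

theorem expC_mul_conj (n m : ℤ) (β : ℝ) :
    expC n β * (starRingEnd ℂ) (expC m β) = expC (n - m) β := by
  rw [expC, expC, expC, ← exp_conj, ← exp_add, map_mul, conj_I,
    conj_ofReal]
  push_cast
  ring_nf

theorem integral_expC (k : ℤ) : ∫ β in (0 : ℝ)..2, expC k β = if k = 0 then 2 else 0 := by
  split_ifs with h
  · subst h
    simp [expC]
  · have hc : 2 * Real.pi * k * I ≠ 0 := by simp [Real.pi_ne_zero, h]
    have e : ∀ β : ℝ, expC k β = exp (2 * Real.pi * k * I * β) := fun β => by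
      rw [expC]
      push_cast
      ring_nf
    simp_rw [e]
    rw [integral_exp_mul_complex hc, show 2 * (Real.pi : ℂ) * k * I * (2 : ℝ) =
      ((2 * k : ℤ) : ℂ) * (2 * Real.pi * I) by push_cast; ring, exp_int_mul_two_pi_mul_I]
    simp

theorem integral_norm_sq_trigPoly (s : Finset ℕ) (b : ℕ → ℂ) :
    ∫ β in (0 : ℝ)..2, ‖∑ n ∈ s, b n * expC n β‖ ^ 2 = 2 * ∑ n ∈ s, ‖b n‖ ^ 2 := by
  have hInt : ∀ f : ℝ → ℂ, Continuous f → IntervalIntegrable f volume 0 2 :=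
    fun f hf => hf.intervalIntegrable _ _
  have key : ∫ β in (0 : ℝ)..2, ((‖∑ n ∈ s, b n * expC n β‖ ^ 2 : ℝ) : ℂ) =
      ((2 * ∑ n ∈ s, ‖b n‖ ^ 2 : ℝ) : ℂ) := by
    have e : ∀ β : ℝ, ((‖∑ n ∈ s, b n * expC n β‖ ^ 2 : ℝ) : ℂ) =
        ∑ n ∈ s, ∑ m ∈ s, b n * (starRingEnd ℂ) (b m) * expC (n - m) β := fun β => by
      push_cast
      rw [← mul_conj', map_sum, sum_mul_sum]
      refine sum_congr rfl fun n _ => sum_congr rfl fun m _ => ?_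
      rw [map_mul, ← expC_mul_conj]
      ring
    simp_rw [e]
    rw [intervalIntegral.integral_finsetSum fun n _ => hInt _ (by fun_prop)]
    push_cast
    rw [mul_sum]
    refine sum_congr rfl fun n hn => ?_
    rw [intervalIntegral.integral_finsetSum fun m _ => hInt _ (by fun_prop)]
    simp_rw [intervalIntegral.integral_const_mul, integral_expC]
    rw [sum_eq_single_of_mem n hn fun m _ hm => ?_]
    · rw [sub_self, if_pos rfl, mul_conj']
      ring
    · rw [if_neg, mul_zero]
      rw [sub_eq_zero]
      exact_mod_cast hm.symm
  rw [intervalIntegral.integral_ofReal] at key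
  exact_mod_cast key

theorem norm_integral_sq_le {f : ℝ → ℂ} (hf : Continuous f) {a δ : ℝ} (hδ : 0 < δ) :
    ‖∫ β in a..a + δ, f β‖ ^ 2 ≤ δ * ∫ β in a..a + δ, ‖f β‖ ^ 2 := by
  have hle : a ≤ a + δ := by linarith
  set m := (∫ β in a..a + δ, ‖f β‖) / δ with hm
  have h1 : ‖∫ β in a..a + δ, f β‖ ≤ m * δ := by
    rw [hm, div_mul_cancel₀ _ hδ.ne']
    exact intervalIntegral.norm_integral_le_integral_norm hle
  have h2 : 0 ≤ ∫ β in a..a + δ, (‖f β‖ - m) ^ 2 :=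
    intervalIntegral.integral_nonneg hle fun β _ => sq_nonneg _
  have hInt : ∀ g : ℝ → ℝ, Continuous g → IntervalIntegrable g volume a (a + δ) :=
    fun g hg => hg.intervalIntegrable _ _
  have h3 : ∫ β in a..a + δ, (‖f β‖ - m) ^ 2 = (∫ β in a..a + δ, ‖f β‖ ^ 2) - m ^ 2 * δ := by
    simp_rw [sub_sq]
    rw [intervalIntegral.integral_add (hInt _ (by fun_prop)) (hInt _ (by fun_prop)),
      intervalIntegral.integral_sub (hInt _ (by fun_prop)) (hInt _ (by fun_prop)),
      intervalIntegral.integral_mul_const, intervalIntegral.integral_const_mul,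
      intervalIntegral.integral_const, smul_eq_mul, add_sub_cancel_left,
      show ∫ β in a..a + δ, ‖f β‖ = m * δ by rw [hm, div_mul_cancel₀ _ hδ.ne']]
    ring
  have h4 : ‖∫ β in a..a + δ, f β‖ ^ 2 ≤ (m * δ) ^ 2 := by gcongr
  nlinarith

/-- The large sieve inequality for `δ`-spaced points. -/
theorem large_sieve_spaced {ι : Type*} (P : Finset ι) (α : ι → ℝ) {δ : ℝ} (hδ : 0 < δ) (hδ1 : δ ≤ 1)
    (h0 : ∀ i ∈ P, 0 ≤ α i) (h1 : ∀ i ∈ P, α i ≤ 1)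
    (hsp : ∀ i ∈ P, ∀ j ∈ P, i ≠ j → δ ≤ |α i - α j|) (N : ℕ) (hN : 16 * N * δ ≤ 1) (c : ℕ → ℂ) :
    ∑ i ∈ P, ‖∑ n ∈ Icc 1 N, c n * expC n (α i)‖ ^ 2 ≤
      8 / δ * ∑ n ∈ Icc 1 N, ‖c n‖ ^ 2 := by
  set w : ℕ → ℂ := fun n => (∫ β in (0 : ℝ)..δ, expC n β) / δ with hw
  have hδc : (δ : ℂ) ≠ 0 := by exact_mod_cast hδ.ne'
  have hwn : ∀ n ∈ Icc 1 N, 1 / 2 ≤ ‖w n‖ := fun n hn => by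
    have h2 : ‖(∫ β in (0 : ℝ)..δ, expC n β) - δ‖ ≤ 1 / 2 * |δ - 0| := by
      have e : (∫ β in (0 : ℝ)..δ, expC n β) - δ = ∫ β in (0 : ℝ)..δ, (expC n β - 1) := by
        rw [intervalIntegral.integral_sub ((continuous_expC n).intervalIntegrable _ _) (by simp)]
        simp
      rw [e]
      refine intervalIntegral.norm_integral_le_of_norm_le_const fun β hβ => ?_
      rw [Set.uIoc_of_le hδ.le] at hβ
      have h3 := Real.norm_exp_I_mul_ofReal_sub_one_le (x := 2 * Real.pi * (n : ℤ) * β)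
      rw [expC, mul_comm]
      refine h3.trans ?_
      have hnN : (n : ℝ) ≤ N := by exact_mod_cast (mem_Icc.1 hn).2
      have h4 : (n : ℝ) * β ≤ 1 / 16 := by
        have : (n : ℝ) * β ≤ N * δ := mul_le_mul hnN hβ.2 hβ.1.le (by positivity)
        linarith
      have hb := hβ.1
      rw [Real.norm_of_nonneg (by positivity)]
      push_cast
      nlinarith [Real.pi_lt_four, Real.pi_pos]
    rw [sub_zero, abs_of_pos hδ] at h2
    have h3 : ‖w n - 1‖ ≤ 1 / 2 := by
      rw [hw]
      simp only []
      rw [div_sub_one hδc, norm_div, norm_real, Real.norm_of_nonneg hδ.le, div_le_iff₀ hδ]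
      exact h2
    have h4 := norm_sub_norm_le (1 : ℂ) (w n)
    rw [norm_one, norm_sub_rev] at h4
    linarith
  set b : ℕ → ℂ := fun n => c n / w n with hb
  set T : ℝ → ℂ := fun β => ∑ n ∈ Icc 1 N, b n * expC n β with hT
  have hTc : Continuous T := by simp only [hT]; fun_prop
  have hS : ∀ a : ℝ, ∑ n ∈ Icc 1 N, c n * expC n a = (∫ β in a..a + δ, T β) / δ := fun a => by
    have e : ∫ β in a..a + δ, T β = ∫ β in (0 : ℝ)..δ, T (a + β) := by
      rw [intervalIntegral.integral_comp_add_left, add_zero]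
    rw [e]
    simp only [hT, expC_add]
    rw [intervalIntegral.integral_finsetSum fun n _ =>
      Continuous.intervalIntegrable (by fun_prop) _ _, sum_div]
    refine sum_congr rfl fun n hn => ?_
    have hw0 : w n ≠ 0 := fun h => by
      have := hwn n hn
      rw [h, norm_zero] at this
      linarith
    simp_rw [← mul_assoc]
    rw [intervalIntegral.integral_const_mul, mul_div_assoc,
      show (∫ β in (0 : ℝ)..δ, expC n β) / (δ : ℂ) = w n from rfl]
    simp only [hb]
    field_simp
  have hpt : ∀ a : ℝ, ‖∑ n ∈ Icc 1 N, c n * expC n a‖ ^ 2 ≤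
      1 / δ * ∫ β in Set.Ioc a (a + δ), ‖T β‖ ^ 2 := fun a => by
    have h := norm_integral_sq_le hTc (a := a) hδ
    rw [hS, norm_div, norm_real, Real.norm_of_nonneg hδ.le, div_pow,
      div_le_iff₀ (by positivity), ← intervalIntegral.integral_of_le (by linarith)]
    calc _ ≤ _ := h
      _ = _ := by field_simp
  have hg : Continuous fun β => ‖T β‖ ^ 2 := by fun_prop
  have hInt : ∀ a b : ℝ, IntegrableOn (fun β => ‖T β‖ ^ 2) (Set.Ioc a b) :=
    fun a b => hg.integrableOn_Ioc
  have hdisj : (P : Set ι).Pairwise (Function.onFun Disjoint fun i => Set.Ioc (α i) (α i + δ)) := by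
    intro i hi j hj hij
    refine Set.disjoint_left.2 fun z hz hz' => ?_
    have := hsp i hi j hj hij
    rcases le_abs.1 this with h | h <;> linarith [hz.1, hz.2, hz'.1, hz'.2]
  calc _ ≤ ∑ i ∈ P, 1 / δ * ∫ β in Set.Ioc (α i) (α i + δ), ‖T β‖ ^ 2 :=
        sum_le_sum fun i _ => hpt (α i)
    _ = 1 / δ * ∫ β in ⋃ i ∈ P, Set.Ioc (α i) (α i + δ), ‖T β‖ ^ 2 := by
        rw [← mul_sum, integral_biUnion_finset P (fun _ _ => measurableSet_Ioc) hdisj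
          fun i _ => hInt _ _]
    _ ≤ 1 / δ * ∫ β in Set.Ioc (0 : ℝ) 2, ‖T β‖ ^ 2 := by
        gcongr 1 / δ * ?_
        refine setIntegral_mono_set (hInt 0 2) (Filter.Eventually.of_forall fun β => by positivity)
          (LE.le.eventuallyLE ?_)
        refine Set.iUnion₂_subset fun i hi => Set.Ioc_subset_Ioc (h0 i hi) ?_
        linarith [h1 i hi]
    _ = 1 / δ * (2 * ∑ n ∈ Icc 1 N, ‖b n‖ ^ 2) := by
        rw [← intervalIntegral.integral_of_le (by norm_num), integral_norm_sq_trigPoly]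
    _ ≤ 1 / δ * (2 * ∑ n ∈ Icc 1 N, 4 * ‖c n‖ ^ 2) := by
        gcongr with n hn
        have := hwn n hn
        simp only [hb]
        rw [norm_div, div_pow, div_le_iff₀ (by positivity)]
        have h4 : 1 ≤ 4 * ‖w n‖ ^ 2 := by nlinarith
        nlinarith [sq_nonneg ‖c n‖]
    _ = _ := by
        rw [← mul_sum]
        ring

theorem stdAddChar_mul_eq_expC {q : ℕ} [NeZero q] (n : ℕ) (a : ZMod q) :
    ZMod.stdAddChar ((n : ZMod q) * a) = expC n ((a.val : ℝ) / q) := by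
  have e : (n : ZMod q) * a = ((n * a.val : ℤ) : ZMod q) := by
    push_cast
    rw [ZMod.natCast_zmod_val]
  rw [e, ZMod.stdAddChar_coe, expC]
  push_cast
  ring_nf

/-- The large sieve inequality over Farey fractions. -/
theorem large_sieve_farey (U N : ℕ) (hU : 1 ≤ U) (c : ℕ → ℂ) :
    ∑ k ∈ range U, ∑ a : (ZMod (k + 1))ˣ,
      ‖∑ n ∈ Icc 1 N, c n * ZMod.stdAddChar ((n : ZMod (k + 1)) * (a : ZMod (k + 1)))‖ ^ 2 ≤
      128 * (N + U ^ 2 : ℝ) * ∑ n ∈ Icc 1 N, ‖c n‖ ^ 2 := by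
  set δ : ℝ := 1 / (16 * (N + U ^ 2)) with hδ
  have hU' : (1 : ℝ) ≤ U := by exact_mod_cast hU
  have hδ0 : 0 < δ := by positivity
  simp_rw [stdAddChar_mul_eq_expC]
  rw [sum_sigma' (range U) (fun k => (univ : Finset (ZMod (k + 1))ˣ))]
  refine (large_sieve_spaced _ (fun i : (k : ℕ) × (ZMod (k + 1))ˣ =>
    ((i.2 : ZMod (i.1 + 1)).val : ℝ) / ((i.1 + 1 : ℕ) : ℝ)) hδ0 ?_ ?_ ?_ ?_ N ?_ c).trans (le_of_eq ?_)
  · rw [hδ, div_le_one (by positivity)]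
    nlinarith [(Nat.cast_nonneg N : (0 : ℝ) ≤ N)]
  · intro i _
    positivity
  · intro i _
    rw [div_le_one (by positivity)]
    exact_mod_cast (ZMod.val_lt _).le
  · rintro ⟨k, a⟩ hi ⟨l, b⟩ hj hij
    simp only [mem_sigma, mem_range, mem_univ, and_true] at hi hj
    simp only []
    have hk : (0 : ℝ) < ((k + 1 : ℕ) : ℝ) := by positivity
    have hl : (0 : ℝ) < ((l + 1 : ℕ) : ℝ) := by positivity
    have hne : ((a : ZMod (k + 1)).val : ℤ) * (l + 1 : ℕ) - ((k + 1 : ℕ) : ℤ) * (b : ZMod (l + 1)).val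
        ≠ 0 := by
      intro h
      have h' : (a : ZMod (k + 1)).val * (l + 1) = (b : ZMod (l + 1)).val * (k + 1) := by
        zify
        push_cast at h
        linarith
      have ca := ZMod.val_coe_unit_coprime a
      have cb := ZMod.val_coe_unit_coprime b
      have hkl : k + 1 = l + 1 := by
        refine Nat.dvd_antisymm (ca.symm.dvd_of_dvd_mul_left ⟨(b : ZMod (l + 1)).val, ?_⟩)
          (cb.symm.dvd_of_dvd_mul_left ⟨(a : ZMod (k + 1)).val, ?_⟩) <;> linarith
      obtain rfl : k = l := by omega
      have h2 := Nat.eq_of_mul_eq_mul_right (Nat.succ_pos k) h'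
      exact hij (by rw [Units.ext (ZMod.val_injective _ h2)])
    rw [div_sub_div _ _ hk.ne' hl.ne', abs_div, abs_of_pos (mul_pos hk hl), hδ]
    have h1 : (1 : ℝ) ≤ |((a : ZMod (k + 1)).val : ℝ) * ((l + 1 : ℕ) : ℝ) -
        ((k + 1 : ℕ) : ℝ) * ((b : ZMod (l + 1)).val : ℝ)| := by
      exact_mod_cast Int.one_le_abs hne
    have h2 : ((k + 1 : ℕ) : ℝ) * ((l + 1 : ℕ) : ℝ) ≤ 16 * (N + U ^ 2) := by
      have hk' : ((k + 1 : ℕ) : ℝ) ≤ U := by exact_mod_cast hi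
      have hl' : ((l + 1 : ℕ) : ℝ) ≤ U := by exact_mod_cast hj
      nlinarith [(Nat.cast_nonneg N : (0 : ℝ) ≤ N)]
    gcongr
  · rw [hδ, mul_one_div, div_le_one (by positivity)]
    nlinarith
  · rw [hδ]
    field_simp
    ring

/-- Parseval's identity for Dirichlet characters. -/
theorem sum_norm_sq_character {q : ℕ} [NeZero q] (f : (ZMod q)ˣ → ℂ) :
    ∑ χ : DirichletCharacter ℂ q, ‖∑ a : (ZMod q)ˣ, χ (a : ZMod q) * f a‖ ^ 2 =
      q.totient * ∑ a, ‖f a‖ ^ 2 := by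
  have key : ((∑ χ : DirichletCharacter ℂ q, ‖∑ a : (ZMod q)ˣ, χ (a : ZMod q) * f a‖ ^ 2 : ℝ) : ℂ) =
      ((q.totient * ∑ a, ‖f a‖ ^ 2 : ℝ) : ℂ) := by
    push_cast
    have e : ∀ χ : DirichletCharacter ℂ q, (‖∑ a : (ZMod q)ˣ, χ (a : ZMod q) * f a‖ : ℂ) ^ 2 =
        ∑ a : (ZMod q)ˣ, ∑ b : (ZMod q)ˣ, (starRingEnd ℂ (f a) * f b) *
          (χ (a : ZMod q)⁻¹ * χ (b : ZMod q)) := fun χ => by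
      rw [← conj_mul', map_sum, sum_mul_sum]
      refine sum_congr rfl fun a _ => sum_congr rfl fun b _ => ?_
      rw [map_mul, starRingEnd_apply, MulChar.star_apply', MulChar.inv_apply, Ring.inverse_unit, ZMod.inv_coe_unit]
      ring
    simp_rw [e]
    rw [sum_comm, mul_sum]
    refine sum_congr rfl fun a _ => ?_
    rw [sum_comm]
    simp_rw [← mul_sum]
    rw [sum_eq_single_of_mem a (mem_univ a) fun b _ hb => ?_]
    · rw [DirichletCharacter.sum_char_inv_mul_char_eq ℂ a.isUnit, if_pos rfl, conj_mul']
      ring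
    · rw [DirichletCharacter.sum_char_inv_mul_char_eq ℂ a.isUnit, if_neg, mul_zero]
      exact fun h => hb (Units.ext h).symm
  exact_mod_cast key

theorem norm_sq_gaussSum {q : ℕ} [NeZero q] {χ : DirichletCharacter ℂ q} (hχ : χ.IsPrimitive) :
    ‖gaussSum χ ZMod.stdAddChar‖ ^ 2 = q := by
  have key : (gaussSum χ ZMod.stdAddChar) * (starRingEnd ℂ) (gaussSum χ ZMod.stdAddChar) = q := by
    rw [starRingEnd_apply, star_gaussSum_eq, show gaussSum χ⁻¹ (ZMod.stdAddChar (N := q))⁻¹ =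
      ∑ a, χ⁻¹ a * (ZMod.stdAddChar (N := q))⁻¹ a from rfl, mul_sum]
    have e : ∀ a : ZMod q, gaussSum χ ZMod.stdAddChar * (χ⁻¹ a * (ZMod.stdAddChar (N := q))⁻¹ a) =
        ∑ b : ZMod q, χ b * ZMod.stdAddChar (a * (b - 1)) := fun a => by
      rw [← mul_assoc, mul_comm (gaussSum χ _), ← gaussSum_mulShift_of_isPrimitive _ hχ a, gaussSum,
        sum_mul]
      refine sum_congr rfl fun b _ => ?_
      rw [AddChar.mulShift_apply, AddChar.inv_apply, mul_assoc, ← AddChar.map_add_eq_mul]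
      ring_nf
    simp_rw [e]
    rw [sum_comm]
    simp_rw [← mul_sum, AddChar.sum_mulShift _ (ZMod.isPrimitive_stdAddChar q), sub_eq_zero]
    simp [ZMod.card]
  rw [mul_conj'] at key
  exact_mod_cast key

/-- The multiplicative large sieve inequality. -/
theorem large_sieve_character (U N : ℕ) (hU : 1 ≤ U) (c : ℕ → ℝ) :
    ∑ k ∈ range U, ((k + 1 : ℕ) : ℝ) / ((k + 1).totient : ℝ) *
      ∑ χ : DirichletCharacter ℂ (k + 1) with χ.IsPrimitive,
        ‖∑ n ∈ Icc 1 N, χ n * (c n : ℂ)‖ ^ 2 ≤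
      128 * (N + U ^ 2 : ℝ) * ∑ n ∈ Icc 1 N, c n ^ 2 := by
  have h := large_sieve_farey U N hU fun n => (c n : ℂ)
  simp only [norm_real, Real.norm_eq_abs, sq_abs] at h
  refine le_trans (sum_le_sum fun k _ => ?_) h
  have ht : (0 : ℝ) < ((k + 1).totient : ℝ) := by exact_mod_cast Nat.totient_pos.2 k.succ_pos
  rw [div_mul_eq_mul_div, div_le_iff₀ ht, mul_comm _ ((k + 1).totient : ℝ), ← sum_norm_sq_character,
    mul_sum]
  refine (sum_le_sum fun χ hχ => ?_).trans
    (sum_le_sum_of_subset_of_nonneg (filter_subset _ _) fun _ _ _ => by positivity)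
  have hp := (mem_filter.1 hχ).2
  have e : ∑ a : (ZMod (k + 1))ˣ, χ (a : ZMod (k + 1)) * ∑ n ∈ Icc 1 N, (c n : ℂ) *
      ZMod.stdAddChar ((n : ZMod (k + 1)) * (a : ZMod (k + 1))) =
      gaussSum χ ZMod.stdAddChar * (starRingEnd ℂ) (∑ n ∈ Icc 1 N, χ n * (c n : ℂ)) := by
    simp_rw [mul_sum]
    rw [sum_comm, map_sum, mul_sum]
    refine sum_congr rfl fun n _ => ?_
    rw [map_mul, conj_ofReal, starRingEnd_apply, MulChar.star_apply', ← mul_assoc,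
      mul_comm (gaussSum χ _), ← gaussSum_mulShift_of_isPrimitive _ hp, gaussSum, sum_mul]
    simp_rw [AddChar.mulShift_apply]
    rw [← sum_subset (subset_univ ((univ : Finset (ZMod (k + 1))ˣ).map
      ⟨Units.val, Units.val_injective⟩)) fun a _ ha => ?_, sum_map]
    · refine sum_congr rfl fun a _ => ?_
      simp only [Function.Embedding.coeFn_mk]
      ring
    · rw [MulChar.map_nonunit, zero_mul, zero_mul]
      exact fun hu => ha (mem_map.2 ⟨hu.unit, mem_univ _, rfl⟩)
  rw [e, norm_mul, mul_pow, norm_sq_gaussSum hp, RCLike.norm_conj]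

end LargeSieve

section TotientSums

open Finset Real

theorem one_le_card_succ_mul_prod (s : Finset ℕ) (hs : ∀ p ∈ s, 2 ≤ p) :
    (1 : ℝ) ≤ (s.card + 1) * ∏ p ∈ s, (1 - (p : ℝ)⁻¹) := by
  induction s using induction_on_max with
  | empty => simp
  | insert a s ha ih =>
    have hn : a ∉ s := fun h => lt_irrefl a (ha a h)
    have h1 := ih fun p hp => hs p (mem_insert_of_mem hp)
    have hc : s.card + 2 ≤ a := by
      have h2 : s ⊆ Ico 2 a := fun p hp =>
        mem_Ico.2 ⟨hs p (mem_insert_of_mem hp), ha p hp⟩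
      have h3 := card_le_card h2
      have h4 := hs a (mem_insert_self _ _)
      rw [Nat.card_Ico] at h3
      omega
    have hc' : (s.card + 2 : ℝ) ≤ a := by exact_mod_cast hc
    rw [prod_insert hn, card_insert_of_notMem hn]
    have h5 : (s.card + 1 : ℝ) ≤ (s.card + 2) * (1 - (a : ℝ)⁻¹) := by
      have h6 : (s.card + 2 : ℝ) * (a : ℝ)⁻¹ ≤ 1 := by
        rw [← div_eq_mul_inv]
        exact div_le_one_of_le₀ hc' (by positivity)
      linarith
    have h7 : 0 ≤ ∏ p ∈ s, (1 - (p : ℝ)⁻¹) := prod_nonneg fun p hp => by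
      have : (1 : ℝ) ≤ p := by exact_mod_cast (hs p (mem_insert_of_mem hp)).trans' one_le_two
      linarith [inv_le_one_of_one_le₀ this]
    push_cast
    nlinarith [mul_le_mul_of_nonneg_right h5 h7]

theorem card_primeFactors_le_log {m : ℕ} (hm : m ≠ 0) : m.primeFactors.card ≤ Nat.log 2 m := by
  refine Nat.le_log_of_pow_le one_lt_two ?_
  calc 2 ^ m.primeFactors.card ≤ ∏ p ∈ m.primeFactors, p :=
        pow_card_le_prod _ _ _ fun p hp => (Nat.prime_of_mem_primeFactors hp).two_le
    _ ≤ m := Nat.le_of_dvd (Nat.pos_of_ne_zero hm) (Nat.prod_primeFactors_dvd m)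

theorem inv_totient_le {m : ℕ} (hm : m ≠ 0) :
    ((m.totient : ℕ) : ℝ)⁻¹ ≤ (Nat.log 2 m + 1) * (m : ℝ)⁻¹ := by
  have h1 : (m.totient : ℝ) = m * ∏ p ∈ m.primeFactors, (1 - (p : ℝ)⁻¹) := by
    have := congrArg (fun r : ℚ => (r : ℝ)) (Nat.totient_eq_mul_prod_factors m)
    push_cast at this
    exact this
  have h2 := one_le_card_succ_mul_prod m.primeFactors
    fun p hp => (Nat.prime_of_mem_primeFactors hp).two_le
  have h3 : (0 : ℝ) < m := by exact_mod_cast Nat.pos_of_ne_zero hm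
  have h4 : (0 : ℝ) < m.totient := by exact_mod_cast Nat.totient_pos.2 (Nat.pos_of_ne_zero hm)
  have h5 : (m.primeFactors.card : ℝ) ≤ Nat.log 2 m := by exact_mod_cast card_primeFactors_le_log hm
  have h6 : (m : ℝ) ≤ (m.primeFactors.card + 1) * m.totient := by
    rw [h1]
    nlinarith
  rw [← div_eq_mul_inv, inv_eq_one_div, div_le_div_iff₀ h4 h3]
  nlinarith

theorem sum_inv_totient_le (y : ℕ) :
    ∑ m ∈ Icc 1 y, ((m.totient : ℕ) : ℝ)⁻¹ ≤ (Nat.log 2 y + 2) ^ 2 := by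
  rcases Nat.eq_zero_or_pos y with rfl | hy
  · simp
  have hy' : (0 : ℝ) < y := by exact_mod_cast hy
  calc _ ≤ ∑ m ∈ Icc 1 y, (Nat.log 2 y + 1 : ℝ) * (m : ℝ)⁻¹ := by
        refine sum_le_sum fun m hm => ?_
        have hm := mem_Icc.1 hm
        refine (inv_totient_le (by omega)).trans ?_
        have : (Nat.log 2 m : ℝ) ≤ Nat.log 2 y := by exact_mod_cast Nat.log_mono_right hm.2
        gcongr
    _ = (Nat.log 2 y + 1 : ℝ) * ((harmonic y : ℚ) : ℝ) := by
        rw [harmonic_eq_sum_Icc, ← mul_sum]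
        push_cast
        rfl
    _ ≤ (Nat.log 2 y + 1 : ℝ) * (1 + log y) := by gcongr; exact harmonic_le_one_add_log y
    _ ≤ (Nat.log 2 y + 1 : ℝ) * (1 + (Nat.log 2 y + 1)) := by
        gcongr
        have h1 : (y : ℝ) ≤ 2 ^ (Nat.log 2 y + 1) := by
          exact_mod_cast (Nat.lt_pow_succ_log_self one_lt_two y).le
        calc log y ≤ log (2 ^ (Nat.log 2 y + 1)) := log_le_log hy' h1
          _ = (Nat.log 2 y + 1) * log 2 := by rw [log_pow]; push_cast; ring
          _ ≤ _ := mul_le_of_le_one_right (by positivity) (by linarith [log_two_lt_d9])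
    _ ≤ _ := by nlinarith [(Nat.cast_nonneg (Nat.log 2 y) : (0 : ℝ) ≤ _)]

theorem sum_inv_totient_dvd_le (N l : ℕ) :
    ∑ k ∈ range N with l + 1 ∣ k + 1, (((k + 1).totient : ℕ) : ℝ)⁻¹ ≤
      (((l + 1).totient : ℕ) : ℝ)⁻¹ * (Nat.log 2 (N / (l + 1)) + 2) ^ 2 := by
  calc _ = ∑ m ∈ Icc 1 (N / (l + 1)), ((((l + 1) * m).totient : ℕ) : ℝ)⁻¹ := by
        refine sum_nbij' (fun k => (k + 1) / (l + 1)) (fun m => (l + 1) * m - 1) ?_ ?_ ?_ ?_ ?_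
        · intro k hk
          simp only [mem_filter, mem_range] at hk
          exact mem_Icc.2 ⟨Nat.div_pos (Nat.le_of_dvd k.succ_pos hk.2) l.succ_pos,
            Nat.div_le_div_right hk.1⟩
        · intro m hm
          have hm := mem_Icc.1 hm
          have h1 : 0 < (l + 1) * m := Nat.mul_pos l.succ_pos hm.1
          have h2 : (l + 1) * m ≤ N := (Nat.mul_le_mul_left _ hm.2).trans (Nat.mul_div_le _ _)
          simp only [mem_filter, mem_range]
          refine ⟨by omega, ?_⟩
          rw [Nat.sub_add_cancel h1]
          exact dvd_mul_right _ _
        · intro k hk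
          simp only [mem_filter, mem_range] at hk
          simp only [Nat.mul_div_cancel' hk.2, Nat.add_sub_cancel]
        · intro m hm
          have h1 : 0 < (l + 1) * m := Nat.mul_pos l.succ_pos (mem_Icc.1 hm).1
          simp only [Nat.sub_add_cancel h1, Nat.mul_div_cancel_left _ l.succ_pos]
        · intro k hk
          simp only [mem_filter, mem_range] at hk
          simp only [Nat.mul_div_cancel' hk.2]
    _ ≤ ∑ m ∈ Icc 1 (N / (l + 1)),
        (((l + 1).totient : ℕ) : ℝ)⁻¹ * ((m.totient : ℕ) : ℝ)⁻¹ := by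
        refine sum_le_sum fun m hm => ?_
        have h1 : 0 < (l + 1).totient * m.totient := Nat.mul_pos (Nat.totient_pos.2 l.succ_pos)
          (Nat.totient_pos.2 (mem_Icc.1 hm).1)
        rw [← mul_inv]
        exact inv_anti₀ (by exact_mod_cast h1)
          (by exact_mod_cast Nat.totient_super_multiplicative (l + 1) m)
    _ ≤ _ := by
        rw [← mul_sum]
        gcongr
        exact sum_inv_totient_le _

theorem sum_sq_div_two_pow_le (J : ℕ) :
    ∑ j ∈ range J, ((j : ℝ) + 2) ^ 2 / 2 ^ j ≤ 22 := by
  have h : ∑ j ∈ range J, ((j : ℝ) + 2) ^ 2 / 2 ^ j =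
      22 - (2 * ((J : ℝ) + 2) ^ 2 + 4 * (J + 2) + 6) / 2 ^ J := by
    induction J with
    | zero => norm_num
    | succ J ih =>
      rw [sum_range_succ, ih]
      push_cast
      field_simp
      ring
  rw [h]
  have : 0 ≤ (2 * ((J : ℝ) + 2) ^ 2 + 4 * (J + 2) + 6) / 2 ^ J := by positivity
  linarith

theorem log_two_le_two_mul_log {N : ℕ} {x : ℝ} (hx : 1 ≤ x) (hN : (N : ℝ) ≤ x) :
    (Nat.log 2 N : ℝ) ≤ 2 * log x := by
  rcases Nat.eq_zero_or_pos N with rfl | h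
  · simpa using log_nonneg hx
  have h1 : (2 : ℝ) ^ Nat.log 2 N ≤ x :=
    le_trans (by exact_mod_cast Nat.pow_log_le_self 2 h.ne') hN
  have h2 := log_le_log (by positivity) h1
  rw [log_pow] at h2
  nlinarith [log_two_gt_d9, (Nat.cast_nonneg (Nat.log 2 N) : (0 : ℝ) ≤ _)]

end TotientSums

section CharSums

open Finset Real

variable (K : Type*) [Field K] [NumberField K]

theorem psiK_eq_sum (x : ℝ) (q : ℕ) (a : ZMod q) :
    psiK K x q a = ∑ n ∈ Icc 1 ⌊x⌋₊ with ((n : ℕ) : ZMod q) = a, vmK K n := by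
  rw [psiK, tsum_eq_sum (s := (Icc 1 ⌊x⌋₊).biUnion (idealsOfNorm K)) fun I hI => ?_,
    sum_biUnion fun m _ n _ hmn => ?_, sum_filter]
  · refine sum_congr rfl fun n hn => ?_
    have hx : (n : ℝ) ≤ x := (Nat.le_floor_iff' (by have := (mem_Icc.1 hn).1; omega)).1
      (mem_Icc.1 hn).2
    rw [sum_congr rfl (g := fun I => if (n : ZMod q) = a then LambdaK K I else 0) fun I hI => by
      rw [mem_idealsOfNorm.1 hI]
      simp [hx]]
    split_ifs with h
    · rfl
    · exact sum_const_zero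
  · refine disjoint_left.2 fun I h1 h2 => hmn ?_
    rw [mem_idealsOfNorm] at h1 h2
    exact h1.symm.trans h2
  · by_cases h0 : I = ⊥
    · rw [h0, LambdaK_bot, ite_self]
    · refine if_neg fun h => hI ?_
      have h1 : absNorm I ≠ 0 := absNorm_ne_zero_iff_ne_bot.2 h0
      exact mem_biUnion.2 ⟨absNorm I, mem_Icc.2 ⟨Nat.one_le_iff_ne_zero.2 h1,
        Nat.le_floor h.1⟩, mem_idealsOfNorm.2 rfl⟩

theorem sum_vmK_not_coprime_le {q X : ℕ} (hq : q ≠ 0) (hX : q ≤ X) :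
    ∑ n ∈ Icc 1 X with ¬ n.Coprime q, vmK K n ≤
      ((Module.finrank ℚ K : ℕ) : ℝ) * ((Nat.log 2 X + 1) ^ 2 * log X) := by
  set S := (q.primeFactors ×ˢ range (Nat.log 2 X + 1)).image fun z => z.1 ^ z.2 with hS
  have hlog : 0 ≤ log X := log_natCast_nonneg X
  have hmem : ∀ n ∈ Icc 1 X, ¬ n.Coprime q → vmK K n ≠ 0 → n ∈ S := fun n hn hc h0 => by
    have hΛ : ArithmeticFunction.vonMangoldt n ≠ 0 := fun h => h0 (le_antisymm
      ((vmK_le K n).trans (by rw [h, mul_zero])) (vmK_nonneg K n))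
    rw [ArithmeticFunction.vonMangoldt_ne_zero_iff, isPrimePow_nat_iff] at hΛ
    obtain ⟨p, m, hp, hm, rfl⟩ := hΛ
    have hX' := (mem_Icc.1 hn).2
    refine mem_image.2 ⟨(p, m), mem_product.2 ⟨Nat.mem_primeFactors.2 ⟨hp, ?_, hq⟩,
      mem_range.2 (Nat.lt_succ_of_le (Nat.le_log_of_pow_le one_lt_two
        ((Nat.pow_le_pow_left hp.two_le m).trans hX')))⟩, rfl⟩
    by_contra hd
    exact hc (Nat.Coprime.pow_left m ((Nat.Prime.coprime_iff_not_dvd hp).2 hd))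
  have hcard : (S.card : ℝ) ≤ (Nat.log 2 X + 1) ^ 2 := by
    have h1 : S.card ≤ Nat.log 2 q * (Nat.log 2 X + 1) := card_image_le.trans (by
      rw [card_product, card_range]
      exact Nat.mul_le_mul_right _ (card_primeFactors_le_log hq))
    have h2 : Nat.log 2 q ≤ Nat.log 2 X + 1 := (Nat.log_mono_right hX).trans (Nat.le_succ _)
    exact_mod_cast h1.trans (by rw [pow_two]; exact Nat.mul_le_mul_right _ h2)
  calc _ ≤ ∑ n ∈ S, ((Module.finrank ℚ K : ℕ) : ℝ) * log X := by
        rw [← sum_filter_ne_zero]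
        refine (sum_le_sum fun n hn => ?_).trans (sum_le_sum_of_subset_of_nonneg
          (fun n hn => ?_) fun _ _ _ => by positivity)
        · simp only [mem_filter, mem_Icc] at hn
          refine (vmK_le K n).trans ?_
          gcongr
          refine ArithmeticFunction.vonMangoldt_le_log.trans (log_le_log ?_ ?_)
          · exact_mod_cast hn.1.1.1
          · exact_mod_cast hn.1.1.2
        · simp only [mem_filter] at hn
          exact hmem n hn.1.1 hn.1.2 hn.2
    _ = S.card * (((Module.finrank ℚ K : ℕ) : ℝ) * log X) := by
        rw [sum_const, nsmul_eq_mul]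
    _ ≤ (Nat.log 2 X + 1) ^ 2 * (((Module.finrank ℚ K : ℕ) : ℝ) * log X) := by gcongr
    _ = _ := by ring

/-- Weighted sums of `vmK` agree up to `O(log³ x)` when the weights agree away from `q`. -/
theorem norm_sum_sub_sum_le {x : ℝ} (hx : 3 ≤ x) {q : ℕ} (hq : q ≠ 0) (hqx : (q : ℝ) ≤ x)
    {f g : ℕ → ℂ} (hfg : ∀ n, vmK K n ≠ 0 → n.Coprime q → f n = g n)
    (hf : ∀ n, ¬ n.Coprime q → f n = 0) (hg : ∀ n, ‖g n‖ ≤ 1) :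
    ‖∑ n ∈ Icc 1 ⌊x⌋₊, f n * (vmK K n : ℂ) - ∑ n ∈ Icc 1 ⌊x⌋₊, g n * (vmK K n : ℂ)‖ ≤
      9 * ((Module.finrank ℚ K : ℕ) : ℝ) * log x ^ 3 := by
  have hL := one_le_log_of_three_le hx
  have hfl : (⌊x⌋₊ : ℝ) ≤ x := Nat.floor_le (by linarith)
  have h1 := sum_vmK_not_coprime_le K hq (Nat.le_floor hqx)
  have h2 := log_two_le_two_mul_log (by linarith) hfl
  have h3 : log (⌊x⌋₊ : ℝ) ≤ log x :=
    log_le_log (by exact_mod_cast Nat.floor_pos.2 (by linarith)) hfl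
  calc _ ≤ ∑ n ∈ Icc 1 ⌊x⌋₊, ‖f n * (vmK K n : ℂ) - g n * (vmK K n : ℂ)‖ := by
        rw [← sum_sub_distrib]
        exact norm_sum_le _ _
    _ ≤ ∑ n ∈ Icc 1 ⌊x⌋₊, if ¬ n.Coprime q then vmK K n else 0 := by
        refine sum_le_sum fun n _ => ?_
        by_cases hc : n.Coprime q
        · by_cases h0 : vmK K n = 0
          · simp [h0]
          · simp [hfg n h0 hc, hc]
        · rw [hf n hc, zero_mul, zero_sub, norm_neg, norm_mul, Complex.norm_real,
            norm_of_nonneg (vmK_nonneg K n), if_pos hc]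
          exact mul_le_of_le_one_left (vmK_nonneg K n) (hg n)
    _ ≤ ((Module.finrank ℚ K : ℕ) : ℝ) * ((Nat.log 2 ⌊x⌋₊ + 1) ^ 2 * log (⌊x⌋₊ : ℝ)) := by
        rw [← sum_filter]
        exact h1
    _ ≤ ((Module.finrank ℚ K : ℕ) : ℝ) * ((2 * log x + log x) ^ 2 * log x) := by
        gcongr
    _ = _ := by ring

theorem norm_coefLam_changeLevel_sub_le {x : ℝ} (hx : 3 ≤ x) {k l : ℕ} (hk : ((k + 1 : ℕ) : ℝ) ≤ x)
    (h : l + 1 ∣ k + 1) (χ : DirichletCharacter ℂ (l + 1)) :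
    ‖∑ n ∈ Icc 1 ⌊x⌋₊, coefLam K (DirichletCharacter.changeLevel h χ) n -
      ∑ n ∈ Icc 1 ⌊x⌋₊, coefLam K χ n‖ ≤
      9 * ((Module.finrank ℚ K : ℕ) : ℝ) * log x ^ 3 := by
  refine norm_sum_sub_sum_le K hx k.succ_ne_zero hk (fun n _ hc => ?_) (fun n hc => ?_)
    fun n => χ.norm_le_one _
  · have := DirichletCharacter.changeLevel_eq_cast_of_dvd χ h (ZMod.unitOfCoprime n hc)
    rwa [ZMod.coe_unitOfCoprime, ZMod.cast_natCast h] at this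
  · exact MulChar.map_nonunit _ fun hu => hc ((ZMod.isUnit_iff_coprime n _).1 hu)

theorem TrivG.norm_coefLam_sub_le {x : ℝ} (hx : 3 ≤ x) {q : ℕ} [NeZero q] (hq : (q : ℝ) ≤ x)
    {χ : DirichletCharacter ℂ q} (h : TrivG K χ) :
    ‖∑ n ∈ Icc 1 ⌊x⌋₊, coefLam K χ n - ∑ n ∈ Icc 1 ⌊x⌋₊, (vmK K n : ℂ)‖ ≤
      9 * ((Module.finrank ℚ K : ℕ) : ℝ) * log x ^ 3 := by
  have := norm_sum_sub_sum_le K hx (NeZero.ne q) hq (f := fun n => χ n) (g := fun _ => 1)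
    (fun n h0 hc => ?_) (fun n hc => ?_) fun n => by simp
  · simpa only [one_mul, coefLam] using this
  · obtain ⟨u, hu, h1⟩ := exists_mem_Gq_of_idealCount K
      (fun hn => h0 (by rw [hn, vmK_zero])) (idealCount_ne_zero_of_vmK K h0) hc
    rw [← h1]
    exact h u hu
  · exact MulChar.map_nonunit _ fun hu => hc ((ZMod.isUnit_iff_coprime n _).1 hu)

end CharSums

section Variance

open Finset DirichletCharacter

variable (K : Type*) [Field K] [NumberField K]

theorem unitsMap_mem_Gq {q m : ℕ} [NeZero q] [NeZero m] (h : m ∣ q) {a : (ZMod q)ˣ}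
    (ha : a ∈ Gq K q) : ZMod.unitsMap h a ∈ Gq K m := by
  rw [Gq_eq] at ha ⊢
  obtain ⟨σ, rfl⟩ := ha
  have hζ := IsCyclotomicExtension.zeta_spec q K (CyclotomicField q K)
  have hz := IsCyclotomicExtension.zeta_spec m K (CyclotomicField m K)
  set ζ := IsCyclotomicExtension.zeta q K (CyclotomicField q K)
  set z := IsCyclotomicExtension.zeta m K (CyclotomicField m K)
  have hsplit : ((Polynomial.cyclotomic m K).map
      (algebraMap K (CyclotomicField q K))).Splits := by
    have hX := IsCyclotomicExtension.splits_X_pow_sub_one (S := {q}) K (CyclotomicField q K)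
      (Set.mem_singleton q)
    have hne : (Polynomial.X ^ q - 1 : Polynomial K) ≠ 0 :=
      Polynomial.X_pow_sub_C_ne_zero (NeZero.pos q) 1
    refine hX.of_dvd ((Polynomial.map_ne_zero_iff (algebraMap K _).injective).2 hne)
      (Polynomial.map_dvd _ ((Polynomial.cyclotomic.dvd_X_pow_sub_one m K).trans ?_))
    obtain ⟨c, rfl⟩ := h
    rw [pow_mul]
    simpa using sub_dvd_pow_sub_pow (Polynomial.X ^ m : Polynomial K) 1 c
  have := IsCyclotomicExtension.splitting_field_cyclotomic m K (CyclotomicField m K)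
  let f : CyclotomicField m K →ₐ[K] CyclotomicField q K :=
    Polynomial.IsSplittingField.lift (CyclotomicField m K) (Polynomial.cyclotomic m K) hsplit
  let : Algebra (CyclotomicField m K) (CyclotomicField q K) := f.toRingHom.toAlgebra
  have : IsScalarTower K (CyclotomicField m K) (CyclotomicField q K) :=
    IsScalarTower.of_algebraMap_eq fun r => (f.commutes r).symm
  have : IsGalois K (CyclotomicField m K) := IsCyclotomicExtension.isGalois {m} K _
  refine ⟨σ.restrictNormal (CyclotomicField m K), ?_⟩
  set b := hz.autToPow K (σ.restrictNormal (CyclotomicField m K)) with hb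
  have hη : IsPrimitiveRoot (f z) m := hz.map_of_injective f.injective
  have h1 : f z ^ (b : ZMod m).val = σ (f z) := by
    rw [← map_pow, hb, hz.autToPow_spec K]
    exact σ.restrictNormal_commutes (CyclotomicField m K) z
  have h2 : σ (f z) = f z ^ (hζ.autToPow K σ : ZMod q).val := by
    obtain ⟨i, -, hi⟩ := hζ.eq_pow_of_pow_eq_one (ξ := f z) (by
      obtain ⟨c, rfl⟩ := h
      rw [pow_mul, hη.pow_eq_one, one_pow])
    rw [← hi, map_pow, ← hζ.autToPow_spec K σ, ← pow_mul, ← pow_mul, mul_comm]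
  rw [h2] at h1
  have h3 := (hη.isOfFinOrder (NeZero.ne m)).pow_inj_mod.1 h1
  rw [← hη.eq_orderOf] at h3
  refine Units.ext ?_
  rw [ZMod.unitsMap_val, ← ZMod.natCast_zmod_val (b : ZMod m), ZMod.cast_eq_val]
  exact (ZMod.natCast_eq_natCast_iff' _ _ _).2 h3

theorem TrivG.changeLevel {k l : ℕ} (h : l + 1 ∣ k + 1) {χ : DirichletCharacter ℂ (l + 1)}
    (hχ : TrivG K χ) : TrivG K (changeLevel h χ) := fun a ha => by
  rw [changeLevel_eq_cast_of_dvd, ← ZMod.unitsMap_val h]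
  exact hχ _ (unitsMap_mem_Gq K h ha)

/-- Sums over all characters are dominated by sums over the primitive characters inducing them. -/
theorem sum_character_le_sum_primitive (k : ℕ) (F : DirichletCharacter ℂ (k + 1) → ℝ)
    (G : (l : ℕ) → DirichletCharacter ℂ (l + 1) → ℝ) (hG : ∀ l χ, 0 ≤ G l χ)
    (h : ∀ (l : ℕ) (hl : l + 1 ∣ k + 1) (χ : DirichletCharacter ℂ (l + 1)), χ.IsPrimitive →
      F (changeLevel hl χ) ≤ G l χ) :
    ∑ χ, F χ ≤ ∑ l ∈ range (k + 1) with l + 1 ∣ k + 1,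
      ∑ χ : DirichletCharacter ℂ (l + 1) with χ.IsPrimitive, G l χ := by
  have hex : ∀ χ : DirichletCharacter ℂ (k + 1), ∃ z : Σ l, DirichletCharacter ℂ (l + 1),
      ∃ hl : z.1 + 1 ∣ k + 1, z.2.IsPrimitive ∧ χ = changeLevel hl z.2 := by
    intro χ
    have aux : ∀ (c : ℕ) (hc : c ∣ k + 1) (ψ : DirichletCharacter ℂ c), ψ.IsPrimitive →
        χ = changeLevel hc ψ → ∃ z : Σ l, DirichletCharacter ℂ (l + 1),
        ∃ hl : z.1 + 1 ∣ k + 1, z.2.IsPrimitive ∧ χ = changeLevel hl z.2 := by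
      rintro (_ | c) hc ψ h1 h2
      · exact absurd (zero_dvd_iff.1 hc) k.succ_ne_zero
      · exact ⟨⟨c, ψ⟩, hc, h1, h2⟩
    exact aux _ χ.conductor_dvd_level χ.primitiveCharacter χ.primitiveCharacter_isPrimitive
      (χ.factorsThrough_conductor.eq_changeLevel)
  choose e he hp hχ using hex
  have hinj : Function.Injective e := by
    refine Function.LeftInverse.injective (g := fun z => if hz : z.1 + 1 ∣ k + 1 then
      changeLevel hz z.2 else 1) fun χ => ?_
    exact (dif_pos (he χ)).trans (hχ χ).symm
  rw [sum_sigma']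
  calc ∑ χ, F χ ≤ ∑ χ, G (e χ).1 (e χ).2 := sum_le_sum fun χ _ => by
        conv_lhs => rw [hχ χ]
        exact h _ (he χ) _ (hp χ)
    _ = ∑ z ∈ univ.image e, G z.1 z.2 :=
        (sum_image (f := fun z => G z.1 z.2) fun _ _ _ _ h => hinj h).symm
    _ ≤ _ := by
        refine sum_le_sum_of_subset_of_nonneg (fun z hz => ?_) fun z _ _ => hG _ _
        obtain ⟨χ, -, rfl⟩ := mem_image.1 hz
        simp only [mem_sigma, mem_filter, mem_range, mem_univ, true_and]
        exact ⟨⟨Nat.le_of_dvd k.succ_pos (he χ), he χ⟩, hp χ⟩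

theorem sum_Gq_character (q : ℕ) [NeZero q] (χ : DirichletCharacter ℂ q) :
    ∑ a : (ZMod q)ˣ, χ (a : ZMod q) * (if a ∈ Gq K q then 1 else 0) =
      if TrivG K χ then (phiK K q : ℂ) else 0 := by
  have h1 := sum_hom_units (R := ℂ) ((Units.coeHom ℂ).comp
    ((MulChar.toUnitHom χ).comp (Gq K q).subtype))
  have e : (Units.coeHom ℂ).comp ((MulChar.toUnitHom χ).comp (Gq K q).subtype) = 1 ↔ TrivG K χ := by
    rw [MonoidHom.ext_iff]
    exact ⟨fun h a ha => h ⟨a, ha⟩, fun h a => h a.1 a.2⟩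
  simp only [mul_ite, mul_one, mul_zero]
  rw [← sum_filter, sum_subtype (p := fun a => a ∈ Gq K q) _ (fun a => by simp)]
  simp only [e] at h1
  rw [phiK, Nat.card_eq_fintype_card]
  refine Eq.trans ?_ (h1.trans (by push_cast; rfl))
  rfl

/-- The variance over `G_q` in terms of character sums. -/
theorem finsum_Gq_sq_le (x : ℝ) (q : ℕ) [NeZero q] :
    ∑ᶠ a ∈ Gq K q, (psiK K x q (a : ZMod q) - x / phiK K q) ^ 2 ≤
      ((q.totient : ℕ) : ℝ)⁻¹ * ∑ χ : DirichletCharacter ℂ q,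
        ‖∑ n ∈ Icc 1 ⌊x⌋₊, coefLam K χ n - (if TrivG K χ then (x : ℂ) else 0)‖ ^ 2 := by
  have hφ : (phiK K q : ℂ) ≠ 0 := by exact_mod_cast (phiK_pos K q).ne'
  have ht : (0 : ℝ) < q.totient := by exact_mod_cast Nat.totient_pos.2 (NeZero.pos q)
  have hP := sum_norm_sq_character (fun a : (ZMod q)ˣ =>
    ((psiK K x q (a : ZMod q) : ℂ) - x / phiK K q * (if a ∈ Gq K q then 1 else 0)))
  have e : ∀ χ : DirichletCharacter ℂ q, ∑ a : (ZMod q)ˣ, χ (a : ZMod q) *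
      ((psiK K x q (a : ZMod q) : ℂ) - x / phiK K q * (if a ∈ Gq K q then 1 else 0)) =
      ∑ n ∈ Icc 1 ⌊x⌋₊, coefLam K χ n - (if TrivG K χ then (x : ℂ) else 0) := fun χ => by
    simp_rw [mul_sub, mul_left_comm _ ((x : ℂ) / phiK K q)]
    rw [sum_sub_distrib, ← mul_sum, sum_Gq_character]
    congr 1
    · simp_rw [psiK_eq_sum, sum_filter]
      push_cast
      simp_rw [mul_sum]
      rw [sum_comm]
      refine sum_congr rfl fun n _ => ?_
      by_cases hu : IsUnit (n : ZMod q)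
      · rw [sum_eq_single_of_mem hu.unit (mem_univ _) fun a _ ha => ?_]
        · simp [coefLam]
        · rw [if_neg fun h => ha (Units.ext h.symm)]
          simp
      · rw [coefLam, MulChar.map_nonunit _ hu, zero_mul]
        refine sum_eq_zero fun a _ => ?_
        rw [if_neg fun h : (n : ZMod q) = a => hu (h ▸ a.isUnit)]
        simp
    · split_ifs
      · exact div_mul_cancel₀ _ hφ
      · exact mul_zero _
  simp_rw [e] at hP
  rw [hP, ← mul_assoc, inv_mul_cancel₀ ht.ne', one_mul]
  refine (finsum_mem_eq_finite_toFinset_sum _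
    (Set.toFinite (Gq K q : Set (ZMod q)ˣ))).trans_le ((sum_le_sum fun a ha => ?_).trans
    (sum_le_sum_of_subset_of_nonneg (subset_univ _) fun _ _ _ => by positivity))
  have ha' : a ∈ Gq K q := (Set.Finite.mem_toFinset _).1 ha
  rw [if_pos ha', mul_one, ← Complex.ofReal_natCast,
    ← Complex.ofReal_div, ← Complex.ofReal_sub, Complex.norm_real, Real.norm_eq_abs, sq_abs]

end Variance

section Assembly

open Finset

/-- Dyadic summation of a large sieve bound. -/
theorem sum_dyadic_le {P : ℕ → ℝ} (hP : ∀ l, 0 ≤ P l) {D x R : ℝ} (hD : 0 ≤ D) (hx : 3 ≤ x)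
    (hR : 0 < R) {N : ℕ} (hN : (N : ℝ) ≤ x)
    (hLS : ∀ U : ℕ, 1 ≤ U → ∑ l ∈ range U, ((l + 1 : ℕ) : ℝ) / ((l + 1).totient : ℝ) * P l ≤
      (x + U ^ 2) * D) :
    ∑ l ∈ range N with R < ((l + 1 : ℕ) : ℝ),
      P l * ((((l + 1).totient : ℕ) : ℝ)⁻¹ * (Nat.log 2 (N / (l + 1)) + 2) ^ 2) ≤
      D * (96 * Real.log x ^ 3 * x / R + 44 * N) := by
  have hL := one_le_log_of_three_le hx
  have hlogN := log_two_le_two_mul_log (by linarith) hN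
  have hgroup : ∀ j ∈ range (Nat.log 2 N + 1),
      ∑ l ∈ ((range N).filter fun l : ℕ => R < ((l + 1 : ℕ) : ℝ)) with
        Nat.log 2 (N / (l + 1)) = j,
        P l * ((((l + 1).totient : ℕ) : ℝ)⁻¹ * (Nat.log 2 (N / (l + 1)) + 2) ^ 2) ≤
      D * (((j : ℝ) + 2) ^ 2 * (2 * x / R) + 2 * N * (((j : ℝ) + 2) ^ 2 / 2 ^ j)) := by
    intro j _
    set S := filter (fun l => Nat.log 2 (N / (l + 1)) = j)
      ((range N).filter fun l : ℕ => R < ((l + 1 : ℕ) : ℝ)) with hS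
    have hmem : ∀ l ∈ S, l < N ∧ R < ((l + 1 : ℕ) : ℝ) ∧ (l + 1) * 2 ^ j ≤ N ∧
        N < 2 ^ (j + 1) * (l + 1) := by
      intro l hl
      simp only [hS, mem_filter, mem_range] at hl
      obtain ⟨⟨h1, h2⟩, rfl⟩ := hl
      have h0 : N / (l + 1) ≠ 0 := (Nat.div_pos h1 l.succ_pos).ne'
      refine ⟨h1, h2, ?_, ?_⟩
      · exact (Nat.mul_le_mul_left _ (Nat.pow_log_le_self 2 h0)).trans (Nat.mul_div_le _ _)
      · exact (Nat.div_lt_iff_lt_mul l.succ_pos).1 (Nat.lt_pow_succ_log_self one_lt_two _)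
    rcases S.eq_empty_or_nonempty with he | ⟨l₀, hl₀⟩
    · rw [he, sum_empty]
      positivity
    obtain ⟨h1, h2, h3, -⟩ := hmem l₀ hl₀
    have hNpos : (0 : ℝ) < N := by exact_mod_cast (Nat.zero_le l₀).trans_lt h1
    have h3' : ((l₀ + 1 : ℕ) : ℝ) * 2 ^ j ≤ N := by exact_mod_cast h3
    have h2j : (0 : ℝ) < 2 ^ j := by positivity
    have hRj : R * 2 ^ j ≤ N := (mul_le_mul_of_nonneg_right h2.le h2j.le).trans h3'
    have hU : 1 ≤ N / 2 ^ j := Nat.div_pos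
      ((Nat.le_mul_of_pos_left _ l₀.succ_pos).trans h3) (by positivity)
    have hUN : ((N / 2 ^ j : ℕ) : ℝ) ≤ N / 2 ^ j := by exact_mod_cast Nat.cast_div_le (α := ℝ)
    calc _ ≤ ∑ l ∈ S, ((j : ℝ) + 2) ^ 2 * (2 ^ (j + 1) / N) *
          (((l + 1 : ℕ) : ℝ) / ((l + 1).totient : ℝ) * P l) := by
          refine sum_le_sum fun l hl => ?_
          obtain ⟨-, -, -, h4⟩ := hmem l hl
          have h4' : (N : ℝ) ≤ 2 ^ (j + 1) * ((l + 1 : ℕ) : ℝ) := by exact_mod_cast h4.le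
          have h5 : 1 ≤ 2 ^ (j + 1) / (N : ℝ) * ((l + 1 : ℕ) : ℝ) := by
            rwa [div_mul_eq_mul_div, one_le_div hNpos]
          have h6 : Nat.log 2 (N / (l + 1)) = j := (mem_filter.1 hl).2
          rw [h6]
          have h7 : 0 ≤ P l * ((((l + 1).totient : ℕ) : ℝ)⁻¹ * ((j : ℝ) + 2) ^ 2) := by
            have := hP l
            positivity
          calc _ ≤ P l * ((((l + 1).totient : ℕ) : ℝ)⁻¹ * ((j : ℝ) + 2) ^ 2) *
                (2 ^ (j + 1) / (N : ℝ) * ((l + 1 : ℕ) : ℝ)) := le_mul_of_one_le_right h7 h5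
            _ = _ := by ring
      _ ≤ ((j : ℝ) + 2) ^ 2 * (2 ^ (j + 1) / N) * ((x + ((N / 2 ^ j : ℕ) : ℝ) ^ 2) * D) := by
          rw [← mul_sum]
          gcongr
          refine le_trans (sum_le_sum_of_subset_of_nonneg (fun l hl => ?_) fun l _ _ => ?_)
            (hLS _ hU)
          · exact mem_range.2 ((Nat.le_div_iff_mul_le (by positivity)).2 (hmem l hl).2.2.1)
          · have := hP l
            positivity
      _ ≤ ((j : ℝ) + 2) ^ 2 * (2 ^ (j + 1) / N) * ((x + (N / 2 ^ j) ^ 2) * D) := by gcongr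
      _ = D * (((j : ℝ) + 2) ^ 2 * (2 * x * (2 ^ j / N)) +
          2 * N * (((j : ℝ) + 2) ^ 2 / 2 ^ j)) := by
          field_simp
          ring
      _ ≤ _ := by
          rw [div_eq_mul_inv (2 * x) R]
          have : (2 : ℝ) ^ j / N ≤ R⁻¹ := by
            rw [div_le_iff₀ hNpos, ← div_eq_inv_mul, le_div_iff₀ hR, mul_comm]
            exact hRj
          gcongr
  rw [← sum_fiberwise_of_maps_to (t := range (Nat.log 2 N + 1))
    (g := fun l => Nat.log 2 (N / (l + 1))) fun l _ => mem_range.2 (Nat.lt_succ_of_le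
      (Nat.log_mono_right (Nat.div_le_self _ _)))]
  refine (sum_le_sum hgroup).trans ?_
  rw [← mul_sum, sum_add_distrib, ← mul_sum]
  have h1 : ∑ j ∈ range (Nat.log 2 N + 1), ((j : ℝ) + 2) ^ 2 * (2 * x / R) ≤
      96 * Real.log x ^ 3 * x / R := by
    calc _ ≤ ∑ j ∈ range (Nat.log 2 N + 1), (4 * Real.log x) ^ 2 * (2 * x / R) := by
          refine sum_le_sum fun j hj => ?_
          have : (j : ℝ) ≤ Nat.log 2 N := by exact_mod_cast Nat.le_of_lt_succ (mem_range.1 hj)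
          gcongr
          linarith
      _ = (Nat.log 2 N + 1) * ((4 * Real.log x) ^ 2 * (2 * x / R)) := by
          rw [sum_const, card_range, nsmul_eq_mul]
          push_cast
          ring
      _ ≤ (3 * Real.log x) * ((4 * Real.log x) ^ 2 * (2 * x / R)) := by
          gcongr
          linarith
      _ = _ := by ring
  have h2 := sum_sq_div_two_pow_le (Nat.log 2 N + 1)
  refine mul_le_mul_of_nonneg_left (add_le_add h1 ?_) hD
  nlinarith [(Nat.cast_nonneg N : (0 : ℝ) ≤ N)]

variable (K : Type*) [Field K] [NumberField K]

/-- The second moment of the character sums over nontrivial primitive characters mod `l + 1`. -/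
noncomputable def primSum (x : ℝ) (l : ℕ) : ℝ :=
  ∑ χ : DirichletCharacter ℂ (l + 1) with χ.IsPrimitive,
    if TrivG K χ then 0 else ‖∑ n ∈ Icc 1 ⌊x⌋₊, coefLam K χ n‖ ^ 2

theorem primSum_nonneg (x : ℝ) (l : ℕ) : 0 ≤ primSum K x l :=
  sum_nonneg fun χ _ => by split_ifs <;> positivity

theorem card_character (q : ℕ) [NeZero q] :
    (univ : Finset (DirichletCharacter ℂ q)).card = q.totient := by
  rw [card_univ, ← Nat.card_eq_fintype_card]
  exact DirichletCharacter.card_eq_totient_of_hasEnoughRootsOfUnity ℂ q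

theorem primSum_le {x T : ℝ} {l : ℕ} (h : ∀ χ : DirichletCharacter ℂ (l + 1),
    ¬ TrivG K χ → ‖∑ n ∈ Icc 1 ⌊x⌋₊, coefLam K χ n‖ ≤ T) :
    primSum K x l ≤ (l + 1).totient * T ^ 2 := by
  calc primSum K x l ≤ ∑ χ : DirichletCharacter ℂ (l + 1) with χ.IsPrimitive, T ^ 2 :=
        sum_le_sum fun χ _ => by
          split_ifs with hχ
          · positivity
          · have := h χ hχ
            gcongr
    _ ≤ ∑ χ : DirichletCharacter ℂ (l + 1), T ^ 2 :=
        sum_le_sum_of_subset_of_nonneg (filter_subset _ _) fun _ _ _ => by positivity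
    _ = _ := by rw [sum_const, card_character, nsmul_eq_mul]

theorem sum_primSum_le {x : ℝ} (hx : 0 ≤ x) (U : ℕ) (hU : 1 ≤ U) :
    ∑ l ∈ range U, ((l + 1 : ℕ) : ℝ) / ((l + 1).totient : ℝ) * primSum K x l ≤
      (x + U ^ 2) * (128 * ∑ n ∈ Icc 1 ⌊x⌋₊, vmK K n ^ 2) := by
  have hs : 0 ≤ ∑ n ∈ Icc 1 ⌊x⌋₊, vmK K n ^ 2 := sum_nonneg fun _ _ => sq_nonneg _
  calc _ ≤ ∑ k ∈ range U, ((k + 1 : ℕ) : ℝ) / ((k + 1).totient : ℝ) *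
        ∑ χ : DirichletCharacter ℂ (k + 1) with χ.IsPrimitive,
          ‖∑ n ∈ Icc 1 ⌊x⌋₊, χ n * (vmK K n : ℂ)‖ ^ 2 := by
        refine sum_le_sum fun k _ => ?_
        rw [primSum]
        gcongr with χ
        split_ifs
        · positivity
        · exact le_rfl
    _ ≤ 128 * (⌊x⌋₊ + U ^ 2 : ℝ) * ∑ n ∈ Icc 1 ⌊x⌋₊, vmK K n ^ 2 :=
        large_sieve_character U ⌊x⌋₊ hU _
    _ ≤ 128 * (x + U ^ 2 : ℝ) * ∑ n ∈ Icc 1 ⌊x⌋₊, vmK K n ^ 2 := by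
        gcongr
        exact Nat.floor_le hx
    _ = _ := by ring

theorem card_filter_trivG_le (q : ℕ) [NeZero q] :
    (univ.filter fun χ : DirichletCharacter ℂ q => TrivG K χ).card ≤ Module.finrank ℚ K := by
  have h1 := card_trivG K q
  rw [Nat.card_eq_fintype_card, Fintype.card_subtype] at h1
  exact Nat.le_of_mul_le_mul_right (h1.le.trans (totient_le_mul_phiK K q)) (phiK_pos K q)

theorem finsum_Gq_sq_le_primSum {x T : ℝ} (hx : 3 ≤ x)
    (hT : |∑ n ∈ Icc 1 ⌊x⌋₊, vmK K n - x| ≤ T) {k : ℕ} (hk : ((k + 1 : ℕ) : ℝ) ≤ x) :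
    ∑ᶠ a ∈ Gq K (k + 1), (psiK K x (k + 1) (a : ZMod (k + 1)) - x / phiK K (k + 1)) ^ 2 ≤
      (((k + 1).totient : ℕ) : ℝ)⁻¹ * (((Module.finrank ℚ K : ℕ) : ℝ) * (2 * T ^ 2)) +
      2 * (9 * ((Module.finrank ℚ K : ℕ) : ℝ) * Real.log x ^ 3) ^ 2 +
      (((k + 1).totient : ℕ) : ℝ)⁻¹ *
        ∑ l ∈ range (k + 1) with l + 1 ∣ k + 1, 2 * primSum K x l := by
  set E := 9 * ((Module.finrank ℚ K : ℕ) : ℝ) * Real.log x ^ 3 with hE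
  set d := ((Module.finrank ℚ K : ℕ) : ℝ) with hd
  have ht : (0 : ℝ) < (k + 1).totient := by exact_mod_cast Nat.totient_pos.2 k.succ_pos
  set S : DirichletCharacter ℂ (k + 1) → ℂ := fun χ => ∑ n ∈ Icc 1 ⌊x⌋₊, coefLam K χ n
  set F : DirichletCharacter ℂ (k + 1) → ℝ := fun χ =>
    if TrivG K χ then 0 else ‖S χ‖ ^ 2 - 2 * E ^ 2 with hF
  have hsq : ∀ u v e f : ℝ, 0 ≤ u → u ≤ e + f → v = e ^ 2 → u ^ 2 ≤ 2 * v + 2 * f ^ 2 :=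
    fun u v e f h0 h1 h2 => by
      have := mul_self_le_mul_self h0 h1
      nlinarith [sq_nonneg (e - f)]
  have h1 : ∀ χ : DirichletCharacter ℂ (k + 1), ‖S χ - (if TrivG K χ then (x : ℂ) else 0)‖ ^ 2 ≤
      F χ + ((if TrivG K χ then 2 * T ^ 2 else 0) + 2 * E ^ 2) := fun χ => by
    simp only [hF]
    split_ifs with h
    · rw [zero_add]
      refine hsq _ _ T E (norm_nonneg _) ?_ rfl
      have h2 := h.norm_coefLam_sub_le K hx hk
      have h3 : ‖(∑ n ∈ Icc 1 ⌊x⌋₊, (vmK K n : ℂ)) - x‖ ≤ T := by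
        rw [← Complex.ofReal_sum, ← Complex.ofReal_sub, Complex.norm_real]
        exact hT
      linarith [norm_sub_le_norm_sub_add_norm_sub (S χ)
        (∑ n ∈ Icc 1 ⌊x⌋₊, (vmK K n : ℂ)) (x : ℂ)]
    · rw [sub_zero]
      linarith
  have h2 : ∑ χ, F χ ≤ ∑ l ∈ range (k + 1) with l + 1 ∣ k + 1, 2 * primSum K x l := by
    refine (sum_character_le_sum_primitive k F (fun l χ => 2 * if TrivG K χ then 0 else
      ‖∑ n ∈ Icc 1 ⌊x⌋₊, coefLam K χ n‖ ^ 2) (fun l χ => by split_ifs <;> positivity)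
      fun l hl χ _ => ?_).trans_eq (sum_congr rfl fun l _ => ?_)
    · simp only [hF]
      by_cases h : TrivG K χ
      · rw [if_pos h, if_pos (h.changeLevel K hl), mul_zero]
      · rw [if_neg h]
        split_ifs
        · positivity
        · have h3 := norm_coefLam_changeLevel_sub_le K hx hk hl χ
          have h4 := hsq _ _ ‖∑ n ∈ Icc 1 ⌊x⌋₊, coefLam K χ n‖ E
            (norm_nonneg (S (DirichletCharacter.changeLevel hl χ))) (by
              linarith [norm_sub_norm_le (S (DirichletCharacter.changeLevel hl χ))
                (∑ n ∈ Icc 1 ⌊x⌋₊, coefLam K χ n)]) rfl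
          linarith
    · rw [primSum, mul_sum]
  have h3 : ∑ χ : DirichletCharacter ℂ (k + 1), ((if TrivG K χ then 2 * T ^ 2 else 0) +
      2 * E ^ 2) ≤ d * (2 * T ^ 2) + (k + 1).totient * (2 * E ^ 2) := by
    rw [sum_add_distrib, ← sum_filter, sum_const, sum_const,
      card_character, nsmul_eq_mul, nsmul_eq_mul]
    have : ((univ.filter fun χ : DirichletCharacter ℂ (k + 1) => TrivG K χ).card : ℝ) ≤ d := by
      rw [hd]
      exact_mod_cast card_filter_trivG_le K (k + 1)
    gcongr
  calc _ ≤ _ := finsum_Gq_sq_le K x (k + 1)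
    _ ≤ (((k + 1).totient : ℕ) : ℝ)⁻¹ * ∑ χ : DirichletCharacter ℂ (k + 1),
        (F χ + ((if TrivG K χ then 2 * T ^ 2 else 0) + 2 * E ^ 2)) := by
        gcongr with χ
        exact h1 χ
    _ ≤ (((k + 1).totient : ℕ) : ℝ)⁻¹ * (∑ l ∈ range (k + 1) with l + 1 ∣ k + 1,
        2 * primSum K x l + (d * (2 * T ^ 2) + (k + 1).totient * (2 * E ^ 2))) := by
        rw [sum_add_distrib]
        gcongr
    _ = _ := by
        field_simp
        ring

end Assembly

section Final

open Finset Real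

variable (K : Type*) [Field K] [NumberField K]

theorem sum_finsum_Gq_le {x T R W : ℝ} (hx : 3 ≤ x) (hR : 0 < R)
    (hT : |∑ n ∈ Icc 1 ⌊x⌋₊, vmK K n - x| ≤ T)
    (hW : ∀ (l : ℕ) (χ : DirichletCharacter ℂ (l + 1)), ((l + 1 : ℕ) : ℝ) ≤ R → ¬ TrivG K χ →
      ‖∑ n ∈ Icc 1 ⌊x⌋₊, coefLam K χ n‖ ≤ W) {N : ℕ} (hN : (N : ℝ) ≤ x) :
    ∑ q ∈ Icc 1 N, ∑ᶠ a ∈ Gq K q, (psiK K x q (a : ZMod q) - x / phiK K q) ^ 2 ≤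
      32 * ((Module.finrank ℚ K : ℕ) : ℝ) * log x ^ 2 * T ^ 2 +
      162 * ((Module.finrank ℚ K : ℕ) : ℝ) ^ 2 * log x ^ 6 * N +
      32 * R * log x ^ 2 * W ^ 2 +
      2 * ((128 * ∑ n ∈ Icc 1 ⌊x⌋₊, vmK K n ^ 2) *
        (96 * log x ^ 3 * x / R + 44 * N)) := by
  have hL := one_le_log_of_three_le hx
  set d := ((Module.finrank ℚ K : ℕ) : ℝ) with hd
  set L := log x with hLdef
  set D := 128 * ∑ n ∈ Icc 1 ⌊x⌋₊, vmK K n ^ 2 with hD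
  have hD0 : 0 ≤ D := mul_nonneg (by norm_num) (sum_nonneg fun _ _ => sq_nonneg _)
  have hsq : ∀ y : ℕ, y ≤ N → ((Nat.log 2 y : ℝ) + 2) ^ 2 ≤ 16 * L ^ 2 := fun y hy => by
    have h1 := log_two_le_two_mul_log (N := y) (by linarith) (le_trans (by exact_mod_cast hy) hN)
    calc _ ≤ (4 * L) ^ 2 := by
          gcongr
          linarith
      _ = _ := by ring
  have hbase : ∑ k ∈ range N, (((k + 1).totient : ℕ) : ℝ)⁻¹ ≤ 16 * L ^ 2 := by
    have h1 := sum_inv_totient_dvd_le N 0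
    simp only [zero_add, one_dvd, filter_true, Nat.totient_one, Nat.cast_one, inv_one,
      one_mul, Nat.div_one] at h1
    exact h1.trans (hsq N le_rfl)
  have hswap : ∑ k ∈ range N, (((k + 1).totient : ℕ) : ℝ)⁻¹ *
      ∑ l ∈ range (k + 1) with l + 1 ∣ k + 1, 2 * primSum K x l ≤
      2 * ∑ l ∈ range N, primSum K x l *
        ((((l + 1).totient : ℕ) : ℝ)⁻¹ * (Nat.log 2 (N / (l + 1)) + 2) ^ 2) := by
    calc _ ≤ ∑ k ∈ range N, ∑ l ∈ range N, if l + 1 ∣ k + 1 then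
          2 * primSum K x l * (((k + 1).totient : ℕ) : ℝ)⁻¹ else 0 := by
          refine sum_le_sum fun k hk => ?_
          rw [← sum_filter, mul_sum]
          refine (sum_le_sum_of_subset_of_nonneg (filter_subset_filter _
            (range_subset_range.2 (mem_range.1 hk))) fun l _ _ => ?_).trans_eq
            (sum_congr rfl fun l _ => mul_comm _ _)
          have := primSum_nonneg K x l
          positivity
      _ = ∑ l ∈ range N, 2 * primSum K x l *
          ∑ k ∈ range N with l + 1 ∣ k + 1, (((k + 1).totient : ℕ) : ℝ)⁻¹ := by
          rw [sum_comm]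
          refine sum_congr rfl fun l _ => ?_
          rw [← sum_filter, mul_sum]
      _ ≤ _ := by
          rw [mul_sum]
          refine sum_le_sum fun l _ => ?_
          rw [mul_assoc]
          have := primSum_nonneg K x l
          gcongr
          exact sum_inv_totient_dvd_le N l
  have hsmall : ∑ l ∈ range N with ¬ R < ((l + 1 : ℕ) : ℝ), primSum K x l *
      ((((l + 1).totient : ℕ) : ℝ)⁻¹ * (Nat.log 2 (N / (l + 1)) + 2) ^ 2) ≤
      R * (16 * L ^ 2 * W ^ 2) := by
    calc _ ≤ ∑ l ∈ range N with ¬ R < ((l + 1 : ℕ) : ℝ), 16 * L ^ 2 * W ^ 2 := by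
          refine sum_le_sum fun l hl => ?_
          have hl := not_lt.1 (mem_filter.1 hl).2
          have ht : (0 : ℝ) < (l + 1).totient := by exact_mod_cast Nat.totient_pos.2 l.succ_pos
          calc _ ≤ ((l + 1).totient * W ^ 2) * ((((l + 1).totient : ℕ) : ℝ)⁻¹ * (16 * L ^ 2)) := by
                gcongr
                · exact primSum_le K fun χ hχ => hW l χ hl hχ
                · exact hsq _ (Nat.div_le_self _ _)
            _ = _ := by
                field_simp
      _ ≤ _ := by
          rw [sum_const, nsmul_eq_mul]
          gcongr
          have hsub : (range N).filter (fun l => ¬ R < ((l + 1 : ℕ) : ℝ)) ⊆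
              range ⌊R⌋₊ := fun l hl =>
            mem_range.2 (Nat.le_floor (not_lt.1 (mem_filter.1 hl).2))
          have := card_le_card hsub
          rw [card_range] at this
          exact le_trans (by exact_mod_cast this) (Nat.floor_le hR.le)
  have hlarge := sum_dyadic_le (primSum_nonneg K x) hD0 hx hR hN
    (sum_primSum_le K (by linarith))
  have hsplit := sum_filter_add_sum_filter_not (range N)
    (fun l => R < ((l + 1 : ℕ) : ℝ)) fun l => primSum K x l *
      ((((l + 1).totient : ℕ) : ℝ)⁻¹ * (Nat.log 2 (N / (l + 1)) + 2) ^ 2)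
  calc _ = ∑ k ∈ range N, ∑ᶠ a ∈ Gq K (k + 1),
        (psiK K x (k + 1) (a : ZMod (k + 1)) - x / phiK K (k + 1)) ^ 2 := by
        rw [range_eq_Ico, sum_Ico_add' (fun q => ∑ᶠ a ∈ Gq K q,
          (psiK K x q (a : ZMod q) - x / phiK K q) ^ 2) 0 N 1]
        rfl
    _ ≤ ∑ k ∈ range N, ((((k + 1).totient : ℕ) : ℝ)⁻¹ * (d * (2 * T ^ 2)) +
        2 * (9 * d * L ^ 3) ^ 2 + (((k + 1).totient : ℕ) : ℝ)⁻¹ *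
          ∑ l ∈ range (k + 1) with l + 1 ∣ k + 1, 2 * primSum K x l) :=
        sum_le_sum fun k hk => finsum_Gq_sq_le_primSum K hx hT
          (le_trans (by exact_mod_cast mem_range.1 hk) hN)
    _ ≤ 16 * L ^ 2 * (d * (2 * T ^ 2)) + N * (2 * (9 * d * L ^ 3) ^ 2) +
        2 * ∑ l ∈ range N, primSum K x l *
          ((((l + 1).totient : ℕ) : ℝ)⁻¹ * (Nat.log 2 (N / (l + 1)) + 2) ^ 2) := by
        rw [sum_add_distrib, sum_add_distrib, ← sum_mul, sum_const,
          card_range, nsmul_eq_mul]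
        gcongr
    _ ≤ _ := by
        rw [← hsplit]
        linarith

theorem sum_vmK_sq_le {x T : ℝ} (hx : 3 ≤ x)
    (hT : |∑ n ∈ Icc 1 ⌊x⌋₊, vmK K n - x| ≤ T * x) :
    ∑ n ∈ Icc 1 ⌊x⌋₊, vmK K n ^ 2 ≤
      ((Module.finrank ℚ K : ℕ) : ℝ) * (1 + T) * x * log x := by
  have hL := one_le_log_of_three_le hx
  have h1 := (abs_le.1 hT).2
  calc _ ≤ ∑ n ∈ Icc 1 ⌊x⌋₊, ((Module.finrank ℚ K : ℕ) : ℝ) * log x * vmK K n := by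
        refine sum_le_sum fun n hn => ?_
        have hn := mem_Icc.1 hn
        have hnx : (n : ℝ) ≤ x := (Nat.le_floor_iff (by linarith)).1 hn.2
        have h2 : vmK K n ≤ ((Module.finrank ℚ K : ℕ) : ℝ) * log x := by
          refine (vmK_le K n).trans ?_
          gcongr
          exact ArithmeticFunction.vonMangoldt_le_log.trans
            (log_le_log (by exact_mod_cast hn.1) hnx)
        rw [pow_two]
        exact mul_le_mul_of_nonneg_right h2 (vmK_nonneg K n)
    _ = ((Module.finrank ℚ K : ℕ) : ℝ) * log x * ∑ n ∈ Icc 1 ⌊x⌋₊, vmK K n := by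
        rw [mul_sum]
    _ ≤ ((Module.finrank ℚ K : ℕ) : ℝ) * log x * ((1 + T) * x) := by
        gcongr
        linarith
    _ = _ := by ring

theorem exists_bound_of_three_le [IsGalois ℚ K] (m : ℕ) :
    ∃ C : ℝ, 0 < C ∧ ∀ x Q : ℝ, 3 ≤ x → x / log x ^ m ≤ Q → Q ≤ x →
      ∑ q ∈ Icc 1 ⌊Q⌋₊, ∑ᶠ a ∈ Gq K q,
          (psiK K x q (a : ZMod q) - x / phiK K q) ^ 2 ≤ C * (x * Q * log x) := by
  set d := ((Module.finrank ℚ K : ℕ) : ℝ) with hd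
  obtain ⟨C₁, hC₁, h₁⟩ := exists_prime_ideal_theorem K (2 * m + 5)
  obtain ⟨C₂, hC₂, h₂⟩ := exists_siegel_walfisz K (m + 3) (2 * m + 5)
  refine ⟨32 * d * C₁ ^ 2 + 19440 * d ^ 2 + 32 * C₂ ^ 2 + 35840 * (d * (1 + C₁)), by positivity,
    fun x Q hx hQ hQx => ?_⟩
  have hL := one_le_log_of_three_le hx
  set L := log x with hLdef
  have hL0 : 0 < L := by linarith
  have hQ0 : 0 < Q := lt_of_lt_of_le (by positivity) hQ
  have hN : (⌊Q⌋₊ : ℝ) ≤ Q := Nat.floor_le hQ0.le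
  have hLn : ∀ n : ℕ, 1 ≤ L ^ n := fun n => one_le_pow₀ hL
  have hT := h₁ x hx
  refine (sum_finsum_Gq_le K hx (pow_pos hL0 (m + 3)) hT
    (W := C₂ * x / L ^ (2 * m + 5)) (fun l χ hl hχ => h₂ x (l + 1) χ hx hl hχ)
    (hN.trans hQx)).trans ?_
  have hT' : |∑ n ∈ Icc 1 ⌊x⌋₊, vmK K n - x| ≤ C₁ * x :=
    hT.trans (div_le_self (by positivity) (hLn _))
  have hD := sum_vmK_sq_le K hx hT'
  have hsmall : x ^ 2 / L ^ (3 * m + 5) ≤ x * Q * L := by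
    calc x ^ 2 / L ^ (3 * m + 5) ≤ x ^ 2 / L ^ m :=
          div_le_div_of_nonneg_left (by positivity) (by positivity)
            (pow_le_pow_right₀ hL (by omega))
      _ = x * (x / L ^ m) := by ring
      _ ≤ x * Q := by gcongr
      _ ≤ x * Q * L := le_mul_of_one_le_right (by positivity) hL
  have e1 : 32 * d * L ^ 2 * (C₁ * x / L ^ (2 * m + 5)) ^ 2 ≤ 32 * d * C₁ ^ 2 * (x * Q * L) := by
    calc _ = 32 * d * C₁ ^ 2 * (x ^ 2 / L ^ (4 * m + 8)) := by
          field_simp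
          ring
      _ ≤ 32 * d * C₁ ^ 2 * (x ^ 2 / L ^ (3 * m + 5)) := by
          gcongr 32 * d * C₁ ^ 2 * (x ^ 2 / ?_)
          exact pow_le_pow_right₀ hL (by omega)
      _ ≤ _ := by gcongr
  have e2 : 162 * d ^ 2 * L ^ 6 * (⌊Q⌋₊ : ℝ) ≤ 19440 * d ^ 2 * (x * Q * L) := by
    have h5 : L ^ 5 ≤ 120 * x := by
      have := log_pow_le_mul 5 (x := x) (by linarith)
      norm_num [Nat.factorial] at this
      exact this
    calc _ ≤ 162 * d ^ 2 * L ^ 6 * Q := by gcongr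
      _ = 162 * d ^ 2 * L * Q * L ^ 5 := by ring
      _ ≤ 162 * d ^ 2 * L * Q * (120 * x) := by gcongr
      _ = _ := by ring
  have e3 : 32 * L ^ (m + 3) * L ^ 2 * (C₂ * x / L ^ (2 * m + 5)) ^ 2 ≤
      32 * C₂ ^ 2 * (x * Q * L) := by
    calc _ = 32 * C₂ ^ 2 * (x ^ 2 / L ^ (3 * m + 5)) := by
          field_simp
          ring
      _ ≤ _ := by gcongr
  have e4 : 2 * ((128 * ∑ n ∈ Icc 1 ⌊x⌋₊, vmK K n ^ 2) *
      (96 * L ^ 3 * x / L ^ (m + 3) + 44 * (⌊Q⌋₊ : ℝ))) ≤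
      35840 * (d * (1 + C₁)) * (x * Q * L) := by
    have h6 : 96 * L ^ 3 * x / L ^ (m + 3) = 96 * (x / L ^ m) := by
      field_simp
      ring
    rw [h6]
    calc _ ≤ 2 * ((128 * (d * (1 + C₁) * x * L)) * (96 * Q + 44 * Q)) := by gcongr
      _ = _ := by ring
  linarith

/-- The case of bounded `x`. -/
theorem exists_bound_of_lt_three (M : ℝ) :
    ∃ C : ℝ, 0 < C ∧ ∀ x Q : ℝ, 2 ≤ x → x < 3 → x * log x ^ (-M) ≤ Q → Q ≤ x →
      ∑ q ∈ Icc 1 ⌊Q⌋₊, ∑ᶠ a ∈ Gq K q,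
          (psiK K x q (a : ZMod q) - x / phiK K q) ^ 2 ≤ C * (x * Q * log x) := by
  set d := ((Module.finrank ℚ K : ℕ) : ℝ) with hd
  refine ⟨4 * (2 * d + 3) ^ 2, by positivity, fun x Q hx hx3 hQ hQx => ?_⟩
  have hlog : 1 / 2 < log x :=
    lt_of_lt_of_le (by linarith [log_two_gt_d9]) (log_le_log two_pos hx)
  rcases lt_or_ge Q 1 with hQ1 | hQ1
  · rw [Nat.floor_eq_zero.2 hQ1]
    have : 0 ≤ Q := le_trans (by positivity) hQ
    simp only [zero_lt_one, Icc_eq_empty_of_lt, sum_empty]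
    positivity
  have hfl : ⌊x⌋₊ = 2 := (Nat.floor_eq_iff (by linarith)).2 ⟨by norm_num; exact hx, by norm_num; exact hx3⟩
  have hQ2 : ⌊Q⌋₊ ≤ 2 := hfl ▸ Nat.floor_le_floor hQx
  have hterm : ∀ q ∈ Icc 1 ⌊Q⌋₊, ∑ᶠ a ∈ Gq K q,
      (psiK K x q (a : ZMod q) - x / phiK K q) ^ 2 ≤ (2 * d + 3) ^ 2 := by
    intro q hq
    have hq := mem_Icc.1 hq
    have hq0 : NeZero q := ⟨by omega⟩
    have hφ : (1 : ℝ) ≤ phiK K q := by exact_mod_cast phiK_pos K q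
    have hpt : ∀ a : ZMod q, (psiK K x q a - x / phiK K q) ^ 2 ≤ (2 * d + 3) ^ 2 := fun a => by
      have h1 : 0 ≤ psiK K x q a := by
        rw [psiK_eq_sum]
        exact sum_nonneg fun n _ => vmK_nonneg K n
      have h2 : psiK K x q a ≤ 2 * d := by
        rw [psiK_eq_sum, hfl]
        calc _ ≤ ∑ n ∈ Icc 1 2, vmK K n := sum_le_sum_of_subset_of_nonneg
              (filter_subset _ _) fun n _ _ => vmK_nonneg K n
          _ ≤ ∑ n ∈ Icc 1 2, d := by
              refine sum_le_sum fun n hn => (vmK_le K n).trans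
                (mul_le_of_le_one_right (by positivity) ?_)
              have hn := mem_Icc.1 hn
              refine ArithmeticFunction.vonMangoldt_le_log.trans
                ((log_le_log (by exact_mod_cast hn.1) (y := 2) (by exact_mod_cast hn.2)).trans ?_)
              linarith [log_two_lt_d9]
          _ = _ := by simp
      have h3 : x / phiK K q ≤ x := div_le_self (by linarith) hφ
      have h4 : 0 ≤ x / phiK K q := by positivity
      exact sq_le_sq' (by linarith) (by linarith)
    have hsub : Subsingleton (ZMod q)ˣ := by
      have h5 : q = 1 ∨ q = 2 := by omega
      rcases h5 with rfl | rfl <;> infer_instance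
    refine (finsum_mem_eq_finite_toFinset_sum _
      (Set.toFinite (Gq K q : Set (ZMod q)ˣ))).trans_le ?_
    refine (sum_le_card_nsmul _ _ ((2 * d + 3) ^ 2) fun a _ => ?_).trans ?_
    · exact hpt a
    rw [nsmul_eq_mul]
    exact mul_le_of_le_one_left (by positivity)
      (by exact_mod_cast card_le_one_of_subsingleton _)
  calc _ ≤ ∑ q ∈ Icc 1 ⌊Q⌋₊, (2 * d + 3) ^ 2 := sum_le_sum hterm
    _ = ⌊Q⌋₊ * (2 * d + 3) ^ 2 := by simp
    _ ≤ 2 * (2 * d + 3) ^ 2 := by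
        gcongr
        exact_mod_cast hQ2
    _ ≤ 4 * (2 * d + 3) ^ 2 * (x * Q * log x) := by
        have h1 : 1 ≤ x * Q := one_le_mul_of_one_le_of_one_le (by linarith) hQ1
        have h2 : 1 / 2 ≤ x * Q * log x := by nlinarith
        nlinarith [sq_nonneg (2 * d + 3)]

end Final

/-- **Barban–Davenport–Halberstam for number fields.**
For fixed `M > 0`: for all `x ≥ 2` and all `Q` with `x (log x)^{-M} ≤ Q ≤ x`,
`∑_{q ≤ Q} ∑_{a ∈ G_q} (ψ_K(x;q,a) − x/φ_K(q))² ≪ x Q log x`,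
the implied constant depending only on `K` and `M`. -/
theorem bdh_number_field (K : Type*) [Field K] [NumberField K] [IsGalois ℚ K]
    (M : ℝ) (hM : 0 < M) :
    ∃ C : ℝ, 0 < C ∧ ∀ x Q : ℝ, 2 ≤ x → x * Real.log x ^ (-M) ≤ Q → Q ≤ x →
      ∑ q ∈ Finset.Icc 1 ⌊Q⌋₊, ∑ᶠ a ∈ Gq K q,
          (psiK K x q (a : ZMod q) - x / phiK K q) ^ 2 ≤
        C * (x * Q * Real.log x) := by
  obtain ⟨C₁, hC₁, h₁⟩ := exists_bound_of_three_le K ⌈M⌉₊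
  obtain ⟨C₂, hC₂, h₂⟩ := exists_bound_of_lt_three K M
  refine ⟨C₁ + C₂, by positivity, fun x Q hx hQ hQx => ?_⟩
  have hlog : 0 < Real.log x := Real.log_pos (by linarith)
  have hQ0 : 0 ≤ Q := le_trans (by positivity) hQ
  have h0 : 0 ≤ x * Q * Real.log x := by positivity
  rcases lt_or_ge x 3 with h3 | h3
  · exact (h₂ x Q hx h3 hQ hQx).trans (mul_le_mul_of_nonneg_right (by linarith) h0)
  · refine (h₁ x Q h3 (le_trans ?_ hQ) hQx).trans (mul_le_mul_of_nonneg_right (by linarith) h0)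
    rw [div_eq_mul_inv, ← Real.rpow_natCast, ← Real.rpow_neg hlog.le]
    gcongr
    · exact one_le_log_of_three_le h3
    · exact Nat.le_ceil M
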